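/- Under the local blowup setup, if the blowup at the origin is non-simple, i.e. max_{1≤i≤n} max_{x∈B_δ} (ũ_i^k(x) + 2μ log|x|) → ∞ along the sequence, then μ = 1+γ is a positive integer (equivalently, the strength γ of the singular source is a nonnegative integer, so 4πγ is a multiple of 4π). -/

import Mathlib

open MeasureTheory Metric Filter

noncomputable section

/-- The plane `ℝ²`. -/
abbrev E2 := EuclideanSpace ℝ (Fin 2)

/-- An n×n real matrix `A` satisfies (H1) if it is symmetric, has all entries nonnegative,
is irreducible, and is invertible. -/
def H1 {n : ℕ} (A : Matrix (Fin n) (Fin n) ℝ) : Prop :=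
  A.IsSymm ∧ (∀ i j, 0 ≤ A i j) ∧
  (¬ ∃ S : Finset (Fin n), S.Nonempty ∧ Sᶜ.Nonempty ∧ ∀ i ∈ S, ∀ j ∈ Sᶜ, A i j = 0) ∧
  IsUnit A.det

/-- An n×n real matrix `A` satisfies (H2) if its inverse `A⁻¹ = (aⁱʲ)` satisfies
`aⁱⁱ ≤ 0`, `aⁱʲ ≥ 0` for `i ≠ j`, and all row sums of `A⁻¹` are nonnegative. -/
def H2 {n : ℕ} (A : Matrix (Fin n) (Fin n) ℝ) : Prop :=
  (∀ i, A⁻¹ i i ≤ 0) ∧ (∀ i j, i ≠ j → 0 ≤ A⁻¹ i j) ∧ (∀ i, 0 ≤ ∑ j, A⁻¹ i j)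

/-- The Laplacian of a function on the plane, as the sum of its pure second derivatives
in the coordinate directions. -/
def lap (f : E2 → ℝ) (x : E2) : ℝ :=
  ∑ i : Fin 2, fderiv ℝ (fun y => fderiv ℝ f y (EuclideanSpace.single i 1)) x
    (EuclideanSpace.single i 1)

/-- The local blowup setup of the paper: `ũᵏ = u` is a sequence of solutions of the singular
Liouville system `Δũᵢᵏ + Σⱼ aᵢⱼ |x|^{2γ} hⱼᵏ e^{ũⱼᵏ} = 0` on the ball `B_δ ⊂ ℝ²`, with
uniformly bounded positive `C¹` coefficient functions `hᵢᵏ`, uniformly bounded energy,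
uniformly bounded boundary oscillation, blowup `M_k := (1/μ) maxᵢ max_{B_δ} ũᵢᵏ → ∞`
(`μ = 1 + γ`), and no blowup away from the origin. -/
structure LocalBlowupSetup (n : ℕ) (δ γ : ℝ) (A : Matrix (Fin n) (Fin n) ℝ)
    (h u : ℕ → Fin n → E2 → ℝ) (M : ℕ → ℝ) where
  /-- uniform lower bound for the coefficient functions -/
  c₁ : ℝ
  /-- uniform upper bound for the coefficient functions -/
  c₂ : ℝ
  /-- uniform `C¹` bound for the coefficient functions -/
  c₃ : ℝ
  /-- uniform energy/oscillation bound -/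
  C : ℝ
  hn : 0 < n
  hδ : 0 < δ
  hγ : -1 < γ
  hH1 : H1 A
  hH2 : H2 A
  c₁_pos : 0 < c₁
  h_lb : ∀ k i, ∀ x ∈ closedBall (0:E2) δ, c₁ ≤ h k i x
  h_ub : ∀ k i, ∀ x ∈ closedBall (0:E2) δ, h k i x ≤ c₂
  h_c1 : ∀ k i, ContDiffOn ℝ 1 (h k i) (closedBall (0:E2) δ)
  h_grad : ∀ k i, ∀ x ∈ closedBall (0:E2) δ,
    ‖fderivWithin ℝ (h k i) (closedBall (0:E2) δ) x‖ ≤ c₃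
  u_cont : ∀ k i, ContinuousOn (u k i) (closedBall (0:E2) δ)
  u_c2 : ∀ k i, ContDiffOn ℝ 2 (u k i) (ball (0:E2) δ \ {0})
  pde : ∀ k i, ∀ x ∈ ball (0:E2) δ \ {0},
    lap (u k i) x + ∑ j, A i j * (‖x‖ ^ (2*γ) * (h k j x * Real.exp (u k j x))) = 0
  energy : ∀ k i, ∫ x in closedBall (0:E2) δ, ‖x‖ ^ (2*γ) * (h k i x * Real.exp (u k i x)) ≤ C
  osc : ∀ k i, ∀ x ∈ sphere (0:E2) δ, ∀ y ∈ sphere (0:E2) δ, |u k i x - u k i y| ≤ C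
  M_attained : ∀ k, ∃ i, ∃ x ∈ closedBall (0:E2) δ, u k i x = (1+γ) * M k
  M_max : ∀ k i, ∀ x ∈ closedBall (0:E2) δ, u k i x ≤ (1+γ) * M k
  M_inf : Tendsto M atTop atTop
  no_blowup_away : ∀ ε, 0 < ε → ε < δ → ∃ Cε : ℝ, ∀ k i, ∀ x ∈ closedBall (0:E2) δ,
    ε ≤ ‖x‖ → u k i x + 2*γ*Real.log ‖x‖ ≤ Cε

/-- The blowup is simple if `ũᵢᵏ(x) + 2μ log|x|` is bounded above uniformly. -/
def SimpleBlowup {n : ℕ} (δ γ : ℝ) (u : ℕ → Fin n → E2 → ℝ) : Prop :=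
  ∃ C : ℝ, ∀ k i, ∀ x ∈ closedBall (0:E2) δ, x ≠ 0 →
    u k i x + 2*(1+γ)*Real.log ‖x‖ ≤ C

open Topology Real
open Finset (abs_sum_le_sum_abs card_univ mem_univ mul_sum single_le_sum sum_add_distrib sum_comm
  sum_congr sum_const sum_div sum_eq_zero sum_eq_zero_iff_of_nonneg sum_le_sum sum_mul sum_nonneg
  sum_pair sum_pos sum_sub_distrib)
open Set (Icc Iio Ioc Ioi indicator_nonneg indicator_of_mem indicator_of_notMem)

section Algebra
open Matrix

variable {n : ℕ} {A : Matrix (Fin n) (Fin n) ℝ}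

lemma H1.isSymm_inv (hA : H1 A) : A⁻¹.IsSymm := by
  rw [IsSymm, transpose_nonsing_inv, hA.1]

lemma H1.inv_mulVec (hA : H1 A) (x : Fin n → ℝ) : A⁻¹ *ᵥ (A *ᵥ x) = x := by
  rw [mulVec_mulVec, nonsing_inv_mul _ hA.2.2.2, one_mulVec]

lemma H1.mulVec_inv (hA : H1 A) (x : Fin n → ℝ) : A *ᵥ (A⁻¹ *ᵥ x) = x := by
  rw [mulVec_mulVec, mul_nonsing_inv _ hA.2.2.2, one_mulVec]

lemma dotProduct_mulVec_comm (hA : A.IsSymm) (x y : Fin n → ℝ) :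
    x ⬝ᵥ (A *ᵥ y) = y ⬝ᵥ (A *ᵥ x) := by
  rw [dotProduct_mulVec, ← mulVec_transpose, hA, dotProduct_comm]

/-- A nonnegative vector with `A f ≤ c f` vanishes everywhere or nowhere. -/
lemma H1.eq_zero_or_pos (hA : H1 A) {f : Fin n → ℝ} {c : ℝ} (hf : ∀ i, 0 ≤ f i)
    (h : ∀ i, (A *ᵥ f) i ≤ c * f i) : f = 0 ∨ ∀ i, 0 < f i := by
  by_contra! hne
  obtain ⟨hf0, i0, hi0⟩ := hne
  obtain ⟨i1, hi1⟩ := Function.ne_iff.1 hf0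
  refine hA.2.2.1 ⟨Finset.univ.filter (f · = 0), ⟨i0, by simpa using le_antisymm hi0 (hf i0)⟩,
    ⟨i1, by simpa using hi1⟩, fun i hi j hj => ?_⟩
  have hi' : f i = 0 := by simpa using hi
  have hj' : f j ≠ 0 := by simpa using hj
  have h1 := single_le_sum (fun j _ => mul_nonneg (hA.2.1 i j) (hf j)) (mem_univ j)
  have h2 : ∑ j, A i j * f j ≤ 0 := by simpa [hi', mulVec, dotProduct] using h i
  exact (mul_eq_zero.1 (le_antisymm (h1.trans h2) (mul_nonneg (hA.2.1 i j) (hf j)))).resolve_right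
    hj'

/-- An eigenvector of `A⁻¹` for a positive eigenvalue does not change sign. -/
lemma H1.eigenvector_sign (hA : H1 A) (hA2 : H2 A) {z : Fin n → ℝ} {β : ℝ} (hβ : 0 < β)
    (hz : A⁻¹ *ᵥ z = β • z) (hz0 : z ≠ 0) : (∀ i, 0 < z i) ∨ ∀ i, z i < 0 := by
  have hAz : A *ᵥ z = β⁻¹ • z := by
    rw [eq_inv_smul_iff₀ hβ.ne', ← mulVec_smul, ← hz, hA.mulVec_inv]
  have h1 : ∀ i, 0 ≤ (A⁻¹ *ᵥ |z| - β • |z|) i := fun i => by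
    have h2 : ∀ s : ℝ, |s| = 1 → s * (A⁻¹ *ᵥ z) i ≤ (A⁻¹ *ᵥ |z|) i - A⁻¹ i i * (|z i| - s * z i) := by
      intro s hs
      have : ∀ j, s * (A⁻¹ i j * z j) ≤
          A⁻¹ i j * |z j| - if j = i then A⁻¹ i i * (|z i| - s * z i) else 0 := fun j => by
        split_ifs with hij
        · subst hij; linarith
        · have h3 : s * z j ≤ |z j| := (le_abs_self _).trans_eq (by rw [abs_mul, hs, one_mul])
          nlinarith [hA2.2.1 i j (Ne.symm hij)]
      simpa [mulVec, dotProduct, mul_sum] using sum_le_sum fun j (_ : j ∈ Finset.univ) => this j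
    rw [hz] at h2
    simp only [Pi.sub_apply, Pi.smul_apply, Pi.abs_apply, smul_eq_mul] at h2 ⊢
    rcases abs_cases (z i) with ⟨h, -⟩ | ⟨h, -⟩
    · have := h2 1 (by simp); rw [h] at this ⊢; linarith
    · have := h2 (-1) (by simp); rw [h] at this ⊢; linarith
  have h2 : ∀ i, (A *ᵥ |z|) i ≤ β⁻¹ * |z i| := fun i => by
    have h3 : 0 ≤ (A *ᵥ (A⁻¹ *ᵥ |z| - β • |z|)) i :=
      dotProduct_nonneg_of_nonneg (hA.2.1 i) h1
    rw [mulVec_sub, hA.mulVec_inv, mulVec_smul] at h3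
    rw [le_inv_mul_iff₀ hβ]
    simpa using h3
  have h3 : ∀ s : ℝ, |s| = 1 → |z| + s • z = 0 ∨ ∀ i, 0 < (|z| + s • z) i := fun s hs =>
    hA.eq_zero_or_pos (c := β⁻¹) (fun i => by
      have : -(s * z i) ≤ |z i| := (neg_le_abs _).trans_eq (by rw [abs_mul, hs, one_mul])
      simp; linarith) fun i => by
        have := h2 i
        simp [mulVec_add, mulVec_smul, hAz]; linarith
  obtain ⟨i0, hi0⟩ := Function.ne_iff.1 hz0
  rcases h3 (-1) (by simp) with h | h <;> rcases h3 1 (by simp) with h' | h'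
  · have e1 := congrFun h i0
    have e2 := congrFun h' i0
    simp at e1 e2 hi0; grind
  · refine .inl fun i => ?_
    have e1 := congrFun h i
    have e2 := h' i
    simp at e1 e2; linarith
  · refine .inr fun i => ?_
    have e1 := congrFun h' i
    have e2 := h i
    simp at e1 e2; linarith
  · have e1 := h i0
    have e2 := h' i0
    simp at e1 e2; grind

/-- The quadratic form of `A⁻¹` is nonpositive on the orthogonal complement of the vector of
row sums of `A⁻¹`. -/
lemma H1.inv_form_nonpos (hA : H1 A) (hA2 : H2 A) (z : Fin n → ℝ)
    (hz : (fun _ => (1 : ℝ)) ⬝ᵥ (A⁻¹ *ᵥ z) = 0) : z ⬝ᵥ (A⁻¹ *ᵥ z) ≤ 0 := by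
  have hH : A⁻¹.IsHermitian := by
    rw [IsHermitian, conjTranspose_eq_transpose_of_trivial]; exact hA.isSymm_inv
  set e : Fin n → Fin n → ℝ := fun i => (hH.eigenvectorBasis i).ofLp
  set β := hH.eigenvalues
  have he : ∀ i, A⁻¹ *ᵥ e i = β i • e i := hH.mulVec_eigenvectorBasis
  have he0 : ∀ i, e i ≠ 0 := fun i h =>
    hH.eigenvectorBasis.orthonormal.ne_zero i ((WithLp.ofLp_eq_zero 2).1 h)
  have hform : ∀ x : Fin n → ℝ, x ⬝ᵥ (A⁻¹ *ᵥ x) = ∑ i, β i * (x ⬝ᵥ e i) ^ 2 := by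
    intro x
    have h1 := hH.eigenvectorBasis.sum_inner_mul_inner (WithLp.toLp 2 (A⁻¹ *ᵥ x)) (WithLp.toLp 2 x)
    simp only [EuclideanSpace.inner_eq_star_dotProduct, star_trivial] at h1
    rw [← h1]
    refine sum_congr rfl fun i _ => ?_
    rw [dotProduct_mulVec_comm hA.isSymm_inv]
    change x ⬝ᵥ (A⁻¹ *ᵥ e i) * (x ⬝ᵥ e i) = _
    rw [he, dotProduct_smul, smul_eq_mul]; ring
  have hdot : ∀ i, 0 < β i → ∀ w : Fin n → ℝ, (∀ k, 0 < w k) → w ⬝ᵥ e i ≠ 0 := by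
    intro i hi w hw
    obtain ⟨k, -⟩ := Function.ne_iff.1 (he0 i)
    rcases hA.eigenvector_sign hA2 hi (he i) (he0 i) with h | h
    · exact (sum_pos (fun j _ => mul_pos (hw j) (h j)) ⟨k, mem_univ k⟩).ne'
    · exact (Finset.sum_neg (fun j _ => mul_neg_of_pos_of_neg (hw j) (h j)) ⟨k, mem_univ k⟩).ne
  by_cases hβ : ∃ i, 0 < β i
  · obtain ⟨i, hi⟩ := hβ
    have horth : ∀ j ≠ i, β j ≤ 0 := by
      intro j hj
      by_contra! hβj
      have h1 : e i ⬝ᵥ e j = 0 := hH.eigenvectorBasis.orthonormal.2 hj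
      rcases hA.eigenvector_sign hA2 hi (he i) (he0 i) with h | h
      · exact hdot j hβj (e i) h h1
      · exact hdot j hβj (-e i) (fun k => neg_pos.2 (h k)) (by rw [neg_dotProduct, h1, neg_zero])
    set o : Fin n → ℝ := fun _ => 1
    have ho : o ⬝ᵥ e i ≠ 0 := hdot i hi o fun _ => one_pos
    set t := (z ⬝ᵥ e i) / (o ⬝ᵥ e i) with ht
    have h1 : (z - t • o) ⬝ᵥ (A⁻¹ *ᵥ (z - t • o)) ≤ 0 := by
      rw [hform]
      refine Finset.sum_nonpos fun j _ => ?_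
      by_cases hj : j = i
      · simp [hj, sub_dotProduct, ht, ho]
      · exact mul_nonpos_of_nonpos_of_nonneg (horth j hj) (sq_nonneg _)
    have h2 : 0 ≤ o ⬝ᵥ (A⁻¹ *ᵥ o) := sum_nonneg fun i _ => by
      simpa [o, mulVec, dotProduct] using hA2.2.2 i
    simp only [mulVec_sub, mulVec_smul, sub_dotProduct, dotProduct_sub, dotProduct_smul,
      smul_dotProduct, smul_eq_mul, dotProduct_mulVec_comm hA.isSymm_inv z o, hz] at h1
    nlinarith [mul_nonneg (sq_nonneg t) h2]
  · rw [hform]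
    exact Finset.sum_nonpos fun i _ => mul_nonpos_of_nonpos_of_nonneg
      (not_lt.1 fun h => hβ ⟨i, h⟩) (sq_nonneg _)

lemma H1.inv_form_one_pos (hn : 0 < n) (hA : H1 A) (hA2 : H2 A) :
    0 < (fun _ => (1 : ℝ)) ⬝ᵥ (A⁻¹ *ᵥ fun _ => 1) := by
  have hr : ∀ i ∈ Finset.univ, 0 ≤ 1 * (A⁻¹ *ᵥ fun _ => (1 : ℝ)) i := fun i _ => by
    simpa [mulVec, dotProduct] using hA2.2.2 i
  refine lt_of_le_of_ne (sum_nonneg hr) fun h => ?_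
  have h1 : A⁻¹ *ᵥ (fun _ => (1 : ℝ)) = 0 := funext fun i => by
    simpa using (sum_eq_zero_iff_of_nonneg hr).1 h.symm i (mem_univ i)
  have h2 := hA.mulVec_inv fun _ => 1
  rw [h1, mulVec_zero] at h2
  exact zero_ne_one (congrFun h2 ⟨0, hn⟩)

/-- The interaction of two concentrated masses which are both seen from a larger scale. -/
lemma pair_interaction (hn : 0 < n) (hA : H1 A)
    (hA2 : H2 A) (σ τ : Fin n → ℝ) (hσ : ∀ i, 0 ≤ σ i) (hτ : ∀ i, 0 ≤ τ i)
    (hσ0 : 0 < ∑ i, σ i) (hτ0 : 0 < ∑ i, τ i) (μ ν : ℝ) (hμ : 0 < μ) (hν : 0 < ν)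
    (hQσ : σ ⬝ᵥ (A *ᵥ σ) = 4 * μ * ∑ i, σ i) (hQτ : τ ⬝ᵥ (A *ᵥ τ) = 4 * ν * ∑ i, τ i)
    (a b : ℝ) (hb : 0 ≤ b) (hab : 0 < a + b)
    (h1 : ∀ i, 0 < σ i → b * ((A *ᵥ τ) i - 2 * ν) ≤ a * ((A *ᵥ σ) i - 2 * μ))
    (h2 : ∀ i, 0 < τ i → a * ((A *ᵥ σ) i - 2 * μ) ≤ b * ((A *ᵥ τ) i - 2 * ν)) :
    σ ⬝ᵥ (A *ᵥ τ) = 2 * (ν * ∑ i, σ i + μ * ∑ i, τ i) := by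
  set o : Fin n → ℝ := fun _ => 1
  have hQ := dotProduct_mulVec_comm hA.1 τ σ
  have ho : ∀ x, A *ᵥ x ⬝ᵥ (A⁻¹ *ᵥ o) = ∑ i, x i := fun x => by
    rw [dotProduct_mulVec_comm hA.isSymm_inv, hA.inv_mulVec]; simp [o, dotProduct]
  have ho' : ∀ x, o ⬝ᵥ x = ∑ i, x i := fun x => by simp [o, dotProduct]
  have hR : 0 < ∑ i, (A⁻¹ *ᵥ o) i := ho' _ ▸ H1.inv_form_one_pos hn hA hA2
  have hc : ∀ x y, A *ᵥ x ⬝ᵥ y = y ⬝ᵥ (A *ᵥ x) := fun x y => dotProduct_comm _ _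
  have hsum : ∀ x y z : Fin n → ℝ, ∀ s t c d : ℝ, (∀ i, 0 ≤ x i) →
      (∀ i, 0 < x i → s * (y i - c) ≤ t * (z i - d)) →
      s * (x ⬝ᵥ y - c * ∑ i, x i) ≤ t * (x ⬝ᵥ z - d * ∑ i, x i) := by
    intro x y z s t c d hx h
    simp only [dotProduct, mul_sum, ← sum_sub_distrib]
    refine sum_le_sum fun i _ => ?_
    rcases (hx i).eq_or_lt with h0 | h0
    · simp [← h0]
    · linarith [mul_le_mul_of_nonneg_left (h i h0) h0.le]
  have k1 := hsum _ _ _ _ _ _ _ hσ h1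
  have k2 := hsum _ _ _ _ _ _ _ hτ h2
  have hrev : ∀ s t w : ℝ, s * ∑ i, σ i + t * ∑ i, τ i + w * ∑ i, (A⁻¹ *ᵥ o) i = 0 →
      s ^ 2 * (4 * μ * ∑ i, σ i) + 2 * s * t * (σ ⬝ᵥ (A *ᵥ τ)) + t ^ 2 * (4 * ν * ∑ i, τ i)
        ≤ w ^ 2 * ∑ i, (A⁻¹ *ᵥ o) i := by
    intro s t w h
    have e : A⁻¹ *ᵥ (s • A *ᵥ σ + t • A *ᵥ τ + w • o) = s • σ + t • τ + w • (A⁻¹ *ᵥ o) := by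
      simp only [mulVec_add, mulVec_smul, hA.inv_mulVec]
    have h3 := hA.inv_form_nonpos hA2 (s • A *ᵥ σ + t • A *ᵥ τ + w • o) (by
      rw [e, ho']; simpa [mul_sum, sum_add_distrib] using h)
    rw [e] at h3
    simp only [dotProduct_add, add_dotProduct, dotProduct_smul, smul_dotProduct, smul_eq_mul, ho,
      ho', hc, hQ, hQσ, hQτ] at h3
    linear_combination h3 - 2 * w * h
  have e1 := hrev (∑ i, (A⁻¹ *ᵥ o) i) 0 (-∑ i, σ i) (by ring)
  have e2 := hrev 0 (∑ i, (A⁻¹ *ᵥ o) i) (-∑ i, τ i) (by ring)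
  rw [hQσ] at k1
  rw [hQτ, hQ] at k2
  generalize σ ⬝ᵥ (A *ᵥ τ) = Q at *
  generalize ∑ i, (A⁻¹ *ᵥ o) i = R at *
  generalize ∑ i, σ i = S at *
  generalize ∑ i, τ i = T at *
  have hS : 4 * μ * R ≤ S := le_of_mul_le_mul_right (by linarith) (mul_pos hR hσ0)
  have hT : 4 * ν * R ≤ T := le_of_mul_le_mul_right (by linarith) (mul_pos hR hτ0)
  obtain ⟨p, rfl⟩ : ∃ p, S = p + 2 * μ * R := ⟨S - 2 * μ * R, by ring⟩
  obtain ⟨q, rfl⟩ : ∃ q, T = q + 2 * ν * R := ⟨T - 2 * ν * R, by ring⟩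
  obtain ⟨c, rfl⟩ : ∃ c, Q = c + 2 * ν * p + 2 * μ * q + 4 * μ * ν * R :=
    ⟨Q - 2 * ν * p - 2 * μ * q - 4 * μ * ν * R, by ring⟩
  have hμR := mul_pos hμ hR
  have hνR := mul_pos hν hR
  have hp : 0 < p := by linarith
  have hq : 0 < q := by linarith
  have hpq := mul_pos hp hq
  have hνp := mul_pos hν hp
  have hμq := mul_pos hμ hq
  have hc4 : 4 * μ * ν * R ≤ c := by
    refine le_of_mul_le_mul_right ?_ hpq
    linarith [hrev q (-p) (2 * ν * p - 2 * μ * q) (by ring),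
      mul_nonneg hR.le (sq_nonneg (μ * q - ν * p))]
  have k1' : b * (c + 2 * μ * q) ≤ a * (2 * μ * (2 * μ * R + p)) := by linarith
  have k2' : a * (c + 2 * ν * p) ≤ b * (2 * ν * (2 * ν * R + q)) := by linarith
  suffices c = 4 * μ * ν * R by linarith
  refine (hc4.eq_or_lt).elim Eq.symm fun hlt => ?_
  have hμνR := mul_pos hμ hνR
  have h3 : 0 ≤ c + 2 * ν * p := by linarith
  have h4 := mul_le_mul_of_nonneg_right k1' h3
  have h5 := mul_le_mul_of_nonneg_right k2' (by positivity : 0 ≤ 2 * μ * (2 * μ * R + p))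
  have h6 : 2 * μ * (2 * ν * R + q) * (2 * ν * (2 * μ * R + p)) <
      (c + 2 * μ * q) * (c + 2 * ν * p) :=
    mul_lt_mul'' (by linarith) (by linarith) (by positivity) (by positivity)
  have hb0 : b = 0 := le_antisymm
    (nonpos_of_mul_nonpos_left (by linarith) (sub_pos.2 h6)) hb
  rw [hb0, zero_mul] at k2'
  linarith [mul_pos (by linarith : 0 < a) (by linarith : 0 < c + 2 * ν * p)]

/-- The inverse of an irreducible matrix does not decouple. -/
lemma H1.exists_inv_entry_ne_zero (hA : H1 A) (S : Finset (Fin n)) (hS : S.Nonempty)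
    (hSc : Sᶜ.Nonempty) : ∃ i ∈ S, ∃ j ∈ Sᶜ, A⁻¹ i j ≠ 0 := by
  by_contra! hcon
  set P : Matrix (Fin n) (Fin n) ℝ := diagonal fun i => if i ∈ S then 1 else 0 with hP
  have hcomm : P * A⁻¹ = A⁻¹ * P := by
    ext i j
    rw [hP, diagonal_mul, mul_diagonal]
    by_cases hi : i ∈ S <;> by_cases hj : j ∈ S <;> simp [hi, hj]
    · exact hcon i hi j (by simpa using hj)
    · rw [← hA.isSymm_inv.apply, hcon j hj i (by simpa using hi)]
  have hcomm2 : A * P = P * A := by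
    calc A * P = A * (P * A⁻¹) * A := by
          simp only [mul_assoc, nonsing_inv_mul _ hA.2.2.2, mul_one]
      _ = P * A := by rw [hcomm, ← mul_assoc, mul_nonsing_inv _ hA.2.2.2, one_mul]
  refine hA.2.2.1 ⟨S, hS, hSc, fun i hi j hj => ?_⟩
  have := congrFun (congrFun hcomm2 i) j
  rw [hP, diagonal_mul, mul_diagonal] at this
  simp only [Finset.mem_compl] at hj
  simpa [hi, hj] using this.symm

/-- If the decay rates are positive on the support of the mass vector, they all are. -/
lemma decay_rates_pos (hA : H1 A) (hA2 : H2 A) (σ : Fin n → ℝ) (hσ : ∀ i, 0 ≤ σ i)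
    (hσ0 : ∃ i, 0 < σ i) (μ : ℝ) (hy : ∀ i, 0 < σ i → 0 < (A *ᵥ σ) i - 2 * μ) (i : Fin n) :
    0 < (A *ᵥ σ) i - 2 * μ := by
  obtain ⟨i1, hi1⟩ := hσ0
  have : Nonempty (Fin n) := ⟨i1⟩
  obtain ⟨i0, hi0⟩ := Finite.exists_min (A *ᵥ σ)
  by_contra! hcon
  have hm : (A *ᵥ σ) i0 - 2 * μ ≤ 0 := by linarith [hi0 i]
  obtain ⟨j, hj, l, hl, hjl⟩ := hA.exists_inv_entry_ne_zero
    (Finset.univ.filter fun i => (A *ᵥ σ) i = (A *ᵥ σ) i0) ⟨i0, by simp⟩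
    ⟨i1, by
      have := hy i1 hi1
      simp only [Finset.mem_compl, Finset.mem_filter, mem_univ, true_and]
      intro h; linarith⟩
  have hj' : (A *ᵥ σ) j = (A *ᵥ σ) i0 := by simpa using hj
  have hl' : (A *ᵥ σ) l ≠ (A *ᵥ σ) i0 := by simpa using hl
  have hσj : σ j = 0 := by
    by_contra h
    linarith [hy j (lt_of_le_of_ne (hσ j) (Ne.symm h))]
  have h1 : ∑ k, A⁻¹ j k * (A *ᵥ σ) k = 0 := (congrFun (hA.inv_mulVec σ) j).trans hσj
  have h2 : ∑ k, A⁻¹ j k * ((A *ᵥ σ) k - (A *ᵥ σ) j) ≤ 0 := by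
    simp only [mul_sub, sum_sub_distrib, h1, ← sum_mul, zero_sub, neg_nonpos]
    exact mul_nonneg (hA2.2.2 j) (dotProduct_nonneg_of_nonneg (hA.2.1 j) hσ)
  have h3 : ∀ k ∈ Finset.univ, 0 ≤ A⁻¹ j k * ((A *ᵥ σ) k - (A *ᵥ σ) j) := by
    intro k _
    by_cases hk : j = k
    · simp [hk]
    · exact mul_nonneg (hA2.2.1 j k hk) (by rw [hj']; linarith [hi0 k])
  rcases mul_eq_zero.1 ((sum_eq_zero_iff_of_nonneg h3).1
    (le_antisymm h2 (sum_nonneg h3)) l (mem_univ l)) with h5 | h5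
  · exact hjl h5
  · exact hl' (by linarith)

lemma sum_strengths_eq {ι : Type*} (Z : Finset ι)
    (σ : ι → Fin n → ℝ) (m : ι → ℝ) (μ : ℝ)
    (hpair : ∀ z ∈ Z, ∀ w ∈ Z,
      σ z ⬝ᵥ (A *ᵥ σ w) = 2 * (m w * ∑ i, σ z i + m z * ∑ i, σ w i))
    (htot : (∑ z ∈ Z, σ z) ⬝ᵥ (A *ᵥ (∑ z ∈ Z, σ z)) = 4 * μ * ∑ i, (∑ z ∈ Z, σ z) i)
    (hpos : 0 < ∑ i, (∑ z ∈ Z, σ z) i) : ∑ z ∈ Z, m z = μ := by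
  have e1 : (∑ z ∈ Z, σ z) ⬝ᵥ (A *ᵥ (∑ z ∈ Z, σ z)) =
      ∑ z ∈ Z, ∑ w ∈ Z, σ z ⬝ᵥ (A *ᵥ σ w) := by
    rw [sum_dotProduct]
    refine sum_congr rfl fun z _ => ?_
    rw [mulVec_sum, dotProduct_sum]
  have e2 : ∑ i, (∑ z ∈ Z, σ z) i = ∑ z ∈ Z, ∑ i, σ z i := by
    simp only [Finset.sum_apply]; exact sum_comm
  have e3 : ∑ z ∈ Z, ∑ w ∈ Z, σ z ⬝ᵥ (A *ᵥ σ w) =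
      4 * (∑ z ∈ Z, m z) * ∑ z ∈ Z, ∑ i, σ z i := by
    have h1 : ∑ z ∈ Z, ∑ w ∈ Z, σ z ⬝ᵥ (A *ᵥ σ w) =
        ∑ z ∈ Z, ∑ w ∈ Z, 2 * (m w * ∑ i, σ z i + m z * ∑ i, σ w i) :=
      sum_congr rfl fun z hz => sum_congr rfl fun w hw => hpair z hz w hw
    have h2 : ∑ z ∈ Z, ∑ w ∈ Z, m z * ∑ i, σ w i =
        (∑ z ∈ Z, m z) * ∑ z ∈ Z, ∑ i, σ z i := (Finset.sum_mul_sum ..).symm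
    have h3 : ∑ z ∈ Z, ∑ w ∈ Z, m w * ∑ i, σ z i =
        (∑ z ∈ Z, m z) * ∑ z ∈ Z, ∑ i, σ z i := by rw [sum_comm, h2]
    rw [h1]; simp only [← mul_sum, sum_add_distrib] at h2 h3 ⊢
    simp only [mul_sum] at h2 h3 ⊢
    rw [h2, h3]; simp only [← mul_sum]; ring
  rw [e1, e3] at htot
  rw [e2] at htot hpos
  have := mul_right_cancel₀ hpos.ne' htot
  linarith

end Algebra

section Concentration
open Matrix

/-- A family of vectors of measures on the plane, together with averaged logarithms `lam` of their
densities, which satisfies the a priori estimates of a Liouville system. -/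
structure LiouvilleFamily (n : ℕ) (A : Matrix (Fin n) (Fin n) ℝ) (γ : ℝ) where
  ρ : ℕ → Fin n → Measure E2
  lam : ℕ → Fin n → E2 → ℝ → ℝ
  r₀ : ℝ
  K : ℝ
  ε₀ : ℝ
  r₀_pos : 0 < r₀
  K_pos : 0 < K
  ε₀_pos : 0 < ε₀
  finite : ∀ k i, IsFiniteMeasure (ρ k i)
  mass_le : ∀ k, ∑ i, (ρ k i).real Set.univ ≤ K
  diffuse : ∀ k, ∀ ε > 0, ∃ t > 0, ∀ x, ∑ i, (ρ k i).real (closedBall x t) < ε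
  exp_lam_le : ∀ k i x s, 0 < s → ‖x‖ + 2 * s ≤ r₀ →
    exp (lam k i x s) ≤ K * (ρ k i).real (closedBall x s)
  le_exp_lam : ∀ k i x s, 0 < s → ‖x‖ + 2 * s ≤ r₀ →
    ∑ j, (ρ k j).real (closedBall x (2 * s)) ≤ ε₀ →
    (ρ k i).real (closedBall x (s / 2)) ≤ K * exp (lam k i x s)
  compare : ∀ Λ : ℝ, ∃ D, ∀ k i x x' s s', 0 < s → 0 < s' → s ≤ Λ * s' → s' ≤ Λ * s →
    ‖x - x'‖ ≤ Λ * s' → |lam k i x s - lam k i x' s'| ≤ D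
  slope_le : ∀ k i x s s', 0 < s → s ≤ s' →
    lam k i x s' - lam k i x s ≤
      (2 - ∑ j, A i j * (ρ k j).real (closedBall x s)) * log (s' / s) +
        2 * γ * log (max ‖x‖ s' / max ‖x‖ s)
  le_slope : ∀ k i x s s', 0 < s → s ≤ s' →
    (2 - ∑ j, A i j * (ρ k j).real (closedBall x s')) * log (s' / s) +
      2 * γ * log (max ‖x‖ s' / max ‖x‖ s) ≤ lam k i x s' - lam k i x s
  pohozaev : ∀ k p s T μ, 0 < s → 4 ≤ T → ‖p‖ + T * s ≤ r₀ →
    ((p = 0 ∧ μ = 1 + γ) ∨ (4 * s ≤ ‖p‖ ∧ μ = 1)) →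
    |(fun j => (ρ k j).real (closedBall p s)) ⬝ᵥ (A *ᵥ fun j => (ρ k j).real (closedBall p s)) -
        4 * μ * ∑ j, (ρ k j).real (closedBall p s)| ≤
      K * (∑ j, (ρ k j).real (closedBall p (T * s) \ closedBall p s) + 1 / T + s + s / ‖p‖)

namespace LiouvilleFamily

variable {n : ℕ} {A : Matrix (Fin n) (Fin n) ℝ} {γ : ℝ} (P : LiouvilleFamily n A γ)
  (𝒰 : Ultrafilter ℕ)

instance (k : ℕ) (i : Fin n) : IsFiniteMeasure (P.ρ k i) := P.finite k i

/-- The vector of masses of a closed ball. -/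
def mass (k : ℕ) (x : E2) (s : ℝ) : Fin n → ℝ := fun j => (P.ρ k j).real (closedBall x s)

/-- The total mass of a set. -/
def tot (k : ℕ) (S : Set E2) : ℝ := ∑ j, (P.ρ k j).real S

/-- The strength of a center: `1 + γ` at the singular source, `1` elsewhere. -/
def strength (γ : ℝ) (b : Bool) : ℝ := if b then 1 + γ else 1

/-- `q` is the origin if `b`, or is far from the origin at scale `d` otherwise. -/
def IsCenter (b : Bool) (q : ℕ → E2) (d : ℕ → ℝ) : Prop :=
  if b then ∀ᶠ k in (𝒰 : Filter ℕ), q k = 0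
  else ∃ Λ, ∀ᶠ k in (𝒰 : Filter ℕ), d k ≤ Λ * ‖q k‖

/-- The frame at `q` of size `d` shrinks to the origin. -/
def Shrinks (q : ℕ → E2) (d : ℕ → ℝ) : Prop :=
  (∀ᶠ k in (𝒰 : Filter ℕ), 0 < d k) ∧ ∀ ε > 0, ∀ᶠ k in (𝒰 : Filter ℕ), ‖q k‖ + d k ≤ ε

/-- `f` is negligible with respect to `d`. -/
def Negl (f d : ℕ → ℝ) : Prop := ∀ ε > 0, ∀ᶠ k in (𝒰 : Filter ℕ), f k ≤ ε * d k

/-- Mass concentrates at the point `z` of the frame at `p` of size `d`. -/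
def IsAtom (p : ℕ → E2) (d : ℕ → ℝ) (z : E2) : Prop :=
  ∀ s > 0, ∀ᶠ k in (𝒰 : Filter ℕ), P.ε₀ ≤ P.tot k (closedBall (p k + d k • z) (s * d k))

/-- A single bubble at scale `r` around `q`, with mass `σ`, which is isolated up to scale `d`. -/
structure IsSimpleAt (b : Bool) (q : ℕ → E2) (d : ℕ → ℝ) (σ : Fin n → ℝ) (r : ℕ → ℝ) : Prop where
  r_pos : ∀ᶠ k in (𝒰 : Filter ℕ), 0 < r k
  r_negl : Negl 𝒰 r d
  mass_near : ∀ ε > 0, ∃ R ≥ 1, ∃ s > 0, ∀ᶠ k in (𝒰 : Filter ℕ), ∀ t, R * r k ≤ t → t ≤ s * d k →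
    ∀ j, |P.mass k (q k) t j - σ j| ≤ ε
  lam_ge : ∀ i, 0 < σ i → ∃ D, ∀ᶠ k in (𝒰 : Filter ℕ), -D ≤ P.lam k i (q k) (r k)
  rate_pos : ∀ i, 0 < (A *ᵥ σ) i - 2 * strength γ b
  poh : σ ⬝ᵥ (A *ᵥ σ) = 4 * strength γ b * ∑ i, σ i

lemma mass_nonneg (k : ℕ) (x : E2) (s : ℝ) (j : Fin n) : 0 ≤ P.mass k x s j := measureReal_nonneg

lemma tot_nonneg (k : ℕ) (S : Set E2) : 0 ≤ P.tot k S :=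
  sum_nonneg fun _ _ => measureReal_nonneg

lemma tot_mono (k : ℕ) {S T : Set E2} (h : S ⊆ T) : P.tot k S ≤ P.tot k T :=
  sum_le_sum fun _ _ => measureReal_mono h

lemma tot_le (k : ℕ) (S : Set E2) : P.tot k S ≤ P.K :=
  (P.tot_mono k (Set.subset_univ S)).trans (P.mass_le k)

lemma tot_diff (k : ℕ) {S T : Set E2} (h : S ⊆ T) (hS : MeasurableSet S) :
    P.tot k (T \ S) = P.tot k T - P.tot k S := by
  unfold tot
  rw [← sum_sub_distrib]
  exact sum_congr rfl fun j _ => measureReal_sdiff h hS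

lemma tot_union_le (k : ℕ) (S T : Set E2) : P.tot k (S ∪ T) ≤ P.tot k S + P.tot k T := by
  unfold tot
  rw [← sum_add_distrib]
  exact sum_le_sum fun j _ => measureReal_union_le S T

lemma tot_add_le (k : ℕ) {S T V : Set E2} (hd : Disjoint S T) (hT : MeasurableSet T)
    (hS : S ⊆ V) (hTV : T ⊆ V) : P.tot k S + P.tot k T ≤ P.tot k V := by
  refine le_trans (le_of_eq ?_) (P.tot_mono k (Set.union_subset hS hTV))
  unfold tot
  rw [← sum_add_distrib]
  exact sum_congr rfl fun j _ => (measureReal_union hd hT).symm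

lemma le_tot (k : ℕ) (S : Set E2) (j : Fin n) : (P.ρ k j).real S ≤ P.tot k S :=
  single_le_sum (f := fun j => (P.ρ k j).real S) (fun _ _ => measureReal_nonneg)
    (mem_univ j)

lemma sum_mass (k : ℕ) (x : E2) (s : ℝ) : ∑ j, P.mass k x s j = P.tot k (closedBall x s) := rfl

lemma mass_le_K (k : ℕ) (x : E2) (s : ℝ) (j : Fin n) : P.mass k x s j ≤ P.K :=
  (P.le_tot k _ j).trans (P.tot_le k _)

lemma mass_mono (k : ℕ) (x : E2) {s t : ℝ} (h : s ≤ t) (j : Fin n) :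
    P.mass k x s j ≤ P.mass k x t j := measureReal_mono (closedBall_subset_closedBall h)

omit P in
lemma exists_tendsto_of_bounded (f : ℕ → ℝ) (a b : ℝ)
    (h : ∀ᶠ k in (𝒰 : Filter ℕ), f k ∈ Icc a b) :
    ∃ l ∈ Icc a b, Tendsto f 𝒰 (𝓝 l) := by
  obtain ⟨l, hl, hle⟩ := (isCompact_Icc (a := a) (b := b)).ultrafilter_le_nhds (𝒰.map f)
    (le_principal_iff.2 h)
  exact ⟨l, hl, hle⟩

variable {𝒰} {P}

omit P in
lemma IsCenter.mono {b : Bool} {q : ℕ → E2} {d d' : ℕ → ℝ} (h : IsCenter 𝒰 b q d)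
    (hd : ∀ᶠ k in (𝒰 : Filter ℕ), d' k ≤ d k) : IsCenter 𝒰 b q d' := by
  cases b
  · obtain ⟨Λ, hΛ⟩ := by simpa [IsCenter] using h
    simp only [IsCenter, Bool.false_eq_true, if_false]
    exact ⟨Λ, by filter_upwards [hΛ, hd] with k h1 h2 using h2.trans h1⟩
  · simpa [IsCenter] using h

omit P in
lemma Shrinks.mono {q : ℕ → E2} {d d' : ℕ → ℝ} (h : Shrinks 𝒰 q d)
    (h0 : ∀ᶠ k in (𝒰 : Filter ℕ), 0 < d' k)
    (hd : ∀ᶠ k in (𝒰 : Filter ℕ), d' k ≤ d k) : Shrinks 𝒰 q d' :=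
  ⟨h0, fun ε hε => by filter_upwards [h.2 ε hε, hd] with k h1 h2 using by linarith⟩

omit P in
lemma Shrinks.move {q q' : ℕ → E2} {d : ℕ → ℝ} (h : Shrinks 𝒰 q d) (C : ℝ)
    (hq : ∀ᶠ k in (𝒰 : Filter ℕ), ‖q' k - q k‖ ≤ C * d k) : Shrinks 𝒰 q' d := by
  refine ⟨h.1, fun ε hε => ?_⟩
  have hC : 0 < |C| + 1 := by positivity
  filter_upwards [h.2 (ε / (|C| + 1)) (by positivity), hq, h.1] with k h1 h2 h3
  have h4 : ‖q' k‖ ≤ ‖q' k - q k‖ + ‖q k‖ := by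
    simpa using norm_add_le (q' k - q k) (q k)
  rw [le_div_iff₀ hC] at h1
  have h5 : C * d k ≤ |C| * d k := mul_le_mul_of_nonneg_right (le_abs_self C) h3.le
  nlinarith [norm_nonneg (q k), abs_nonneg C]

omit P in
lemma Shrinks.eventually_le {q : ℕ → E2} {d : ℕ → ℝ} (h : Shrinks 𝒰 q d) (T : ℝ) {ε : ℝ}
    (hε : 0 < ε) : ∀ᶠ k in (𝒰 : Filter ℕ), ‖q k‖ + T * d k ≤ ε := by
  have hC : 0 < |T| + 1 := by positivity
  filter_upwards [h.2 (ε / (|T| + 1)) (by positivity), h.1] with k h1 h3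
  rw [le_div_iff₀ hC] at h1
  have h5 : T * d k ≤ |T| * d k := mul_le_mul_of_nonneg_right (le_abs_self T) h3.le
  nlinarith [norm_nonneg (q k), abs_nonneg T]

variable (P)

lemma slope_center {b : Bool} {q : ℕ → E2} {d : ℕ → ℝ} (hc : IsCenter 𝒰 b q d) :
    ∃ D, ∀ᶠ k in (𝒰 : Filter ℕ), ∀ s s', 0 < s → s ≤ s' → s' ≤ d k → ∀ i,
      P.lam k i (q k) s' - P.lam k i (q k) s ≤
        (2 * strength γ b - (A *ᵥ P.mass k (q k) s) i) * log (s' / s) + D ∧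
      (2 * strength γ b - (A *ᵥ P.mass k (q k) s') i) * log (s' / s) - D ≤
        P.lam k i (q k) s' - P.lam k i (q k) s := by
  have hm : ∀ k x s i, ∑ j, A i j * (P.ρ k j).real (closedBall x s) = (A *ᵥ P.mass k x s) i :=
    fun _ _ _ _ => rfl
  cases b
  · obtain ⟨Λ, hΛ⟩ := by simpa [IsCenter] using hc
    refine ⟨|2 * γ| * log (max Λ 1), ?_⟩
    filter_upwards [hΛ] with k hk s s' hs hss hs' i
    have h1 := P.slope_le k i (q k) s s' hs hss
    have h2 := P.le_slope k i (q k) s s' hs hss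
    rw [hm] at h1 h2
    have hpos : 0 < max ‖q k‖ s := lt_of_lt_of_le hs (le_max_right _ _)
    have h3 : |log (max ‖q k‖ s' / max ‖q k‖ s)| ≤ log (max Λ 1) := by
      have h4 : 1 ≤ max ‖q k‖ s' / max ‖q k‖ s := by
        rw [le_div_iff₀ hpos, one_mul]; exact max_le_max le_rfl hss
      rw [abs_of_nonneg (log_nonneg h4)]
      refine log_le_log (by linarith) ?_
      rw [div_le_iff₀ hpos]
      refine max_le ?_ ?_
      · calc ‖q k‖ ≤ max ‖q k‖ s := le_max_left _ _
          _ ≤ _ := le_mul_of_one_le_left hpos.le (le_max_right _ _)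
      · calc s' ≤ Λ * ‖q k‖ := hs'.trans hk
          _ ≤ max Λ 1 * ‖q k‖ := mul_le_mul_of_nonneg_right (le_max_left _ _) (norm_nonneg _)
          _ ≤ _ := mul_le_mul_of_nonneg_left (le_max_left _ _) (by positivity)
    have h5 : |2 * γ * log (max ‖q k‖ s' / max ‖q k‖ s)| ≤ |2 * γ| * log (max Λ 1) := by
      rw [abs_mul]; exact mul_le_mul_of_nonneg_left h3 (abs_nonneg _)
    rw [abs_le] at h5
    simp only [strength, Bool.false_eq_true, if_false, mul_one]
    constructor <;> linarith [h5.1, h5.2]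
  · have hc' : ∀ᶠ k in (𝒰 : Filter ℕ), q k = 0 := by simpa [IsCenter] using hc
    refine ⟨0, ?_⟩
    filter_upwards [hc'] with k hk s s' hs hss hs' i
    have h1 := P.slope_le k i (q k) s s' hs hss
    have h2 := P.le_slope k i (q k) s s' hs hss
    rw [hm, hk, norm_zero, max_eq_right hs.le, max_eq_right (hs.le.trans hss)] at h1 h2
    simp only [strength, if_true, hk]
    constructor <;> nlinarith

lemma lam_bddAbove {q : ℕ → E2} {r : ℕ → ℝ} (h : Shrinks 𝒰 q r) :
    ∀ᶠ k in (𝒰 : Filter ℕ), ∀ i, P.lam k i (q k) (r k) ≤ P.K * P.K := by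
  filter_upwards [h.1, h.eventually_le 2 P.r₀_pos] with k h1 h2 i
  have h3 := P.exp_lam_le k i (q k) (r k) h1 h2
  have h4 := mul_le_mul_of_nonneg_left (P.mass_le_K k (q k) (r k) i) P.K_pos.le
  have h5 := add_one_le_exp (P.lam k i (q k) (r k))
  unfold mass at h4
  linarith

variable {P}

lemma IsSimpleAt.nonneg {b : Bool} {q : ℕ → E2} {d r : ℕ → ℝ} {σ : Fin n → ℝ}
    (h : P.IsSimpleAt 𝒰 b q d σ r) (hd : ∀ᶠ k in (𝒰 : Filter ℕ), 0 < d k) (j : Fin n) :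
    0 ≤ σ j := by
  by_contra! hneg
  obtain ⟨R, hR, s, hs, hev⟩ := h.mass_near (-σ j / 2) (by linarith)
  obtain ⟨k, h1, h2, h3⟩ := (hev.and ((h.r_negl (s / R) (by positivity)).and hd)).exists
  have h4 : R * r k ≤ s * d k := by
    have := mul_le_mul_of_nonneg_left h2 (by linarith : 0 ≤ R)
    calc R * r k ≤ R * (s / R * d k) := this
      _ = s * d k := by field_simp
  have h5 := h1 (s * d k) h4 le_rfl j
  have h6 := P.mass_nonneg k (q k) (s * d k) j
  rw [abs_le] at h5
  linarith [h5.2]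

lemma IsSimpleAt.sum_pos (hγ : -1 < γ) {b : Bool} {q : ℕ → E2}
    {d r : ℕ → ℝ} {σ : Fin n → ℝ} (hn : 0 < n)
    (h : P.IsSimpleAt 𝒰 b q d σ r) (hd : ∀ᶠ k in (𝒰 : Filter ℕ), 0 < d k) : 0 < ∑ i, σ i := by
  have hσ := fun j => h.nonneg hd j
  refine lt_of_le_of_ne (sum_nonneg fun i _ => hσ i) fun h0 => ?_
  have h1 : σ = 0 := by
    funext i
    simpa using (sum_eq_zero_iff_of_nonneg fun i _ => hσ i).1 h0.symm i (mem_univ i)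
  have h2 := h.rate_pos ⟨0, hn⟩
  rw [h1, mulVec_zero] at h2
  have : 0 < strength γ b := by unfold strength; split_ifs <;> linarith
  simp at h2; linarith

omit P in
lemma tendsto_log_ratio {r d : ℕ → ℝ} (hr : ∀ᶠ k in (𝒰 : Filter ℕ), 0 < r k)
    (hrd : Negl 𝒰 r d) : Tendsto (fun k => log (d k / r k)) 𝒰 atTop := by
  rw [Filter.tendsto_atTop]
  intro B
  filter_upwards [hr, hrd (exp (-B)) (exp_pos _)] with k h1 h2
  have h3 : exp B ≤ d k / r k := by
    rw [le_div_iff₀ h1]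
    calc exp B * r k ≤ exp B * (exp (-B) * d k) :=
          mul_le_mul_of_nonneg_left h2 (exp_pos _).le
      _ = d k := by rw [← mul_assoc, ← exp_add]; simp
  rw [← log_exp B]
  exact log_le_log (exp_pos _) h3

lemma IsSimpleAt.lam_decay {b : Bool} {q : ℕ → E2} {d r : ℕ → ℝ} {σ : Fin n → ℝ}
    (h : P.IsSimpleAt 𝒰 b q d σ r) (hd : ∀ᶠ k in (𝒰 : Filter ℕ), 0 < d k)
    (hc : IsCenter 𝒰 b q d) (i : Fin n) (ε : ℝ) (hε : 0 < ε) :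
    ∃ D, ∀ᶠ k in (𝒰 : Filter ℕ),
      |P.lam k i (q k) (d k) - P.lam k i (q k) (r k) +
        ((A *ᵥ σ) i - 2 * strength γ b) * log (d k / r k)| ≤
        ε * log (d k / r k) + D := by
  obtain ⟨D₁, hD₁⟩ := P.slope_center hc
  set a := ∑ j, |A i j| with ha
  have ha0 : 0 ≤ a := sum_nonneg fun j _ => abs_nonneg _
  obtain ⟨R, hR, s₀, hs₀, hev₀⟩ := h.mass_near (ε / (a + 1)) (by positivity)
  set s := min s₀ 1 with hs
  have hspos : 0 < s := lt_min hs₀ one_pos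
  obtain ⟨D₂, hD₂⟩ := P.compare (max R s⁻¹)
  set y := (A *ᵥ σ) i - 2 * strength γ b with hy
  refine ⟨(|y| + ε) * |log (s / R)| + D₁ + 2 * D₂, ?_⟩
  filter_upwards [hD₁, hev₀, h.r_pos, hd, h.r_negl (s / R) (by positivity)] with k h1 h2 h3 h4 h5
  have hRr : R * r k ≤ s * d k := by
    calc R * r k ≤ R * (s / R * d k) := mul_le_mul_of_nonneg_left h5 (by linarith)
      _ = s * d k := by field_simp
  have hRrpos : 0 < R * r k := by positivity
  have hss : s * d k ≤ s₀ * d k := mul_le_mul_of_nonneg_right (min_le_left _ _) h4.le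
  have hs1 : s * d k ≤ d k := by
    have := mul_le_mul_of_nonneg_right (min_le_right s₀ 1) h4.le; linarith
  have hAm : ∀ t, R * r k ≤ t → t ≤ s * d k → |(A *ᵥ P.mass k (q k) t) i - (A *ᵥ σ) i| ≤ ε := by
    intro t ht1 ht2
    have e : (A *ᵥ P.mass k (q k) t) i - (A *ᵥ σ) i = ∑ j, A i j * (P.mass k (q k) t j - σ j) := by
      simp only [mulVec, dotProduct, ← sum_sub_distrib, mul_sub]
    rw [e]
    calc _ ≤ ∑ j, |A i j * (P.mass k (q k) t j - σ j)| := abs_sum_le_sum_abs _ _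
      _ ≤ ∑ j, |A i j| * (ε / (a + 1)) := sum_le_sum fun j _ => by
          rw [abs_mul]
          exact mul_le_mul_of_nonneg_left (h2 t ht1 (ht2.trans hss) j) (abs_nonneg _)
      _ = a * (ε / (a + 1)) := by rw [← sum_mul]
      _ ≤ ε := by rw [mul_div_assoc', div_le_iff₀ (by positivity)]; nlinarith
  obtain ⟨g1, g2⟩ := h1 (R * r k) (s * d k) hRrpos hRr hs1 i
  have b1 := hAm (R * r k) le_rfl hRr
  have b2 := hAm (s * d k) hRr le_rfl
  set ℓ := log (s * d k / (R * r k)) with hℓ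
  have hℓ0 : 0 ≤ ℓ := log_nonneg (by rw [le_div_iff₀ hRrpos]; linarith)
  have hℓe : ℓ = log (d k / r k) + log (s / R) := by
    rw [hℓ, ← log_mul (by positivity) (by positivity)]
    congr 1; field_simp
  have c1 : |P.lam k i (q k) (r k) - P.lam k i (q k) (R * r k)| ≤ D₂ := by
    refine hD₂ k i (q k) (q k) _ _ h3 hRrpos ?_ ?_ ?_
    · have : 1 ≤ max R s⁻¹ * R := by
        nlinarith [le_max_left R s⁻¹]
      nlinarith
    · exact mul_le_mul_of_nonneg_right (le_max_left _ _) h3.le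
    · simp; positivity
  have c2 : |P.lam k i (q k) (s * d k) - P.lam k i (q k) (d k)| ≤ D₂ := by
    have hm : 1 ≤ max R s⁻¹ := hR.trans (le_max_left _ _)
    refine hD₂ k i (q k) (q k) _ _ (by positivity) h4 ?_ ?_ ?_
    · nlinarith
    · rw [← mul_assoc]
      have : 1 ≤ max R s⁻¹ * s := by
        calc 1 = s⁻¹ * s := by field_simp
          _ ≤ _ := mul_le_mul_of_nonneg_right (le_max_right _ _) hspos.le
      nlinarith
    · simp; positivity
  rw [abs_le] at b1 b2 c1 c2
  have u1 : P.lam k i (q k) (s * d k) - P.lam k i (q k) (R * r k) ≤ (-y + ε) * ℓ + D₁ := by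
    refine g1.trans ?_
    have : (2 * strength γ b - (A *ᵥ P.mass k (q k) (R * r k)) i) ≤ -y + ε := by
      rw [hy]; linarith [b1.1]
    linarith [mul_le_mul_of_nonneg_right this hℓ0]
  have u2 : (-y - ε) * ℓ - D₁ ≤ P.lam k i (q k) (s * d k) - P.lam k i (q k) (R * r k) := by
    refine le_trans ?_ g2
    have : -y - ε ≤ (2 * strength γ b - (A *ᵥ P.mass k (q k) (s * d k)) i) := by
      rw [hy]; linarith [b2.2]
    linarith [mul_le_mul_of_nonneg_right this hℓ0]
  rw [hℓe] at u1 u2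
  have v1 : |y * log (s / R)| ≤ |y| * |log (s / R)| := (abs_mul _ _).le
  have v2 : |ε * log (s / R)| ≤ ε * |log (s / R)| := by rw [abs_mul, abs_of_pos hε]
  rw [abs_le] at v1 v2 ⊢
  constructor <;> nlinarith [v1.1, v1.2, v2.1, v2.2, c1.1, c1.2, c2.1, c2.2]

lemma IsSimpleAt.lam_tendsto {b : Bool} {q : ℕ → E2} {d r : ℕ → ℝ} {σ : Fin n → ℝ}
    (h : P.IsSimpleAt 𝒰 b q d σ r) (hd : Shrinks 𝒰 q d)
    (hc : IsCenter 𝒰 b q d) (i : Fin n) :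
    Tendsto (fun k => P.lam k i (q k) (d k)) 𝒰 atBot := by
  set y := (A *ᵥ σ) i - 2 * strength γ b with hy
  have hy0 : 0 < y := h.rate_pos i
  obtain ⟨D, hD⟩ := h.lam_decay hd.1 hc i (y / 2) (by positivity)
  have hr : Shrinks 𝒰 q r := hd.mono h.r_pos (by
    filter_upwards [h.r_negl 1 one_pos] with k hk; linarith)
  have hup := P.lam_bddAbove hr
  have hlog := tendsto_log_ratio h.r_pos h.r_negl
  rw [Filter.tendsto_atBot]
  intro B
  filter_upwards [hD, hup, hlog.eventually_ge_atTop ((D + P.K * P.K - B) * (2 / y))]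
    with k h1 h2 h3
  rw [abs_le] at h1
  have h4 := h2 i
  have h5 : D + P.K * P.K - B ≤ y / 2 * log (d k / r k) := by
    have := mul_le_mul_of_nonneg_left h3 (by positivity : 0 ≤ y / 2)
    calc D + P.K * P.K - B = y / 2 * ((D + P.K * P.K - B) * (2 / y)) := by field_simp
      _ ≤ _ := this
  linarith [h1.2]

variable (P)

/-- Away from atoms the mass is controlled by the averaged logarithms. -/
lemma mass_le_of_no_atoms {p : ℕ → E2} {d : ℕ → ℝ} (hd : Shrinks 𝒰 p d) {S : Set E2}
    (hS : IsCompact S) (hat : ∀ z ∈ S, ¬ P.IsAtom 𝒰 p d z) :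
    ∃ D > 0, ∀ᶠ k in (𝒰 : Filter ℕ), ∀ i,
      (P.ρ k i).real ((fun y => p k + d k • y) '' S) ≤
        D * exp (P.lam k i (p k) (d k)) := by
  refine hS.induction_on (p := fun S => ∃ D > 0, ∀ᶠ k in (𝒰 : Filter ℕ), ∀ i,
      (P.ρ k i).real ((fun y => p k + d k • y) '' S) ≤
        D * exp (P.lam k i (p k) (d k))) ?_ ?_ ?_ ?_
  · exact ⟨1, one_pos, Eventually.of_forall fun k i => by simp; positivity⟩
  · rintro S T hST ⟨D, hD, h⟩
    exact ⟨D, hD, h.mono fun k hk i => (measureReal_mono (Set.image_mono hST)).trans (hk i)⟩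
  · rintro S T ⟨D, hD, h⟩ ⟨D', hD', h'⟩
    refine ⟨D + D', by positivity, ?_⟩
    filter_upwards [h, h'] with k h1 h2 i
    rw [Set.image_union, add_mul]
    exact (measureReal_union_le _ _).trans (add_le_add (h1 i) (h2 i))
  · intro z hz
    have h1 := hat z hz
    unfold IsAtom at h1
    push Not at h1
    obtain ⟨s, hs, h1⟩ := h1
    obtain ⟨D, hD⟩ := P.compare (max (s / 2) (max (2 / s) ‖z‖))
    refine ⟨closedBall z (s / 4), mem_nhdsWithin_of_mem_nhds (closedBall_mem_nhds z (by positivity)),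
      P.K * exp D, by have := P.K_pos; positivity, ?_⟩
    have hmv : Shrinks 𝒰 (fun k => p k + d k • z) d := hd.move ‖z‖ (by
      filter_upwards [hd.1] with k hk
      simp [norm_smul, abs_of_pos hk, mul_comm])
    filter_upwards [h1, hd.1, hmv.eventually_le s P.r₀_pos] with k h2 h3 h4 i
    have h5 := P.le_exp_lam k i (p k + d k • z) (s * d k / 2) (by positivity) (by linarith) (by
      have e : 2 * (s * d k / 2) = s * d k := by ring
      rw [e]; exact h2.le)
    have h6 := hD k i (p k + d k • z) (p k) (s * d k / 2) (d k) (by positivity) h3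
      (by
        have := mul_le_mul_of_nonneg_right (le_max_left (s / 2) (max (2 / s) ‖z‖)) h3.le
        linarith)
      (by
        have := mul_le_mul_of_nonneg_right
          ((le_max_left (2 / s) ‖z‖).trans (le_max_right (s / 2) (max (2 / s) ‖z‖)))
          (by positivity : 0 ≤ s * d k / 2)
        have e : 2 / s * (s * d k / 2) = d k := by field_simp
        linarith)
      (by
        have := mul_le_mul_of_nonneg_right
          ((le_max_right (2 / s) ‖z‖).trans (le_max_right (s / 2) (max (2 / s) ‖z‖))) h3.le
        simp [norm_smul, abs_of_pos h3]; linarith)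
    rw [abs_le] at h6
    have h7 : (fun y => p k + d k • y) '' closedBall z (s / 4) ⊆
        closedBall (p k + d k • z) (s * d k / 2 / 2) := by
      rintro _ ⟨y, hy, rfl⟩
      rw [mem_closedBall, dist_eq_norm] at hy ⊢
      have e : p k + d k • y - (p k + d k • z) = d k • (y - z) := by rw [smul_sub]; abel
      rw [e, norm_smul, norm_eq_abs, abs_of_pos h3]
      have := mul_le_mul_of_nonneg_left hy h3.le
      linarith
    calc _ ≤ (P.ρ k i).real (closedBall (p k + d k • z) (s * d k / 2 / 2)) := measureReal_mono h7
      _ ≤ _ := h5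
      _ ≤ P.K * (exp D * exp (P.lam k i (p k) (d k))) := by
          rw [← exp_add]
          exact mul_le_mul_of_nonneg_left (exp_le_exp.2 (by linarith [h6.2])) P.K_pos.le
      _ = _ := by ring

end LiouvilleFamily
end Concentration

section Splitting
open Matrix

namespace LiouvilleFamily

variable {n : ℕ} {A : Matrix (Fin n) (Fin n) ℝ} {γ : ℝ} {P : LiouvilleFamily n A γ}
  {𝒰 : Ultrafilter ℕ}

lemma strength_pos (hγ : -1 < γ) (b : Bool) : 0 < strength γ b := by
  unfold strength; split_ifs <;> linarith

lemma exists_separation (Z : Finset E2) : ∃ s > 0, ∀ z ∈ Z, ∀ w ∈ Z, z ≠ w → s ≤ dist z w := by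
  have h : ∀ᶠ s in 𝓝[>] (0 : ℝ), ∀ z ∈ Z, ∀ w ∈ Z, z ≠ w → s ≤ dist z w := by
    rw [Finset.eventually_all]
    intro z _
    rw [Finset.eventually_all]
    intro w _
    by_cases hzw : z = w
    · exact Eventually.of_forall fun s h => absurd hzw h
    · have : Iio (dist z w) ∈ 𝓝[>] (0 : ℝ) :=
        mem_nhdsWithin_of_mem_nhds (Iio_mem_nhds (dist_pos.2 hzw))
      filter_upwards [this] with s hs _ using le_of_lt hs
  obtain ⟨s, hs, hs0⟩ := (h.and self_mem_nhdsWithin).exists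
  exact ⟨s, hs0, hs⟩

lemma sum_measureReal_le (ν : Measure E2) [IsFiniteMeasure ν] {ι : Type*} (Z : Finset ι)
    (f : ι → Set E2) (hm : ∀ z ∈ Z, MeasurableSet (f z))
    (hd : ∀ z ∈ Z, ∀ w ∈ Z, z ≠ w → Disjoint (f z) (f w)) {S : Set E2}
    (hS : ∀ z ∈ Z, f z ⊆ S) : ∑ z ∈ Z, ν.real (f z) ≤ ν.real S := by
  rw [← measureReal_biUnion_finset (fun z hz w hw h => hd z hz w hw h) hm]
  exact measureReal_mono (Set.iUnion₂_subset hS)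

lemma dist_frame {p : E2} {d : ℝ} (hd : 0 < d) (z w : E2) :
    dist (p + d • z) (p + d • w) = d * dist z w := by
  rw [dist_add_left, dist_smul₀, norm_eq_abs, abs_of_pos hd]

variable (P) in
lemma card_atoms_le {p : ℕ → E2} {d : ℕ → ℝ} (hd : ∀ᶠ k in (𝒰 : Filter ℕ), 0 < d k)
    (Z : Finset E2) (hZ : ∀ z ∈ Z, P.IsAtom 𝒰 p d z) : Z.card * P.ε₀ ≤ P.K := by
  obtain ⟨s, hs, hsep⟩ := exists_separation Z
  have h1 : ∀ᶠ k in (𝒰 : Filter ℕ), ∀ z ∈ Z,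
      P.ε₀ ≤ P.tot k (closedBall (p k + d k • z) (s / 3 * d k)) := by
    rw [Finset.eventually_all]
    exact fun z hz => hZ z hz _ (by positivity)
  obtain ⟨k, h2, h3⟩ := (h1.and hd).exists
  calc Z.card * P.ε₀ = ∑ z ∈ Z, P.ε₀ := by simp
    _ ≤ ∑ z ∈ Z, P.tot k (closedBall (p k + d k • z) (s / 3 * d k)) := sum_le_sum h2
    _ = ∑ j, ∑ z ∈ Z, (P.ρ k j).real (closedBall (p k + d k • z) (s / 3 * d k)) :=
        sum_comm
    _ ≤ ∑ j, (P.ρ k j).real Set.univ := by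
        refine sum_le_sum fun j _ => sum_measureReal_le _ Z _
          (fun _ _ => measurableSet_closedBall) ?_ (fun _ _ => Set.subset_univ _)
        intro z hz w hw hzw
        refine closedBall_disjoint_closedBall ?_
        rw [dist_frame h3]
        have := mul_le_mul_of_nonneg_left (hsep z hz w hw hzw) h3.le
        nlinarith [mul_pos hs h3]
    _ ≤ P.K := P.mass_le k

variable (P) in
lemma finite_atoms {p : ℕ → E2} {d : ℕ → ℝ} (hd : ∀ᶠ k in (𝒰 : Filter ℕ), 0 < d k) :
    {z | P.IsAtom 𝒰 p d z}.Finite := by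
  by_contra hinf
  obtain ⟨Z, hZ, hc⟩ := Set.Infinite.exists_subset_card_eq hinf (⌊P.K / P.ε₀⌋₊ + 1)
  have h1 := P.card_atoms_le hd Z fun z hz => hZ hz
  rw [hc, ← le_div_iff₀ P.ε₀_pos] at h1
  have h2 := Nat.lt_floor_add_one (P.K / P.ε₀)
  push_cast at h1
  linarith

variable (P) in
lemma compare_near {q q' : ℕ → E2} {d : ℕ → ℝ} (hd : ∀ᶠ k in (𝒰 : Filter ℕ), 0 < d k) (C : ℝ)
    (hq : ∀ᶠ k in (𝒰 : Filter ℕ), ‖q k - q' k‖ ≤ C * d k) :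
    ∃ D, ∀ᶠ k in (𝒰 : Filter ℕ), ∀ i, |P.lam k i (q k) (d k) - P.lam k i (q' k) (d k)| ≤ D := by
  obtain ⟨D, hD⟩ := P.compare (max C 1)
  refine ⟨D, ?_⟩
  filter_upwards [hd, hq] with k h1 h2 i
  have h3 : d k ≤ max C 1 * d k := le_mul_of_one_le_left h1.le (le_max_right _ _)
  exact hD k i _ _ _ _ h1 h1 h3 h3
    (h2.trans (mul_le_mul_of_nonneg_right (le_max_left _ _) h1.le))

/-- Compatibility of the decay of two bubbles at a common scale. -/
lemma IsSimpleAt.rate_le {b b' : Bool} {q q' : ℕ → E2} {d r r' : ℕ → ℝ} {σ σ' : Fin n → ℝ}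
    (h : P.IsSimpleAt 𝒰 b q d σ r) (h' : P.IsSimpleAt 𝒰 b' q' d σ' r')
    (hc : IsCenter 𝒰 b q d) (hc' : IsCenter 𝒰 b' q' d) (hd' : Shrinks 𝒰 q' d)
    (C : ℝ) (hq : ∀ᶠ k in (𝒰 : Filter ℕ), ‖q k - q' k‖ ≤ C * d k) (a a' : ℝ)
    (ha : Tendsto (fun k => log (d k / r k) /
      (log (d k / r k) + log (d k / r' k))) 𝒰 (𝓝 a))
    (ha' : Tendsto (fun k => log (d k / r' k) /
      (log (d k / r k) + log (d k / r' k))) 𝒰 (𝓝 a')) (i : Fin n) (hi : 0 < σ i) :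
    a' * ((A *ᵥ σ') i - 2 * strength γ b') ≤ a * ((A *ᵥ σ) i - 2 * strength γ b) := by
  set y := (A *ᵥ σ) i - 2 * strength γ b
  set y' := (A *ᵥ σ') i - 2 * strength γ b'
  refine le_of_forall_pos_le_add fun ε hε => ?_
  obtain ⟨D₁, hD₁⟩ := h.lam_decay hd'.1 hc i ε hε
  obtain ⟨D₂, hD₂⟩ := h'.lam_decay hd'.1 hc' i ε hε
  obtain ⟨D₃, hD₃⟩ := P.compare_near hd'.1 C hq
  obtain ⟨D₄, hD₄⟩ := h.lam_ge i hi
  have hr' : Shrinks 𝒰 q' r' := hd'.mono h'.r_pos (by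
    filter_upwards [h'.r_negl 1 one_pos] with k hk; linarith)
  have hup := P.lam_bddAbove hr'
  have hL := tendsto_log_ratio h.r_pos h.r_negl
  have hL' := tendsto_log_ratio h'.r_pos h'.r_negl
  set E := D₁ + D₂ + D₃ + D₄ + P.K * P.K
  have hlim : Tendsto (fun k => log (d k / r k) /
      (log (d k / r k) + log (d k / r' k)) * y + ε +
      E / (log (d k / r k) + log (d k / r' k))) 𝒰 (𝓝 (a * y + ε + 0)) :=
    ((ha.mul_const y).add_const ε).add ((hL.atTop_add_atTop hL').const_div_atTop E)
  rw [add_zero] at hlim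
  refine le_of_tendsto_of_tendsto (ha'.mul_const y') hlim ?_
  filter_upwards [hD₁, hD₂, hD₃, hD₄, hup, hL.eventually_gt_atTop 0, hL'.eventually_gt_atTop 0]
    with k h1 h2 h3 h4 h5 h6 h7
  have h3 := h3 i
  have h5 := h5 i
  rw [abs_le] at h1 h2 h3
  have hs : 0 < log (d k / r k) + log (d k / r' k) := by linarith
  rw [div_mul_eq_mul_div, div_mul_eq_mul_div, div_le_iff₀ hs, add_mul, add_mul,
    div_mul_cancel₀ _ hs.ne', div_mul_cancel₀ _ hs.ne']
  have e1 : y * log (d k / r k) = log (d k / r k) * y := mul_comm _ _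
  have e2 : y' * log (d k / r' k) = log (d k / r' k) * y' := mul_comm _ _
  simp only [E]
  linarith [h1.1, h2.2, h3.1]

lemma exists_ratio_limits {L L' : ℕ → ℝ} (hL : Tendsto L 𝒰 atTop) (hL' : Tendsto L' 𝒰 atTop) :
    ∃ a a' : ℝ, 0 ≤ a ∧ 0 ≤ a' ∧ a + a' = 1 ∧
      Tendsto (fun k => L k / (L k + L' k)) 𝒰 (𝓝 a) ∧
      Tendsto (fun k => L' k / (L k + L' k)) 𝒰 (𝓝 a') := by
  have hpos := (hL.eventually_gt_atTop 0).and (hL'.eventually_gt_atTop 0)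
  obtain ⟨a, ha, hlim⟩ := exists_tendsto_of_bounded 𝒰 (fun k => L k / (L k + L' k)) 0 1 (by
    filter_upwards [hpos] with k ⟨h1, h2⟩
    exact ⟨by positivity, by rw [div_le_one (by positivity)]; linarith⟩)
  refine ⟨a, 1 - a, ha.1, by linarith [ha.2], by ring, hlim, ?_⟩
  refine (hlim.const_sub 1).congr' ?_
  filter_upwards [hpos] with k ⟨h1, h2⟩
  rw [eq_div_iff (by positivity), sub_mul, div_mul_cancel₀ _ (by positivity)]
  ring

/-- The pair identity for two bubbles centered at distinct points of a common frame. -/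
lemma IsSimpleAt.pair (hn : 0 < n) (hA : H1 A) (hA2 : H2 A) (hγ : -1 < γ)
    {b b' : Bool} {q q' : ℕ → E2} {d r r' : ℕ → ℝ} {σ σ' : Fin n → ℝ}
    (h : P.IsSimpleAt 𝒰 b q d σ r) (h' : P.IsSimpleAt 𝒰 b' q' d σ' r')
    (hc : IsCenter 𝒰 b q d) (hc' : IsCenter 𝒰 b' q' d) (hd : Shrinks 𝒰 q d)
    (hd' : Shrinks 𝒰 q' d)
    (C : ℝ) (hq : ∀ᶠ k in (𝒰 : Filter ℕ), ‖q k - q' k‖ ≤ C * d k) :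
    σ ⬝ᵥ (A *ᵥ σ') = 2 * (strength γ b' * ∑ i, σ i + strength γ b * ∑ i, σ' i) := by
  obtain ⟨a, a', ha, ha', haa, hl, hl'⟩ := exists_ratio_limits
    (tendsto_log_ratio h.r_pos h.r_negl) (tendsto_log_ratio h'.r_pos h'.r_negl)
  refine pair_interaction hn hA hA2 σ σ' (h.nonneg hd.1) (h'.nonneg hd.1)
    (h.sum_pos hγ hn hd.1) (h'.sum_pos hγ hn hd.1) _ _ (strength_pos hγ b) (strength_pos hγ b')
    h.poh h'.poh a a' ha' (by linarith) ?_ ?_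
  · exact h.rate_le h' hc hc' hd' C hq a a' hl hl'
  · refine h'.rate_le h hc' hc hd C ?_ a' a ?_ ?_
    · simpa only [norm_sub_rev] using hq
    · simpa only [add_comm] using hl'
    · simpa only [add_comm] using hl

lemma shrinks_of_near {p q : ℕ → E2} {d : ℕ → ℝ} (hd : Shrinks 𝒰 p d) (z : E2)
    (hq : ∀ ε > 0, ∀ᶠ k in (𝒰 : Filter ℕ), ‖q k - (p k + d k • z)‖ ≤ ε * d k) :
    ∀ᶠ k in (𝒰 : Filter ℕ), ‖q k - p k‖ ≤ (‖z‖ + 1) * d k := by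
  filter_upwards [hq 1 one_pos, hd.1] with k h1 h2
  have e : q k - p k = (q k - (p k + d k • z)) + d k • z := by abel
  have h3 : ‖d k • z‖ = d k * ‖z‖ := by rw [norm_smul, norm_eq_abs, abs_of_pos h2]
  rw [e]
  linarith [norm_add_le (q k - (p k + d k • z)) (d k • z)]

/-- If all atoms of a frame are isolated bubbles, then no mass is lost. -/
lemma tendsto_mass {p : ℕ → E2} {d : ℕ → ℝ} (hd : Shrinks 𝒰 p d) (Z : Finset E2)
    (hZ : ∀ z, z ∈ Z ↔ P.IsAtom 𝒰 p d z) (β : E2 → Bool) (q : E2 → ℕ → E2)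
    (σ : E2 → Fin n → ℝ) (r : E2 → ℕ → ℝ)
    (hnear : ∀ z ∈ Z, ∀ ε > 0, ∀ᶠ k in (𝒰 : Filter ℕ), ‖q z k - (p k + d k • z)‖ ≤ ε * d k)
    (hs : ∀ z ∈ Z, P.IsSimpleAt 𝒰 (β z) (q z) d (σ z) (r z))
    (hlam : ∀ i, Tendsto (fun k => P.lam k i (p k) (d k)) 𝒰 atBot)
    (R : ℝ) (hR : ∀ z ∈ Z, ‖z‖ + 1 ≤ R) (j : Fin n) :
    Tendsto (fun k => P.mass k (p k) (R * d k) j) 𝒰 (𝓝 (∑ z ∈ Z, σ z j)) := by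
  rw [Metric.tendsto_nhds]
  intro ε hε
  set e := ε / (2 * (Z.card + 1)) with he
  have he0 : 0 < e := by positivity
  obtain ⟨s₁, hs₁, hsep⟩ := exists_separation Z
  have h1 : ∀ z ∈ Z, ∃ R' ≥ (1 : ℝ), ∃ s > 0, ∀ᶠ k in (𝒰 : Filter ℕ), ∀ t, R' * r z k ≤ t →
      t ≤ s * d k → ∀ j, |P.mass k (q z k) t j - σ z j| ≤ e := fun z hz => (hs z hz).mass_near e he0
  choose! R' hR' s' hs' hmass using h1
  have h2 : ∀ᶠ s in 𝓝[>] (0 : ℝ), (∀ z ∈ Z, s ≤ s' z) ∧ s ≤ 1 / 2 ∧ s ≤ s₁ / 8 := by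
    have : ∀ c : ℝ, 0 < c → ∀ᶠ s in 𝓝[>] (0 : ℝ), s ≤ c := fun c hc => by
      have h : Iio c ∈ 𝓝[>] (0 : ℝ) := mem_nhdsWithin_of_mem_nhds (Iio_mem_nhds hc)
      filter_upwards [h] with s hs using le_of_lt hs
    refine Eventually.and ?_ ((this _ (by norm_num)).and (this _ (by positivity)))
    rw [Finset.eventually_all]
    exact fun z hz => this _ (hs' z hz)
  obtain ⟨s, ⟨hss', hs2, hs8⟩, hs0⟩ := (h2.and self_mem_nhdsWithin).exists
  have hs0 : 0 < s := hs0
  set S : Set E2 := closedBall 0 R \ ⋃ z ∈ Z, ball z (s / 2) with hS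
  have hSc : IsCompact S :=
    (isCompact_closedBall _ _).diff (isOpen_biUnion fun _ _ => isOpen_ball)
  obtain ⟨D, hD, hrest⟩ := P.mass_le_of_no_atoms hd hSc (by
    intro z hz hat
    refine hz.2 ?_
    simp only [Set.mem_iUnion]
    exact ⟨z, (hZ z).2 hat, mem_ball_self (by positivity)⟩)
  have hsmall : ∀ᶠ k in (𝒰 : Filter ℕ), D * exp (P.lam k j (p k) (d k)) < ε / 2 := by
    have : Tendsto (fun k => D * exp (P.lam k j (p k) (d k))) 𝒰 (𝓝 (D * 0)) :=
      (tendsto_exp_atBot.comp (hlam j)).const_mul D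
    rw [mul_zero] at this
    exact this.eventually_lt_const (by positivity)
  have hev : ∀ᶠ k in (𝒰 : Filter ℕ), ∀ z ∈ Z, (‖q z k - (p k + d k • z)‖ ≤ s / 2 * d k) ∧
      |P.mass k (q z k) (s * d k) j - σ z j| ≤ e := by
    rw [Finset.eventually_all]
    intro z hz
    have hRz := hR' z hz
    filter_upwards [hnear z hz (s / 2) (by positivity), hmass z hz,
      (hs z hz).r_negl (s / R' z) (by have := hR' z hz; positivity), hd.1] with k h3 h4 h5 h6
    refine ⟨h3, h4 _ ?_ (mul_le_mul_of_nonneg_right (hss' z hz) h6.le) j⟩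
    calc R' z * r z k ≤ R' z * (s / R' z * d k) := mul_le_mul_of_nonneg_left h5 (by linarith)
      _ = s * d k := by field_simp
  filter_upwards [hrest, hsmall, hev, hd.1] with k h3 h4 h5 h6
  have h3 := h3 j
  have hsd : 0 < s * d k := by positivity
  have hdisj : ∀ z ∈ Z, ∀ w ∈ Z, z ≠ w →
      Disjoint (closedBall (q z k) (s * d k)) (closedBall (q w k) (s * d k)) := by
    intro z hz w hw hzw
    refine closedBall_disjoint_closedBall ?_
    have g1 := (h5 z hz).1
    have g2 := (h5 w hw).1
    rw [← dist_eq_norm] at g1 g2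
    have g3 := dist_frame (p := p k) h6 z w
    have g4 := mul_le_mul_of_nonneg_left (hsep z hz w hw hzw) h6.le
    have g5 := dist_triangle4 (p k + d k • z) (q z k) (q w k) (p k + d k • w)
    rw [dist_comm (p k + d k • z) (q z k)] at g5
    have g6 := mul_le_mul_of_nonneg_right hs8 h6.le
    linarith
  have hsub : ∀ z ∈ Z, closedBall (q z k) (s * d k) ⊆ closedBall (p k) (R * d k) := by
    intro z hz
    refine closedBall_subset_closedBall' ?_
    have g1 := (h5 z hz).1
    rw [← dist_eq_norm] at g1
    have g2 : dist (p k + d k • z) (p k) = d k * ‖z‖ := by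
      rw [dist_eq_norm]; simp [norm_smul, abs_of_pos h6]
    have g3 := dist_triangle (q z k) (p k + d k • z) (p k)
    have g4 := mul_le_mul_of_nonneg_right (hR z hz) h6.le
    have g5 := mul_le_mul_of_nonneg_right hs2 h6.le
    linarith
  have hlow : ∑ z ∈ Z, P.mass k (q z k) (s * d k) j ≤ P.mass k (p k) (R * d k) j :=
    sum_measureReal_le _ Z _ (fun _ _ => measurableSet_closedBall) hdisj hsub
  have hcov : closedBall (p k) (R * d k) ⊆
      (⋃ z ∈ Z, closedBall (q z k) (s * d k)) ∪ (fun y => p k + d k • y) '' S := by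
    intro x hx
    set y := (d k)⁻¹ • (x - p k) with hy
    have hxy : x = p k + d k • y := by
      rw [hy, smul_smul, mul_inv_cancel₀ h6.ne', one_smul]; abel
    by_cases hyS : y ∈ S
    · exact Or.inr ⟨y, hyS, hxy.symm⟩
    · left
      have hyR : y ∈ closedBall (0 : E2) R := by
        rw [mem_closedBall, dist_eq_norm] at hx
        rw [mem_closedBall_zero_iff, hy, norm_smul, norm_inv, norm_eq_abs, abs_of_pos h6,
          inv_mul_le_iff₀ h6]
        linarith
      have : y ∈ ⋃ z ∈ Z, ball z (s / 2) := by
        by_contra hcon; exact hyS ⟨hyR, hcon⟩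
      simp only [Set.mem_iUnion] at this ⊢
      obtain ⟨z, hz, hyz⟩ := this
      refine ⟨z, hz, ?_⟩
      have g1 := (h5 z hz).1
      rw [← dist_eq_norm] at g1
      rw [mem_ball] at hyz
      rw [mem_closedBall, hxy]
      have g2 := dist_triangle (p k + d k • y) (p k + d k • z) (q z k)
      rw [dist_frame h6, dist_comm (p k + d k • z) (q z k)] at g2
      have g3 := mul_le_mul_of_nonneg_left hyz.le h6.le
      linarith
  have hup : P.mass k (p k) (R * d k) j ≤ ∑ z ∈ Z, P.mass k (q z k) (s * d k) j +
      (P.ρ k j).real ((fun y => p k + d k • y) '' S) := by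
    refine (measureReal_mono hcov).trans ((measureReal_union_le _ _).trans ?_)
    gcongr
    exact measureReal_biUnion_finset_le _ _
  have hsum : |∑ z ∈ Z, P.mass k (q z k) (s * d k) j - ∑ z ∈ Z, σ z j| < ε / 2 := by
    rw [← sum_sub_distrib]
    calc _ ≤ ∑ z ∈ Z, |P.mass k (q z k) (s * d k) j - σ z j| := abs_sum_le_sum_abs _ _
      _ ≤ ∑ z ∈ Z, e := sum_le_sum fun z hz => (h5 z hz).2
      _ = Z.card * e := by simp
      _ < (Z.card + 1) * e := by nlinarith
      _ = ε / 2 := by rw [he]; field_simp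
  rw [abs_lt] at hsum
  rw [dist_eq, abs_lt]
  constructor <;> linarith [hsum.1, hsum.2]

/-- The Pohozaev identity in the limit. -/
lemma pohozaev_limit {p : ℕ → E2} {d : ℕ → ℝ} (hd : Shrinks 𝒰 p d) {b : Bool}
    (hc : b = true → ∀ᶠ k in (𝒰 : Filter ℕ), p k = 0)
    (hsep : b = false → ∀ ε > 0, ∀ᶠ k in (𝒰 : Filter ℕ), d k ≤ ε * ‖p k‖)
    {T : ℝ} (hT : 4 ≤ T) {τ τ' : Fin n → ℝ}
    (h1 : Tendsto (fun k => P.mass k (p k) (d k)) 𝒰 (𝓝 τ))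
    (h2 : Tendsto (fun k => P.mass k (p k) (T * d k)) 𝒰 (𝓝 τ')) :
    |τ ⬝ᵥ (A *ᵥ τ) - 4 * strength γ b * ∑ i, τ i| ≤
      P.K * (∑ i, τ' i - ∑ i, τ i + 1 / T) := by
  have hsum : Continuous fun v : Fin n → ℝ => ∑ j, v j := by fun_prop
  have l2 := (hsum.tendsto τ).comp h1
  have l3 := (hsum.tendsto τ').comp h2
  have l4 : Tendsto d 𝒰 (𝓝 0) := by
    rw [Metric.tendsto_nhds]
    intro ε hε
    filter_upwards [hd.1, hd.2 (ε / 2) (by positivity)] with k h1 h2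
    rw [dist_eq, sub_zero, abs_of_pos (by positivity)]
    linarith [norm_nonneg (p k)]
  have l5 : Tendsto (fun k => d k / ‖p k‖) 𝒰 (𝓝 0) := by
    cases b
    · rw [Metric.tendsto_nhds]
      intro ε hε
      filter_upwards [hd.1, hsep rfl (ε / 2) (by positivity)] with k h1 h2
      rw [dist_eq, sub_zero, abs_of_nonneg (by positivity)]
      have hp : 0 < ‖p k‖ := by
        by_contra hcon
        have h0 : ‖p k‖ = 0 := le_antisymm (not_lt.1 hcon) (norm_nonneg _)
        rw [h0, mul_zero] at h2; linarith
      rw [div_lt_iff₀ hp]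
      nlinarith
    · refine tendsto_const_nhds.congr' ?_
      filter_upwards [hc rfl] with k hk
      simp [hk]
  have lL : Tendsto (fun k => |P.mass k (p k) (d k) ⬝ᵥ (A *ᵥ P.mass k (p k) (d k)) -
      4 * strength γ b * ∑ j, P.mass k (p k) (d k) j|) 𝒰
      (𝓝 |τ ⬝ᵥ (A *ᵥ τ) - 4 * strength γ b * ∑ i, τ i|) := by
    refine Tendsto.abs (Tendsto.sub ?_ (l2.const_mul _))
    exact ((by fun_prop : Continuous fun v : Fin n → ℝ => v ⬝ᵥ (A *ᵥ v)).tendsto τ).comp h1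
  have lR : Tendsto (fun k => P.K * ((∑ j, P.mass k (p k) (T * d k) j -
      ∑ j, P.mass k (p k) (d k) j) + 1 / T + d k + d k / ‖p k‖)) 𝒰
      (𝓝 (P.K * ((∑ j, τ' j - ∑ j, τ j) + 1 / T + 0 + 0))) :=
    (((((l3.sub l2).add_const _).add l4).add l5).const_mul _)
  rw [add_zero, add_zero] at lR
  refine le_of_tendsto_of_tendsto lL lR ?_
  have hcase : ∀ᶠ k in (𝒰 : Filter ℕ), (p k = 0 ∧ strength γ b = 1 + γ) ∨
      (4 * d k ≤ ‖p k‖ ∧ strength γ b = 1) := by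
    cases b
    · filter_upwards [hsep rfl (1 / 4) (by positivity)] with k h1
      exact Or.inr ⟨by linarith, by simp [strength]⟩
    · filter_upwards [hc rfl] with k hk
      exact Or.inl ⟨hk, by simp [strength]⟩
  filter_upwards [hcase, hd.1, hd.eventually_le T P.r₀_pos] with k h1 h2 h3
  have h4 := P.pohozaev k (p k) (d k) T (strength γ b) h2 hT h3 h1
  have h5 := P.tot_diff k (closedBall_subset_closedBall (x := p k)
    (by nlinarith : d k ≤ T * d k)) measurableSet_closedBall
  simp only [tot] at h5
  rw [h5] at h4
  exact h4

/-- If all atoms of a frame are isolated bubbles, their strengths add up to that of the frame. -/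
lemma sum_strength_atoms (hn : 0 < n) (hA : H1 A) (hA2 : H2 A) (hγ : -1 < γ)
    {p : ℕ → E2} {d : ℕ → ℝ} (hd : Shrinks 𝒰 p d) {b : Bool} (hc : IsCenter 𝒰 b p d)
    (hsep : b = false → ∀ ε > 0, ∀ᶠ k in (𝒰 : Filter ℕ), d k ≤ ε * ‖p k‖) (β : E2 → Bool)
    (hsimple : ∀ z, P.IsAtom 𝒰 p d z → ∃ q σ r, IsCenter 𝒰 (β z) q d ∧
      (∀ ε > 0, ∀ᶠ k in (𝒰 : Filter ℕ), ‖q k - (p k + d k • z)‖ ≤ ε * d k) ∧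
      P.IsSimpleAt 𝒰 (β z) q d σ r)
    (hex : ∃ z, P.IsAtom 𝒰 p d z) :
    ∃ Z : Finset E2, (∀ z, z ∈ Z ↔ P.IsAtom 𝒰 p d z) ∧
      ∑ z ∈ Z, strength γ (β z) = strength γ b := by
  classical
  choose! q σ r hcen hnear hs using hsimple
  set Z := (P.finite_atoms (p := p) hd.1).toFinset with hZdef
  have hZ : ∀ z, z ∈ Z ↔ P.IsAtom 𝒰 p d z := fun z => by simp [hZdef]
  refine ⟨Z, hZ, ?_⟩
  have hclose := fun z hz => shrinks_of_near hd z (hnear z hz)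
  have hsh : ∀ z, P.IsAtom 𝒰 p d z → Shrinks 𝒰 (q z) d := fun z hz => hd.move _ (hclose z hz)
  have hlam : ∀ i, Tendsto (fun k => P.lam k i (p k) (d k)) 𝒰 atBot := by
    intro i
    obtain ⟨z, hz⟩ := hex
    have h1 := (hs z hz).lam_tendsto (hsh z hz) (hcen z hz) i
    obtain ⟨D, hD⟩ := P.compare_near hd.1 _ (hclose z hz)
    refine tendsto_atBot_mono' _ ?_ (tendsto_atBot_add_const_right _ D h1)
    filter_upwards [hD] with k hk
    have := hk i
    rw [abs_le] at this
    linarith [this.1]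
  set R := ∑ z ∈ Z, ‖z‖ + 1 with hR
  have hRz : ∀ z ∈ Z, ‖z‖ + 1 ≤ R := fun z hz => by
    have := single_le_sum (f := fun z : E2 => ‖z‖) (fun _ _ => norm_nonneg _) hz
    linarith
  have hR1 : 1 ≤ R := by
    have := sum_nonneg (s := Z) (f := fun z : E2 => ‖z‖) (fun _ _ => norm_nonneg _)
    linarith
  have hmass := fun (R : ℝ) hR j => tendsto_mass hd Z hZ β q σ r (fun z hz => hnear z ((hZ z).1 hz))
    (fun z hz => hs z ((hZ z).1 hz)) hlam R hR j
  have hσ : ∀ z ∈ Z, ∀ i, 0 ≤ σ z i := fun z hz i => (hs z ((hZ z).1 hz)).nonneg hd.1 i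
  have hσpos : ∀ z ∈ Z, 0 < ∑ i, σ z i := fun z hz => (hs z ((hZ z).1 hz)).sum_pos hγ hn hd.1
  refine sum_strengths_eq (A := A) Z σ _ _ ?_ ?_ ?_
  · intro z hz w hw
    have hz' := (hZ z).1 hz
    have hw' := (hZ w).1 hw
    by_cases hzw : z = w
    · subst hzw
      rw [(hs z hz').poh]; ring
    · refine (hs z hz').pair hn hA hA2 hγ (hs w hw') (hcen z hz') (hcen w hw') (hsh z hz')
        (hsh w hw') (‖z‖ + 1 + (‖w‖ + 1)) ?_
      filter_upwards [hclose z hz', hclose w hw'] with k h1 h2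
      have e : q z k - q w k = (q z k - p k) - (q w k - p k) := by abel
      rw [e, add_mul]
      exact (norm_sub_le _ _).trans (add_le_add h1 h2)
  · set τ := ∑ z ∈ Z, σ z with hτ
    have hτj : ∀ j, τ j = ∑ z ∈ Z, σ z j := fun j => by simp [hτ]
    have hRd : Shrinks 𝒰 p fun k => R * d k := ⟨hd.1.mono fun k hk => by positivity,
      fun ε hε => hd.eventually_le R hε⟩
    have hlim : ∀ (R : ℝ), (∀ z ∈ Z, ‖z‖ + 1 ≤ R) →
        Tendsto (fun k => P.mass k (p k) (R * d k)) 𝒰 (𝓝 τ) := fun R hR =>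
      tendsto_pi_nhds.2 fun j => by rw [hτj]; exact hmass R hR j
    have hbound : ∀ T : ℝ, 4 ≤ T →
        |τ ⬝ᵥ (A *ᵥ τ) - 4 * strength γ b * ∑ i, τ i| ≤ P.K * (1 / T) := by
      intro T hT
      have hTR : ∀ z ∈ Z, ‖z‖ + 1 ≤ T * R := fun z hz => (hRz z hz).trans (by nlinarith)
      have := pohozaev_limit hRd (b := b) ?_ ?_ hT (hlim R hRz)
        (by simpa only [mul_assoc] using hlim (T * R) hTR)
      · simpa using this
      · cases b
        · simp
        · simpa [IsCenter] using hc
      · intro hb ε hε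
        filter_upwards [hsep hb (ε / R) (by positivity)] with k hk
        calc R * d k ≤ R * (ε / R * ‖p k‖) := mul_le_mul_of_nonneg_left hk (by linarith)
          _ = ε * ‖p k‖ := by field_simp
    have h0 : |τ ⬝ᵥ (A *ᵥ τ) - 4 * strength γ b * ∑ i, τ i| ≤ 0 := by
      have hlim : Tendsto (fun T : ℝ => P.K * (1 / T)) atTop (𝓝 (P.K * 0)) := by
        simpa using (tendsto_inv_atTop_zero (𝕜 := ℝ)).const_mul P.K
      rw [mul_zero] at hlim
      exact ge_of_tendsto hlim ((eventually_ge_atTop 4).mono hbound)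
    linarith [abs_eq_zero.1 (le_antisymm h0 (abs_nonneg _))]
  · obtain ⟨z, hz⟩ := hex
    have h1 : ∑ i, (∑ z ∈ Z, σ z) i = ∑ z ∈ Z, ∑ i, σ z i := by
      simp only [Finset.sum_apply]; exact sum_comm
    rw [h1]
    exact sum_pos hσpos ⟨z, (hZ z).2 hz⟩

end LiouvilleFamily
end Splitting

section Neck
open Matrix

lemma dyadic_bound {F : ℝ → ℝ} (hF : Monotone F) {ρ b B η : ℝ} (hρ : 0 < ρ) (hη : 0 < η)
    (hB : 0 ≤ B) (h : ∀ t, ρ ≤ t → t ≤ b → F (2 * t) ≤ F t + B * (ρ / t) ^ η) {t : ℝ}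
    (ht : ρ ≤ t) (htb : t ≤ b) : F t ≤ F ρ + B / (1 - 2 ^ (-η)) := by
  set θ : ℝ := 2 ^ (-η) with hθ
  have hθ0 : 0 < θ := by positivity
  have hθ1 : θ < 1 := rpow_lt_one_of_one_lt_of_neg (by norm_num) (by linarith)
  have key : ∀ J : ℕ, 2 ^ J * ρ ≤ 2 * b → F (2 ^ J * ρ) ≤ F ρ + B * ((1 - θ ^ J) / (1 - θ)) := by
    intro J
    induction J with
    | zero => intro _; simp
    | succ J ih =>
      intro hJ
      have h0 : 0 < (2 : ℝ) ^ J := by positivity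
      have h1 : (1 : ℝ) ≤ 2 ^ J := one_le_pow₀ (by norm_num)
      have hJ' : 2 ^ J * ρ ≤ b := by rw [pow_succ] at hJ; linarith
      have h2 := h (2 ^ J * ρ) (by nlinarith) hJ'
      have h3 := ih (by nlinarith)
      have e1 : (2 : ℝ) ^ (J + 1) * ρ = 2 * (2 ^ J * ρ) := by ring
      have e2 : (ρ / (2 ^ J * ρ)) ^ η = θ ^ J := by
        have : ρ / (2 ^ J * ρ) = (2 ^ J : ℝ)⁻¹ := by field_simp
        rw [this, hθ, inv_rpow (by positivity), ← rpow_natCast, ← rpow_natCast,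
          ← rpow_mul (by norm_num), ← rpow_mul (by norm_num),
          ← rpow_neg (by norm_num)]
        congr 1; ring
      rw [e2] at h2
      rw [e1]
      have e3 : B * ((1 - θ ^ (J + 1)) / (1 - θ)) = B * ((1 - θ ^ J) / (1 - θ)) + B * θ ^ J := by
        have : 1 - θ ≠ 0 := by linarith
        field_simp; ring
      rw [e3]; linarith
  obtain ⟨J, hJ⟩ := pow_unbounded_of_one_lt (t / ρ) (one_lt_two : (1 : ℝ) < 2)
  have hex : ∃ J : ℕ, t ≤ 2 ^ J * ρ := ⟨J, by rw [div_lt_iff₀ hρ] at hJ; exact hJ.le⟩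
  classical
  have hJ2 : 2 ^ Nat.find hex * ρ ≤ 2 * b := by
    rcases Nat.eq_zero_or_eq_succ_pred (Nat.find hex) with h0 | h0
    · rw [h0]; simp; linarith
    · have h1 := Nat.find_min hex (m := (Nat.find hex).pred) (by omega)
      rw [h0, pow_succ]
      linarith
  have h1 := key _ hJ2
  have h2 : B * ((1 - θ ^ Nat.find hex) / (1 - θ)) ≤ B / (1 - θ) := by
    rw [mul_div_assoc']
    refine div_le_div_of_nonneg_right ?_ (by linarith)
    have := pow_pos hθ0 (Nat.find hex)
    nlinarith
  linarith [hF (Nat.find_spec hex)]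

namespace LiouvilleFamily

variable {n : ℕ} {A : Matrix (Fin n) (Fin n) ℝ} {γ : ℝ} {P : LiouvilleFamily n A γ}
  {𝒰 : Ultrafilter ℕ}

lemma closedBall_diff_subset_image {q : E2} {t : ℝ} (ht : 0 < t) :
    closedBall q (2 * t) \ closedBall q t ⊆
      (fun y => q + t • y) '' (closedBall 0 2 \ ball 0 1) := by
  rintro x ⟨h1, h2⟩
  rw [mem_closedBall, dist_eq_norm] at h1
  rw [mem_closedBall, dist_eq_norm, not_le] at h2
  refine ⟨t⁻¹ • (x - q), ⟨?_, ?_⟩, ?_⟩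
  · rw [mem_closedBall_zero_iff, norm_smul, norm_inv, norm_eq_abs, abs_of_pos ht,
      inv_mul_le_iff₀ ht]
    linarith
  · rw [mem_ball_zero_iff, norm_smul, norm_inv, norm_eq_abs, abs_of_pos ht,
      inv_mul_lt_iff₀ ht]
    linarith
  · simp only [smul_smul, mul_inv_cancel₀ ht.ne', one_smul]; abel

variable (P) in
/-- On an annulus without concentration the mass is controlled by the averaged logarithms. -/
lemma annulus_le : ∃ C > 0, ∀ k q t, 0 < t → ‖q‖ + 3 * t ≤ P.r₀ →
    P.tot k (closedBall q (8 / 3 * t) \ closedBall q (t / 3)) ≤ P.ε₀ → ∀ i,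
    (P.ρ k i).real (closedBall q (2 * t) \ closedBall q t) ≤ C * exp (P.lam k i q t) := by
  have hSc : IsCompact (closedBall (0 : E2) 2 \ ball 0 1) :=
    (isCompact_closedBall _ _).diff isOpen_ball
  obtain ⟨Z, hZS, hZf, hcov⟩ := hSc.finite_cover_balls (e := 1 / 8) (by norm_num)
  obtain ⟨D, hD⟩ := P.compare 4
  have hK := P.K_pos
  refine ⟨(hZf.toFinset.card + 1) * (P.K * exp D), by positivity, ?_⟩
  intro k q t ht hq hm i
  have hz : ∀ z ∈ hZf.toFinset, (P.ρ k i).real (closedBall (q + t • z) (t / 4 / 2)) ≤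
      P.K * exp D * exp (P.lam k i q t) := by
    intro z hz
    have hzS := hZS (hZf.mem_toFinset.1 hz)
    have hz2 : ‖z‖ ≤ 2 := by simpa using hzS.1
    have hz1 : 1 ≤ ‖z‖ := by simpa using hzS.2
    have htz : ‖t • z‖ = t * ‖z‖ := by rw [norm_smul, norm_eq_abs, abs_of_pos ht]
    have h1 := P.le_exp_lam k i (q + t • z) (t / 4) (by positivity)
      (by
        have := norm_add_le q (t • z)
        rw [htz] at this; nlinarith)
      (by
        refine (P.tot_mono k ?_).trans hm
        intro x hx
        rw [mem_closedBall, dist_eq_norm] at hx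
        have e : x - q = (x - (q + t • z)) + t • z := by abel
        rw [Set.mem_sdiff, mem_closedBall, mem_closedBall, dist_eq_norm, e]
        have g1 := norm_add_le (x - (q + t • z)) (t • z)
        have g2 := norm_sub_le_norm_add (t • z) (x - (q + t • z))
        rw [add_comm (t • z)] at g2
        rw [htz] at g1 g2
        constructor
        · nlinarith
        · rw [not_le]; nlinarith)
    have h2 := hD k i (q + t • z) q (t / 4) t (by positivity) ht (by linarith) (by linarith)
      (by simp [htz]; nlinarith)
    rw [abs_le] at h2
    calc _ ≤ _ := h1
      _ ≤ P.K * (exp D * exp (P.lam k i q t)) := by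
          rw [← exp_add]
          exact mul_le_mul_of_nonneg_left (exp_le_exp.2 (by linarith [h2.2])) hK.le
      _ = _ := by ring
  have hsub : closedBall q (2 * t) \ closedBall q t ⊆
      ⋃ z ∈ hZf.toFinset, closedBall (q + t • z) (t / 4 / 2) := by
    refine (closedBall_diff_subset_image ht).trans ?_
    rintro _ ⟨y, hy, rfl⟩
    have := hcov hy
    simp only [Set.mem_iUnion] at this ⊢
    obtain ⟨z, hz, hyz⟩ := this
    refine ⟨z, hZf.mem_toFinset.2 hz, ?_⟩
    rw [mem_closedBall]
    simp only [dist_frame ht]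
    rw [mem_ball] at hyz
    nlinarith
  calc _ ≤ (P.ρ k i).real (⋃ z ∈ hZf.toFinset, closedBall (q + t • z) (t / 4 / 2)) :=
        measureReal_mono hsub (measure_ne_top _ _)
    _ ≤ ∑ z ∈ hZf.toFinset, (P.ρ k i).real (closedBall (q + t • z) (t / 4 / 2)) :=
        measureReal_biUnion_finset_le _ _
    _ ≤ ∑ z ∈ hZf.toFinset, P.K * exp D * exp (P.lam k i q t) := sum_le_sum hz
    _ = hZf.toFinset.card * (P.K * exp D * exp (P.lam k i q t)) := by simp
    _ ≤ _ := by
        have : 0 < P.K * exp D * exp (P.lam k i q t) := by positivity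
        nlinarith

/-- The limit profile of the masses of large balls at the scale of a bubble. -/
lemma exists_profile (q : ℕ → E2) {r : ℕ → ℝ} (hr : ∀ᶠ k in (𝒰 : Filter ℕ), 0 < r k) :
    ∃ (m : ℕ → Fin n → ℝ) (σ : Fin n → ℝ),
      (∀ N : ℕ, Tendsto (fun k => P.mass k (q k) (N * r k)) 𝒰 (𝓝 (m N))) ∧
      (∀ N j, 0 ≤ m N j) ∧ (∀ N j, m N j ≤ σ j) ∧ Tendsto m atTop (𝓝 σ) := by
  have h1 : ∀ (N : ℕ) j, ∃ l ∈ Icc 0 P.K,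
      Tendsto (fun k => P.mass k (q k) (N * r k) j) 𝒰 (𝓝 l) := fun N j =>
    exists_tendsto_of_bounded 𝒰 _ 0 P.K (Eventually.of_forall fun k =>
      ⟨P.mass_nonneg k _ _ j, P.mass_le_K k _ _ j⟩)
  choose m hm hlim using h1
  have hmono : ∀ j, Monotone fun N => m N j := by
    intro j N N' hN
    refine le_of_tendsto_of_tendsto (hlim N j) (hlim N' j) ?_
    filter_upwards [hr] with k hk
    refine P.mass_mono k _ (mul_le_mul_of_nonneg_right ?_ hk.le) j
    exact_mod_cast hN
  have hbdd : ∀ j, BddAbove (Set.range fun N => m N j) := fun j =>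
    ⟨P.K, by rintro _ ⟨N, rfl⟩; exact (hm N j).2⟩
  exact ⟨m, fun j => ⨆ N, m N j, fun N => tendsto_pi_nhds.2 (hlim N), fun N j => (hm N j).1,
    fun N j => le_ciSup (hbdd j) N,
    tendsto_pi_nhds.2 fun j => tendsto_atTop_ciSup (hmono j) (hbdd j)⟩

/-- A frame without atoms whose exterior carries little mass on each dyadic annulus is an isolated
bubble. -/
lemma exists_isSimpleAt (hA : H1 A) (hA2 : H2 A)
    {b : Bool} {q : ℕ → E2} {d r : ℕ → ℝ} (hd : Shrinks 𝒰 q d) (hc : IsCenter 𝒰 b q d)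
    (hr : ∀ᶠ k in (𝒰 : Filter ℕ), 0 < r k) (hrd : Negl 𝒰 r d) {R₀ s₀ : ℝ} (hs₀ : 0 < s₀)
    (hann : ∀ᶠ k in (𝒰 : Filter ℕ), ∀ t, R₀ * r k ≤ t → t ≤ s₀ * d k →
      P.tot k (closedBall (q k) (2 * t) \ closedBall (q k) t) ≤ P.ε₀ / 3)
    (hat : ∀ z, ¬ P.IsAtom 𝒰 q r z)
    (hcore : ∀ᶠ k in (𝒰 : Filter ℕ), P.ε₀ ≤ P.tot k (closedBall (q k) (r k))) :
    ∃ σ, P.IsSimpleAt 𝒰 b q d σ r := by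
  obtain ⟨m, σ, hm, hm0, hmσ, hmlim⟩ := exists_profile (P := P) q hr
  have hK := P.K_pos
  have hε₀ := P.ε₀_pos
  have hσ0 : ∀ j, 0 ≤ σ j := fun j => (hm0 0 j).trans (hmσ 0 j)
  have hnn := hA.2.1
  have hrs : Shrinks 𝒰 q r := hd.mono hr (by
    filter_upwards [hrd 1 one_pos] with k hk; linarith)
  have hsumc : Continuous fun v : Fin n → ℝ => ∑ j, v j := by fun_prop
  have hmlimj : ∀ j, Tendsto (fun N => m N j) atTop (𝓝 (σ j)) := tendsto_pi_nhds.1 hmlim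
  have hAc : ∀ i, Continuous fun v : Fin n → ℝ => (A *ᵥ v) i := fun i => by fun_prop
  have hlam : ∀ i, 0 < σ i → ∃ D, ∀ᶠ k in (𝒰 : Filter ℕ), -D ≤ P.lam k i (q k) (r k) := by
    intro i hi
    obtain ⟨N, hN⟩ := ((hmlimj i).eventually_const_lt (half_lt_self hi)).exists
    obtain ⟨D, hD, hev⟩ := P.mass_le_of_no_atoms hrs
      (isCompact_closedBall (0 : E2) N) fun z _ => hat z
    refine ⟨-log (σ i / 2 / D), ?_⟩
    filter_upwards [hev, ((tendsto_pi_nhds.1 (hm N)) i).eventually_const_lt hN, hr]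
      with k h1 h2 h3
    have h4 : closedBall (q k) (N * r k) ⊆ (fun y => q k + r k • y) '' closedBall 0 (N : ℝ) := by
      intro x hx
      rw [mem_closedBall, dist_eq_norm] at hx
      refine ⟨(r k)⁻¹ • (x - q k), ?_, ?_⟩
      · rw [mem_closedBall_zero_iff, norm_smul, norm_inv, norm_eq_abs, abs_of_pos h3,
          inv_mul_le_iff₀ h3]
        linarith
      · simp only [smul_smul, mul_inv_cancel₀ h3.ne', one_smul]; abel
    have h5 : P.mass k (q k) (N * r k) i ≤ D * exp (P.lam k i (q k) (r k)) :=
      (measureReal_mono h4 (measure_ne_top _ _)).trans (h1 i)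
    rw [neg_neg, log_le_iff_le_exp (by positivity), div_le_iff₀ hD]
    linarith
  have hsumpos : P.ε₀ ≤ ∑ i, σ i := by
    have h1 := (hsumc.tendsto _).comp (hm 1)
    have h2 : P.ε₀ ≤ ∑ j, m 1 j := by
      refine ge_of_tendsto h1 ?_
      filter_upwards [hcore] with k hk
      simpa [P.sum_mass] using hk
    exact h2.trans (sum_le_sum fun j _ => hmσ 1 j)
  have hex : ∃ i, 0 < σ i := by
    by_contra! hcon
    have := Finset.sum_nonpos fun i (_ : i ∈ Finset.univ) => hcon i
    linarith
  have hrq : b = false → ∀ ε > 0, ∀ᶠ k in (𝒰 : Filter ℕ), r k ≤ ε * ‖q k‖ := by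
    rintro rfl ε hε
    obtain ⟨Λ, hΛ⟩ := by simpa [IsCenter] using hc
    have hΛ0 : 0 < |Λ| + 1 := by positivity
    filter_upwards [hΛ, hrd (ε / (|Λ| + 1)) (by positivity), hd.1] with k h1 h2 h3
    have h4 : d k ≤ (|Λ| + 1) * ‖q k‖ := h1.trans
      (mul_le_mul_of_nonneg_right (by linarith [le_abs_self Λ]) (norm_nonneg _))
    calc r k ≤ ε / (|Λ| + 1) * d k := h2
      _ ≤ ε / (|Λ| + 1) * ((|Λ| + 1) * ‖q k‖) := mul_le_mul_of_nonneg_left h4 (by positivity)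
      _ = ε * ‖q k‖ := by field_simp
  have hpoh : σ ⬝ᵥ (A *ᵥ σ) = 4 * strength γ b * ∑ i, σ i := by
    have h1 : ∀ N : ℕ, 1 ≤ N → ∀ T : ℕ, 4 ≤ T →
        |m N ⬝ᵥ (A *ᵥ m N) - 4 * strength γ b * ∑ i, m N i| ≤
          P.K * (∑ i, σ i - ∑ i, m N i + 1 / T) := by
      intro N hN T hT
      have hN' : (1 : ℝ) ≤ N := by exact_mod_cast hN
      have hNr : Shrinks 𝒰 q fun k => N * r k := ⟨hr.mono fun k hk => by positivity,
        fun ε hε => hrs.eventually_le N hε⟩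
      have h2 := pohozaev_limit hNr (b := b) ?_ ?_ (T := T) (by exact_mod_cast hT) (hm N)
        (by simpa only [Nat.cast_mul, mul_assoc] using hm (T * N))
      · refine h2.trans (mul_le_mul_of_nonneg_left ?_ hK.le)
        have := sum_le_sum fun j (_ : j ∈ Finset.univ) => hmσ (T * N) j
        linarith
      · rintro rfl; simpa [IsCenter] using hc
      · intro hb ε hε
        filter_upwards [hrq hb (ε / N) (by positivity)] with k hk
        calc N * r k ≤ N * (ε / N * ‖q k‖) := mul_le_mul_of_nonneg_left hk (by linarith)
          _ = ε * ‖q k‖ := by field_simp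
    have h2 : ∀ T : ℕ, 4 ≤ T →
        |σ ⬝ᵥ (A *ᵥ σ) - 4 * strength γ b * ∑ i, σ i| ≤ P.K * (1 / T) := by
      intro T hT
      have l1 : Tendsto (fun N => |m N ⬝ᵥ (A *ᵥ m N) - 4 * strength γ b * ∑ i, m N i|) atTop
          (𝓝 |σ ⬝ᵥ (A *ᵥ σ) - 4 * strength γ b * ∑ i, σ i|) :=
        ((by fun_prop : Continuous fun v : Fin n → ℝ =>
          |v ⬝ᵥ (A *ᵥ v) - 4 * strength γ b * ∑ i, v i|).tendsto σ).comp hmlim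
      have l2 : Tendsto (fun N => P.K * (∑ i, σ i - ∑ i, m N i + 1 / (T : ℝ))) atTop
          (𝓝 (P.K * (∑ i, σ i - ∑ i, σ i + 1 / (T : ℝ)))) :=
        ((((hsumc.tendsto σ).comp hmlim).const_sub _).add_const _).const_mul _
      rw [sub_self, zero_add] at l2
      exact le_of_tendsto_of_tendsto l1 l2
        ((eventually_ge_atTop 1).mono fun N hN => h1 N hN T hT)
    have h3 : |σ ⬝ᵥ (A *ᵥ σ) - 4 * strength γ b * ∑ i, σ i| ≤ 0 := by
      have hlim : Tendsto (fun T : ℕ => P.K * (1 / (T : ℝ))) atTop (𝓝 (P.K * 0)) :=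
        (tendsto_one_div_atTop_nhds_zero_nat (𝕜 := ℝ)).const_mul P.K
      rw [mul_zero] at hlim
      exact ge_of_tendsto hlim ((eventually_ge_atTop 4).mono h2)
    linarith [abs_eq_zero.1 (le_antisymm h3 (abs_nonneg _))]
  obtain ⟨D₁, hD₁⟩ := P.slope_center hc
  have hrate : ∀ i, 0 < (A *ᵥ σ) i - 2 * strength γ b := by
    refine decay_rates_pos hA hA2 σ hσ0 hex (strength γ b) ?_
    intro i hi
    by_contra! hy
    obtain ⟨D₂, hD₂⟩ := hlam i hi
    obtain ⟨D₃, hD₃⟩ := P.compare 3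
    set c := exp (-(D₁ + D₂ + D₃ + 1)) / P.K with hcdef
    have hc0 : 0 < c := by positivity
    have hgap : ∀ N : ℕ, 2 ≤ N → m N i + c ≤ m (4 * N) i := by
      intro N hN
      have hN' : (2 : ℝ) ≤ N := by exact_mod_cast hN
      have hlogN : 0 < log N := log_pos (by linarith)
      have hAN : (A *ᵥ m N) i ≤ (A *ᵥ σ) i := by
        simp only [mulVec, dotProduct]
        exact sum_le_sum fun j _ => mul_le_mul_of_nonneg_left (hmσ N j) (hnn i j)
      have hAev : ∀ᶠ k in (𝒰 : Filter ℕ),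
          (A *ᵥ P.mass k (q k) (N * r k)) i < (A *ᵥ σ) i + 1 / log N := by
        refine (((hAc i).tendsto _).comp (hm N)).eventually_lt_const ?_
        have : 0 < 1 / log N := by positivity
        linarith
      refine le_of_tendsto_of_tendsto (((tendsto_pi_nhds.1 (hm N)) i).add_const c)
        ((tendsto_pi_nhds.1 (hm (4 * N))) i) ?_
      filter_upwards [hAev, hD₁, hD₂, hr, hrd (1 / N) (by positivity),
        hrs.eventually_le (5 * N) P.r₀_pos] with k h1 h2 h3 h4 h5 h6
      have hNr : 0 < N * r k := by positivity
      have hle : r k ≤ N * r k := by nlinarith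
      have h7 := (h2 (r k) (N * r k) h4 hle (by
        calc N * r k ≤ N * (1 / N * d k) := mul_le_mul_of_nonneg_left h5 (by positivity)
          _ = d k := by field_simp) i).2
      rw [mul_div_assoc, div_self h4.ne', mul_one] at h7
      have h8 : -1 ≤ (2 * strength γ b - (A *ᵥ P.mass k (q k) (N * r k)) i) * log N := by
        have : -(1 / log N) ≤ 2 * strength γ b - (A *ᵥ P.mass k (q k) (N * r k)) i := by
          linarith
        have h9 := mul_le_mul_of_nonneg_right this hlogN.le
        rwa [neg_mul, div_mul_cancel₀ _ hlogN.ne'] at h9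
      set v : E2 := EuclideanSpace.single 0 (3 * (N * r k)) with hv
      have hvn : ‖v‖ = 3 * (N * r k) := by simp [hv, abs_of_pos h4]
      have h10 := hD₃ k i (q k + v) (q k) (N * r k) (N * r k) hNr hNr (by linarith) (by linarith)
        (by simp [hvn])
      rw [abs_le] at h10
      have h11 := P.exp_lam_le k i (q k + v) (N * r k) hNr
        (by have := norm_add_le (q k) v; linarith)
      have h12 : exp (-(D₁ + D₂ + D₃ + 1)) ≤ exp (P.lam k i (q k + v) (N * r k)) :=
        exp_le_exp.2 (by linarith [h10.1])
      have h13 : c ≤ (P.ρ k i).real (closedBall (q k + v) (N * r k)) := by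
        rw [hcdef, div_le_iff₀ hK]; linarith
      have h14 : Disjoint (closedBall (q k) (N * r k)) (closedBall (q k + v) (N * r k)) := by
        refine closedBall_disjoint_closedBall ?_
        rw [dist_self_add_right, hvn]; linarith
      have h15 : closedBall (q k) (N * r k) ∪ closedBall (q k + v) (N * r k) ⊆
          closedBall (q k) ((4 * N : ℕ) * r k) := by
        refine Set.union_subset (closedBall_subset_closedBall ?_)
          (closedBall_subset_closedBall' ?_)
        · push_cast; nlinarith
        · rw [dist_self_add_left, hvn]; push_cast; nlinarith
      have h16 := measureReal_mono (μ := P.ρ k i) h15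
      rw [measureReal_union h14 measurableSet_closedBall] at h16
      exact (add_le_add le_rfl h13).trans h16
    have l1 := (hmlimj i).add_const c
    have l2 : Tendsto (fun N : ℕ => m (4 * N) i) atTop (𝓝 (σ i)) :=
      (hmlimj i).comp (tendsto_id.const_mul_atTop' (by norm_num : 0 < 4))
    have := le_of_tendsto_of_tendsto l1 l2 ((eventually_ge_atTop 2).mono hgap)
    linarith
  refine ⟨σ, hr, hrd, ?_, hlam, hrate, hpoh⟩
  obtain ⟨η, hη, hηy⟩ : ∃ η > 0, ∀ i, 2 * η ≤ (A *ᵥ σ) i - 2 * strength γ b := by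
    obtain ⟨i₁, _⟩ := hex
    have : Nonempty (Fin n) := ⟨i₁⟩
    obtain ⟨i₀, hi₀⟩ := Finite.exists_min fun i => (A *ᵥ σ) i
    exact ⟨((A *ᵥ σ) i₀ - 2 * strength γ b) / 2, by linarith [hrate i₀],
      fun i => by linarith [hi₀ i]⟩
  obtain ⟨N₁, hN₁, hN₁1⟩ : ∃ N₁ : ℕ, (∀ i, 2 * strength γ b + η < (A *ᵥ m N₁) i) ∧ 1 ≤ N₁ := by
    have h1 : ∀ᶠ N in atTop, ∀ i, 2 * strength γ b + η < (A *ᵥ m N) i := by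
      rw [eventually_all]
      exact fun i => (((hAc i).tendsto _).comp hmlim).eventually_const_lt
        (show 2 * strength γ b + η < (A *ᵥ σ) i by linarith [hηy i])
    exact (h1.and (eventually_ge_atTop 1)).exists
  have hN₁' : (1 : ℝ) ≤ N₁ := by exact_mod_cast hN₁1
  have hN₁ev : ∀ᶠ k in (𝒰 : Filter ℕ), ∀ i,
      2 * strength γ b + η < (A *ᵥ P.mass k (q k) (N₁ * r k)) i := by
    rw [eventually_all]
    exact fun i => (((hAc i).tendsto _).comp (hm N₁)).eventually_const_lt (hN₁ i)
  obtain ⟨C, hC, hCann⟩ := P.annulus_le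
  have hN₁s : Shrinks 𝒰 q fun k => N₁ * r k := ⟨hr.mono fun k hk => by positivity,
    fun ε hε => hrs.eventually_le N₁ hε⟩
  have hup := P.lam_bddAbove hN₁s
  set B₀ := n * (C * exp (P.K * P.K + D₁)) with hB₀
  have hB₀0 : 0 ≤ B₀ := by positivity
  intro ε hε
  have hlimB : Tendsto (fun N : ℕ => B₀ * ((N₁ : ℝ) / N) ^ η / (1 - 2 ^ (-η))) atTop (𝓝 0) := by
    have h1 : Tendsto (fun N : ℕ => ((N₁ : ℝ) / N) ^ η) atTop (𝓝 (0 ^ η)) :=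
      (tendsto_const_div_atTop_nhds_zero_nat (N₁ : ℝ)).rpow_const (Or.inr hη.le)
    rw [zero_rpow hη.ne'] at h1
    simpa using (h1.const_mul B₀).div_const (1 - 2 ^ (-η))
  obtain ⟨N, hNB, hNσ, hNN, hNR⟩ := ((hlimB.eventually_lt_const (half_pos hε)).and
    ((eventually_all.2 fun j => (hmlimj j).eventually_const_lt
      (show σ j - ε / 2 < σ j by linarith)).and ((eventually_ge_atTop N₁).and
      ((tendsto_natCast_atTop_atTop (R := ℝ)).eventually_ge_atTop (3 * R₀))))).exists
  have hN1 : (1 : ℝ) ≤ N := by exact_mod_cast hN₁1.trans hNN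
  have hNN' : (N₁ : ℝ) ≤ N := by exact_mod_cast hNN
  refine ⟨N, hN1, min (1 / 4) (s₀ / 2), by positivity, ?_⟩
  have hNlow : ∀ᶠ k in (𝒰 : Filter ℕ), ∀ j, σ j - ε < P.mass k (q k) (N * r k) j ∧
      P.mass k (q k) (N * r k) j < σ j + ε / 2 := by
    rw [eventually_all]
    exact fun j => (((tendsto_pi_nhds.1 (hm N)) j).eventually_const_lt
      (by linarith [hNσ j])).and (((tendsto_pi_nhds.1 (hm N)) j).eventually_lt_const
      (by linarith [hmσ N j]))
  filter_upwards [hNlow, hN₁ev, hann, hup, hr, hd.1, hd.eventually_le 1 P.r₀_pos, hD₁]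
    with k h1 h2 h3 h4 h5 h6 h7 h8 t ht1 ht2 j
  have hNr : 0 < N * r k := by positivity
  have hmono : Monotone fun t => P.tot k (closedBall (q k) t) := fun s t hst =>
    P.tot_mono k (closedBall_subset_closedBall hst)
  have hdiff : ∀ s t, s ≤ t → P.tot k (closedBall (q k) t \ closedBall (q k) s) =
      P.tot k (closedBall (q k) t) - P.tot k (closedBall (q k) s) := fun s t hst =>
    P.tot_diff k (closedBall_subset_closedBall hst) measurableSet_closedBall
  have hsd : ∀ t, t ≤ min (1 / 4) (s₀ / 2) * d k → t ≤ 1 / 4 * d k ∧ t ≤ s₀ / 2 * d k :=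
    fun t ht => ⟨ht.trans (mul_le_mul_of_nonneg_right (min_le_left _ _) h6.le),
      ht.trans (mul_le_mul_of_nonneg_right (min_le_right _ _) h6.le)⟩
  have hstep : ∀ t, N * r k ≤ t → t ≤ min (1 / 4) (s₀ / 2) * d k →
      P.tot k (closedBall (q k) (2 * t)) ≤ P.tot k (closedBall (q k) t) +
        B₀ * ((N₁ : ℝ) / N) ^ η * (N * r k / t) ^ η := by
    intro t ht1 ht2
    obtain ⟨ht3, ht4⟩ := hsd t ht2
    have ht0 : 0 < t := hNr.trans_le ht1
    have hsd0 : 0 < s₀ * d k := by positivity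
    have hNRr : R₀ * r k ≤ t / 3 := by nlinarith
    have g1 := h3 (t / 3) hNRr (by linarith)
    have g2 := h3 (2 * (t / 3)) (by linarith) (by linarith)
    have g3 := h3 (2 * (2 * (t / 3))) (by linarith) (by linarith)
    rw [hdiff _ _ (by linarith)] at g1 g2 g3
    have e1 : 2 * (2 * (2 * (t / 3))) = 8 / 3 * t := by ring
    rw [e1] at g3
    have g4 := hCann k (q k) t ht0 (by linarith) (by
      rw [hdiff _ _ (by linarith)]; linarith)
    have hN₁r : N₁ * r k ≤ t := (mul_le_mul_of_nonneg_right hNN' h5.le).trans ht1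
    have hN₁r0 : 0 < N₁ * r k := by positivity
    have g5 : ∀ i, exp (P.lam k i (q k) t) ≤
        exp (P.K * P.K + D₁) * (N₁ * r k / t) ^ η := by
      intro i
      have hlog : 0 ≤ log (t / (N₁ * r k)) :=
        log_nonneg (by rw [le_div_iff₀ hN₁r0]; linarith)
      have f1 := (h8 (N₁ * r k) t hN₁r0 hN₁r (by linarith) i).1
      have f2 := h4 i
      have f3 := mul_le_mul_of_nonneg_right (show 2 * strength γ b -
        (A *ᵥ P.mass k (q k) (N₁ * r k)) i ≤ -η by linarith [h2 i]) hlog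
      rw [rpow_def_of_pos (by positivity), ← exp_add]
      refine exp_le_exp.2 ?_
      have e2 : log (N₁ * r k / t) = -log (t / (N₁ * r k)) := by
        rw [← log_inv, inv_div]
      rw [e2]; linarith
    have g6 : P.tot k (closedBall (q k) (2 * t) \ closedBall (q k) t) ≤
        B₀ * (N₁ * r k / t) ^ η := by
      calc _ ≤ ∑ i : Fin n, C * (exp (P.K * P.K + D₁) * (N₁ * r k / t) ^ η) :=
            sum_le_sum fun i _ =>
              (g4 i).trans (mul_le_mul_of_nonneg_left (g5 i) hC.le)
        _ = _ := by rw [sum_const, card_univ, Fintype.card_fin, nsmul_eq_mul]; ring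
    have e3 : ((N₁ : ℝ) / N) ^ η * (N * r k / t) ^ η = (N₁ * r k / t) ^ η := by
      rw [← mul_rpow (by positivity) (by positivity)]
      congr 1; field_simp
    rw [hdiff _ _ (by linarith)] at g6
    rw [mul_assoc, e3]; linarith
  have hfin := dyadic_bound hmono hNr hη (by positivity) hstep ht1 ht2
  have hdj : P.mass k (q k) t j - P.mass k (q k) (N * r k) j ≤
      P.tot k (closedBall (q k) t) - P.tot k (closedBall (q k) (N * r k)) := by
    rw [← hdiff _ _ ht1]
    refine le_trans (le_of_eq ?_) (P.le_tot k _ j)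
    exact (measureReal_sdiff (closedBall_subset_closedBall ht1)
      measurableSet_closedBall).symm
  have hmj := P.mass_mono k (q k) ht1 j
  rw [abs_le]
  constructor <;> linarith [(h1 j).1, (h1 j).2]

end LiouvilleFamily
end Neck

section Claims
open Matrix

namespace LiouvilleFamily

variable {n : ℕ} {A : Matrix (Fin n) (Fin n) ℝ} {γ : ℝ} {P : LiouvilleFamily n A γ}
  {𝒰 : Ultrafilter ℕ}

variable (P 𝒰) in
/-- Every atom of mass less than `m * ε₀ / 6` at a center of a frame is an isolated bubble. -/
def Resolves (b : Bool) (m : ℕ) : Prop :=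
  ∀ (p : ℕ → E2) (d : ℕ → ℝ), Shrinks 𝒰 p d → IsCenter 𝒰 b p d → P.IsAtom 𝒰 p d 0 →
    (∃ s > 0, ∀ᶠ k in (𝒰 : Filter ℕ),
      P.tot k (closedBall (p k) (s * d k)) < m * (P.ε₀ / 6)) →
    ∃ q σ r, IsCenter 𝒰 b q d ∧
      (∀ ε > 0, ∀ᶠ k in (𝒰 : Filter ℕ), ‖q k - p k‖ ≤ ε * d k) ∧ P.IsSimpleAt 𝒰 b q d σ r

lemma Shrinks.translate {p : ℕ → E2} {d : ℕ → ℝ} (hd : Shrinks 𝒰 p d) (z : E2) :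
    Shrinks 𝒰 (fun k => p k + d k • z) d :=
  hd.move ‖z‖ (by
    filter_upwards [hd.1] with k hk
    simp [norm_smul, abs_of_pos hk, mul_comm])

lemma IsAtom.translate {p : ℕ → E2} {d : ℕ → ℝ} {z : E2} (h : P.IsAtom 𝒰 p d z) :
    P.IsAtom 𝒰 (fun k => p k + d k • z) d 0 := by
  simpa [IsAtom] using h

lemma isCenter_false_translate {b : Bool} {p : ℕ → E2} {d : ℕ → ℝ} (hd : Shrinks 𝒰 p d)
    (hc : b = true → ∀ᶠ k in (𝒰 : Filter ℕ), p k = 0)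
    (hsep : b = false → ∀ ε > 0, ∀ᶠ k in (𝒰 : Filter ℕ), d k ≤ ε * ‖p k‖) {z : E2}
    (hz : b = true → z ≠ 0) : IsCenter 𝒰 false (fun k => p k + d k • z) d := by
  simp only [IsCenter, Bool.false_eq_true, if_false]
  cases b
  · refine ⟨1, ?_⟩
    filter_upwards [hsep rfl (1 / (‖z‖ + 1)) (by positivity), hd.1] with k h1 h2
    have h3 : (‖z‖ + 1) * d k ≤ ‖p k‖ := by
      calc (‖z‖ + 1) * d k ≤ (‖z‖ + 1) * (1 / (‖z‖ + 1) * ‖p k‖) :=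
            mul_le_mul_of_nonneg_left h1 (by positivity)
        _ = ‖p k‖ := by field_simp
    have h4 : ‖d k • z‖ = d k * ‖z‖ := by rw [norm_smul, norm_eq_abs, abs_of_pos h2]
    have h5 := norm_sub_le_norm_add (p k) (d k • z)
    rw [h4] at h5
    linarith
  · have hz := hz rfl
    refine ⟨‖z‖⁻¹, ?_⟩
    filter_upwards [hc rfl, hd.1] with k h1 h2
    rw [h1, zero_add, norm_smul, norm_eq_abs, abs_of_pos h2]
    have : ‖z‖ ≠ 0 := norm_ne_zero_iff.2 hz
    field_simp
    exact le_rfl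

lemma resolve_false (hF : ∀ m, Resolves P 𝒰 false m) {p : ℕ → E2} {d : ℕ → ℝ}
    (hd : Shrinks 𝒰 p d) {z : E2} (hc : IsCenter 𝒰 false (fun k => p k + d k • z) d)
    (hz : P.IsAtom 𝒰 p d z) :
    ∃ q σ r, IsCenter 𝒰 false q d ∧
      (∀ ε > 0, ∀ᶠ k in (𝒰 : Filter ℕ), ‖q k - (p k + d k • z)‖ ≤ ε * d k) ∧
      P.IsSimpleAt 𝒰 false q d σ r := by
  have hε := P.ε₀_pos
  obtain ⟨M, hM⟩ := exists_nat_gt (P.K / (P.ε₀ / 6))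
  rw [div_lt_iff₀ (by positivity)] at hM
  exact hF M _ d (hd.translate z) hc hz.translate
    ⟨1, one_pos, Eventually.of_forall fun k => (P.tot_le k _).trans_lt hM⟩

/-- The origin has no neighbouring atoms if `1 + γ` is not a positive integer. -/
lemma isAtom_eq_zero (hn : 0 < n) (hA : H1 A) (hA2 : H2 A) (hγ : -1 < γ)
    (hint : ¬ ∃ m : ℕ, 0 < m ∧ 1 + γ = (m : ℝ)) (hF : ∀ m, Resolves P 𝒰 false m)
    {p : ℕ → E2} {d : ℕ → ℝ} (hd : Shrinks 𝒰 p d)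
    (hc : ∀ᶠ k in (𝒰 : Filter ℕ), p k = 0)
    (h0 : P.IsAtom 𝒰 p d 0 → ∃ q σ r, IsCenter 𝒰 true q d ∧
      (∀ ε > 0, ∀ᶠ k in (𝒰 : Filter ℕ), ‖q k - p k‖ ≤ ε * d k) ∧ P.IsSimpleAt 𝒰 true q d σ r)
    (z : E2) (hz : P.IsAtom 𝒰 p d z) : z = 0 := by
  classical
  by_contra hz0
  have hct : IsCenter 𝒰 true p d := by simpa [IsCenter] using hc
  obtain ⟨Z, hZ, hsum⟩ := sum_strength_atoms hn hA hA2 hγ hd hct (by simp)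
    (fun z => decide (z = 0)) (by
      intro w hw
      by_cases hw0 : w = 0
      · subst hw0
        simpa using h0 hw
      · simpa [hw0] using resolve_false hF hd
          (isCenter_false_translate (b := true) hd (fun _ => hc) (by simp) fun _ => hw0) hw) ⟨z, hz⟩
  have hzZ := (hZ z).2 hz
  by_cases h0Z : (0 : E2) ∈ Z
  · have h1 : ∑ w ∈ {0, z}, strength γ (decide (w = (0 : E2))) ≤
        ∑ w ∈ Z, strength γ (decide (w = (0 : E2))) :=
      Finset.sum_le_sum_of_subset_of_nonneg (by
        intro w hw
        simp only [Finset.mem_insert, Finset.mem_singleton] at hw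
        rcases hw with rfl | rfl <;> assumption) fun w _ _ => (strength_pos hγ _).le
    rw [sum_pair (Ne.symm hz0), hsum] at h1
    simp [strength, hz0] at h1
    linarith
  · refine hint ⟨Z.card, Finset.card_pos.2 ⟨z, hzZ⟩, ?_⟩
    have h1 : ∑ w ∈ Z, strength γ (decide (w = (0 : E2))) = ∑ w ∈ Z, (1 : ℝ) :=
      sum_congr rfl fun w hw => by
        have : w ≠ 0 := fun h => h0Z (h ▸ hw)
        simp [strength, this]
    rw [h1] at hsum
    simpa [strength] using hsum.symm

variable (P) in
lemma exists_gap (q : ℕ → E2) {d : ℕ → ℝ} (hd : ∀ᶠ k in (𝒰 : Filter ℕ), 0 < d k) {s₀ ε : ℝ}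
    (hs₀ : 0 < s₀) (hε : 0 < ε) : ∃ s₂ > 0, s₂ ≤ s₀ ∧ ∀ s > 0, ∀ᶠ k in (𝒰 : Filter ℕ),
      P.tot k (closedBall (q k) (s₂ * d k) \ closedBall (q k) (s * d k)) < ε := by
  have h1 : ∀ s : ℝ, ∃ l ∈ Icc 0 P.K,
      Tendsto (fun k => P.tot k (closedBall (q k) (s * d k))) 𝒰 (𝓝 l) := fun s =>
    exists_tendsto_of_bounded 𝒰 _ 0 P.K (Eventually.of_forall fun k =>
      ⟨P.tot_nonneg k _, P.tot_le k _⟩)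
  choose f hf hlim using h1
  have hmono : Monotone f := by
    intro s t hst
    refine le_of_tendsto_of_tendsto (hlim s) (hlim t) ?_
    filter_upwards [hd] with k hk
    exact P.tot_mono k (closedBall_subset_closedBall (mul_le_mul_of_nonneg_right hst hk.le))
  have hbdd : BddBelow (f '' Ioi 0) := ⟨0, by rintro _ ⟨s, _, rfl⟩; exact (hf s).1⟩
  obtain ⟨_, ⟨t, ht, rfl⟩, htlt⟩ := exists_lt_of_csInf_lt
    (Set.Nonempty.image f ⟨1, by norm_num⟩ : (f '' Ioi (0 : ℝ)).Nonempty)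
    (lt_add_of_pos_right (sInf (f '' Ioi 0)) hε)
  have ht : 0 < t := ht
  refine ⟨min t s₀, lt_min ht hs₀, min_le_right _ _, fun s hs => ?_⟩
  have hst : 0 < min s (min t s₀) := lt_min hs (lt_min ht hs₀)
  have h2 : f (min t s₀) - f (min s (min t s₀)) < ε := by
    have h3 := csInf_le hbdd ⟨_, hst, rfl⟩
    have h4 := hmono (min_le_left t s₀)
    linarith
  filter_upwards [((hlim (min t s₀)).sub (hlim (min s (min t s₀)))).eventually_lt_const h2, hd]
    with k h3 h4
  refine lt_of_le_of_lt (P.tot_mono k (T := closedBall (q k) (min t s₀ * d k) \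
    closedBall (q k) (min s (min t s₀) * d k)) ?_) ?_
  · exact Set.sdiff_subset_sdiff_right (closedBall_subset_closedBall
      (mul_le_mul_of_nonneg_right (min_le_left _ _) h4.le))
  · rw [P.tot_diff k (closedBall_subset_closedBall
      (mul_le_mul_of_nonneg_right (min_le_right _ _) h4.le)) measurableSet_closedBall]
    exact h3

lemma exists_pow_half_le {ε : ℝ} (hε : 0 < ε) : ∃ J : ℕ, (1 / 2 : ℝ) ^ J ≤ ε := by
  obtain ⟨J, hJ⟩ := exists_pow_lt_of_lt_one hε (by norm_num : (1 / 2 : ℝ) < 1)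
  exact ⟨J, hJ.le⟩

/-- A smallest dyadic scale of concentration among balls centered in `X`. -/
lemma exists_anchor {p : ℕ → E2} {d : ℕ → ℝ} (hd : ∀ᶠ k in (𝒰 : Filter ℕ), 0 < d k)
    (hat : P.IsAtom 𝒰 p d 0) (X : ℕ → Set E2) (hX : ∀ᶠ k in (𝒰 : Filter ℕ), p k ∈ X k) :
    ∃ (q : ℕ → E2) (r : ℕ → ℝ), (∀ᶠ k in (𝒰 : Filter ℕ), q k ∈ X k) ∧
      (∀ᶠ k in (𝒰 : Filter ℕ), 0 < r k) ∧ Negl 𝒰 r d ∧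
      (∀ᶠ k in (𝒰 : Filter ℕ), P.ε₀ ≤ P.tot k (closedBall (q k) (r k))) ∧
      ∀ᶠ k in (𝒰 : Filter ℕ), ∀ x ∈ X k, P.tot k (closedBall x (r k / 2)) < P.ε₀ := by
  have hat' : ∀ J : ℕ, ∀ᶠ k in (𝒰 : Filter ℕ),
      ∃ x ∈ X k, P.ε₀ ≤ P.tot k (closedBall x ((1 / 2) ^ J * d k)) := by
    intro J
    filter_upwards [hat ((1 / 2) ^ J) (by positivity), hX] with k h1 h2
    exact ⟨p k, h2, by simpa using h1⟩
  have hmax : ∀ k, (0 < d k ∧ ∃ x ∈ X k, P.ε₀ ≤ P.tot k (closedBall x ((1 / 2) ^ 0 * d k))) →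
      ∃ (j : ℕ) (x : E2), (x ∈ X k ∧ P.ε₀ ≤ P.tot k (closedBall x ((1 / 2) ^ j * d k))) ∧
        ∀ j' > j, ¬ ∃ x ∈ X k, P.ε₀ ≤ P.tot k (closedBall x ((1 / 2) ^ j' * d k)) := by
    classical
    rintro k ⟨hk, h0⟩
    obtain ⟨t, ht, hsmall⟩ := P.diffuse k P.ε₀ P.ε₀_pos
    obtain ⟨J, hJ⟩ := exists_pow_half_le (ε := t / d k) (by positivity)
    have hJ' : ∀ j ≥ J, ¬ ∃ x ∈ X k, P.ε₀ ≤ P.tot k (closedBall x ((1 / 2) ^ j * d k)) := by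
      rintro j hj ⟨x, -, hx⟩
      have h1 : (1 / 2 : ℝ) ^ j ≤ t / d k :=
        (pow_le_pow_of_le_one (by norm_num) (by norm_num) hj).trans hJ
      rw [le_div_iff₀ hk] at h1
      exact absurd (hsmall x) (not_lt.2 (hx.trans
        (P.tot_mono k (closedBall_subset_closedBall h1))))
    obtain ⟨x, hx⟩ := Nat.findGreatest_spec (P := fun j =>
      ∃ x ∈ X k, P.ε₀ ≤ P.tot k (closedBall x ((1 / 2) ^ j * d k))) (Nat.zero_le J) h0
    refine ⟨_, x, hx, fun j' hj' => ?_⟩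
    by_cases hjJ : j' ≤ J
    · exact Nat.findGreatest_is_greatest hj' hjJ
    · exact hJ' j' (by omega)
  choose! j q hq hj using hmax
  refine ⟨q, fun k => (1 / 2) ^ j k * d k, ?_, ?_, ?_, ?_, ?_⟩
  · filter_upwards [hd, hat' 0] with k h1 h2 using (hq k ⟨h1, h2⟩).1
  · filter_upwards [hd] with k h1
    positivity
  · intro ε hε
    obtain ⟨J, hJ⟩ := exists_pow_half_le hε
    filter_upwards [hd, hat' 0, hat' J] with k h1 h2 h3
    have h4 : J ≤ j k := by
      by_contra! hlt
      exact hj k ⟨h1, h2⟩ J hlt h3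
    exact mul_le_mul_of_nonneg_right
      ((pow_le_pow_of_le_one (by norm_num) (by norm_num) h4).trans hJ) h1.le
  · filter_upwards [hd, hat' 0] with k h1 h2 using (hq k ⟨h1, h2⟩).2
  · filter_upwards [hd, hat' 0] with k h1 h2 x hx
    have h3 := hj k ⟨h1, h2⟩ (j k + 1) (Nat.lt_succ_self _)
    push Not at h3
    have h4 := h3 x hx
    rwa [pow_succ, mul_assoc, show (1 / 2 : ℝ) ^ j k * (1 / 2 * d k) = (1 / 2) ^ j k * d k / 2
      by ring] at h4

/-- The last dyadic annulus with substantial mass. -/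
lemma exists_last_annulus (k : ℕ) (q : E2) {r S ε : ℝ} (hr : 0 < r) :
    ∃ T, r ≤ T ∧ (T = r ∨ (2 * T ≤ S ∧
      ε ≤ P.tot k (closedBall q (2 * T) \ closedBall q T))) ∧
      ∀ t, 2 * T ≤ t → t ≤ S / 4 → P.tot k (closedBall q (2 * t) \ closedBall q t) ≤ 2 * ε := by
  classical
  let Q : ℕ → Prop := fun j => 2 * (2 ^ j * r) ≤ S ∧
    ε ≤ P.tot k (closedBall q (2 * (2 ^ j * r)) \ closedBall q (2 ^ j * r))
  have key : ∀ T, r ≤ T → (∀ j : ℕ, T < 2 ^ j * r → ¬ Q j) →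
      ∀ t, 2 * T ≤ t → t ≤ S / 4 →
        P.tot k (closedBall q (2 * t) \ closedBall q t) ≤ 2 * ε := by
    intro T hT hQ t ht1 ht2
    have h1 : 1 ≤ t / r := by rw [le_div_iff₀ hr]; linarith
    obtain ⟨j, hj1, hj2⟩ := exists_nat_pow_near h1 (one_lt_two : (1 : ℝ) < 2)
    rw [le_div_iff₀ hr] at hj1
    rw [div_lt_iff₀ hr] at hj2
    have hs : (2 : ℝ) ^ (j + 1) * r = 2 * (2 ^ j * r) := by ring
    rw [hs] at hj2
    have g1 := hQ j (by linarith)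
    have g2 := hQ (j + 1) (by rw [hs]; linarith)
    simp only [Q, hs, not_and, not_le] at g1 g2
    have g1 := g1 (by linarith)
    have g2 := g2 (by linarith)
    have hsub : closedBall q (2 * t) \ closedBall q t ⊆
        (closedBall q (2 * (2 ^ j * r)) \ closedBall q (2 ^ j * r)) ∪
        (closedBall q (2 * (2 * (2 ^ j * r))) \ closedBall q (2 * (2 ^ j * r))) := by
      rintro x ⟨hx1, hx2⟩
      rw [mem_closedBall] at hx1 hx2
      by_cases hx : dist x q ≤ 2 * (2 ^ j * r)
      · exact Or.inl ⟨hx, fun h => hx2 (le_trans (mem_closedBall.1 h) hj1)⟩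
      · exact Or.inr ⟨by rw [mem_closedBall]; linarith, hx⟩
    linarith [(P.tot_mono k hsub).trans (P.tot_union_le k _ _)]
  by_cases hex : ∃ j, Q j
  · obtain ⟨j₀, hj₀⟩ := hex
    obtain ⟨J, hJ⟩ := pow_unbounded_of_one_lt (S / r) (one_lt_two : (1 : ℝ) < 2)
    rw [div_lt_iff₀ hr] at hJ
    have hbound : ∀ j, Q j → j ≤ J := by
      intro j hj
      by_contra! hlt
      have := pow_le_pow_right₀ (one_le_two : (1 : ℝ) ≤ 2) hlt.le
      nlinarith [hj.1, mul_le_mul_of_nonneg_right this hr.le, pow_pos (two_pos : (0 : ℝ) < 2) j]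
    set j₁ := Nat.findGreatest Q J
    have hj₁ : Q j₁ := Nat.findGreatest_spec (hbound _ hj₀) hj₀
    have hr1 : r ≤ 2 ^ j₁ * r := le_mul_of_one_le_left hr.le (one_le_pow₀ (by norm_num))
    refine ⟨2 ^ j₁ * r, hr1, Or.inr hj₁, key _ hr1 fun j hj hQ => ?_⟩
    have h1 : (2 : ℝ) ^ j₁ < 2 ^ j := lt_of_mul_lt_mul_right hj hr.le
    have h2 : j₁ < j := (pow_lt_pow_iff_right₀ (by norm_num : (1 : ℝ) < 2)).1 h1
    exact Nat.findGreatest_is_greatest h2 (hbound j hQ) hQ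
  · push Not at hex
    exact ⟨r, le_rfl, Or.inl rfl, key r le_rfl fun j _ => hex j⟩

variable (P) in
/-- Recentering of an atom at its core. -/
lemma exists_core {b : Bool} {p : ℕ → E2} {d : ℕ → ℝ} (hd : ∀ᶠ k in (𝒰 : Filter ℕ), 0 < d k)
    (hc : IsCenter 𝒰 b p d) (hat : P.IsAtom 𝒰 p d 0) {s₀ : ℝ} (hs₀ : 0 < s₀) :
    ∃ (q : ℕ → E2) (r : ℕ → ℝ), (∀ ε > 0, ∀ᶠ k in (𝒰 : Filter ℕ), ‖q k - p k‖ ≤ ε * d k) ∧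
      IsCenter 𝒰 b q d ∧ (∀ᶠ k in (𝒰 : Filter ℕ), 0 < r k) ∧ Negl 𝒰 r d ∧
      (∀ᶠ k in (𝒰 : Filter ℕ), P.ε₀ ≤ P.tot k (closedBall (q k) (r k))) ∧
      (∀ z, (b = true → z = 0) → ¬ P.IsAtom 𝒰 q r z) ∧
      ∃ s₁ > 0, s₁ ≤ s₀ / 2 ∧ ∀ s > 0, ∀ᶠ k in (𝒰 : Filter ℕ),
        P.tot k (closedBall (q k) (s₁ * d k) \ closedBall (q k) (s * d k)) < P.ε₀ / 6 := by
  have hε₀ := P.ε₀_pos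
  obtain ⟨s₂, hs₂, hs₂₀, hgap⟩ := P.exists_gap p hd hs₀ (by positivity : 0 < P.ε₀ / 6)
  set X : ℕ → Set E2 := fun k => if b then {p k} else closedBall (p k) (s₂ / 2 * d k) with hX
  obtain ⟨q, r, hqX, hr, hrd, hcore, hmax⟩ := exists_anchor (P := P) hd hat X (by
    filter_upwards [hd] with k hk
    cases b
    · simpa [hX] using (by positivity : 0 ≤ s₂ / 2 * d k)
    · simp [hX])
  have hqp : ∀ ε > 0, ∀ᶠ k in (𝒰 : Filter ℕ), ‖q k - p k‖ ≤ ε * d k := by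
    intro ε hε
    cases b
    · filter_upwards [hqX, hd, hr, hrd (min (ε / 2) (s₂ / 2)) (by positivity), hcore,
        hgap (ε / 2) (by positivity)] with k h1 h2 h3 h4 h5 h6
      by_contra! hlt
      simp only [hX, Bool.false_eq_true, if_false, mem_closedBall, dist_eq_norm] at h1
      have h7 : r k ≤ ε / 2 * d k := h4.trans
        (mul_le_mul_of_nonneg_right (min_le_left _ _) h2.le)
      have h8 : r k ≤ s₂ / 2 * d k := h4.trans
        (mul_le_mul_of_nonneg_right (min_le_right _ _) h2.le)
      have h9 : closedBall (q k) (r k) ⊆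
          closedBall (p k) (s₂ * d k) \ closedBall (p k) (ε / 2 * d k) := by
        intro y hy
        rw [mem_closedBall] at hy
        have hq : dist (q k) (p k) = ‖q k - p k‖ := dist_eq_norm _ _
        refine ⟨?_, fun hy' => ?_⟩
        · rw [mem_closedBall]
          linarith [dist_triangle y (q k) (p k)]
        · rw [mem_closedBall] at hy'
          linarith [dist_triangle (q k) y (p k), dist_comm (q k) y]
      linarith [P.tot_mono k h9]
    · filter_upwards [hqX, hd] with k h1 h2
      simp only [hX, if_true, Set.mem_singleton_iff] at h1
      simp only [h1, sub_self, norm_zero]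
      positivity
  have hcq : IsCenter 𝒰 b q d := by
    cases b
    · obtain ⟨Λ, hΛ⟩ := by simpa [IsCenter] using hc
      simp only [IsCenter, Bool.false_eq_true, if_false]
      refine ⟨2 * (|Λ| + 1), ?_⟩
      filter_upwards [hΛ, hqp (1 / (2 * (|Λ| + 1))) (by positivity), hd] with k h1 h2 h3
      have h4 : ‖p k‖ - ‖q k‖ ≤ ‖q k - p k‖ := by
        rw [norm_sub_rev]; exact norm_sub_norm_le _ _
      have h5 : 2 * (|Λ| + 1) * ‖q k - p k‖ ≤ d k := by
        calc 2 * (|Λ| + 1) * ‖q k - p k‖ ≤ 2 * (|Λ| + 1) * (1 / (2 * (|Λ| + 1)) * d k) :=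
              mul_le_mul_of_nonneg_left h2 (by positivity)
          _ = d k := by field_simp
      have h6 : Λ * ‖p k‖ ≤ |Λ| * ‖p k‖ :=
        mul_le_mul_of_nonneg_right (le_abs_self _) (norm_nonneg _)
      nlinarith [abs_nonneg Λ, norm_nonneg (p k)]
    · simp only [IsCenter, if_true] at hc ⊢
      filter_upwards [hqX, hc] with k h1 h2
      simp only [hX, if_true, Set.mem_singleton_iff] at h1
      rw [h1, h2]
  refine ⟨q, r, hqp, hcq, hr, hrd, hcore, ?_, s₂ / 2, by positivity, by linarith, ?_⟩
  · intro z hz hatz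
    have hmem : ∀ᶠ k in (𝒰 : Filter ℕ), q k + r k • z ∈ X k := by
      cases b
      · filter_upwards [hqp (s₂ / 4) (by positivity),
          hrd (s₂ / 4 / (‖z‖ + 1)) (by positivity), hr, hd] with k h1 h2 h3 h4
        simp only [hX, Bool.false_eq_true, if_false, mem_closedBall, dist_eq_norm]
        have h5 : ‖r k • z‖ = r k * ‖z‖ := by rw [norm_smul, norm_eq_abs, abs_of_pos h3]
        have h6 : (‖z‖ + 1) * r k ≤ s₂ / 4 * d k := by
          calc (‖z‖ + 1) * r k ≤ (‖z‖ + 1) * (s₂ / 4 / (‖z‖ + 1) * d k) :=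
                mul_le_mul_of_nonneg_left h2 (by positivity)
            _ = s₂ / 4 * d k := by field_simp
        rw [show q k + r k • z - p k = (q k - p k) + r k • z by abel]
        linarith [norm_add_le (q k - p k) (r k • z)]
      · filter_upwards [hqX] with k h1
        simpa [hz rfl] using h1
    obtain ⟨k, h1, h2, h3, h4⟩ := (hmem.and (hmax.and (hr.and (hatz (1 / 4)
      (by norm_num))))).exists
    refine absurd (h2 _ h1) (not_lt.2 (h4.trans (P.tot_mono k
      (closedBall_subset_closedBall ?_))))
    linarith
  · intro s hs
    filter_upwards [hgap (s / 2) (by positivity), hd, hqp (min (s / 2) (s₂ / 2)) (by positivity)]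
      with k h1 h2 h3
    have h4 : ‖q k - p k‖ ≤ s / 2 * d k := h3.trans
      (mul_le_mul_of_nonneg_right (min_le_left _ _) h2.le)
    have h5 : ‖q k - p k‖ ≤ s₂ / 2 * d k := h3.trans
      (mul_le_mul_of_nonneg_right (min_le_right _ _) h2.le)
    refine lt_of_le_of_lt (P.tot_mono k ?_) h1
    rintro y ⟨hy1, hy2⟩
    rw [← dist_eq_norm] at h4 h5
    rw [mem_closedBall] at hy1 hy2
    refine ⟨?_, fun hy' => hy2 ?_⟩
    · rw [mem_closedBall]
      linarith [dist_triangle y (q k) (p k)]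
    · rw [mem_closedBall] at hy'
      linarith [dist_triangle y (p k) (q k), dist_comm (p k) (q k)]

lemma resolves_succ (hn : 0 < n) (hA : H1 A) (hA2 : H2 A) (hγ : -1 < γ) {b : Bool}
    (hb : b = true → (¬ ∃ m : ℕ, 0 < m ∧ 1 + γ = (m : ℝ)) ∧ ∀ m, Resolves P 𝒰 false m) {m : ℕ}
    (ih : Resolves P 𝒰 b m) : Resolves P 𝒰 b (m + 1) := by
  classical
  rintro p d hd hc hat ⟨s₀, hs₀, hmass⟩
  have hε₀ := P.ε₀_pos
  obtain ⟨q, r, hqp, hcq, hr, hrd, hcore, hnoat, s₁, hs₁, hs₁₀, hgap⟩ :=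
    P.exists_core hd.1 hc hat hs₀
  have hdq : Shrinks 𝒰 q d := hd.move 1 (hqp 1 one_pos)
  have hmassq : ∀ᶠ k in (𝒰 : Filter ℕ),
      P.tot k (closedBall (q k) (s₁ * d k)) < (m + 1) * (P.ε₀ / 6) := by
    filter_upwards [hmass, hqp (s₀ / 2) (by positivity), hd.1] with k h1 h2 h3
    push_cast at h1
    refine lt_of_le_of_lt (P.tot_mono k (closedBall_subset_closedBall' ?_)) h1
    rw [dist_eq_norm]
    nlinarith
  have hrd1 : ∀ᶠ k in (𝒰 : Filter ℕ), r k ≤ d k := by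
    filter_upwards [hrd 1 one_pos] with k hk; linarith
  have hrq : Shrinks 𝒰 q r := hdq.mono hr hrd1
  have hnoat' : ∀ z, ¬ P.IsAtom 𝒰 q r z := by
    intro z hz
    refine hnoat z (fun hbt => ?_) hz
    subst hbt
    exact isAtom_eq_zero hn hA hA2 hγ (hb rfl).1 (hb rfl).2 hrq
      (by simpa [IsCenter] using hcq) (fun h0 => absurd h0 (hnoat 0 fun _ => rfl)) z hz
  have hTex : ∀ k, ∃ T, 0 < r k → r k ≤ T ∧ (T = r k ∨ (2 * T ≤ s₁ * d k ∧
      P.ε₀ / 6 ≤ P.tot k (closedBall (q k) (2 * T) \ closedBall (q k) T))) ∧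
      ∀ t, 2 * T ≤ t → t ≤ s₁ * d k / 4 →
        P.tot k (closedBall (q k) (2 * t) \ closedBall (q k) t) ≤ 2 * (P.ε₀ / 6) := by
    intro k
    by_cases h : 0 < r k
    · obtain ⟨T, hT⟩ := exists_last_annulus (P := P) k (q k) (S := s₁ * d k) (ε := P.ε₀ / 6) h
      exact ⟨T, fun _ => hT⟩
    · exact ⟨0, fun h' => absurd h' h⟩
  choose T hT using hTex
  have hT0 : ∀ᶠ k in (𝒰 : Filter ℕ), 0 < T k := by
    filter_upwards [hr] with k h1 using h1.trans_le (hT k h1).1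
  have hTd : Negl 𝒰 T d := by
    intro ε hε
    filter_upwards [hr, hrd ε hε, hgap ε hε] with k h1 h2 h3
    by_contra! hlt
    obtain ⟨-, h4 | ⟨h4, h5⟩, -⟩ := hT k h1
    · linarith
    · have h6 : closedBall (q k) (2 * T k) \ closedBall (q k) (T k) ⊆
          closedBall (q k) (s₁ * d k) \ closedBall (q k) (ε * d k) := by
        rintro y ⟨hy1, hy2⟩
        exact ⟨closedBall_subset_closedBall h4 hy1,
          fun hy => hy2 (closedBall_subset_closedBall hlt.le hy)⟩
      linarith [P.tot_mono k h6]
  by_cases hR : ∃ R, ∀ᶠ k in (𝒰 : Filter ℕ), T k ≤ R * r k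
  · obtain ⟨R, hR⟩ := hR
    obtain ⟨σ, hσ⟩ := exists_isSimpleAt hA hA2 hdq hcq hr hrd (R₀ := 2 * R) (s₀ := s₁ / 4)
      (by positivity) (by
        filter_upwards [hR, hr] with k h1 h2 t h3 h4
        have := (hT k h2).2.2 t (by linarith) (by linarith)
        linarith) hnoat' hcore
    exact ⟨q, σ, r, hcq, hqp, hσ⟩
  exfalso
  push Not at hR
  have hR' : ∀ R, ∀ᶠ k in (𝒰 : Filter ℕ), R * r k < T k := hR
  have hrT : Negl 𝒰 r T := by
    intro ε hε
    filter_upwards [hR' ε⁻¹] with k h1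
    rw [inv_mul_lt_iff₀ hε] at h1
    exact h1.le
  have hTd1 : ∀ᶠ k in (𝒰 : Filter ℕ), T k ≤ d k := by
    filter_upwards [hTd 1 one_pos] with k hk; linarith
  have hTs : Shrinks 𝒰 q T := hdq.mono hT0 hTd1
  have hcT : IsCenter 𝒰 b q T := hcq.mono hTd1
  have hsep : b = false → ∀ ε > 0, ∀ᶠ k in (𝒰 : Filter ℕ), T k ≤ ε * ‖q k‖ := by
    rintro rfl ε hε
    obtain ⟨Λ, hΛ⟩ := by simpa [IsCenter] using hcq
    filter_upwards [hΛ, hTd (ε / (|Λ| + 1)) (by positivity)] with k h1 h2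
    have h3 : Λ * ‖q k‖ ≤ (|Λ| + 1) * ‖q k‖ :=
      mul_le_mul_of_nonneg_right (by linarith [le_abs_self Λ]) (norm_nonneg _)
    calc T k ≤ ε / (|Λ| + 1) * d k := h2
      _ ≤ ε / (|Λ| + 1) * ((|Λ| + 1) * ‖q k‖) :=
        mul_le_mul_of_nonneg_left (h1.trans h3) (by positivity)
      _ = ε * ‖q k‖ := by field_simp
  have h0at : P.IsAtom 𝒰 q T 0 := by
    intro s hs
    filter_upwards [hrT s hs, hcore] with k h1 h2
    simpa using h2.trans (P.tot_mono k (closedBall_subset_closedBall h1))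
  have hC : ∀ C, 0 < C → ∀ᶠ k in (𝒰 : Filter ℕ), C * T k ≤ s₁ * d k := by
    intro C hC
    filter_upwards [hTd (s₁ / C) (by positivity)] with k h1
    calc C * T k ≤ C * (s₁ / C * d k) := mul_le_mul_of_nonneg_left h1 hC.le
      _ = s₁ * d k := by field_simp
  have hTann : ∀ᶠ k in (𝒰 : Filter ℕ), 2 * T k ≤ s₁ * d k ∧
      P.ε₀ / 6 ≤ P.tot k (closedBall (q k) (2 * T k) \ closedBall (q k) (T k)) := by
    filter_upwards [hR' 1, hr] with k h1 h2
    obtain ⟨-, h3 | h3, -⟩ := hT k h2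
    · linarith
    · exact h3
  have h0res := ih q T hTs hcT h0at ⟨1, one_pos, by
    filter_upwards [hTann, hmassq, hT0] with k h1 h2 h3
    have h4 := P.tot_diff k (closedBall_subset_closedBall (by linarith : T k ≤ 2 * T k) :
      closedBall (q k) (T k) ⊆ closedBall (q k) (2 * T k)) measurableSet_closedBall
    have h5 := P.tot_mono k (closedBall_subset_closedBall h1.1 :
      closedBall (q k) (2 * T k) ⊆ closedBall (q k) (s₁ * d k))
    rw [one_mul]
    linarith⟩
  have hlam : ∀ i, Tendsto (fun k => P.lam k i (q k) (T k)) 𝒰 atBot := by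
    obtain ⟨q', σ, r', hc', hq', hs'⟩ := h0res
    intro i
    have h1 := hs'.lam_tendsto (hTs.move 1 (hq' 1 one_pos)) hc' i
    obtain ⟨D, hD⟩ := P.compare_near hT0 1 (hq' 1 one_pos)
    rw [tendsto_atBot] at h1 ⊢
    intro B
    filter_upwards [h1 (B - D), hD] with k h2 h3
    have := (abs_le.1 (h3 i)).1
    linarith
  obtain ⟨z, hz, hzat⟩ : ∃ z ∈ closedBall (0 : E2) 2 \ ball 0 1, P.IsAtom 𝒰 q T z := by
    by_contra! hno
    obtain ⟨D, hD, hev⟩ := P.mass_le_of_no_atoms hTs ((isCompact_closedBall _ _).diff isOpen_ball) hno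
    have h1 : Tendsto (fun k => ∑ i, D * exp (P.lam k i (q k) (T k))) 𝒰
        (𝓝 (∑ i : Fin n, D * 0)) :=
      tendsto_finsetSum _ fun i _ => (tendsto_exp_atBot.comp (hlam i)).const_mul D
    have h2 := h1.eventually_lt_const (u := P.ε₀ / 6) (by simp; positivity)
    obtain ⟨k, h3, h4, h5, h6⟩ := (h2.and (hev.and (hTann.and hT0))).exists
    have h7 : P.tot k (closedBall (q k) (2 * T k) \ closedBall (q k) (T k)) ≤
        ∑ i, D * exp (P.lam k i (q k) (T k)) :=
      sum_le_sum fun i _ =>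
        (measureReal_mono (closedBall_diff_subset_image h6)).trans (h4 i)
    linarith [h5.2]
  have hz0 : z ≠ 0 := by
    rintro rfl
    simp at hz
  have hres : ∀ w, w ≠ 0 → P.IsAtom 𝒰 q T w → ∃ q' σ r', IsCenter 𝒰 false q' T ∧
      (∀ ε > 0, ∀ᶠ k in (𝒰 : Filter ℕ), ‖q' k - (q k + T k • w)‖ ≤ ε * T k) ∧
      P.IsSimpleAt 𝒰 false q' T σ r' := by
    intro w hw hwat
    have hcw := isCenter_false_translate (b := b) hTs
      (by rintro rfl; simpa [IsCenter] using hcT) hsep (z := w) fun _ => hw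
    cases b
    · have hw' : 0 < ‖w‖ := norm_pos_iff.2 hw
      refine ih _ T (hTs.translate w) hcw hwat.translate ⟨‖w‖ / 2, by positivity, ?_⟩
      filter_upwards [h0at (‖w‖ / 4) (by positivity), hC (2 * ‖w‖) (by positivity), hmassq, hT0]
        with k h1 h2 h3 h4
      have h5 : dist (q k + T k • w) (q k) = T k * ‖w‖ := by
        rw [dist_eq_norm, add_sub_cancel_left, norm_smul, norm_eq_abs, abs_of_pos h4]
      have h8 : 0 < T k * ‖w‖ := by positivity
      have h6 := P.tot_add_le k (S := closedBall (q k + T k • w) (‖w‖ / 2 * T k))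
        (T := closedBall (q k + T k • (0 : E2)) (‖w‖ / 4 * T k))
        (V := closedBall (q k) (s₁ * d k)) ?_ measurableSet_closedBall ?_ ?_
      · linarith
      · refine closedBall_disjoint_closedBall ?_
        rw [smul_zero, add_zero, h5]
        nlinarith
      · refine closedBall_subset_closedBall' ?_
        rw [h5]
        nlinarith
      · refine closedBall_subset_closedBall' ?_
        rw [smul_zero, add_zero, dist_self]
        nlinarith
    · exact resolve_false (hb rfl).2 hTs hcw hwat
  obtain ⟨Z, hZ, hsum⟩ := sum_strength_atoms hn hA hA2 hγ hTs hcT hsep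
    (fun w => if w = 0 then b else false) (by
      intro w hw
      by_cases hw0 : w = 0
      · subst hw0
        simpa using h0res
      · simpa [hw0] using hres w hw0 hw) ⟨z, hzat⟩
  have h1 : ∑ w ∈ {0, z}, strength γ (if w = (0 : E2) then b else false) ≤
      ∑ w ∈ Z, strength γ (if w = (0 : E2) then b else false) :=
    Finset.sum_le_sum_of_subset_of_nonneg (by
      intro w hw
      simp only [Finset.mem_insert, Finset.mem_singleton] at hw
      rcases hw with rfl | rfl
      · exact (hZ _).2 h0at
      · exact (hZ _).2 hzat) fun w _ _ => (strength_pos hγ _).le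
  rw [sum_pair (Ne.symm hz0), hsum, if_pos rfl, if_neg hz0] at h1
  simp [strength] at h1
  linarith

lemma resolves (hn : 0 < n) (hA : H1 A) (hA2 : H2 A) (hγ : -1 < γ) {b : Bool}
    (hb : b = true → (¬ ∃ m : ℕ, 0 < m ∧ 1 + γ = (m : ℝ)) ∧ ∀ m, Resolves P 𝒰 false m) (m : ℕ) :
    Resolves P 𝒰 b m := by
  induction m with
  | zero =>
    rintro p d - - - ⟨s, -, hs⟩
    obtain ⟨k, hk⟩ := hs.exists
    simp only [Nat.cast_zero, zero_mul] at hk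
    exact absurd (P.tot_nonneg k _) (not_le.2 hk)
  | succ m ih => exact resolves_succ hn hA hA2 hγ hb ih

/-- If mass concentrates away from the origin at the scale of the distance to the origin, then the
strength of the singularity is a positive integer. -/
theorem strength_eq_natCast (P : LiouvilleFamily n A γ) (hn : 0 < n) (hA : H1 A) (hA2 : H2 A)
    (hγ : -1 < γ) (x : ℕ → E2) (hx0 : ∀ᶠ k in (𝒰 : Filter ℕ), x k ≠ 0)
    (hx : ∀ ε > 0, ∀ᶠ k in (𝒰 : Filter ℕ), ‖x k‖ ≤ ε)
    (hconc : ∀ ε > 0, ∀ᶠ k in (𝒰 : Filter ℕ),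
      P.ε₀ ≤ P.tot k (closedBall (x k) (ε * ‖x k‖))) :
    ∃ m : ℕ, 0 < m ∧ 1 + γ = (m : ℝ) := by
  by_contra hint
  have hε₀ := P.ε₀_pos
  have hF : ∀ m, Resolves P 𝒰 false m := resolves hn hA hA2 hγ (by simp)
  have hT : ∀ m, Resolves P 𝒰 true m := resolves hn hA hA2 hγ fun _ => ⟨hint, hF⟩
  have hd : Shrinks 𝒰 (fun _ => (0 : E2)) (fun k => ‖x k‖) :=
    ⟨by filter_upwards [hx0] with k hk using norm_pos_iff.2 hk, by simpa using hx⟩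
  obtain ⟨z, hz, hlim⟩ := (isCompact_sphere (0 : E2) 1).ultrafilter_le_nhds
    (𝒰.map fun k => ‖x k‖⁻¹ • x k) (le_principal_iff.2 (by
      change ∀ᶠ k in (𝒰 : Filter ℕ), _
      filter_upwards [hx0] with k hk
      simp [norm_smul, hk]))
  have hlim : Tendsto (fun k => ‖x k‖⁻¹ • x k) 𝒰 (𝓝 z) := hlim
  have hzat : P.IsAtom 𝒰 (fun _ => (0 : E2)) (fun k => ‖x k‖) z := by
    intro s hs
    filter_upwards [hconc (s / 2) (by positivity), hx0,
      hlim.eventually (ball_mem_nhds z (half_pos hs))] with k h1 h2 h3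
    refine h1.trans (P.tot_mono k (closedBall_subset_closedBall' ?_))
    have h4 : 0 < ‖x k‖ := norm_pos_iff.2 h2
    have h5 := dist_frame (p := 0) h4 (‖x k‖⁻¹ • x k) z
    rw [smul_inv_smul₀ h4.ne', zero_add, zero_add] at h5
    rw [zero_add, h5]
    have h3 : dist (‖x k‖⁻¹ • x k) z < s / 2 := h3
    nlinarith
  obtain ⟨M, hM⟩ := exists_nat_gt (P.K / (P.ε₀ / 6))
  rw [div_lt_iff₀ (by positivity)] at hM
  have h0 := isAtom_eq_zero hn hA hA2 hγ hint hF hd (Eventually.of_forall fun _ => rfl)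
    (fun h => hT M _ _ hd (by simp [IsCenter]) h
      ⟨1, one_pos, Eventually.of_forall fun k => (P.tot_le k _).trans_lt hM⟩) z hzat
  rw [h0] at hz
  simp at hz

end LiouvilleFamily
end Claims

section Kernel

/-- Riesz kernels of order less than two are integrable on sets of finite area. -/
lemma exists_kernel_bound {q : ℝ} (hq : 0 ≤ q) (hq2 : q < 2) : ∃ C > 0, ∀ (z : E2) (s : ℝ), 0 < s →
    ∀ S : Set E2, MeasurableSet S → volume S ≠ ⊤ →
      IntegrableOn (fun y => (s / ‖y - z‖) ^ q) S ∧
      ∫ y in S, (s / ‖y - z‖) ^ q ≤ C * s ^ 2 + volume.real S := by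
  set C := (Module.finrank ℝ E2 : ℝ) * volume.real (ball (0 : E2) 1) * (1 / (2 - q)) with hC
  have hCpos : 0 < C := by
    have h1 : 0 < volume.real (ball (0 : E2) 1) :=
      ENNReal.toReal_pos (measure_ball_pos _ _ one_pos).ne' measure_ball_lt_top.ne
    have h2 : 0 < 2 - q := by linarith
    rw [hC, finrank_euclideanSpace_fin]
    positivity
  refine ⟨C, hCpos, fun z s hs S hS hvol => ?_⟩
  set f : ℝ → ℝ := fun t => if t ≤ s then (s / t) ^ q else 0 with hf
  have hrad : ∀ t ∈ Ioi (0 : ℝ), t ^ (Module.finrank ℝ E2 - 1) • f t =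
      (Ioc 0 s).indicator (fun t => s ^ q * t ^ (1 - q)) t := by
    intro t ht
    have ht : 0 < t := ht
    rw [finrank_euclideanSpace_fin]
    by_cases h : t ≤ s
    · rw [indicator_of_mem (show t ∈ Ioc 0 s from ⟨ht, h⟩)]
      simp only [hf, if_pos h, smul_eq_mul, Nat.add_one_sub_one, pow_one]
      rw [div_rpow hs.le ht.le, rpow_sub ht, rpow_one]
      ring
    · rw [indicator_of_notMem fun h' => h h'.2]
      simp [hf, h]
  have hint : IntervalIntegrable (fun t : ℝ => s ^ q * t ^ (1 - q)) volume 0 s :=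
    (intervalIntegral.intervalIntegrable_rpow' (by linarith)).const_mul _
  have hon : IntegrableOn (fun t : ℝ => s ^ q * t ^ (1 - q)) (Ioc 0 s) :=
    (intervalIntegrable_iff_integrableOn_Ioc_of_le hs.le).1 hint
  have hInt : Integrable (fun y : E2 => f ‖y‖) := by
    rw [integrable_fun_norm_addHaar]
    refine (integrableOn_congr_fun hrad measurableSet_Ioi).2 ?_
    exact ((integrable_indicator_iff measurableSet_Ioc).2 hon).integrableOn
  have hval : ∫ y : E2, f ‖y‖ = C * s ^ 2 := by
    rw [integral_fun_norm_addHaar, setIntegral_congr_fun measurableSet_Ioi hrad,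
      setIntegral_indicator measurableSet_Ioc,
      Set.inter_eq_right.2 (Set.Ioc_subset_Ioi_self : Ioc 0 s ⊆ Ioi 0),
      ← intervalIntegral.integral_of_le hs.le, intervalIntegral.integral_const_mul,
      integral_rpow (Or.inl (by linarith)), zero_rpow (by linarith)]
    have h5 : (1 : ℝ) - q + 1 = 2 - q := by ring
    have h3 : s ^ q * s ^ (2 - q) = s ^ 2 := by
      rw [← rpow_add hs, ← rpow_natCast]
      norm_num
    have h4 : (2 : ℝ) - q ≠ 0 := by linarith
    simp only [smul_eq_mul, hC, nsmul_eq_mul]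
    rw [sub_zero, h5, ← h3]
    field_simp
  have hpt : ∀ y, (s / ‖y - z‖) ^ q ≤ f ‖y - z‖ + 1 := by
    intro y
    by_cases h : ‖y - z‖ ≤ s
    · simp [hf, h]
    · simp only [hf, if_neg h, zero_add]
      push Not at h
      exact rpow_le_one (by positivity) ((div_le_one (hs.trans h)).2 h.le) hq
  have hInt' : Integrable (fun y : E2 => f ‖y - z‖) := hInt.comp_sub_right z
  have hsum : IntegrableOn (fun y : E2 => f ‖y - z‖ + 1) S :=
    hInt'.integrableOn.add (integrableOn_const hvol)
  have hk : IntegrableOn (fun y => (s / ‖y - z‖) ^ q) S := by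
    refine hsum.mono' (by
      exact ((by measurability : Measurable fun y : E2 => (s / ‖y - z‖) ^ q)).aestronglyMeasurable) (ae_of_all _ fun y => ?_)
    rw [norm_eq_abs, abs_of_nonneg (by positivity)]
    exact hpt y
  refine ⟨hk, (setIntegral_mono hk hsum hpt).trans ?_⟩
  rw [integral_add hInt'.integrableOn (integrableOn_const hvol), setIntegral_const, smul_eq_mul,
    mul_one]
  have h6 : ∫ y in S, f ‖y - z‖ ≤ ∫ y, f ‖y - z‖ := by
    refine setIntegral_le_integral hInt' (ae_of_all _ fun y => ?_)
    simp only [hf, Pi.zero_apply]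
    split_ifs <;> positivity
  have h7 : ∫ y, f ‖y - z‖ = ∫ y : E2, f ‖y‖ := integral_sub_right_eq_self (fun y : E2 => f ‖y‖) z
  rw [h7, hval] at h6
  linarith

end Kernel

section RieszDensity

/-- The measure with the given density. -/
def dens (f : E2 → ℝ) : Measure E2 := volume.withDensity fun x => ENNReal.ofReal (f x)

/-- Compactly supported densities with at most a power singularity at the origin. -/
structure IsRieszDensity (κ : ℝ) (f : E2 → ℝ) : Prop where
  meas : Measurable f
  nonneg : ∀ x, 0 ≤ f x
  bound : ∃ M R : ℝ, 0 ≤ M ∧ (∀ x, f x ≤ M * (1 / ‖x‖) ^ κ) ∧ ∀ x, R < ‖x‖ → f x = 0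

lemma rpow_mul_rpow_le_add {a b κ q : ℝ} (ha : 0 ≤ a) (hb : 0 ≤ b) (hκ : 0 ≤ κ) (hq : 0 ≤ q) :
    a ^ κ * b ^ q ≤ a ^ (κ + q) + b ^ (κ + q) := by
  rcases le_total a b with h | h
  · have h1 : a ^ κ * b ^ q ≤ b ^ κ * b ^ q := by gcongr
    rw [← rpow_add_of_nonneg hb hκ hq] at h1
    linarith [rpow_nonneg ha (κ + q)]
  · have h1 : a ^ κ * b ^ q ≤ a ^ κ * a ^ q := by gcongr
    rw [← rpow_add_of_nonneg ha hκ hq] at h1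
    linarith [rpow_nonneg hb (κ + q)]

lemma measurable_riesz (q s : ℝ) (z : E2) : Measurable fun y : E2 => (s / ‖y - z‖) ^ q := by
  measurability

lemma dens_absolutelyContinuous (f : E2 → ℝ) : dens f ≪ volume :=
  withDensity_absolutelyContinuous _ _

lemma ae_ne_dens (f : E2 → ℝ) (x : E2) : ∀ᵐ y ∂dens f, y ≠ x :=
  (dens_absolutelyContinuous f).ae_le (Measure.ae_ne volume x)

lemma integral_dens {f : E2 → ℝ} (hf : Measurable f) (h0 : ∀ x, 0 ≤ f x) (φ : E2 → ℝ) :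
    ∫ y, φ y ∂dens f = ∫ y, f y * φ y := by
  have h := integral_withDensity_eq_integral_smul (μ := (volume : Measure E2))
    (f := fun x => (f x).toNNReal) hf.real_toNNReal φ
  refine (Eq.trans h ?_)
  refine integral_congr_ae (ae_of_all _ fun y => ?_)
  simp [NNReal.smul_def, coe_toNNReal _ (h0 y)]

lemma integrable_dens_iff {f : E2 → ℝ} (hf : Measurable f) (h0 : ∀ x, 0 ≤ f x) {φ : E2 → ℝ} :
    Integrable φ (dens f) ↔ Integrable fun y => f y * φ y := by
  have h := integrable_withDensity_iff_integrable_smul (μ := (volume : Measure E2))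
    (f := fun x => (f x).toNNReal) hf.real_toNNReal (g := φ)
  refine h.trans (integrable_congr (ae_of_all _ fun y => ?_))
  simp [NNReal.smul_def, coe_toNNReal _ (h0 y)]

namespace IsRieszDensity

variable {κ : ℝ} {f : E2 → ℝ}

lemma integrable_riesz (hf : IsRieszDensity κ f) (hκ : 0 ≤ κ) {q : ℝ} (hq : 0 ≤ q)
    (hκq : κ + q < 2) (z : E2) {s : ℝ} (hs : 0 < s) :
    Integrable (fun y => (s / ‖y - z‖) ^ q) (dens f) := by
  obtain ⟨M, R, hM, hb, hsupp⟩ := hf.bound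
  rw [integrable_dens_iff hf.meas hf.nonneg]
  obtain ⟨C, -, hC⟩ := exists_kernel_bound (add_nonneg hκ hq) hκq
  have h1 := (hC 0 1 one_pos (closedBall 0 R) measurableSet_closedBall
    measure_closedBall_lt_top.ne).1
  have h2 := (hC z s hs (closedBall 0 R) measurableSet_closedBall
    measure_closedBall_lt_top.ne).1
  have h3 := (integrable_indicator_iff measurableSet_closedBall).2
    ((h1.add h2).const_mul M)
  refine h3.mono' (hf.meas.mul (measurable_riesz q s z)).aestronglyMeasurable
    (ae_of_all _ fun y => ?_)
  have hn : 0 ≤ (s / ‖y - z‖) ^ q := by positivity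
  rw [norm_eq_abs, abs_of_nonneg (mul_nonneg (hf.nonneg y) hn)]
  by_cases hy : ‖y‖ ≤ R
  · rw [indicator_of_mem (by simpa using hy)]
    have h4 := rpow_mul_rpow_le_add (a := 1 / ‖y‖) (b := s / ‖y - z‖) (by positivity)
      (by positivity) hκ hq
    have h5 := mul_le_mul_of_nonneg_right (hb y) hn
    have h6 := mul_le_mul_of_nonneg_left h4 hM
    simp only [sub_zero, Pi.add_apply]
    linarith
  · rw [hsupp y (not_le.1 hy), zero_mul]
    exact indicator_nonneg (fun x _ => mul_nonneg hM
      (add_nonneg (by positivity) (by positivity))) y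

lemma isFiniteMeasure (hf : IsRieszDensity κ f) (hκ : 0 ≤ κ) (hκ2 : κ < 2) :
    IsFiniteMeasure (dens f) := by
  have h := hf.integrable_riesz hκ le_rfl (by linarith) 0 one_pos
  simp only [rpow_zero] at h
  rcases (integrable_const_iff (c := (1 : ℝ))).1 h with h | h
  · norm_num at h
  · exact h

lemma integrable (hf : IsRieszDensity κ f) (hκ : 0 ≤ κ) (hκ2 : κ < 2) : Integrable f := by
  have h := hf.integrable_riesz hκ le_rfl (by linarith) 0 one_pos
  rw [integrable_dens_iff hf.meas hf.nonneg] at h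
  simpa using h

lemma real_dens (hf : IsRieszDensity κ f) (hκ : 0 ≤ κ) (hκ2 : κ < 2) (S : Set E2) (hS : MeasurableSet S) :
    (dens f).real S = ∫ x in S, f x := by
  rw [Measure.real, dens, withDensity_apply _ hS, ← ofReal_integral_eq_lintegral_ofReal
    (hf.integrable hκ hκ2).integrableOn (ae_of_all _ hf.nonneg), ENNReal.toReal_ofReal]
  exact integral_nonneg hf.nonneg

lemma ae_norm_le (hf : IsRieszDensity κ f) : ∃ R, 1 ≤ R ∧ ∀ᵐ y ∂dens f, ‖y‖ ≤ R := by
  obtain ⟨M, R, hM, hb, hsupp⟩ := hf.bound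
  refine ⟨max 1 R, le_max_left _ _, ?_⟩
  refine (ae_withDensity_iff hf.meas.ennreal_ofReal).2 (ae_of_all _ fun y hy => ?_)
  by_contra h
  push Not at h
  rw [hsupp y (lt_of_le_of_lt (le_max_right _ _) h)] at hy
  simp at hy

lemma abs_log_le {q t : ℝ} (hq : 0 < q) (ht : 0 < t) : |log t| ≤ t + (1 / t) ^ q / q := by
  have h1 := log_le_rpow_div (x := 1 / t) (by positivity) hq
  have h2 := log_le_sub_one_of_pos ht
  have h3 : (0 : ℝ) ≤ (1 / t) ^ q / q := by positivity
  rw [one_div, log_inv] at h1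
  rw [one_div] at h3 ⊢
  rw [abs_le]
  constructor <;> linarith

lemma integrable_log (hf : IsRieszDensity κ f) (hκ : 0 ≤ κ) (hκ2 : κ < 2) (x : E2) :
    Integrable (fun y => log ‖x - y‖) (dens f) := by
  have := hf.isFiniteMeasure hκ hκ2
  obtain ⟨R, hR1, hR⟩ := hf.ae_norm_le
  set q := (2 - κ) / 2 with hq
  have hq0 : 0 < q := by rw [hq]; linarith
  have h1 := hf.integrable_riesz hκ hq0.le (by rw [hq]; linarith) x one_pos
  refine ((integrable_const (‖x‖ + R)).add (h1.div_const q)).mono'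
    (by exact (by measurability : Measurable fun y : E2 => log ‖x - y‖).aestronglyMeasurable) ?_
  filter_upwards [hR, ae_ne_dens f x] with y hy hyx
  have hpos : 0 < ‖x - y‖ := norm_pos_iff.2 (sub_ne_zero.2 hyx.symm)
  have h2 := abs_log_le hq0 hpos
  simp only [norm_eq_abs, Pi.add_apply]
  rw [norm_sub_rev y x]
  linarith [norm_sub_le x y]

lemma integrable_log_max (hf : IsRieszDensity κ f) (hκ : 0 ≤ κ) (hκ2 : κ < 2) (x : E2)
    (s : ℝ) : Integrable (fun y => log (max ‖x - y‖ s)) (dens f) := by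
  have := hf.isFiniteMeasure hκ hκ2
  refine ((hf.integrable_log hκ hκ2 x).abs.add (integrable_const |log s|)).mono'
    (by exact (by measurability : Measurable fun y : E2 => log (max ‖x - y‖ s)).aestronglyMeasurable)
    (ae_of_all _ fun y => ?_)
  simp only [norm_eq_abs, Pi.add_apply]
  rcases le_total ‖x - y‖ s with h | h
  · rw [max_eq_right h]; linarith [abs_nonneg (log ‖x - y‖)]
  · rw [max_eq_left h]; linarith [abs_nonneg (log s)]

lemma diffuse (hf : IsRieszDensity κ f) (hκ : 0 ≤ κ) (hκ2 : κ < 2) {ε : ℝ} (hε : 0 < ε) :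
    ∃ t > 0, ∀ x, (dens f).real (closedBall x t) < ε := by
  have hfin : ∫⁻ x, ENNReal.ofReal (f x) ≠ ⊤ := by
    have := (hf.isFiniteMeasure hκ hκ2).measure_univ_lt_top
    rw [dens, withDensity_apply _ MeasurableSet.univ, Measure.restrict_univ] at this
    exact this.ne
  obtain ⟨η, hη, h⟩ := exists_pos_setLIntegral_lt_of_measure_lt hfin
    (ε := ENNReal.ofReal ε) (by simpa using hε)
  have hlim : Tendsto (fun t : ℝ => volume (closedBall (0 : E2) t)) (𝓝[>] 0) (𝓝 0) := by
    have h1 : ∀ t : ℝ, 0 ≤ t → volume (closedBall (0 : E2) t) =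
        ENNReal.ofReal (t ^ 2) * volume (ball (0 : E2) 1) := by
      intro t ht
      rw [Measure.addHaar_closedBall _ _ ht, finrank_euclideanSpace_fin]
    have h2 : Tendsto (fun t : ℝ => ENNReal.ofReal (t ^ 2) * volume (ball (0 : E2) 1)) (𝓝[>] 0)
        (𝓝 (ENNReal.ofReal ((0 : ℝ) ^ 2) * volume (ball (0 : E2) 1))) := by
      refine ENNReal.Tendsto.mul_const ?_ (Or.inr measure_ball_lt_top.ne)
      refine (ENNReal.continuous_ofReal.tendsto _).comp ?_
      exact ((continuous_pow 2).tendsto (0 : ℝ)).mono_left nhdsWithin_le_nhds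
    have h3 : ENNReal.ofReal ((0 : ℝ) ^ 2) * volume (ball (0 : E2) 1) = 0 := by simp
    rw [h3] at h2
    refine h2.congr' ?_
    filter_upwards [self_mem_nhdsWithin] with t ht using (h1 t (le_of_lt ht)).symm
  obtain ⟨t, ht, ht0⟩ := ((hlim.eventually (gt_mem_nhds hη)).and self_mem_nhdsWithin).exists
  refine ⟨t, ht0, fun x => ?_⟩
  have h4 := h (closedBall x t) (by rwa [Measure.addHaar_closedBall_center])
  rw [Measure.real, dens, withDensity_apply _ measurableSet_closedBall]
  exact (ENNReal.lt_ofReal_iff_toReal_lt h4.ne_top).1 h4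

lemma sum {ι : Type*} [Fintype ι] {a : ι → ℝ} (ha : ∀ i, 0 ≤ a i) {f : ι → E2 → ℝ}
    (hf : ∀ i, IsRieszDensity κ (f i)) : IsRieszDensity κ fun x => ∑ i, a i * f i x := by
  choose M R hM hb hs using fun i => (hf i).bound
  refine ⟨Finset.measurable_fun_sum _ fun i _ => (hf i).meas.const_mul _,
    fun x => sum_nonneg fun i _ => mul_nonneg (ha i) ((hf i).nonneg x),
    ∑ i, a i * M i, ∑ i, |R i|, sum_nonneg fun i _ => mul_nonneg (ha i) (hM i),
    fun x => ?_, fun x hx => ?_⟩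
  · rw [sum_mul]
    refine sum_le_sum fun i _ => ?_
    rw [mul_assoc]
    exact mul_le_mul_of_nonneg_left (hb i x) (ha i)
  · refine sum_eq_zero fun i _ => ?_
    rw [hs i x, mul_zero]
    refine lt_of_le_of_lt ((le_abs_self _).trans ?_) hx
    exact single_le_sum (f := fun i => |R i|) (fun _ _ => abs_nonneg _) (mem_univ i)

lemma integral_sum {ι : Type*} [Fintype ι] {a : ι → ℝ} (ha : ∀ i, 0 ≤ a i) {f : ι → E2 → ℝ}
    (hf : ∀ i, IsRieszDensity κ (f i)) {φ : E2 → ℝ} (hφ : ∀ i, Integrable φ (dens (f i))) :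
    ∫ y, φ y ∂dens (fun x => ∑ i, a i * f i x) = ∑ i, a i * ∫ y, φ y ∂dens (f i) := by
  rw [integral_dens (sum ha hf).meas (sum ha hf).nonneg]
  simp_rw [sum_mul, integral_dens (hf _).meas (hf _).nonneg, mul_assoc]
  rw [integral_finsetSum _ fun i _ =>
    ((integrable_dens_iff (hf i).meas (hf i).nonneg).1 (hφ i)).const_mul _]
  simp_rw [integral_const_mul]

lemma real_sum {ι : Type*} [Fintype ι] {a : ι → ℝ} (ha : ∀ i, 0 ≤ a i) {f : ι → E2 → ℝ}
    (hf : ∀ i, IsRieszDensity κ (f i)) (hκ : 0 ≤ κ) (hκ2 : κ < 2) {S : Set E2}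
    (hS : MeasurableSet S) :
    (dens fun x => ∑ i, a i * f i x).real S = ∑ i, a i * (dens (f i)).real S := by
  rw [(sum ha hf).real_dens hκ hκ2 S hS, integral_finsetSum _ fun i _ =>
    ((hf i).integrable hκ hκ2).integrableOn.const_mul _]
  simp_rw [integral_const_mul, (hf _).real_dens hκ hκ2 S hS]

end IsRieszDensity
end RieszDensity

section Potential

/-- The exponent of the singularity of `‖x‖ ^ (2 * γ)` at the origin. -/
def singExp (γ : ℝ) : ℝ := max 0 (-(2 * γ))

lemma singExp_nonneg (γ : ℝ) : 0 ≤ singExp γ := le_max_left _ _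

lemma singExp_lt_two {γ : ℝ} (hγ : -1 < γ) : singExp γ < 2 := max_lt two_pos (by linarith)

/-- The sum of the entries of `A`. -/
def entrySum {n : ℕ} (A : Matrix (Fin n) (Fin n) ℝ) : ℝ := ∑ i, ∑ j, A i j

lemma entry_le_entrySum {n : ℕ} {A : Matrix (Fin n) (Fin n) ℝ} (hA : ∀ i j, 0 ≤ A i j)
    (i j : Fin n) : A i j ≤ entrySum A :=
  (single_le_sum (f := fun j => A i j) (fun j _ => hA i j) (mem_univ j)).trans
    (single_le_sum (f := fun i => ∑ j, A i j)
      (fun i _ => sum_nonneg fun j _ => hA i j) (mem_univ i))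

lemma entrySum_nonneg {n : ℕ} {A : Matrix (Fin n) (Fin n) ℝ} (hA : ∀ i j, 0 ≤ A i j) :
    0 ≤ entrySum A :=
  sum_nonneg fun i _ => sum_nonneg fun j _ => hA i j

/-- Densities of a Liouville system in integral form on the disc of radius `r`, with bounds
controlled by `B`. -/
structure LiouvillePotential {n : ℕ} (A : Matrix (Fin n) (Fin n) ℝ) (γ r B : ℝ) where
  f : Fin n → E2 → ℝ
  H : Fin n → E2 → ℝ
  c : Fin n → ℝ
  riesz : ∀ i, IsRieszDensity (singExp γ) (f i)
  mass_le : ∑ i, (dens (f i)).real Set.univ ≤ B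
  eq : ∀ i x, x ≠ 0 → ‖x‖ < r → f i x = ‖x‖ ^ (2 * γ) * (H i x * exp (c i -
    ∫ y, log ‖x - y‖ ∂dens fun y => ∑ j, A i j * f j y))
  H_diff : ∀ i x, x ≠ 0 → ‖x‖ < r → DifferentiableAt ℝ (H i) x
  H_le : ∀ i x, x ≠ 0 → ‖x‖ < r → H i x ≤ B
  le_H : ∀ i x, x ≠ 0 → ‖x‖ < r → B⁻¹ ≤ H i x
  H_grad : ∀ i x, x ≠ 0 → ‖x‖ < r → ‖fderiv ℝ (H i) x‖ ≤ B

lemma abs_log_max_sub_le {x x' z : E2} {s s' Λ : ℝ} (hs : 0 < s) (hs' : 0 < s') (h1 : s ≤ Λ * s')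
    (h2 : s' ≤ Λ * s) (h3 : ‖x - x'‖ ≤ Λ * s') :
    |log (max ‖x - z‖ s) - log (max ‖x' - z‖ s')| ≤ log (1 + Λ + Λ ^ 2) := by
  have hΛ : 0 < Λ := by
    by_contra h
    push Not at h
    nlinarith
  have hm : 0 < max ‖x - z‖ s := lt_max_of_lt_right hs
  have hm' : 0 < max ‖x' - z‖ s' := lt_max_of_lt_right hs'
  have key : ∀ a b : ℝ, 0 < a → 0 < b → a ≤ (1 + Λ + Λ ^ 2) * b →
      log a - log b ≤ log (1 + Λ + Λ ^ 2) := by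
    intro a b ha hb hab
    have := log_le_log ha hab
    rw [log_mul (by positivity) hb.ne'] at this
    linarith
  have e1 : ‖x - z‖ ≤ ‖x - x'‖ + ‖x' - z‖ := norm_sub_le_norm_sub_add_norm_sub _ _ _
  have e2 : ‖x' - z‖ ≤ ‖x - x'‖ + ‖x - z‖ := by
    rw [norm_sub_rev x x']; exact norm_sub_le_norm_sub_add_norm_sub _ _ _
  have m1 := le_max_left ‖x - z‖ s
  have m2 := le_max_right ‖x - z‖ s
  have m3 := le_max_left ‖x' - z‖ s'
  have m4 := le_max_right ‖x' - z‖ s'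
  have hs2 : Λ * s' ≤ Λ * (Λ * s) := mul_le_mul_of_nonneg_left h2 hΛ.le
  have hp1 := mul_le_mul_of_nonneg_left m4 hΛ.le
  have hp2 := mul_le_mul_of_nonneg_left m2 (sq_nonneg Λ)
  have hp3 := mul_nonneg (sq_nonneg Λ) hm'.le
  have hp4 := mul_nonneg hΛ.le hm.le
  have hp5 := mul_le_mul_of_nonneg_left m2 hΛ.le
  have hp6 := mul_nonneg (sq_nonneg Λ) hm.le
  refine abs_sub_le_iff.2 ⟨key _ _ hm hm' (max_le ?_ ?_), key _ _ hm' hm (max_le ?_ ?_)⟩ <;>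
    nlinarith

lemma indicator_le_log_max_sub {x z : E2} {s s' : ℝ} (hs : 0 < s) (h : s ≤ s') :
    (closedBall x s).indicator (fun _ => log (s' / s)) z ≤
      log (max ‖x - z‖ s') - log (max ‖x - z‖ s) := by
  by_cases hz : z ∈ closedBall x s
  · rw [indicator_of_mem hz]
    have hz : ‖x - z‖ ≤ s := by rwa [mem_closedBall, dist_comm, dist_eq_norm] at hz
    rw [max_eq_right hz, max_eq_right (hz.trans h), log_div (hs.trans_le h).ne' hs.ne']
  · rw [indicator_of_notMem hz]
    exact sub_nonneg.2 (log_le_log (lt_max_of_lt_right hs) (max_le_max le_rfl h))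

lemma log_max_sub_le_indicator {x z : E2} {s s' : ℝ} (hs : 0 < s) (h : s ≤ s') :
    log (max ‖x - z‖ s') - log (max ‖x - z‖ s) ≤
      (closedBall x s').indicator (fun _ => log (s' / s)) z := by
  have hs' := hs.trans_le h
  by_cases hz : z ∈ closedBall x s'
  · rw [indicator_of_mem hz]
    have hz : ‖x - z‖ ≤ s' := by rwa [mem_closedBall, dist_comm, dist_eq_norm] at hz
    rw [max_eq_right hz, log_div hs'.ne' hs.ne']
    linarith [log_le_log hs (le_max_right ‖x - z‖ s)]
  · rw [indicator_of_notMem hz]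
    have hz : s' < ‖x - z‖ := by rwa [mem_closedBall, dist_comm, dist_eq_norm, not_le] at hz
    rw [max_eq_left hz.le, max_eq_left (h.trans hz.le), sub_self]

namespace LiouvillePotential

variable {n : ℕ} {A : Matrix (Fin n) (Fin n) ℝ} {γ r B : ℝ} (P : LiouvillePotential A γ r B)

/-- The measures of the system. -/
def ρ (i : Fin n) : Measure E2 := dens (P.f i)

/-- The Riesz mass of the `i`-th potential. -/
def ν (i : Fin n) : Measure E2 := dens fun y => ∑ j, A i j * P.f j y

/-- The averaged logarithm of the `i`-th density at scale `s` around `x`, normalised to be scale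
invariant. -/
def lam (i : Fin n) (x : E2) (s : ℝ) : ℝ :=
  P.c i + 2 * log s + 2 * γ * log (max ‖x‖ s) -
    ∫ z, log (max ‖x - z‖ s) ∂P.ν i

variable (hγ : -1 < γ) (hA : ∀ i j, 0 ≤ A i j)
include hγ

lemma isFiniteMeasure_ρ (i : Fin n) : IsFiniteMeasure (P.ρ i) :=
  (P.riesz i).isFiniteMeasure (singExp_nonneg γ) (singExp_lt_two hγ)

lemma diffuse {ε : ℝ} (hε : 0 < ε) :
    ∃ t > 0, ∀ x, ∑ i, (P.ρ i).real (closedBall x t) < ε := by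
  have h1 : ∀ j : Fin n, (0 : ℝ) ≤ 1 := fun _ => zero_le_one
  obtain ⟨t, ht, h⟩ := (IsRieszDensity.sum h1 P.riesz).diffuse (singExp_nonneg γ)
    (singExp_lt_two hγ) hε
  refine ⟨t, ht, fun x => ?_⟩
  have h2 := h x
  rw [IsRieszDensity.real_sum h1 P.riesz (singExp_nonneg γ) (singExp_lt_two hγ)
    measurableSet_closedBall] at h2
  simp only [one_mul] at h2
  exact h2

include hA

omit hγ in
lemma riesz_ν (i : Fin n) : IsRieszDensity (singExp γ) fun y => ∑ j, A i j * P.f j y :=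
  IsRieszDensity.sum (hA i) P.riesz

lemma isFiniteMeasure_ν (i : Fin n) : IsFiniteMeasure (P.ν i) :=
  (P.riesz_ν hA i).isFiniteMeasure (singExp_nonneg γ) (singExp_lt_two hγ)

omit hγ in
lemma integral_ν (i : Fin n) {φ : E2 → ℝ} (hφ : ∀ j, Integrable φ (P.ρ j)) :
    ∫ y, φ y ∂P.ν i = ∑ j, A i j * ∫ y, φ y ∂P.ρ j :=
  IsRieszDensity.integral_sum (hA i) P.riesz hφ

lemma real_ν (i : Fin n) {S : Set E2} (hS : MeasurableSet S) :
    (P.ν i).real S = ∑ j, A i j * (P.ρ j).real S :=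
  IsRieszDensity.real_sum (hA i) P.riesz (singExp_nonneg γ) (singExp_lt_two hγ) hS

lemma real_ν_le (i : Fin n) {S : Set E2} (hS : MeasurableSet S) :
    (P.ν i).real S ≤ entrySum A * ∑ j, (P.ρ j).real S := by
  rw [P.real_ν hγ hA i hS, mul_sum]
  exact sum_le_sum fun j _ =>
    mul_le_mul_of_nonneg_right (entry_le_entrySum hA i j) measureReal_nonneg

lemma real_ν_univ_le (i : Fin n) : (P.ν i).real Set.univ ≤ entrySum A * B :=
  (P.real_ν_le hγ hA i MeasurableSet.univ).trans
    (mul_le_mul_of_nonneg_left P.mass_le (entrySum_nonneg hA))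

lemma integrable_log_max (i : Fin n) (x : E2) (s : ℝ) :
    Integrable (fun z => log (max ‖x - z‖ s)) (P.ν i) :=
  (P.riesz_ν hA i).integrable_log_max (singExp_nonneg γ) (singExp_lt_two hγ) x s

lemma integrable_log (i : Fin n) (x : E2) :
    Integrable (fun z => log ‖x - z‖) (P.ν i) :=
  (P.riesz_ν hA i).integrable_log (singExp_nonneg γ) (singExp_lt_two hγ) x

lemma abs_lam_sub_le {Λ : ℝ} (i : Fin n) {x x' : E2} {s s' : ℝ} (hs : 0 < s) (hs' : 0 < s')
    (h1 : s ≤ Λ * s') (h2 : s' ≤ Λ * s) (h3 : ‖x - x'‖ ≤ Λ * s') :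
    |P.lam i x s - P.lam i x' s'| ≤
      (2 + 2 * |γ| + entrySum A * B) * log (1 + Λ + Λ ^ 2) := by
  have := P.isFiniteMeasure_ν hγ hA i
  set L := log (1 + Λ + Λ ^ 2) with hL
  have hs0 : |log s - log s'| ≤ L := by
    have hΛ : 0 < Λ := by
      by_contra h
      push Not at h
      nlinarith
    have := abs_log_max_sub_le (x := 0) (x' := 0) (z := 0) hs hs' h1 h2 (by simp; positivity)
    simpa [max_eq_right hs.le, max_eq_right hs'.le] using this
  have hx0 : |log (max ‖x‖ s) - log (max ‖x'‖ s')| ≤ L := by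
    simpa using abs_log_max_sub_le (z := 0) hs hs' h1 h2 h3
  have hL0 : 0 ≤ L := (abs_nonneg _).trans hs0
  have hint : |∫ z, log (max ‖x - z‖ s) ∂P.ν i - ∫ z, log (max ‖x' - z‖ s') ∂P.ν i| ≤
      entrySum A * B * L := by
    rw [← integral_sub (P.integrable_log_max hγ hA i x s) (P.integrable_log_max hγ hA i x' s')]
    have h4 := norm_integral_le_of_norm_le_const (μ := P.ν i) (C := L)
      (f := fun z => log (max ‖x - z‖ s) - log (max ‖x' - z‖ s'))
      (ae_of_all _ fun z => abs_log_max_sub_le hs hs' h1 h2 h3)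
    rw [norm_eq_abs] at h4
    have h5 := mul_le_mul_of_nonneg_left (P.real_ν_univ_le hγ hA i) hL0
    linarith
  have hg : |2 * γ * (log (max ‖x‖ s) - log (max ‖x'‖ s'))| ≤ 2 * |γ| * L := by
    rw [abs_mul, abs_mul, abs_two]
    exact mul_le_mul_of_nonneg_left hx0 (by positivity)
  have e : P.lam i x s - P.lam i x' s' = 2 * (log s - log s') +
      2 * γ * (log (max ‖x‖ s) - log (max ‖x'‖ s')) -
      (∫ z, log (max ‖x - z‖ s) ∂P.ν i - ∫ z, log (max ‖x' - z‖ s') ∂P.ν i) := by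
    unfold lam; ring
  rw [e]
  rw [abs_le] at *
  constructor <;> linarith

lemma lam_sub_eq (i : Fin n) (x : E2) {s s' : ℝ} (hs : 0 < s) (h : s ≤ s') :
    P.lam i x s' - P.lam i x s = 2 * log (s' / s) +
      2 * γ * log (max ‖x‖ s' / max ‖x‖ s) -
      ∫ z, (log (max ‖x - z‖ s') - log (max ‖x - z‖ s)) ∂P.ν i := by
  have hs' := hs.trans_le h
  rw [integral_sub (P.integrable_log_max hγ hA i x s') (P.integrable_log_max hγ hA i x s),
    log_div hs'.ne' hs.ne',
    log_div (lt_max_of_lt_right hs').ne' (lt_max_of_lt_right hs).ne']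
  unfold lam
  ring

lemma lam_sub_le (i : Fin n) (x : E2) {s s' : ℝ} (hs : 0 < s) (h : s ≤ s') :
    P.lam i x s' - P.lam i x s ≤
      (2 - ∑ j, A i j * (P.ρ j).real (closedBall x s)) * log (s' / s) +
        2 * γ * log (max ‖x‖ s' / max ‖x‖ s) := by
  have := P.isFiniteMeasure_ν hγ hA i
  rw [P.lam_sub_eq hγ hA i x hs h, ← P.real_ν hγ hA i measurableSet_closedBall]
  have h1 := integral_mono ((integrable_const (μ := P.ν i) (log (s' / s))).indicator
    (isClosed_closedBall (x := x) (ε := s)).measurableSet)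
    ((P.integrable_log_max hγ hA i x s').sub (P.integrable_log_max hγ hA i x s))
    fun z => indicator_le_log_max_sub hs h
  rw [integral_indicator measurableSet_closedBall, setIntegral_const, smul_eq_mul] at h1
  simp only [Pi.sub_apply] at h1
  linarith

lemma le_lam_sub (i : Fin n) (x : E2) {s s' : ℝ} (hs : 0 < s) (h : s ≤ s') :
    (2 - ∑ j, A i j * (P.ρ j).real (closedBall x s')) * log (s' / s) +
        2 * γ * log (max ‖x‖ s' / max ‖x‖ s) ≤ P.lam i x s' - P.lam i x s := by
  have := P.isFiniteMeasure_ν hγ hA i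
  rw [P.lam_sub_eq hγ hA i x hs h, ← P.real_ν hγ hA i measurableSet_closedBall]
  have h1 := integral_mono 
    ((P.integrable_log_max hγ hA i x s').sub (P.integrable_log_max hγ hA i x s))
    ((integrable_const (μ := P.ν i) (log (s' / s))).indicator
    (isClosed_closedBall (x := x) (ε := s')).measurableSet)
    fun z => log_max_sub_le_indicator hs h
  rw [integral_indicator measurableSet_closedBall, setIntegral_const, smul_eq_mul] at h1
  simp only [Pi.sub_apply] at h1
  linarith

omit hγ hA in
lemma exp_lam_eq (i : Fin n) (x : E2) {s : ℝ} (hs : 0 < s) :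
    exp (P.lam i x s) = s ^ 2 * (max ‖x‖ s ^ (2 * γ) *
      exp (P.c i - ∫ z, log (max ‖x - z‖ s) ∂P.ν i)) := by
  have hm : 0 < max ‖x‖ s := lt_max_of_lt_right hs
  rw [rpow_def_of_pos hm, ← exp_add, ← exp_log (pow_pos hs 2), ← exp_add,
    log_pow]
  unfold lam
  congr 1
  push_cast
  ring

lemma exp_lam_le_mul_density (hB : 0 < B) (i : Fin n) {x y : E2} {s : ℝ} (hs : 0 < s)
    (hy0 : y ≠ 0) (hyr : ‖y‖ < r) (h1 : max ‖x‖ s ≤ 4 * ‖y‖) (h2 : ‖y‖ ≤ 4 * max ‖x‖ s)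
    (h3 : ‖y - x‖ ≤ s) :
    exp (P.lam i x s) ≤ s ^ 2 * (B * 4 ^ (|2 * γ|) *
      exp (entrySum A * B * log 2) * P.f i y) := by
  have := P.isFiniteMeasure_ν hγ hA i
  have hm : 0 < max ‖x‖ s := lt_max_of_lt_right hs
  have hy : 0 < ‖y‖ := norm_pos_iff.2 hy0
  rw [P.exp_lam_eq i x hs, P.eq i y hy0 hyr]
  have hw : max ‖x‖ s ^ (2 * γ) ≤ 4 ^ (|2 * γ|) * ‖y‖ ^ (2 * γ) := by
    rcases le_total 0 γ with h | h
    · rw [abs_of_nonneg (by linarith), ← mul_rpow (by norm_num) hy.le]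
      exact rpow_le_rpow hm.le h1 (by linarith)
    · rw [abs_of_nonpos (by linarith)]
      have h4 := rpow_le_rpow_of_nonpos hy h2 (show 2 * γ ≤ 0 by linarith)
      rw [mul_rpow (by norm_num) hm.le] at h4
      have h5 : (4 : ℝ) ^ (-(2 * γ)) * 4 ^ (2 * γ) = 1 := by
        rw [← rpow_add (by norm_num)]; simp
      calc max ‖x‖ s ^ (2 * γ) = (4 : ℝ) ^ (-(2 * γ)) * (4 ^ (2 * γ) * max ‖x‖ s ^ (2 * γ)) := by
            rw [← mul_assoc, h5, one_mul]
        _ ≤ _ := by gcongr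
  have hH : 1 ≤ B * P.H i y := by
    have := mul_le_mul_of_nonneg_left (P.le_H i y hy0 hyr) hB.le
    rwa [mul_inv_cancel₀ hB.ne'] at this
  have hlog : ∫ z, log ‖y - z‖ ∂P.ν i ≤
      ∫ z, log (max ‖x - z‖ s) ∂P.ν i + entrySum A * B * log 2 := by
    have hmono := integral_mono_ae (P.integrable_log hγ hA i y)
      ((P.integrable_log_max hγ hA i x s).add (integrable_const (log 2))) (by
        filter_upwards [ae_ne_dens _ y] with z hz
        have h0 : 0 < ‖y - z‖ := norm_pos_iff.2 (sub_ne_zero.2 hz.symm)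
        have h6 : ‖y - z‖ ≤ max ‖x - z‖ s * 2 := by
          have := norm_sub_le_norm_sub_add_norm_sub y x z
          linarith [le_max_left ‖x - z‖ s, le_max_right ‖x - z‖ s]
        have := log_le_log h0 h6
        rwa [log_mul (lt_max_of_lt_right hs).ne' two_ne_zero] at this)
    simp only [Pi.add_apply] at hmono
    rw [integral_add (P.integrable_log_max hγ hA i x s) (integrable_const _), integral_const,
      smul_eq_mul] at hmono
    have := mul_le_mul_of_nonneg_right (P.real_ν_univ_le hγ hA i) (log_nonneg one_le_two)
    linarith
  have hexp : exp (P.c i - ∫ z, log (max ‖x - z‖ s) ∂P.ν i) ≤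
      exp (entrySum A * B * log 2) *
        exp (P.c i - ∫ z, log ‖y - z‖ ∂P.ν i) := by
    rw [← exp_add]
    exact exp_le_exp.2 (by linarith)
  gcongr s ^ 2 * ?_
  set e1 := exp (P.c i - ∫ z, log (max ‖x - z‖ s) ∂P.ν i)
  set e2 := exp (P.c i - ∫ z, log ‖y - z‖ ∂P.ν i) with he2
  have he2' : exp (P.c i - ∫ z, log ‖y - z‖ ∂dens fun y => ∑ j, A i j * P.f j y) = e2 :=
    rfl
  rw [he2']
  calc max ‖x‖ s ^ (2 * γ) * e1
      ≤ (4 ^ (|2 * γ|) * ‖y‖ ^ (2 * γ)) * (exp (entrySum A * B * log 2) * e2) := by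
        gcongr
    _ ≤ (B * P.H i y) * ((4 ^ (|2 * γ|) * ‖y‖ ^ (2 * γ)) *
        (exp (entrySum A * B * log 2) * e2)) := by
        exact le_mul_of_one_le_left (by positivity) hH
    _ = _ := by ring

omit hγ hA P in
lemma exists_norm_eq_add (x : E2) {t : ℝ} (ht : 0 ≤ t) :
    ∃ x' : E2, ‖x' - x‖ = t ∧ ‖x'‖ = ‖x‖ + t := by
  by_cases hx : x = 0
  · exact ⟨t • EuclideanSpace.single 0 1, by simp [hx, norm_smul, abs_of_nonneg ht]⟩
  · have hx' : 0 < ‖x‖ := norm_pos_iff.2 hx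
    refine ⟨x + (t / ‖x‖) • x, ?_, ?_⟩
    · rw [add_sub_cancel_left, norm_smul, norm_eq_abs, abs_of_nonneg (by positivity)]
      field_simp
    · rw [show x + (t / ‖x‖) • x = (1 + t / ‖x‖) • x by rw [add_smul, one_smul], norm_smul,
        norm_eq_abs, abs_of_nonneg (by positivity)]
      field_simp

lemma exp_lam_le_mul_real (hB : 0 < B) (i : Fin n) {x : E2} {s : ℝ} (hs : 0 < s)
    (hr : ‖x‖ + 2 * s ≤ r) :
    exp (P.lam i x s) ≤ (16 / volume.real (ball (0 : E2) 1)) * (B * 4 ^ (|2 * γ|) *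
      exp (entrySum A * B * log 2)) * (P.ρ i).real (closedBall x s) := by
  have := P.isFiniteMeasure_ρ hγ i
  obtain ⟨x', hx1, hx2⟩ := exists_norm_eq_add x (t := s / 2) (by positivity)
  set C := B * 4 ^ (|2 * γ|) * exp (entrySum A * B * log 2) with hC
  have hCpos : 0 < C := by rw [hC]; positivity
  set v := volume.real (ball (0 : E2) 1) with hv
  have hvpos : 0 < v := ENNReal.toReal_pos (measure_ball_pos _ _ one_pos).ne' measure_ball_lt_top.ne
  have hsub : closedBall x' (s / 4) ⊆ closedBall x s := by
    refine closedBall_subset_closedBall' ?_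
    rw [dist_eq_norm, hx1]
    linarith
  have hlow : ∀ y ∈ closedBall x' (s / 4), exp (P.lam i x s) / (s ^ 2 * C) ≤ P.f i y := by
    intro y hy
    rw [mem_closedBall, dist_eq_norm] at hy
    have h1 : ‖x'‖ ≤ ‖y‖ + ‖y - x'‖ := by
      have := norm_sub_le y (y - x'); simpa using this
    have h2 : ‖y‖ ≤ ‖x'‖ + ‖y - x'‖ := by
      have := norm_add_le x' (y - x'); simpa using this
    have h3 : ‖y - x‖ ≤ ‖y - x'‖ + ‖x' - x‖ := norm_sub_le_norm_sub_add_norm_sub _ _ _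
    have hx0 := norm_nonneg x
    have hy0 : y ≠ 0 := by rw [← norm_pos_iff]; linarith
    rw [div_le_iff₀ (by positivity)]
    have := P.exp_lam_le_mul_density hγ hA hB i (x := x) (y := y) hs hy0 (by linarith)
      (max_le (by linarith) (by linarith))
      (by linarith [le_max_left ‖x‖ s, le_max_right ‖x‖ s]) (by linarith)
    linarith
  have h5 : (s / 4) ^ 2 * v * (exp (P.lam i x s) / (s ^ 2 * C)) ≤ (P.ρ i).real (closedBall x s) := by
    refine le_trans ?_ (measureReal_mono hsub)
    rw [show P.ρ i = dens (P.f i) from rfl, (P.riesz i).real_dens (singExp_nonneg γ)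
      (singExp_lt_two hγ) _ measurableSet_closedBall]
    have h6 := setIntegral_mono_on (μ := (volume : Measure E2)) (s := closedBall x' (s / 4))
      (f := fun _ => exp (P.lam i x s) / (s ^ 2 * C)) (g := P.f i)
      (integrableOn_const measure_closedBall_lt_top.ne)
      ((P.riesz i).integrable (singExp_nonneg γ) (singExp_lt_two hγ)).integrableOn
      measurableSet_closedBall hlow
    rwa [setIntegral_const, smul_eq_mul, Measure.addHaar_real_closedBall _ _ (by positivity),
      finrank_euclideanSpace_fin] at h6
  calc exp (P.lam i x s) = (16 / v) * C *
        ((s / 4) ^ 2 * v * (exp (P.lam i x s) / (s ^ 2 * C))) := by field_simp; norm_num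
    _ ≤ _ := by gcongr

end LiouvillePotential
end Potential

section ExponentialIntegrability

lemma rpow_le_one_add_rpow {t p q : ℝ} (ht : 0 ≤ t) (hp : 0 ≤ p) (hpq : p ≤ q) :
    t ^ p ≤ 1 + t ^ q := by
  rcases le_total t 1 with h | h
  · linarith [rpow_le_one ht h hp, rpow_nonneg ht q]
  · linarith [rpow_le_rpow_of_exponent_le h hpq]

namespace IsRieszDensity

variable {κ : ℝ} {g : E2 → ℝ}

lemma integrable_log_div (hg : IsRieszDensity κ g) (hκ : 0 ≤ κ) (hκ2 : κ < 2) {s : ℝ} (hs : 0 < s)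
    (y : E2) : Integrable (fun z => log (s / ‖y - z‖)) (dens g) := by
  have := hg.isFiniteMeasure hκ hκ2
  refine ((integrable_const (log s)).sub (hg.integrable_log hκ hκ2 y)).congr ?_
  filter_upwards [ae_ne_dens g y] with z hz
  have h0 : 0 < ‖y - z‖ := norm_pos_iff.2 (sub_ne_zero.2 hz.symm)
  simp [log_div hs.ne' h0.ne']

lemma exists_exp_integral_log_le (hg : IsRieszDensity κ g) (hκ : 0 ≤ κ) {θ : ℝ} (hθ : 0 ≤ θ)
    (hκθ : κ + θ < 2) {D : Set E2} (hD : (dens g).real D ≤ θ)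
    {s : ℝ} (hs : 0 < s) : ∃ μ : Measure E2, IsProbabilityMeasure μ ∧ ∀ y,
      Integrable (fun z => (s / ‖y - z‖) ^ θ) μ ∧
      exp (∫ z in D, log (s / ‖y - z‖) ∂dens g) ≤ ∫ z, (1 + (s / ‖y - z‖) ^ θ) ∂μ := by
  have hκ2 : κ < 2 := by linarith
  have := hg.isFiniteMeasure hκ hκ2
  have hint : ∀ y, Integrable (fun z => (s / ‖y - z‖) ^ θ) (dens g) := fun y => by
    simpa only [norm_sub_rev] using hg.integrable_riesz hκ hθ hκθ y hs
  by_cases h0 : (dens g) D = 0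
  · refine ⟨Measure.dirac 0, inferInstance, fun y => ⟨?_, ?_⟩⟩
    · exact integrable_dirac (by simp)
    · rw [Measure.restrict_eq_zero.2 h0, integral_zero_measure, exp_zero, integral_dirac]
      linarith [show (0 : ℝ) ≤ (s / ‖y - 0‖) ^ θ by positivity]
  · set F := (dens g).restrict D with hF
    have hFne : NeZero F := ⟨by rwa [hF, Ne, Measure.restrict_eq_zero]⟩
    set μ := (F Set.univ)⁻¹ • F with hμ
    have hμp : IsProbabilityMeasure μ := isProbabilityMeasureSMul
    have hc : (F Set.univ)⁻¹ ≠ ⊤ := ENNReal.inv_ne_top.2 (by simpa using hFne.ne)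
    set m := (dens g).real D with hm
    have hm0 : 0 < m := ENNReal.toReal_pos h0 (measure_ne_top _ _)
    have hFm : (F Set.univ)⁻¹.toReal = m⁻¹ := by
      rw [ENNReal.toReal_inv, hF, Measure.restrict_apply_univ]; rfl
    refine ⟨μ, hμp, fun y => ?_⟩
    have hi : Integrable (fun z => (s / ‖y - z‖) ^ θ) μ := (hint y).restrict.smul_measure hc
    have hl : Integrable (fun z => m * log (s / ‖y - z‖)) μ :=
      ((hg.integrable_log_div hκ hκ2 hs y).restrict.smul_measure hc).const_mul m
    have hae : ∀ᵐ z ∂μ, z ≠ y :=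
      Measure.ae_smul_measure (ae_restrict_of_ae (ae_ne_dens g y)) _
    have hle : ∀ᵐ z ∂μ, exp (m * log (s / ‖y - z‖)) ≤ 1 + (s / ‖y - z‖) ^ θ := by
      filter_upwards [hae] with z hz
      have h1 : 0 < s / ‖y - z‖ := div_pos hs (norm_pos_iff.2 (sub_ne_zero.2 hz.symm))
      rw [mul_comm, ← rpow_def_of_pos h1]
      exact rpow_le_one_add_rpow h1.le hm0.le hD
    have hi1 : Integrable (fun z => 1 + (s / ‖y - z‖) ^ θ) μ := (integrable_const 1).add hi
    have he : Integrable (fun z => exp (m * log (s / ‖y - z‖))) μ := by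
      refine hi1.mono' (continuous_exp.comp_aestronglyMeasurable hl.aestronglyMeasurable) ?_
      filter_upwards [hle] with z hz
      rwa [norm_eq_abs, abs_of_pos (exp_pos _)]
    refine ⟨hi, ?_⟩
    have hJ := convexOn_exp.map_integral_le (μ := μ) (f := fun z => m * log (s / ‖y - z‖))
      continuous_exp.continuousOn isClosed_univ (by simp) hl he
    refine le_trans (le_of_eq ?_) (hJ.trans (integral_mono_ae he hi1 hle))
    congr 1
    rw [integral_const_mul, hμ, integral_smul_measure, hFm, smul_eq_mul, ← mul_assoc,
      mul_inv_cancel₀ hm0.ne', one_mul]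

end IsRieszDensity

lemma one_add_rpow_mul_le {a b κ θ : ℝ} (ha : 0 ≤ a) (hb : 0 ≤ b) (hκ : 0 ≤ κ) (hθ : 0 ≤ θ) :
    (1 + a ^ κ) * (1 + b ^ θ) ≤ 4 * (2 + a ^ (κ + θ) + b ^ (κ + θ)) := by
  have h1 := rpow_mul_rpow_le_add ha hb hκ hθ
  have h2 := rpow_le_one_add_rpow ha hκ (le_add_of_nonneg_right hθ)
  have h3 := rpow_le_one_add_rpow hb hθ (le_add_of_nonneg_left hκ)
  have h4 := rpow_nonneg ha (κ + θ)
  have h5 := rpow_nonneg hb (κ + θ)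
  nlinarith

lemma lintegral_one_add_rpow_mul_le {κ θ : ℝ} (hκ : 0 ≤ κ) (hθ : 0 ≤ θ) (hκθ : κ + θ < 2) :
    ∃ C > 0, ∀ (μ : Measure E2) [IsProbabilityMeasure μ] (s : ℝ), 0 < s → ∀ x : E2,
      ∫⁻ y in closedBall x s, ∫⁻ z,
        ENNReal.ofReal ((1 + (s / ‖y‖) ^ κ) * (1 + (s / ‖y - z‖) ^ θ)) ∂μ ≤
          ENNReal.ofReal (C * s ^ 2) := by
  obtain ⟨C, hC, h⟩ := exists_kernel_bound (add_nonneg hκ hθ) hκθ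
  set v := volume.real (ball (0 : E2) 1) with hv
  have hv0 : 0 ≤ v := measureReal_nonneg
  refine ⟨4 * (2 * C + 4 * v), by positivity, fun μ _ s hs x => ?_⟩
  have hmeas : Measurable fun p : E2 × E2 =>
      ENNReal.ofReal ((1 + (s / ‖p.1‖) ^ κ) * (1 + (s / ‖p.1 - p.2‖) ^ θ)) := by
    have h1 : Measurable fun p : E2 × E2 => (s / ‖p.1‖) ^ κ := by measurability
    have h2 : Measurable fun p : E2 × E2 => (s / ‖p.1 - p.2‖) ^ θ := by measurability
    exact ((h1.const_add 1).mul (h2.const_add 1)).ennreal_ofReal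
  rw [lintegral_lintegral_swap hmeas.aemeasurable]
  have hz : ∀ z, ∫⁻ y in closedBall x s,
      ENNReal.ofReal ((1 + (s / ‖y‖) ^ κ) * (1 + (s / ‖y - z‖) ^ θ)) ≤
        ENNReal.ofReal (4 * (2 * C + 4 * v) * s ^ 2) := by
    intro z
    have hb := measure_closedBall_lt_top (μ := (volume : Measure E2)) (x := x) (r := s)
    obtain ⟨i1, l1⟩ := h 0 s hs (closedBall x s) measurableSet_closedBall hb.ne
    obtain ⟨i2, l2⟩ := h z s hs (closedBall x s) measurableSet_closedBall hb.ne
    simp only [sub_zero] at i1 l1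
    have i3 : IntegrableOn (fun y => 4 * (2 + (s / ‖y‖) ^ (κ + θ) + (s / ‖y - z‖) ^ (κ + θ)))
        (closedBall x s) := (((integrableOn_const hb.ne).add i1).add i2).const_mul 4
    refine (lintegral_mono (g := fun y => ENNReal.ofReal
      (4 * (2 + (s / ‖y‖) ^ (κ + θ) + (s / ‖y - z‖) ^ (κ + θ)))) fun y =>
        ENNReal.ofReal_le_ofReal (one_add_rpow_mul_le (by positivity) (by positivity) hκ hθ)).trans ?_
    rw [← ofReal_integral_eq_lintegral_ofReal i3 (ae_of_all _ fun y => by positivity)]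
    refine ENNReal.ofReal_le_ofReal ?_
    have e0 : IntegrableOn (fun _ => (2 : ℝ)) (closedBall x s) := integrableOn_const hb.ne
    have e1 : IntegrableOn (fun y => 2 + (s / ‖y‖) ^ (κ + θ)) (closedBall x s) :=
      (integrableOn_const hb.ne).add i1
    have hvol : volume.real (closedBall x s) = s ^ 2 * v := by
      rw [Measure.addHaar_real_closedBall _ _ hs.le, finrank_euclideanSpace_fin]
    rw [integral_const_mul, integral_add e1 i2, integral_add e0 i1,
      setIntegral_const, smul_eq_mul]
    rw [hvol] at l1 l2 ⊢
    linarith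
  refine (lintegral_mono hz).trans ?_
  rw [lintegral_const, measure_univ, mul_one]

lemma rpow_weight_le {γ s : ℝ} {x y : E2} (hs : 0 < s) (hy0 : y ≠ 0) (hy : ‖y - x‖ ≤ s / 2) :
    ‖y‖ ^ (2 * γ) ≤ 4 ^ |2 * γ| * max ‖x‖ s ^ (2 * γ) * (1 + (s / ‖y‖) ^ singExp γ) := by
  have hypos : 0 < ‖y‖ := norm_pos_iff.2 hy0
  have hm : 0 < max ‖x‖ s := lt_max_of_lt_right hs
  have h1 : ‖y‖ ≤ ‖x‖ + ‖y - x‖ := by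
    have := norm_add_le x (y - x); simpa using this
  have h2 : ‖x‖ ≤ ‖y‖ + ‖y - x‖ := by
    have := norm_sub_le y (y - x); simpa using this
  have hpos : 0 ≤ (s / ‖y‖) ^ singExp γ := by positivity
  rcases le_or_gt 0 γ with h | h
  · have h3 : ‖y‖ ≤ 4 * max ‖x‖ s := by
      linarith [le_max_left ‖x‖ s, le_max_right ‖x‖ s]
    have h4 := rpow_le_rpow hypos.le h3 (show 0 ≤ 2 * γ by linarith)
    rw [mul_rpow (by norm_num) hm.le] at h4
    rw [abs_of_nonneg (by linarith)]
    exact h4.trans (le_mul_of_one_le_right (by positivity) (by linarith))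
  · have hκ : singExp γ = -(2 * γ) := max_eq_right (by linarith)
    rw [abs_of_neg (by linarith)]
    have h4 : 1 ≤ (4 : ℝ) ^ (-(2 * γ)) := one_le_rpow (by norm_num) (by linarith)
    rcases le_total (max ‖x‖ s) (4 * ‖y‖) with h3 | h3
    · have h5 := rpow_le_rpow_of_nonpos hm h3 (show 2 * γ ≤ 0 by linarith)
      have h6 : (4 : ℝ) ^ (-(2 * γ)) * 4 ^ (2 * γ) = 1 := by
        rw [← rpow_add (by norm_num)]; simp
      rw [mul_rpow (by norm_num) hypos.le] at h5
      calc ‖y‖ ^ (2 * γ) = (4 : ℝ) ^ (-(2 * γ)) * (4 ^ (2 * γ) * ‖y‖ ^ (2 * γ)) := by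
            rw [← mul_assoc, h6, one_mul]
        _ ≤ (4 : ℝ) ^ (-(2 * γ)) * max ‖x‖ s ^ (2 * γ) := by gcongr
        _ ≤ _ := le_mul_of_one_le_right (by positivity) (by linarith)
    · have hx : ‖x‖ ≤ s := by
        by_contra hc
        push Not at hc
        rw [max_eq_left hc.le] at h3
        linarith
      rw [max_eq_right hx, hκ]
      have h7 : s ^ (2 * γ) * (s / ‖y‖) ^ (-(2 * γ)) = ‖y‖ ^ (2 * γ) := by
        rw [div_rpow hs.le hypos.le, rpow_neg hs.le, rpow_neg hypos.le]
        have := (rpow_pos_of_pos hs (2 * γ)).ne'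
        field_simp
      have h8 : 0 ≤ s ^ (2 * γ) := by positivity
      have h9 : 0 ≤ ‖y‖ ^ (2 * γ) := by positivity
      nlinarith

namespace LiouvillePotential

variable {n : ℕ} {A : Matrix (Fin n) (Fin n) ℝ} {γ r B : ℝ} (P : LiouvillePotential A γ r B)
  (hγ : -1 < γ) (hA : ∀ i j, 0 ≤ A i j)
include hγ hA

lemma density_le (hB : 0 < B) (i : Fin n) {x y : E2} {s : ℝ} (hs : 0 < s)
    (hy0 : y ≠ 0) (hyr : ‖y‖ < r) (hy : ‖y - x‖ ≤ s / 2) :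
    P.f i y ≤ (4 ^ |2 * γ| * B * exp (entrySum A * B * log 2)) *
      (exp (P.lam i x s) / s ^ 2) * (1 + (s / ‖y‖) ^ singExp γ) *
      exp (∫ z in closedBall x s, log (s / ‖y - z‖) ∂P.ν i) := by
  have := P.isFiniteMeasure_ν hγ hA i
  have hm : 0 < max ‖x‖ s := lt_max_of_lt_right hs
  rw [P.exp_lam_eq i x hs, P.eq i y hy0 hyr]
  have hcb : MeasurableSet (closedBall x s) := measurableSet_closedBall
  have hld : Integrable (fun z => log (s / ‖y - z‖)) (P.ν i) :=
    (P.riesz_ν hA i).integrable_log_div (singExp_nonneg γ) (singExp_lt_two hγ) hs y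
  have hlog : ∫ z, log (max ‖x - z‖ s) ∂P.ν i ≤ ∫ z, log ‖y - z‖ ∂P.ν i +
      entrySum A * B * log 2 +
      ∫ z in closedBall x s, log (s / ‖y - z‖) ∂P.ν i := by
    have hmono := integral_mono_ae (P.integrable_log_max hγ hA i x s)
      (((P.integrable_log hγ hA i y).add (integrable_const (log 2))).add
        (hld.indicator hcb)) (by
        filter_upwards [ae_ne_dens _ y] with z hz
        have h0 : 0 < ‖y - z‖ := norm_pos_iff.2 (sub_ne_zero.2 hz.symm)
        simp only [Pi.add_apply]
        by_cases hzb : z ∈ closedBall x s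
        · rw [indicator_of_mem hzb, log_div hs.ne' h0.ne']
          rw [mem_closedBall, dist_comm, dist_eq_norm] at hzb
          rw [max_eq_right hzb]
          linarith [log_nonneg one_le_two]
        · rw [indicator_of_notMem hzb]
          rw [mem_closedBall, dist_comm, dist_eq_norm, not_le] at hzb
          rw [max_eq_left hzb.le, ← log_mul h0.ne' two_ne_zero, add_zero]
          refine log_le_log (hs.trans hzb) ?_
          have := norm_sub_le_norm_sub_add_norm_sub x y z
          rw [norm_sub_rev x y] at this
          linarith)
    simp only [Pi.add_apply] at hmono
    have e1 : Integrable (fun z => log ‖y - z‖ + log 2) (P.ν i) :=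
      (P.integrable_log hγ hA i y).add (integrable_const _)
    rw [integral_add e1 (hld.indicator hcb),
      integral_add (P.integrable_log hγ hA i y) (integrable_const _), integral_const,
      smul_eq_mul, integral_indicator hcb] at hmono
    have := mul_le_mul_of_nonneg_right (P.real_ν_univ_le hγ hA i) (log_nonneg one_le_two)
    linarith
  have hexp : exp (P.c i - ∫ z, log ‖y - z‖ ∂P.ν i) ≤
      exp (P.c i - ∫ z, log (max ‖x - z‖ s) ∂P.ν i) *
        exp (entrySum A * B * log 2) *
        exp (∫ z in closedBall x s, log (s / ‖y - z‖) ∂P.ν i) := by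
    rw [← exp_add, ← exp_add]
    exact exp_le_exp.2 (by linarith)
  have hw := rpow_weight_le (γ := γ) hs hy0 hy
  have hH := P.H_le i y hy0 hyr
  have hH0 : 0 ≤ P.H i y := (inv_pos.2 hB).le.trans (P.le_H i y hy0 hyr)
  set e1 := exp (P.c i - ∫ z, log (max ‖x - z‖ s) ∂P.ν i)
  set e2 := exp (P.c i - ∫ z, log ‖y - z‖ ∂P.ν i) with he2
  have he2' : exp (P.c i - ∫ z, log ‖y - z‖ ∂dens fun y => ∑ j, A i j * P.f j y) = e2 :=
    rfl
  rw [he2', mul_div_cancel_left₀ _ (pow_pos hs 2).ne']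
  have e2pos : 0 ≤ e2 := (exp_pos _).le
  refine (mul_le_mul hw (mul_le_mul hH hexp e2pos hB.le) (mul_nonneg hH0 e2pos)
    (by positivity)).trans (le_of_eq (by ring))

lemma exists_real_le_mul_exp_lam (hB : 0 < B) : ∃ K > 0, ∃ ε₀ > 0,
    ∀ (P : LiouvillePotential A γ r B) (i : Fin n) (x : E2) (s : ℝ),
    0 < s → ‖x‖ + 2 * s ≤ r → ∑ j, (P.ρ j).real (closedBall x s) ≤ ε₀ →
    (P.ρ i).real (closedBall x (s / 2)) ≤ K * exp (P.lam i x s) := by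
  have hκ := singExp_nonneg γ
  have hκ2 := singExp_lt_two hγ
  have ha := entrySum_nonneg hA
  set θ := (2 - singExp γ) / 2 with hθ
  have hθ0 : 0 < θ := by rw [hθ]; linarith
  have hκθ : singExp γ + θ < 2 := by rw [hθ]; linarith
  obtain ⟨C, hC, hCbound⟩ := lintegral_one_add_rpow_mul_le hκ hθ0.le hκθ
  set L := 4 ^ |2 * γ| * B * exp (entrySum A * B * log 2) with hL
  have hL0 : 0 < L := by rw [hL]; positivity
  refine ⟨L * C, by positivity, θ / (entrySum A + 1), by positivity, fun P i x s hs hr hsmall => ?_⟩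
  have := P.isFiniteMeasure_ν hγ hA i
  have hν : (P.ν i).real (closedBall x s) ≤ θ := by
    refine (P.real_ν_le hγ hA i measurableSet_closedBall).trans ?_
    refine (mul_le_mul_of_nonneg_left hsmall ha).trans ?_
    rw [mul_div_assoc', div_le_iff₀ (by positivity)]
    nlinarith
  obtain ⟨μ, hμ, hJ⟩ := (P.riesz_ν hA i).exists_exp_integral_log_le hκ hθ0.le hκθ hν hs
  set E := exp (P.lam i x s) with hE
  have hE0 : 0 < E := exp_pos _
  have hpt : ∀ y ∈ closedBall x (s / 2), y ≠ 0 → ENNReal.ofReal (P.f i y) ≤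
      ENNReal.ofReal (L * (E / s ^ 2)) * ∫⁻ z,
        ENNReal.ofReal ((1 + (s / ‖y‖) ^ singExp γ) * (1 + (s / ‖y - z‖) ^ θ)) ∂μ := by
    intro y hy hy0
    rw [mem_closedBall, dist_eq_norm] at hy
    have hyr : ‖y‖ < r := by
      have := norm_add_le x (y - x)
      rw [add_sub_cancel] at this
      linarith
    have h1 := P.density_le hγ hA hB i hs hy0 hyr hy
    obtain ⟨hi, hJy⟩ := hJ y
    have hi1 : Integrable (fun z => (1 + (s / ‖y‖) ^ singExp γ) * (1 + (s / ‖y - z‖) ^ θ)) μ :=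
      ((integrable_const 1).add hi).const_mul _
    have hw : 0 ≤ (1 + (s / ‖y‖) ^ singExp γ) := by positivity
    rw [← ofReal_integral_eq_lintegral_ofReal hi1 (ae_of_all _ fun z => by positivity),
      ← ENNReal.ofReal_mul (by positivity), integral_const_mul]
    refine ENNReal.ofReal_le_ofReal (h1.trans ?_)
    rw [mul_assoc]
    exact mul_le_mul_of_nonneg_left (mul_le_mul_of_nonneg_left hJy hw) (by positivity)
  have hle : (P.ρ i) (closedBall x (s / 2)) ≤ ENNReal.ofReal (L * C * E) := by
    rw [ρ, dens, withDensity_apply _ measurableSet_closedBall]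
    refine (lintegral_mono_ae (g := fun y => ENNReal.ofReal (L * (E / s ^ 2)) * ∫⁻ z,
        ENNReal.ofReal ((1 + (s / ‖y‖) ^ singExp γ) * (1 + (s / ‖y - z‖) ^ θ)) ∂μ) ?_).trans ?_
    · filter_upwards [ae_restrict_mem measurableSet_closedBall,
        ae_restrict_of_ae (Measure.ae_ne volume (0 : E2))] with y hy hy0 using hpt y hy hy0
    · rw [lintegral_const_mul' _ _ ENNReal.ofReal_ne_top]
      refine (mul_le_mul_right ((lintegral_mono_set
        (closedBall_subset_closedBall (by linarith : s / 2 ≤ s))).trans (hCbound μ s hs x)) _).trans ?_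
      rw [← ENNReal.ofReal_mul (by positivity)]
      refine ENNReal.ofReal_le_ofReal (le_of_eq ?_)
      field_simp
  exact ENNReal.toReal_le_of_le_ofReal (by positivity) hle

end LiouvillePotential
end ExponentialIntegrability

section RegularizedLog

/-- The logarithmic potential of a density, regularized at scale `ε`. -/
def regLog (g : E2 → ℝ) (ε : ℝ) (x : E2) : ℝ := ∫ y, log (‖x - y‖ ^ 2 + ε ^ 2) / 2 ∂dens g

/-- The differential of the regularized logarithm. -/
def regKernel (ε : ℝ) (x y : E2) : E2 →L[ℝ] ℝ := (‖x - y‖ ^ 2 + ε ^ 2)⁻¹ • innerSL ℝ (x - y)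

/-- The differential of the regularized logarithmic potential. -/
def regGrad (g : E2 → ℝ) (ε : ℝ) (x : E2) : E2 →L[ℝ] ℝ := ∫ y, regKernel ε x y ∂dens g

lemma hasFDerivAt_log_norm_sq {ε : ℝ} (hε : 0 < ε) (x y : E2) :
    HasFDerivAt (fun x => log (‖x - y‖ ^ 2 + ε ^ 2) / 2) (regKernel ε x y) x := by
  have h1 : HasFDerivAt (fun x : E2 => ‖x - y‖ ^ 2 + ε ^ 2) _ x :=
    (((hasFDerivAt_id x).sub_const y).norm_sq).add_const (ε ^ 2)
  have h2 := (h1.log (by positivity)).mul_const (1 / 2)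
  simp only [mul_one_div] at h2
  refine h2.congr_fderiv ?_
  ext v
  simp [regKernel]
  ring

lemma norm_regKernel_le {ε : ℝ} (hε : 0 < ε) (x y : E2) : ‖regKernel ε x y‖ ≤ 1 / ε := by
  have h0 : 0 < ‖x - y‖ ^ 2 + ε ^ 2 := by positivity
  rw [regKernel, norm_smul, innerSL_apply_norm, norm_eq_abs, abs_of_nonneg (by positivity),
    inv_mul_le_iff₀ h0, mul_one_div, le_div_iff₀ hε]
  nlinarith [sq_nonneg (‖x - y‖ - ε)]

lemma continuous_regKernel {ε : ℝ} (hε : 0 < ε) (x : E2) : Continuous (regKernel ε x) := by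
  unfold regKernel
  have h1 : Continuous fun y => ‖x - y‖ ^ 2 + ε ^ 2 := by fun_prop
  exact (h1.inv₀ fun y => by positivity).smul ((innerSL ℝ).continuous.comp (by fun_prop))

namespace IsRieszDensity

variable {κ : ℝ} {g : E2 → ℝ}

lemma integrable_regLog (hg : IsRieszDensity κ g) (hκ : 0 ≤ κ) (hκ2 : κ < 2) {ε : ℝ} (hε : 0 < ε)
    (x : E2) : Integrable (fun y => log (‖x - y‖ ^ 2 + ε ^ 2) / 2) (dens g) := by
  have := hg.isFiniteMeasure hκ hκ2
  obtain ⟨R, hR1, hR⟩ := hg.ae_norm_le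
  have hc : Continuous fun y => log (‖x - y‖ ^ 2 + ε ^ 2) / 2 :=
    (Continuous.log (by fun_prop) fun y => by positivity).div_const 2
  refine (integrable_const (|log ε| + ((‖x‖ + R) ^ 2 + ε ^ 2))).mono'
    hc.aestronglyMeasurable ?_
  filter_upwards [hR] with y hy
  have h0 : 0 < ‖x - y‖ ^ 2 + ε ^ 2 := by positivity
  have h1 : ‖x - y‖ ≤ ‖x‖ + R := by linarith [norm_sub_le x y]
  have h2 : ‖x - y‖ ^ 2 ≤ (‖x‖ + R) ^ 2 := pow_le_pow_left₀ (norm_nonneg _) h1 2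
  have h3 := log_le_sub_one_of_pos h0
  have h4 : 2 * log ε ≤ log (‖x - y‖ ^ 2 + ε ^ 2) := by
    have := log_le_log (pow_pos hε 2) (show ε ^ 2 ≤ ‖x - y‖ ^ 2 + ε ^ 2 by linarith [sq_nonneg ‖x - y‖])
    rw [log_pow] at this
    exact_mod_cast this
  rw [norm_eq_abs, abs_le]
  have h5 := neg_abs_le (log ε)
  have h6 : 0 ≤ (‖x‖ + R) ^ 2 + ε ^ 2 := by positivity
  have h7 := abs_nonneg (log ε)
  constructor <;> linarith

lemma integrable_regKernel (hg : IsRieszDensity κ g) (hκ : 0 ≤ κ) (hκ2 : κ < 2) {ε : ℝ}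
    (hε : 0 < ε) (x : E2) : Integrable (regKernel ε x) (dens g) := by
  have := hg.isFiniteMeasure hκ hκ2
  exact (integrable_const (1 / ε)).mono' (continuous_regKernel hε x).aestronglyMeasurable
    (ae_of_all _ fun y => norm_regKernel_le hε x y)

lemma hasFDerivAt_regLog (hg : IsRieszDensity κ g) (hκ : 0 ≤ κ) (hκ2 : κ < 2) {ε : ℝ} (hε : 0 < ε)
    (x : E2) : HasFDerivAt (regLog g ε) (regGrad g ε x) x := by
  have := hg.isFiniteMeasure hκ hκ2
  exact hasFDerivAt_integral_of_dominated_of_fderiv_le (F' := fun x y => regKernel ε x y)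
    (bound := fun _ => 1 / ε) univ_mem
    (Eventually.of_forall fun x => (hg.integrable_regLog hκ hκ2 hε x).aestronglyMeasurable)
    (hg.integrable_regLog hκ hκ2 hε x) (continuous_regKernel hε x).aestronglyMeasurable
    (ae_of_all _ fun y x _ => norm_regKernel_le hε x y) (integrable_const _)
    (ae_of_all _ fun y x _ => hasFDerivAt_log_norm_sq hε x y)

lemma regGrad_apply (hg : IsRieszDensity κ g) (hκ : 0 ≤ κ) (hκ2 : κ < 2) {ε : ℝ} (hε : 0 < ε)
    (x v : E2) : regGrad g ε x v =
      ∫ y, inner ℝ (x - y) v / (‖x - y‖ ^ 2 + ε ^ 2) ∂dens g := by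
  rw [regGrad, ContinuousLinearMap.integral_apply (hg.integrable_regKernel hκ hκ2 hε x)]
  refine integral_congr_ae (ae_of_all _ fun y => ?_)
  simp only [regKernel, _root_.smul_apply, innerSL_apply_apply, smul_eq_mul]
  ring

lemma norm_regGrad_le (hg : IsRieszDensity κ g) (hκ : 0 ≤ κ) (hκ2 : κ < 2) {ε : ℝ} (hε : 0 < ε)
    (x : E2) : ‖regGrad g ε x‖ ≤ 1 / ε * (dens g).real Set.univ := by
  have := hg.isFiniteMeasure hκ hκ2
  exact norm_integral_le_of_norm_le_const (ae_of_all _ fun y => norm_regKernel_le hε x y)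

lemma le_regLog (hg : IsRieszDensity κ g) (hκ : 0 ≤ κ) (hκ2 : κ < 2) {ε : ℝ} (hε : 0 < ε)
    (x : E2) : ∫ y, log ‖x - y‖ ∂dens g ≤ regLog g ε x := by
  refine integral_mono_ae (hg.integrable_log hκ hκ2 x) (hg.integrable_regLog hκ hκ2 hε x) ?_
  filter_upwards [ae_ne_dens g x] with y hy
  have h0 : 0 < ‖x - y‖ := norm_pos_iff.2 (sub_ne_zero.2 hy.symm)
  have h1 := log_le_log (pow_pos h0 2)
    (show ‖x - y‖ ^ 2 ≤ ‖x - y‖ ^ 2 + ε ^ 2 by linarith [sq_nonneg ε])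
  rw [log_pow] at h1
  push_cast at h1
  linarith

lemma tendsto_regLog (hg : IsRieszDensity κ g) (hκ : 0 ≤ κ) (hκ2 : κ < 2) (x : E2) :
    Tendsto (fun ε => regLog g ε x) (𝓝[>] 0) (𝓝 (∫ y, log ‖x - y‖ ∂dens g)) := by
  refine tendsto_integral_filter_of_dominated_convergence
    (fun y => |log ‖x - y‖| + |log (‖x - y‖ ^ 2 + 1 ^ 2) / 2|) ?_ ?_ ?_ ?_
  · filter_upwards [self_mem_nhdsWithin] with ε hε
    exact (hg.integrable_regLog hκ hκ2 hε x).aestronglyMeasurable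
  · filter_upwards [self_mem_nhdsWithin, Ioo_mem_nhdsGT one_pos] with ε hε hε1
    filter_upwards [ae_ne_dens g x] with y hy
    have hε : 0 < ε := hε
    have h0 : 0 < ‖x - y‖ := norm_pos_iff.2 (sub_ne_zero.2 hy.symm)
    have h1 := log_le_log (pow_pos h0 2)
      (show ‖x - y‖ ^ 2 ≤ ‖x - y‖ ^ 2 + ε ^ 2 by linarith [sq_nonneg ε])
    rw [log_pow] at h1
    push_cast at h1
    have h2 : log (‖x - y‖ ^ 2 + ε ^ 2) / 2 ≤ log (‖x - y‖ ^ 2 + 1 ^ 2) / 2 := by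
      refine div_le_div_of_nonneg_right (log_le_log (by positivity) ?_) zero_le_two
      nlinarith [hε1.2]
    have h3 := neg_abs_le (log ‖x - y‖)
    have h4 := le_abs_self (log (‖x - y‖ ^ 2 + 1 ^ 2) / 2)
    have h5 := abs_nonneg (log ‖x - y‖)
    have h6 := abs_nonneg (log (‖x - y‖ ^ 2 + 1 ^ 2) / 2)
    rw [norm_eq_abs, abs_le]
    generalize log (‖x - y‖ ^ 2 + 1 ^ 2) / 2 = a at *
    generalize log (‖x - y‖ ^ 2 + ε ^ 2) = b at *
    constructor <;> linarith
  · exact (hg.integrable_log hκ hκ2 x).abs.add (hg.integrable_regLog hκ hκ2 one_pos x).abs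
  · filter_upwards [ae_ne_dens g x] with y hy
    have h0 : 0 < ‖x - y‖ := norm_pos_iff.2 (sub_ne_zero.2 hy.symm)
    have h1 : Tendsto (fun ε : ℝ => log (‖x - y‖ ^ 2 + ε ^ 2) / 2) (𝓝[>] 0)
        (𝓝 (log (‖x - y‖ ^ 2 + 0 ^ 2) / 2)) := by
      refine Tendsto.mono_left ?_ nhdsWithin_le_nhds
      refine ContinuousAt.tendsto (f := fun ε : ℝ => log (‖x - y‖ ^ 2 + ε ^ 2) / 2) ?_
      refine (ContinuousAt.log (by fun_prop) (by positivity)).div_const 2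
    have h2 : log (‖x - y‖ ^ 2 + 0 ^ 2) / 2 = log ‖x - y‖ := by
      rw [zero_pow two_ne_zero, add_zero, log_pow]
      push_cast
      ring
    rwa [h2] at h1

lemma integrable_prod_div {f : E2 → ℝ} (hf : IsRieszDensity κ f) (hg : IsRieszDensity κ g)
    (hκ : 0 ≤ κ) (hκ2 : κ < 2) {φ : E2 → ℝ} (hφ : Measurable φ) {M R : ℝ}
    (hM : ∀ x, f x * |φ x| ≤ M) (hR : ∀ x, R < ‖x‖ → φ x = 0) :
    Integrable (fun z : E2 × E2 => φ z.1 / ‖z.1 - z.2‖) ((dens f).prod (dens g)) := by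
  have := hf.isFiniteMeasure hκ hκ2
  have := hg.isFiniteMeasure hκ hκ2
  have hmeas : Measurable fun z : E2 × E2 => φ z.1 / ‖z.1 - z.2‖ :=
    (hφ.comp measurable_fst).div (by measurability)
  have hM0 : 0 ≤ M := (mul_nonneg (hf.nonneg 0) (abs_nonneg _)).trans (hM 0)
  obtain ⟨C, hC, h⟩ := exists_kernel_bound zero_le_one one_lt_two
  have hcl : MeasurableSet (closedBall (0 : E2) R) := measurableSet_closedBall
  have hk : ∀ y, Integrable ((closedBall (0 : E2) R).indicator fun x => M * (1 / ‖x - y‖) ^ (1 : ℝ)) :=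
    fun y => (integrable_indicator_iff hcl).2
      ((h y 1 one_pos _ hcl measure_closedBall_lt_top.ne).1.const_mul M)
  have hb : ∀ y x, |f x * (φ x / ‖x - y‖)| ≤
      (closedBall (0 : E2) R).indicator (fun x => M * (1 / ‖x - y‖) ^ (1 : ℝ)) x := by
    intro y x
    by_cases hx : ‖x‖ ≤ R
    · rw [indicator_of_mem (by simpa using hx), rpow_one, abs_mul, abs_div,
        abs_of_nonneg (hf.nonneg x), abs_norm, ← mul_div_assoc, mul_one_div]
      gcongr
      exact hM x
    · rw [hR x (not_le.1 hx)]
      simp only [zero_div, mul_zero, abs_zero]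
      exact indicator_nonneg (fun x _ => by positivity) x
  have hi : ∀ y, Integrable (fun x => f x * (φ x / ‖x - y‖)) := fun y =>
    (hk y).mono' (hf.meas.mul (hφ.div (by measurability))).aestronglyMeasurable
      (ae_of_all _ fun x => hb y x)
  rw [integrable_prod_iff' hmeas.aestronglyMeasurable]
  refine ⟨ae_of_all _ fun y => (integrable_dens_iff hf.meas hf.nonneg).2 (hi y), ?_⟩
  refine (integrable_const (M * (C * 1 ^ 2 + volume.real (closedBall (0 : E2) R)))).mono'
    hmeas.norm.stronglyMeasurable.integral_prod_left'.aestronglyMeasurable (ae_of_all _ fun y => ?_)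
  rw [integral_dens hf.meas hf.nonneg, norm_eq_abs,
    abs_of_nonneg (integral_nonneg fun x => mul_nonneg (hf.nonneg x) (norm_nonneg _))]
  have h1 : ∫ x, f x * ‖φ x / ‖x - y‖‖ ≤
      ∫ x, (closedBall (0 : E2) R).indicator (fun x => M * (1 / ‖x - y‖) ^ (1 : ℝ)) x := by
    refine integral_mono_of_nonneg (ae_of_all _ fun x => mul_nonneg (hf.nonneg x) (norm_nonneg _))
      (hk y) (ae_of_all _ fun x => ?_)
    have := hb y x
    rwa [abs_mul, abs_of_nonneg (hf.nonneg x)] at this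
  refine h1.trans ?_
  rw [integral_indicator hcl, integral_const_mul]
  exact mul_le_mul_of_nonneg_left (h y 1 one_pos _ hcl measure_closedBall_lt_top.ne).2 hM0

end IsRieszDensity
end RegularizedLog

section Divergence

variable {φ : E2 → ℝ} {R M : ℝ}

lemma fderiv_eq_zero_of_norm_lt (hR : ∀ x, R < ‖x‖ → φ x = 0) {x : E2} (hx : R < ‖x‖) :
    fderiv ℝ φ x = 0 := by
  have h : φ =ᶠ[𝓝 x] fun _ => 0 := by
    filter_upwards [continuous_norm.continuousAt.eventually (lt_mem_nhds hx)] with y hy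
    exact hR y hy
  rw [h.fderiv_eq, fderiv_fun_const, Pi.zero_apply]

lemma integrable_fderiv_apply (hM : ∀ x, ‖fderiv ℝ φ x‖ ≤ M) (hR : ∀ x, R < ‖x‖ → φ x = 0)
    {v : E2 → E2} (hv : Continuous v) : Integrable fun x => fderiv ℝ φ x (v x) := by
  obtain ⟨N, hN⟩ := (isCompact_closedBall (0 : E2) R).exists_bound_of_continuousOn hv.continuousOn
  have hs : Function.support (fun x => fderiv ℝ φ x (v x)) ⊆ closedBall 0 R := by
    intro x hx
    by_contra h
    rw [mem_closedBall_zero_iff, not_le] at h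
    exact hx (by simp [fderiv_eq_zero_of_norm_lt hR h])
  rw [← integrableOn_iff_integrable_of_support_subset hs]
  have e0 : IntegrableOn (fun _ => M * N) (closedBall (0 : E2) R) :=
    integrableOn_const measure_closedBall_lt_top.ne
  refine e0.mono' (isBoundedBilinearMap_apply.continuous.measurable.comp
    ((measurable_fderiv ℝ φ).prodMk hv.measurable)).aestronglyMeasurable ?_
  filter_upwards [ae_restrict_mem measurableSet_closedBall] with x hx
  exact (ContinuousLinearMap.le_opNorm _ _).trans (mul_le_mul (hM x) (hN x hx) (norm_nonneg _)
    ((norm_nonneg _).trans (hM x)))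

lemma integrable_of_norm_lt (hφ : Continuous φ) (hR : ∀ x, R < ‖x‖ → φ x = 0) : Integrable φ := by
  refine hφ.integrable_of_hasCompactSupport
    (HasCompactSupport.intro (isCompact_closedBall (0 : E2) R) fun x hx => hR x ?_)
  rwa [mem_closedBall_zero_iff, not_le] at hx

/-- The divergence theorem for the vector field `φ x • (x - p)`. -/
lemma integral_two_mul_add_fderiv (hφ : Differentiable ℝ φ) (hM : ∀ x, ‖fderiv ℝ φ x‖ ≤ M)
    (hR : ∀ x, R < ‖x‖ → φ x = 0) (p : E2) : ∫ x, (2 * φ x + fderiv ℝ φ x (x - p)) = 0 := by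
  have hi := integrable_of_norm_lt hφ.continuous hR
  have hd : ∀ i : Fin 2, ∀ x : E2, HasFDerivAt (fun x : E2 => (x - p) i)
      (EuclideanSpace.proj i : E2 →L[ℝ] ℝ) x := fun i x =>
    (EuclideanSpace.proj i : E2 →L[ℝ] ℝ).hasFDerivAt.comp x ((hasFDerivAt_id x).sub_const p)
  have h1 : ∀ i : Fin 2, Integrable fun x =>
      fderiv ℝ φ x (EuclideanSpace.single i 1) * (x - p) i := by
    intro i
    have := integrable_fderiv_apply hM hR (v := fun x => (x - p) i • EuclideanSpace.single i 1)
      (by fun_prop)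
    refine this.congr (ae_of_all _ fun x => ?_)
    simp only [map_smul, smul_eq_mul]
    ring
  have h2 : ∀ i : Fin 2, ∫ x, φ x =
      -∫ x, fderiv ℝ φ x (EuclideanSpace.single i 1) * (x - p) i := by
    intro i
    have h3 : ∀ x, φ x * fderiv ℝ (fun x : E2 => (x - p) i) x (EuclideanSpace.single i 1) = φ x := by
      intro x
      rw [(hd i x).fderiv]
      simp
    have := integral_mul_fderiv_eq_neg_fderiv_mul_of_integrable (μ := volume) (f := φ)
      (g := fun x : E2 => (x - p) i) (v := EuclideanSpace.single i 1) (h1 i)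
      (by simpa only [h3] using hi) ?_ (fun x _ => hφ x) fun x _ => (hd i x).differentiableAt
    · simpa only [h3] using this
    · refine integrable_of_norm_lt (R := R)
        (hφ.continuous.mul (continuous_iff_continuousAt.2 fun x => (hd i x).continuousAt))
        fun x hx => ?_
      rw [hR x hx, zero_mul]
  have h4 : ∀ x, fderiv ℝ φ x (x - p) =
      ∑ i : Fin 2, fderiv ℝ φ x (EuclideanSpace.single i 1) * (x - p) i := by
    intro x
    have : x - p = ∑ i : Fin 2, (x - p) i • EuclideanSpace.single i (1 : ℝ) := by
      ext j
      fin_cases j <;> simp [Fin.sum_univ_two]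
    conv_lhs => rw [this]
    rw [map_sum]
    exact sum_congr rfl fun i _ => by rw [map_smul, smul_eq_mul, mul_comm]
  have e1 : Integrable fun x => ∑ i : Fin 2, fderiv ℝ φ x (EuclideanSpace.single i 1) * (x - p) i :=
    integrable_finsetSum _ fun i _ => h1 i
  simp_rw [h4]
  rw [integral_add (hi.const_mul 2) e1, integral_const_mul, integral_finsetSum _ fun i _ => h1 i,
    Fin.sum_univ_two]
  linarith [h2 0, h2 1]

end Divergence

section Pohozaev

/-- A density `exp v` times the exponential of a logarithmic potential on the annulus
`a ≤ ‖x - p‖ ^ 2 ≤ b`, and a cutoff function `G` adapted to this annulus. -/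
structure IsPohozaevSetup (κ : ℝ) (f g v : E2 → ℝ) (G : ℝ → ℝ) (p : E2) (a b M : ℝ) : Prop where
  nonneg : 0 ≤ κ
  lt_two : κ < 2
  rieszf : IsRieszDensity κ f
  rieszg : IsRieszDensity κ g
  G_smooth : ContDiff ℝ 1 G
  G_le : ∀ t, |G t| ≤ M
  dG_le : ∀ t, |deriv G t| ≤ M
  G_zero : ∀ t, t ∉ Icc a b → G t = 0
  v_diff : ∀ x, ‖x - p‖ ^ 2 ∈ Icc a b → DifferentiableAt ℝ v x
  v_le : ∀ x, ‖x - p‖ ^ 2 ∈ Icc a b → v x ≤ M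
  dv_le : ∀ x, ‖x - p‖ ^ 2 ∈ Icc a b → ‖fderiv ℝ v x‖ ≤ M
  f_le : ∀ x, ‖x - p‖ ^ 2 ∈ Icc a b → f x ≤ M
  eq : ∀ x, ‖x - p‖ ^ 2 ∈ Icc a b → f x = exp (v x - ∫ y, log ‖x - y‖ ∂dens g)

/-- The divergence of the vector field `G (‖x - p‖ ^ 2) • (x - p)` with respect to `exp v`. -/
def pohozaevDiv (v : E2 → ℝ) (G : ℝ → ℝ) (p x : E2) : ℝ :=
  2 * G (‖x - p‖ ^ 2) + 2 * ‖x - p‖ ^ 2 * deriv G (‖x - p‖ ^ 2) +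
    G (‖x - p‖ ^ 2) * fderiv ℝ v x (x - p)

/-- The interaction kernel of the vector field `G (‖x - p‖ ^ 2) • (x - p)`, regularized at
scale `ε`. -/
def pohozaevKernel (G : ℝ → ℝ) (p : E2) (ε : ℝ) (z : E2 × E2) : ℝ :=
  G (‖z.1 - p‖ ^ 2) * (inner ℝ (z.1 - z.2) (z.1 - p) / (‖z.1 - z.2‖ ^ 2 + ε ^ 2))

namespace IsPohozaevSetup

variable {κ : ℝ} {f g v : E2 → ℝ} {G : ℝ → ℝ} {p : E2} {a b M : ℝ}
  (h : IsPohozaevSetup κ f g v G p a b M)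
include h

lemma M_nonneg : 0 ≤ M := (abs_nonneg _).trans (h.G_le 0)

lemma dG_zero {t : ℝ} (ht : t ∉ Icc a b) : deriv G t = 0 := by
  have h1 : G =ᶠ[𝓝 t] fun _ => 0 := by
    filter_upwards [isClosed_Icc.isOpen_compl.mem_nhds ht] with s hs
    exact h.G_zero s hs
  rw [h1.deriv_eq, deriv_const]

omit h in
lemma norm_sub_le_of_mem {x : E2} (hx : ‖x - p‖ ^ 2 ∈ Icc a b) : ‖x - p‖ ≤ |b| + 1 := by
  have h1 := hx.2.trans (le_abs_self b)
  nlinarith [abs_nonneg b, norm_nonneg (x - p)]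

lemma measurable_div : Measurable (pohozaevDiv v G p) := by
  have h1 : Measurable fun x => fderiv ℝ v x (x - p) :=
    isBoundedBilinearMap_apply.continuous.measurable.comp
      ((measurable_fderiv ℝ v).prodMk (measurable_id.sub_const p))
  have h2 : Measurable fun x : E2 => G (‖x - p‖ ^ 2) :=
    h.G_smooth.continuous.measurable.comp (by fun_prop)
  have h3 : Measurable fun x : E2 => deriv G (‖x - p‖ ^ 2) :=
    (measurable_deriv G).comp (by fun_prop)
  exact ((h2.const_mul 2).add ((measurable_id.sub_const p).norm.pow_const 2 |>.const_mul 2 |>.mul h3)).add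
    (h2.mul h1)

lemma measurable_kernel (ε : ℝ) : Measurable (pohozaevKernel G p ε) := by
  have h2 : Measurable fun x : E2 × E2 => G (‖x.1 - p‖ ^ 2) :=
    h.G_smooth.continuous.measurable.comp (by fun_prop)
  have h3 : Measurable fun z : E2 × E2 => (inner ℝ (z.1 - z.2) (z.1 - p) : ℝ) :=
    Continuous.measurable (by fun_prop)
  exact h2.mul (h3.div (by fun_prop))

lemma abs_div_le (x : E2) :
    |pohozaevDiv v G p x| ≤ 2 * M + 2 * |b| * M + M * (M * (|b| + 1)) := by
  have hM := h.M_nonneg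
  by_cases hx : ‖x - p‖ ^ 2 ∈ Icc a b
  · have h1 := h.G_le (‖x - p‖ ^ 2)
    have h2 := h.dG_le (‖x - p‖ ^ 2)
    have h3 : |fderiv ℝ v x (x - p)| ≤ M * (|b| + 1) :=
      (ContinuousLinearMap.le_opNorm _ _).trans
        (mul_le_mul (h.dv_le x hx) (norm_sub_le_of_mem hx) (norm_nonneg _) hM)
    have h4 : ‖x - p‖ ^ 2 ≤ |b| := hx.2.trans (le_abs_self b)
    refine (abs_add_three _ _ _).trans (add_le_add_three ?_ ?_ ?_)
    · rw [abs_mul, abs_two]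
      linarith
    · rw [abs_mul, abs_mul, abs_two, abs_of_nonneg (sq_nonneg _)]
      gcongr
    · rw [abs_mul]
      gcongr
  · rw [pohozaevDiv, h.G_zero _ hx, h.dG_zero hx]
    simp only [mul_zero, zero_mul, add_zero, abs_zero]
    positivity

lemma integrable_div : Integrable (pohozaevDiv v G p) (dens f) := by
  have := h.rieszf.isFiniteMeasure h.nonneg h.lt_two
  exact (integrable_const _).mono' h.measurable_div.aestronglyMeasurable
    (ae_of_all _ fun x => h.abs_div_le x)

omit h in
lemma abs_kernel_le (ε : ℝ) (z : E2 × E2) :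
    |pohozaevKernel G p ε z| ≤ |G (‖z.1 - p‖ ^ 2)| * ‖z.1 - p‖ / ‖z.1 - z.2‖ := by
  rw [pohozaevKernel, abs_mul, abs_div, mul_div_assoc]
  refine mul_le_mul_of_nonneg_left ?_ (abs_nonneg _)
  rcases eq_or_ne z.1 z.2 with e | e
  · simp [e]
  · have h0 : 0 < ‖z.1 - z.2‖ := norm_pos_iff.2 (sub_ne_zero.2 e)
    have h1 : |‖z.1 - z.2‖ ^ 2 + ε ^ 2| = ‖z.1 - z.2‖ ^ 2 + ε ^ 2 := abs_of_nonneg (by positivity)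
    rw [h1, div_le_div_iff₀ (by positivity) h0]
    have h2 := abs_real_inner_le_norm (z.1 - z.2) (z.1 - p)
    have h3 := mul_le_mul_of_nonneg_right h2 h0.le
    have h4 : 0 ≤ ‖z.1 - p‖ * ε ^ 2 := by positivity
    nlinarith

lemma integrable_majorant {g' : E2 → ℝ} (hg' : IsRieszDensity κ g') : Integrable
    (fun z : E2 × E2 => |G (‖z.1 - p‖ ^ 2)| * ‖z.1 - p‖ / ‖z.1 - z.2‖)
    ((dens f).prod (dens g')) := by
  have hM := h.M_nonneg
  refine h.rieszf.integrable_prod_div hg' h.nonneg h.lt_two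
    (φ := fun x => |G (‖x - p‖ ^ 2)| * ‖x - p‖) (M := M * (M * (|b| + 1))) (R := ‖p‖ + |b| + 1)
    ?_ (fun x => ?_) fun x hx => ?_
  · have h2 : Continuous fun x : E2 => G (‖x - p‖ ^ 2) := h.G_smooth.continuous.comp (by fun_prop)
    exact (h2.abs.mul (by fun_prop)).measurable
  · by_cases hx : ‖x - p‖ ^ 2 ∈ Icc a b
    · rw [abs_of_nonneg (mul_nonneg (abs_nonneg _) (norm_nonneg _))]
      exact mul_le_mul (h.f_le x hx) (mul_le_mul (h.G_le _) (norm_sub_le_of_mem hx)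
        (norm_nonneg _) hM) (by positivity) hM
    · rw [h.G_zero _ hx]
      simp only [abs_zero, zero_mul, mul_zero]
      positivity
  · rw [h.G_zero, abs_zero, zero_mul]
    intro h1
    linarith [norm_sub_le_of_mem h1, norm_le_insert' x p]

lemma integrable_kernel (ε : ℝ) {g' : E2 → ℝ} (hg' : IsRieszDensity κ g') :
    Integrable (pohozaevKernel G p ε) ((dens f).prod (dens g')) :=
  (h.integrable_majorant hg').mono' (h.measurable_kernel ε).aestronglyMeasurable
    (ae_of_all _ fun z => abs_kernel_le ε z)

/-- The ratio between the regularized density and the density. -/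
lemma measurable_ratio {ε : ℝ} (hε : 0 < ε) : Measurable fun x =>
    exp ((∫ y, log ‖x - y‖ ∂dens g) - regLog g ε x) := by
  have := h.rieszg.isFiniteMeasure h.nonneg h.lt_two
  have h1 : Continuous (regLog g ε) := continuous_iff_continuousAt.2 fun x =>
    (h.rieszg.hasFDerivAt_regLog h.nonneg h.lt_two hε x).continuousAt
  have h2 : Measurable fun z : E2 × E2 => log ‖z.1 - z.2‖ := by fun_prop
  exact measurable_exp.comp
    (h2.stronglyMeasurable.integral_prod_right.measurable.sub h1.measurable)

lemma ratio_le_one {ε : ℝ} (hε : 0 < ε) (x : E2) :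
    exp ((∫ y, log ‖x - y‖ ∂dens g) - regLog g ε x) ≤ 1 :=
  exp_le_one_iff.2 (sub_nonpos.2 (h.rieszg.le_regLog h.nonneg h.lt_two hε x))

lemma hasFDerivAt_regularized {ε : ℝ} (hε : 0 < ε) (x : E2) :
    HasFDerivAt (fun x => G (‖x - p‖ ^ 2) * exp (v x - regLog g ε x))
      (exp (v x - regLog g ε x) • ((2 * deriv G (‖x - p‖ ^ 2)) • innerSL ℝ (x - p) +
        G (‖x - p‖ ^ 2) • (fderiv ℝ v x - regGrad g ε x))) x := by
  by_cases hx : ‖x - p‖ ^ 2 ∈ Icc a b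
  · have h1 : HasFDerivAt (fun x : E2 => ‖x - p‖ ^ 2) _ x :=
      ((hasFDerivAt_id x).sub_const p).norm_sq
    have h2 : HasFDerivAt (fun x : E2 => G (‖x - p‖ ^ 2)) _ x :=
      (h.G_smooth.differentiable one_ne_zero _).hasDerivAt.comp_hasFDerivAt x h1
    have h3 := ((h.v_diff x hx).hasFDerivAt.sub
      (h.rieszg.hasFDerivAt_regLog h.nonneg h.lt_two hε x)).exp
    refine (h2.mul h3).congr_fderiv ?_
    ext w
    simp
    ring
  · rw [h.G_zero _ hx, h.dG_zero hx]
    simp only [mul_zero, zero_smul, add_zero, smul_zero]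
    refine (hasFDerivAt_const (0 : ℝ) x).congr_of_eventuallyEq ?_
    have h1 : Continuous fun x : E2 => ‖x - p‖ ^ 2 := by fun_prop
    filter_upwards [h1.continuousAt.eventually (isClosed_Icc.isOpen_compl.mem_nhds hx)] with y hy
    rw [h.G_zero _ hy, zero_mul]

lemma integral_regularized {ε : ℝ} (hε : 0 < ε) :
    ∫ x, exp ((∫ y, log ‖x - y‖ ∂dens g) - regLog g ε x) *
      (pohozaevDiv v G p x - G (‖x - p‖ ^ 2) * regGrad g ε x (x - p)) ∂dens f = 0 := by
  have hM := h.M_nonneg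
  have hc : Continuous (regLog g ε) := continuous_iff_continuousAt.2 fun x =>
    (h.rieszg.hasFDerivAt_regLog h.nonneg h.lt_two hε x).continuousAt
  obtain ⟨L, hL⟩ := (isCompact_closedBall p (|b| + 1)).exists_bound_of_continuousOn hc.continuousOn
  set N := 1 / ε * (dens g).real Set.univ
  have hN : ∀ x, ‖regGrad g ε x‖ ≤ N := h.rieszg.norm_regGrad_le h.nonneg h.lt_two hε
  have hN0 : 0 ≤ N := (norm_nonneg _).trans (hN 0)
  have hd := h.hasFDerivAt_regularized hε
  have key := integral_two_mul_add_fderiv (φ := fun x => G (‖x - p‖ ^ 2) *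
    exp (v x - regLog g ε x)) (M := exp (M + L) * (2 * M * (|b| + 1) + M * (M + N)))
    (R := ‖p‖ + |b| + 1) (fun x => (hd x).differentiableAt) (fun x => ?_) (fun x hx => ?_) p
  · rw [integral_dens h.rieszf.meas h.rieszf.nonneg]
    refine Eq.trans (integral_congr_ae (ae_of_all _ fun x => ?_)) key
    simp only [(hd x).fderiv]
    by_cases hx : ‖x - p‖ ^ 2 ∈ Icc a b
    · rw [h.eq x hx, ← mul_assoc, ← exp_add]
      have e2 : (v x - ∫ y, log ‖x - y‖ ∂dens g) +
          ((∫ y, log ‖x - y‖ ∂dens g) - regLog g ε x) = v x - regLog g ε x := by ring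
      rw [e2, pohozaevDiv]
      simp only [_root_.smul_apply, _root_.add_apply, _root_.sub_apply, innerSL_apply_apply, real_inner_self_eq_norm_sq,
        smul_eq_mul]
      ring
    · simp [pohozaevDiv, h.G_zero _ hx, h.dG_zero hx]
  · rw [(hd x).fderiv]
    by_cases hx : ‖x - p‖ ^ 2 ∈ Icc a b
    · have hxb := norm_sub_le_of_mem hx
      have h1 := hL x (by rwa [mem_closedBall, dist_eq_norm])
      rw [norm_eq_abs] at h1
      rw [norm_smul, norm_eq_abs, abs_exp]
      refine mul_le_mul (exp_le_exp.2 (by linarith [h.v_le x hx, neg_abs_le (regLog g ε x)]))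
        ((norm_add_le _ _).trans (add_le_add ?_ ?_)) (norm_nonneg _) (exp_pos _).le
      · rw [norm_smul, innerSL_apply_norm, norm_eq_abs, abs_mul, abs_two]
        have := h.dG_le (‖x - p‖ ^ 2)
        gcongr
      · rw [norm_smul, norm_eq_abs]
        exact mul_le_mul (h.G_le _) ((norm_sub_le _ _).trans (add_le_add (h.dv_le x hx) (hN x)))
          (norm_nonneg _) hM
    · rw [h.G_zero _ hx, h.dG_zero hx]
      simp only [mul_zero, zero_smul, add_zero, smul_zero, norm_zero]
      positivity
  · rw [h.G_zero, zero_mul]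
    intro h1
    linarith [norm_sub_le_of_mem h1, norm_le_insert' x p]

lemma integral_ratio_mul_div {ε : ℝ} (hε : 0 < ε) :
    ∫ x, exp ((∫ y, log ‖x - y‖ ∂dens g) - regLog g ε x) * pohozaevDiv v G p x ∂dens f =
      ∫ z, exp ((∫ y, log ‖z.1 - y‖ ∂dens g) - regLog g ε z.1) *
        pohozaevKernel G p ε z ∂(dens f).prod (dens g) := by
  have := h.rieszf.isFiniteMeasure h.nonneg h.lt_two
  have := h.rieszg.isFiniteMeasure h.nonneg h.lt_two
  have hu := h.measurable_ratio hε
  have hu1 := h.ratio_le_one hε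
  set u := fun x => exp ((∫ y, log ‖x - y‖ ∂dens g) - regLog g ε x) with hudef
  have hu0 : ∀ x, 0 ≤ u x := fun x => (exp_pos _).le
  have i1 : Integrable (fun x => u x * pohozaevDiv v G p x) (dens f) :=
    h.integrable_div.abs.mono' (hu.mul h.measurable_div).aestronglyMeasurable
      (ae_of_all _ fun x => by
        rw [norm_mul, norm_eq_abs, norm_eq_abs, abs_of_nonneg (hu0 x)]
        exact mul_le_of_le_one_left (abs_nonneg _) (hu1 x))
  have i2 : Integrable (fun z : E2 × E2 => u z.1 * pohozaevKernel G p ε z)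
      ((dens f).prod (dens g)) :=
    (h.integrable_kernel ε h.rieszg).abs.mono'
      ((hu.comp measurable_fst).mul (h.measurable_kernel ε)).aestronglyMeasurable
      (ae_of_all _ fun z => by
        rw [norm_mul, norm_eq_abs, norm_eq_abs, abs_of_nonneg (hu0 z.1)]
        exact mul_le_of_le_one_left (abs_nonneg _) (hu1 z.1))
  have e1 : ∀ x, ∫ y, u x * pohozaevKernel G p ε (x, y) ∂dens g =
      u x * (G (‖x - p‖ ^ 2) * regGrad g ε x (x - p)) := by
    intro x
    rw [integral_const_mul, h.rieszg.regGrad_apply h.nonneg h.lt_two hε]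
    simp only [pohozaevKernel, integral_const_mul]
  have i3 := i2.integral_prod_left
  rw [integral_prod _ i2]
  simp only [e1] at i3 ⊢
  rw [← sub_eq_zero, ← integral_sub i1 i3, ← h.integral_regularized hε]
  refine integral_congr_ae (ae_of_all _ fun x => ?_)
  simp only [hudef]
  ring

/-- The Pohozaev identity for one component of a system. -/
theorem integral_div : ∫ x, pohozaevDiv v G p x ∂dens f =
    ∫ z, pohozaevKernel G p 0 z ∂(dens f).prod (dens g) := by
  have hlim : ∀ x, Tendsto (fun ε => exp ((∫ y, log ‖x - y‖ ∂dens g) - regLog g ε x))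
      (𝓝[>] 0) (𝓝 1) := by
    intro x
    have h1 := (h.rieszg.tendsto_regLog h.nonneg h.lt_two x).const_sub
      (∫ y, log ‖x - y‖ ∂dens g)
    rw [sub_self] at h1
    rw [← exp_zero]
    exact (continuous_exp.tendsto 0).comp h1
  have l1 : Tendsto (fun ε => ∫ x, exp ((∫ y, log ‖x - y‖ ∂dens g) - regLog g ε x) *
      pohozaevDiv v G p x ∂dens f) (𝓝[>] 0) (𝓝 (∫ x, pohozaevDiv v G p x ∂dens f)) := by
    refine tendsto_integral_filter_of_dominated_convergence (fun x => |pohozaevDiv v G p x|) ?_ ?_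
      h.integrable_div.abs (ae_of_all _ fun x => ?_)
    · filter_upwards [self_mem_nhdsWithin] with ε hε
      exact ((h.measurable_ratio hε).mul h.measurable_div).aestronglyMeasurable
    · filter_upwards [self_mem_nhdsWithin] with ε hε
      refine ae_of_all _ fun x => ?_
      rw [norm_mul, norm_eq_abs, norm_eq_abs, abs_exp]
      exact mul_le_of_le_one_left (abs_nonneg _) (h.ratio_le_one hε x)
    · simpa using (hlim x).mul_const (pohozaevDiv v G p x)
  have l2 : Tendsto (fun ε => ∫ z, exp ((∫ y, log ‖z.1 - y‖ ∂dens g) - regLog g ε z.1) *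
      pohozaevKernel G p ε z ∂(dens f).prod (dens g)) (𝓝[>] 0)
      (𝓝 (∫ z, pohozaevKernel G p 0 z ∂(dens f).prod (dens g))) := by
    refine tendsto_integral_filter_of_dominated_convergence _ ?_ ?_
      (h.integrable_majorant h.rieszg) (ae_of_all _ fun z => ?_)
    · filter_upwards [self_mem_nhdsWithin] with ε hε
      exact (((h.measurable_ratio hε).comp measurable_fst).mul
        (h.measurable_kernel ε)).aestronglyMeasurable
    · filter_upwards [self_mem_nhdsWithin] with ε hε
      refine ae_of_all _ fun z => ?_
      rw [norm_mul, norm_eq_abs, norm_eq_abs, abs_exp]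
      exact (mul_le_of_le_one_left (abs_nonneg _) (h.ratio_le_one hε z.1)).trans
        (abs_kernel_le ε z)
    · have h2 : Tendsto (fun ε => pohozaevKernel G p ε z) (𝓝[>] 0)
          (𝓝 (pohozaevKernel G p 0 z)) := by
        refine Tendsto.mono_left ?_ nhdsWithin_le_nhds
        rcases eq_or_ne z.1 z.2 with e | e
        · simp only [pohozaevKernel, e, sub_self, inner_zero_left, zero_div, mul_zero]
          exact tendsto_const_nhds
        · have h0 : 0 < ‖z.1 - z.2‖ := norm_pos_iff.2 (sub_ne_zero.2 e)
          refine ContinuousAt.tendsto (f := fun ε => pohozaevKernel G p ε z) ?_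
          unfold pohozaevKernel
          exact continuousAt_const.mul (continuousAt_const.div (by fun_prop) (by positivity))
      simpa using (hlim z.1).mul h2
  refine tendsto_nhds_unique l1 (l2.congr' ?_)
  filter_upwards [self_mem_nhdsWithin] with ε hε
  exact (h.integral_ratio_mul_div hε).symm

end IsPohozaevSetup

end Pohozaev

section Cutoff

lemma exists_deriv_smoothTransition_le :
    ∃ N, 0 ≤ N ∧ (∀ t, |deriv smoothTransition t| ≤ N) ∧
      ∀ t ∉ Icc (0 : ℝ) 1, deriv smoothTransition t = 0 := by
  have hc : Continuous (deriv smoothTransition) :=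
    (smoothTransition.contDiff (n := 1)).continuous_deriv le_rfl
  obtain ⟨N, hN⟩ := (isCompact_Icc (a := (0 : ℝ)) (b := 1)).exists_bound_of_continuousOn
    hc.continuousOn
  have h0 : ∀ t ∉ Icc (0 : ℝ) 1, deriv smoothTransition t = 0 := by
    intro t ht
    rw [Set.mem_Icc, not_and_or, not_le, not_le] at ht
    rcases ht with ht | ht
    · exact IsLocalMin.deriv_eq_zero (Eventually.of_forall fun u => by
        rw [smoothTransition.zero_of_nonpos ht.le]
        exact smoothTransition.nonneg u)
    · exact IsLocalMax.deriv_eq_zero (Eventually.of_forall fun u => by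
        rw [smoothTransition.one_of_one_le ht.le]
        exact smoothTransition.le_one u)
  have hN0 : 0 ≤ N := (norm_nonneg _).trans (hN 0 ⟨le_rfl, zero_le_one⟩)
  refine ⟨N, hN0, fun t => ?_, h0⟩
  by_cases ht : t ∈ Icc (0 : ℝ) 1
  · exact hN t ht
  · rw [h0 t ht, abs_zero]
    exact hN0

/-- Scale invariant radial cutoff functions, as functions of the square of the radius. -/
lemma exists_annular_cutoff : ∃ N, 0 ≤ N ∧ ∀ s τ : ℝ, 0 < τ → 2 * τ < s → ∃ G : ℝ → ℝ,
    ContDiff ℝ 1 G ∧ (∀ t, 0 ≤ G t) ∧ (∀ t, G t ≤ 1) ∧ (∀ t, |t * deriv G t| ≤ N) ∧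
    (∀ t ∉ Icc (τ ^ 2) (4 * s ^ 2), G t = 0) ∧
    ∀ t ∈ Icc (4 * τ ^ 2) (s ^ 2), G t = 1 := by
  obtain ⟨N, hN0, hN, hz⟩ := exists_deriv_smoothTransition_le
  have hst : ContDiff ℝ 1 smoothTransition := smoothTransition.contDiff
  refine ⟨4 * N, by positivity, fun s τ hτ hs => ⟨fun t =>
    smoothTransition ((4 - t / s ^ 2) / 3) * smoothTransition ((t / τ ^ 2 - 1) / 3),
    ?_, ?_, ?_, ?_, ?_, ?_⟩⟩
  · exact (hst.comp (by fun_prop)).mul (hst.comp (by fun_prop))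
  · exact fun t => mul_nonneg (smoothTransition.nonneg _) (smoothTransition.nonneg _)
  · exact fun t => mul_le_one₀ (smoothTransition.le_one _) (smoothTransition.nonneg _)
      (smoothTransition.le_one _)
  · intro t
    have hs0 : 0 < s := by linarith
    have hd : ∀ w, HasDerivAt smoothTransition (deriv smoothTransition w) w :=
      fun w => (hst.differentiable one_ne_zero w).hasDerivAt
    have d1 : HasDerivAt (fun t : ℝ => (4 - t / s ^ 2) / 3) (-(1 / s ^ 2) / 3) t :=
      (((hasDerivAt_id t).div_const (s ^ 2)).const_sub 4).div_const 3
    have d2 : HasDerivAt (fun t : ℝ => (t / τ ^ 2 - 1) / 3) (1 / τ ^ 2 / 3) t :=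
      (((hasDerivAt_id t).div_const (τ ^ 2)).sub_const 1).div_const 3
    have d3 := ((hd _).comp t d1).mul ((hd _).comp t d2)
    have b1 : |deriv smoothTransition ((4 - t / s ^ 2) / 3) * (t / s ^ 2)| ≤ N * 4 := by
      by_cases h : (4 - t / s ^ 2) / 3 ∈ Icc (0 : ℝ) 1
      · rw [abs_mul]
        refine mul_le_mul (hN _) (abs_le.2 ⟨?_, ?_⟩) (abs_nonneg _) hN0 <;> linarith [h.1, h.2]
      · rw [hz _ h, zero_mul, abs_zero]
        positivity
    have b2 : |deriv smoothTransition ((t / τ ^ 2 - 1) / 3) * (t / τ ^ 2)| ≤ N * 4 := by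
      by_cases h : (t / τ ^ 2 - 1) / 3 ∈ Icc (0 : ℝ) 1
      · rw [abs_mul]
        refine mul_le_mul (hN _) (abs_le.2 ⟨?_, ?_⟩) (abs_nonneg _) hN0 <;> linarith [h.1, h.2]
      · rw [hz _ h, zero_mul, abs_zero]
        positivity
    have e : t * deriv (fun t => smoothTransition ((4 - t / s ^ 2) / 3) *
        smoothTransition ((t / τ ^ 2 - 1) / 3)) t =
        -(deriv smoothTransition ((4 - t / s ^ 2) / 3) * (t / s ^ 2)) / 3 *
          smoothTransition ((t / τ ^ 2 - 1) / 3) +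
        smoothTransition ((4 - t / s ^ 2) / 3) *
          ((deriv smoothTransition ((t / τ ^ 2 - 1) / 3) * (t / τ ^ 2)) / 3) := by
      rw [HasDerivAt.deriv (f := fun t => smoothTransition ((4 - t / s ^ 2) / 3) *
        smoothTransition ((t / τ ^ 2 - 1) / 3)) d3]
      simp only [Function.comp_apply]
      ring
    rw [e]
    have c1 := smoothTransition.le_one ((t / τ ^ 2 - 1) / 3)
    have c2 := smoothTransition.le_one ((4 - t / s ^ 2) / 3)
    have c3 := smoothTransition.nonneg ((t / τ ^ 2 - 1) / 3)
    have c4 := smoothTransition.nonneg ((4 - t / s ^ 2) / 3)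
    refine (abs_add_le _ _).trans ?_
    rw [abs_mul, abs_mul, abs_of_nonneg c3, abs_of_nonneg c4, abs_div, abs_div, abs_neg,
      abs_of_pos (three_pos (α := ℝ))]
    have f1 := mul_le_mul (div_le_div_of_nonneg_right b1 (three_pos (α := ℝ)).le) c1 c3
      (by positivity)
    have f2 := mul_le_mul c2 (div_le_div_of_nonneg_right b2 (three_pos (α := ℝ)).le)
      (by positivity) zero_le_one
    linarith
  · intro t ht
    rw [Set.mem_Icc, not_and_or, not_le, not_le] at ht
    rcases ht with ht | ht
    · have h1 : t / τ ^ 2 < 1 := (div_lt_one (by positivity)).2 ht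
      simp only
      rw [smoothTransition.zero_of_nonpos (x := (t / τ ^ 2 - 1) / 3) (by linarith), mul_zero]
    · have hs0 : 0 < s := by linarith
      have h1 : 4 < t / s ^ 2 := (lt_div_iff₀ (by positivity)).2 ht
      simp only
      rw [smoothTransition.zero_of_nonpos (x := (4 - t / s ^ 2) / 3) (by linarith), zero_mul]
  · intro t ht
    have hs0 : 0 < s := by linarith
    have h1 : 4 ≤ t / τ ^ 2 := (le_div_iff₀ (by positivity)).2 ht.1
    have h2 : t / s ^ 2 ≤ 1 := (div_le_one (by positivity)).2 ht.2
    simp only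
    rw [smoothTransition.one_of_one_le (by linarith),
      smoothTransition.one_of_one_le (by linarith), one_mul]

variable {G : ℝ → ℝ}

lemma deriv_eq_zero_of_eq_one (h1 : ∀ t, G t ≤ 1) {t : ℝ} (ht : G t = 1) : deriv G t = 0 :=
  IsLocalMax.deriv_eq_zero (Eventually.of_forall fun u => by rw [ht]; exact h1 u)

lemma deriv_eq_zero_of_eq_zero (h0 : ∀ t, 0 ≤ G t) {t : ℝ} (ht : G t = 0) : deriv G t = 0 :=
  IsLocalMin.deriv_eq_zero (Eventually.of_forall fun u => by rw [ht]; exact h0 u)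

/-- The vector field `G (‖a‖ ^ 2) • a` is Lipschitz. -/
lemma norm_smul_sub_smul_le (hG : Differentiable ℝ G) (h0 : ∀ t, 0 ≤ G t) (h1 : ∀ t, G t ≤ 1)
    {N : ℝ} (hN : ∀ t, |t * deriv G t| ≤ N) (a b : E2) :
    ‖G (‖a‖ ^ 2) • a - G (‖b‖ ^ 2) • b‖ ≤ (1 + 2 * N) * ‖a - b‖ := by
  have hd : ∀ x : E2, HasFDerivAt (fun x : E2 => G (‖x‖ ^ 2) • x)
      (G (‖x‖ ^ 2) • ContinuousLinearMap.id ℝ E2 +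
        (deriv G (‖x‖ ^ 2) • (2 • innerSL ℝ x)).smulRight x) x := by
    intro x
    have h2 : HasFDerivAt (fun x : E2 => ‖x‖ ^ 2) (2 • innerSL ℝ x) x := by
      simpa using (hasFDerivAt_id x).norm_sq
    exact ((hG _).hasDerivAt.comp_hasFDerivAt x h2).smul (hasFDerivAt_id x)
  refine Convex.norm_image_sub_le_of_norm_hasFDerivWithin_le (s := Set.univ)
    (fun x _ => (hd x).hasFDerivWithinAt) (fun x _ => ?_) convex_univ (Set.mem_univ b)
    (Set.mem_univ a)
  refine ContinuousLinearMap.opNorm_le_bound _ (by linarith [(abs_nonneg _).trans (hN 0)])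
    fun v => ?_
  simp only [_root_.add_apply, _root_.smul_apply, ContinuousLinearMap.id_apply,
    ContinuousLinearMap.smulRight_apply, innerSL_apply_apply]
  refine (norm_add_le _ _).trans ?_
  rw [norm_smul, norm_smul, norm_eq_abs, abs_of_nonneg (h0 _)]
  have h3 : G (‖x‖ ^ 2) * ‖v‖ ≤ 1 * ‖v‖ := mul_le_mul_of_nonneg_right (h1 _) (norm_nonneg v)
  have h4 : ‖deriv G (‖x‖ ^ 2) • 2 • (inner ℝ x v : ℝ)‖ * ‖x‖ ≤ 2 * N * ‖v‖ := by
    have h5 := hN (‖x‖ ^ 2)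
    rw [abs_mul, abs_of_nonneg (sq_nonneg _)] at h5
    have h6 := abs_real_inner_le_norm x v
    rw [smul_eq_mul, norm_mul, nsmul_eq_mul, norm_eq_abs, norm_eq_abs, abs_mul]
    have h7 : |((2 : ℕ) : ℝ)| = 2 := by norm_num
    rw [h7]
    calc |deriv G (‖x‖ ^ 2)| * (2 * |(inner ℝ x v : ℝ)|) * ‖x‖
        ≤ |deriv G (‖x‖ ^ 2)| * (2 * (‖x‖ * ‖v‖)) * ‖x‖ := by gcongr
      _ = 2 * (‖x‖ ^ 2 * |deriv G (‖x‖ ^ 2)|) * ‖v‖ := by ring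
      _ ≤ 2 * N * ‖v‖ := by gcongr
  linarith

/-- The symmetrized interaction kernel of a cutoff of the position vector field is close to the
product of the indicator functions of the ball. -/
lemma abs_symm_kernel_sub_le (hG : Differentiable ℝ G) (h0 : ∀ t, 0 ≤ G t) (h1 : ∀ t, G t ≤ 1)
    {N s τ T : ℝ} (hN : ∀ t, |t * deriv G t| ≤ N) (hτ : 0 < τ) (hs : 2 * τ < s) (hT : 4 ≤ T)
    (hz : ∀ t ∉ Icc (τ ^ 2) (4 * s ^ 2), G t = 0)
    (ho : ∀ t ∈ Icc (4 * τ ^ 2) (s ^ 2), G t = 1) (p : E2) {x y : E2} (hxy : x ≠ y) :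
    |pohozaevKernel G p 0 (x, y) + pohozaevKernel G p 0 (y, x) -
      (closedBall p s).indicator 1 x * (closedBall p s).indicator 1 y| ≤
      (2 + 2 * N) * ((closedBall p (T * s) \ closedBall p s ∪ closedBall p (2 * τ)).indicator 1 x +
        (closedBall p (T * s) \ closedBall p s ∪ closedBall p (2 * τ)).indicator 1 y) + 2 / T := by
  have hs0 : 0 < s := by linarith
  have hN0 : 0 ≤ N := (abs_nonneg _).trans (hN 0)
  set D := closedBall p (T * s) \ closedBall p s ∪ closedBall p (2 * τ) with hD
  have hd : 0 < ‖x - y‖ := norm_pos_iff.2 (sub_ne_zero.2 hxy)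
  have hK : pohozaevKernel G p 0 (x, y) + pohozaevKernel G p 0 (y, x) =
      inner ℝ (x - y) (G (‖x - p‖ ^ 2) • (x - p) - G (‖y - p‖ ^ 2) • (y - p)) / ‖x - y‖ ^ 2 := by
    simp only [pohozaevKernel]
    rw [norm_sub_rev y x, ← neg_sub x y, inner_neg_left,
      inner_sub_right (x - y) (G (‖x - p‖ ^ 2) • (x - p)), real_inner_smul_right,
      real_inner_smul_right]
    simp only [ne_eq, OfNat.ofNat_ne_zero, not_false_eq_true, zero_pow, add_zero]
    ring
  have hKle : ∀ c, ‖G (‖x - p‖ ^ 2) • (x - p) - G (‖y - p‖ ^ 2) • (y - p)‖ ≤ c * ‖x - y‖ →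
      |pohozaevKernel G p 0 (x, y) + pohozaevKernel G p 0 (y, x)| ≤ c := by
    intro c hc
    rw [hK, abs_div, abs_of_nonneg (sq_nonneg ‖x - y‖), div_le_iff₀ (by positivity)]
    have := (abs_real_inner_le_norm (x - y) _).trans (mul_le_mul_of_nonneg_left hc hd.le)
    linarith
  have hcases : ∀ w, w ∈ D ∨ (w ∈ closedBall p s ∧ G (‖w - p‖ ^ 2) = 1) ∨
      (w ∉ closedBall p s ∧ T * s < ‖w - p‖ ∧ G (‖w - p‖ ^ 2) = 0) := by
    intro w
    by_cases h : w ∈ D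
    · exact Or.inl h
    · simp only [hD, Set.mem_union, Set.mem_sdiff, mem_closedBall, dist_eq_norm, not_or, not_and_or,
        not_le] at h ⊢
      refine Or.inr ?_
      rcases le_or_gt ‖w - p‖ s with h2 | h2
      · refine Or.inl ⟨h2, ho _ ⟨?_, ?_⟩⟩
        · nlinarith [h.2]
        · exact pow_le_pow_left₀ (norm_nonneg _) h2 2
      · refine Or.inr ⟨h2, ?_, hz _ fun h3 => ?_⟩
        · exact h.1.resolve_right (not_not.2 h2)
        · have h4 := h.1.resolve_right (not_not.2 h2)
          have h5 : 4 * s < ‖w - p‖ := lt_of_le_of_lt (mul_le_mul_of_nonneg_right hT hs0.le) h4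
          nlinarith [h3.2]
  have hi : ∀ S : Set E2, ∀ w, 0 ≤ S.indicator (1 : E2 → ℝ) w :=
    fun S w => indicator_nonneg (fun _ _ => zero_le_one) w
  have hi1 : ∀ S : Set E2, ∀ w, S.indicator (1 : E2 → ℝ) w ≤ 1 :=
    fun S w => Set.indicator_le_self' (fun _ _ => zero_le_one) w
  have hT0 : 0 < 2 / T := by positivity
  have hbig : |pohozaevKernel G p 0 (x, y) + pohozaevKernel G p 0 (y, x) -
      (closedBall p s).indicator 1 x * (closedBall p s).indicator 1 y| ≤ 2 + 2 * N := by
    have e1 := hKle (1 + 2 * N) (by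
      have := norm_smul_sub_smul_le hG h0 h1 hN (x - p) (y - p)
      rwa [sub_sub_sub_cancel_right] at this)
    have e2 := mul_nonneg (hi (closedBall p s) x) (hi (closedBall p s) y)
    have e3 := mul_le_one₀ (hi1 (closedBall p s) x) (hi (closedBall p s) y)
      (hi1 (closedBall p s) y)
    rw [abs_le] at e1 ⊢
    constructor <;> linarith [e1.1, e1.2]
  have hfar : ∀ u w : E2, ‖u - p‖ ≤ s → T * s < ‖w - p‖ → ‖u - p‖ ≤ 2 / T * ‖u - w‖ := by
    intro u w hu hw
    have h2 : ‖w - p‖ ≤ ‖u - w‖ + ‖u - p‖ := by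
      rw [norm_sub_rev u w]; exact norm_sub_le_norm_sub_add_norm_sub _ _ _
    rw [div_mul_eq_mul_div, le_div_iff₀ (by linarith)]
    nlinarith [norm_nonneg (u - p)]
  rcases hcases x with hx | hx | hx
  · rw [indicator_of_mem hx (1 : E2 → ℝ)]
    have := mul_nonneg (show 0 ≤ 2 + 2 * N by positivity) (hi D y)
    simp only [Pi.one_apply]
    linarith
  · rcases hcases y with hy | hy | hy
    · rw [indicator_of_mem hy (1 : E2 → ℝ)]
      have := mul_nonneg (show 0 ≤ 2 + 2 * N by positivity) (hi D x)
      simp only [Pi.one_apply]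
      linarith
    · rw [indicator_of_mem hx.1, indicator_of_mem hy.1, hK, hx.2, hy.2, one_smul, one_smul,
        sub_sub_sub_cancel_right, real_inner_self_eq_norm_sq, div_self (by positivity)]
      simp only [Pi.one_apply, mul_one, sub_self, abs_zero]
      have := hi D x
      have := hi D y
      positivity
    · rw [indicator_of_notMem hy.1, mul_zero, sub_zero]
      have hx1 := hx.1
      rw [mem_closedBall, dist_eq_norm] at hx1
      have e := hKle (2 / T) (by
        rw [hx.2, hy.2.2, one_smul, zero_smul, sub_zero]
        exact hfar x y hx1 hy.2.1)
      have := hi D x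
      have := hi D y
      have : 0 ≤ (2 + 2 * N) * (D.indicator 1 x + D.indicator 1 y) := by positivity
      linarith
  · rw [indicator_of_notMem hx.1, zero_mul, sub_zero]
    rcases hcases y with hy | hy | hy
    · have e1 := hKle (1 + 2 * N) (by
        have := norm_smul_sub_smul_le hG h0 h1 hN (x - p) (y - p)
        rwa [sub_sub_sub_cancel_right] at this)
      rw [indicator_of_mem hy (1 : E2 → ℝ)]
      have := mul_nonneg (show 0 ≤ 2 + 2 * N by positivity) (hi D x)
      simp only [Pi.one_apply]
      linarith
    · have hy1 := hy.1
      rw [mem_closedBall, dist_eq_norm] at hy1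
      have e := hKle (2 / T) (by
        rw [hy.2, hx.2.2, one_smul, zero_smul, zero_sub, norm_neg, norm_sub_rev x y]
        exact hfar y x hy1 hx.2.1)
      have := hi D x
      have := hi D y
      have : 0 ≤ (2 + 2 * N) * (D.indicator 1 x + D.indicator 1 y) := by positivity
      linarith
    · have e := hKle 0 (by rw [hx.2.2, hy.2.2, zero_smul, zero_smul, sub_zero, norm_zero, zero_mul])
      have := hi D x
      have := hi D y
      have : 0 ≤ (2 + 2 * N) * (D.indicator 1 x + D.indicator 1 y) := by positivity
      linarith

end Cutoff

section PohozaevEstimate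
open Matrix

lemma ae_prod_dens_ne (f g : E2 → ℝ) [SFinite (dens f)] [SFinite (dens g)] :
    ∀ᵐ z ∂(dens f).prod (dens g), z.1 ≠ z.2 := by
  have hm : MeasurableSet {z : E2 × E2 | z.1 ≠ z.2} :=
    (isOpen_ne_fun continuous_fst continuous_snd).measurableSet
  refine (Measure.ae_prod_mem_iff_ae_ae_mem hm).2 (ae_of_all _ fun x => ?_)
  filter_upwards [ae_ne_dens g x] with y hy
  exact hy.symm

lemma abs_integral_prod_sub_le {μ ν : Measure E2} [IsFiniteMeasure μ] [IsFiniteMeasure ν]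
    {k : E2 × E2 → ℝ} (hk : Integrable k (μ.prod ν)) {S D : Set E2} (hS : MeasurableSet S)
    (hD : MeasurableSet D) {c e : ℝ}
    (h : ∀ᵐ z ∂μ.prod ν, |k z - S.indicator 1 z.1 * S.indicator 1 z.2| ≤
      c * (D.indicator 1 z.1 + D.indicator 1 z.2) + e) :
    |∫ z, k z ∂μ.prod ν - μ.real S * ν.real S| ≤
      c * (μ.real D * ν.real Set.univ + μ.real Set.univ * ν.real D) +
        e * (μ.real Set.univ * ν.real Set.univ) := by
  have hind : ∀ (μ : Measure E2) [IsFiniteMeasure μ] (S : Set E2), MeasurableSet S →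
      Integrable (S.indicator (1 : E2 → ℝ)) μ := fun μ _ S hS =>
    (integrable_const (1 : ℝ)).indicator hS
  have e1 : ∫ z, S.indicator (1 : E2 → ℝ) z.1 * S.indicator (1 : E2 → ℝ) z.2 ∂μ.prod ν =
      μ.real S * ν.real S := by
    rw [integral_prod_mul (S.indicator (1 : E2 → ℝ)) (S.indicator (1 : E2 → ℝ)),
      integral_indicator_one hS, integral_indicator_one hS]
  have i1 := (hind μ S hS).mul_prod (hind ν S hS)
  have j1 : Integrable (fun z : E2 × E2 => D.indicator (1 : E2 → ℝ) z.1) (μ.prod ν) :=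
    (hind μ D hD).comp_fst ν
  have j2 : Integrable (fun z : E2 × E2 => D.indicator (1 : E2 → ℝ) z.2) (μ.prod ν) :=
    (hind ν D hD).comp_snd μ
  have j3 : Integrable (fun z : E2 × E2 => c * (D.indicator (1 : E2 → ℝ) z.1 +
      D.indicator (1 : E2 → ℝ) z.2)) (μ.prod ν) := (j1.add j2).const_mul c
  rw [← e1, ← integral_sub hk i1]
  have j4 : Integrable (fun z : E2 × E2 => c * (D.indicator (1 : E2 → ℝ) z.1 +
      D.indicator (1 : E2 → ℝ) z.2) + e) (μ.prod ν) := j3.add (integrable_const e)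
  refine (norm_integral_le_of_norm_le (f := fun z : E2 × E2 => k z -
    S.indicator (1 : E2 → ℝ) z.1 * S.indicator (1 : E2 → ℝ) z.2) j4 h).trans_eq ?_
  rw [integral_add j3 (integrable_const e), integral_const_mul, integral_add j1 j2,
    integral_fun_fst (D.indicator (1 : E2 → ℝ)), integral_fun_snd (D.indicator (1 : E2 → ℝ)),
    integral_indicator_one hD, integral_indicator_one hD, integral_const, smul_eq_mul, smul_eq_mul,
    smul_eq_mul, ← Set.univ_prod_univ, measureReal_prod_prod]
  ring

namespace LiouvillePotential

variable {n : ℕ} {A : Matrix (Fin n) (Fin n) ℝ} {γ r B : ℝ} (P : LiouvillePotential A γ r B)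

/-- The logarithm of the density without its logarithmic potential. -/
def v (i : Fin n) (x : E2) : ℝ := γ * log (‖x‖ ^ 2) + log (P.H i x) + P.c i

lemma H_pos (hB : 0 < B) (i : Fin n) {x : E2} (hx : x ≠ 0) (hr : ‖x‖ < r) : 0 < P.H i x :=
  (inv_pos.2 hB).trans_le (P.le_H i x hx hr)

lemma hasFDerivAt_v (hB : 0 < B) (i : Fin n) {x : E2} (hx : x ≠ 0) (hr : ‖x‖ < r) :
    HasFDerivAt (P.v i) ((2 * γ / ‖x‖ ^ 2) • innerSL ℝ x + (P.H i x)⁻¹ • fderiv ℝ (P.H i) x) x := by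
  have h1 : HasFDerivAt (fun x : E2 => ‖x‖ ^ 2) (2 • innerSL ℝ x) x := by
    simpa using (hasFDerivAt_id x).norm_sq
  have h2 := (h1.log (pow_ne_zero 2 (norm_ne_zero_iff.2 hx))).const_mul γ
  have h3 := (P.H_diff i x hx hr).hasFDerivAt.log (P.H_pos hB i hx hr).ne'
  refine ((h2.add h3).add_const (P.c i)).congr_fderiv ?_
  ext w
  simp
  ring

lemma f_eq_exp (hB : 0 < B) (i : Fin n) {x : E2} (hx : x ≠ 0) (hr : ‖x‖ < r) :
    P.f i x = exp (P.v i x - ∫ y, log ‖x - y‖ ∂P.ν i) := by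
  have h0 : 0 < ‖x‖ := norm_pos_iff.2 hx
  have e : P.v i x - ∫ y, log ‖x - y‖ ∂P.ν i = log ‖x‖ * (2 * γ) +
      (log (P.H i x) + (P.c i - ∫ y, log ‖x - y‖ ∂P.ν i)) := by
    rw [v, log_pow]
    push_cast
    ring
  rw [e, exp_add, exp_add, exp_log (P.H_pos hB i hx hr), P.eq i x hx hr,
    rpow_def_of_pos h0]
  rfl

variable (hγ : -1 < γ) (hA : ∀ i j, 0 ≤ A i j)

include hγ hA in
lemma exists_isPohozaevSetup (hB : 0 < B) {G : ℝ → ℝ} (hG : ContDiff ℝ 1 G) (h0 : ∀ t, 0 ≤ G t)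
    (h1 : ∀ t, G t ≤ 1) {N τ b : ℝ} (hN : ∀ t, |t * deriv G t| ≤ N) (hτ : 0 < τ)
    (hz : ∀ t ∉ Icc (τ ^ 2) b, G t = 0) {p : E2}
    (hS : ∀ x : E2, ‖x - p‖ ^ 2 ∈ Icc (τ ^ 2) b → τ ≤ ‖x‖ ∧ ‖x‖ < r) (i : Fin n) :
    ∃ M, IsPohozaevSetup (singExp γ) (P.f i) (fun y => ∑ j, A i j * P.f j y) (P.v i) G p
      (τ ^ 2) b M := by
  obtain ⟨Mf, R, hMf, hf, -⟩ := (P.riesz i).bound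
  have hN0 : 0 ≤ N := (abs_nonneg _).trans (hN 0)
  have m2 : 0 ≤ N / τ ^ 2 := by positivity
  have m3 : 0 ≤ |γ| * (|log (τ ^ 2)| + |log (r ^ 2)|) + |log B| + |P.c i| := by
    positivity
  have m4 : 0 ≤ |2 * γ| / τ + B * B := by positivity
  have m5 : 0 ≤ Mf * (1 / τ) ^ singExp γ := by positivity
  set M := 1 + N / τ ^ 2 + (|γ| * (|log (τ ^ 2)| + |log (r ^ 2)|) + |log B| +
    |P.c i|) + (|2 * γ| / τ + B * B) + Mf * (1 / τ) ^ singExp γ with hM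
  have hx0 : ∀ x : E2, ‖x - p‖ ^ 2 ∈ Icc (τ ^ 2) b → x ≠ 0 := fun x hx =>
    norm_pos_iff.1 (hτ.trans_le (hS x hx).1)
  refine ⟨M, singExp_nonneg γ, singExp_lt_two hγ, P.riesz i, P.riesz_ν hA i, hG, fun t => ?_,
    fun t => ?_, hz, fun x hx => ?_, fun x hx => ?_, fun x hx => ?_, fun x hx => ?_, fun x hx => ?_⟩
  · rw [abs_of_nonneg (h0 t)]
    linarith [h1 t]
  · have key : |deriv G t| ≤ N / τ ^ 2 := by
      by_cases ht : t ∈ Icc (τ ^ 2) b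
      · have ht0 : 0 < t := lt_of_lt_of_le (by positivity) ht.1
        have := hN t
        rw [abs_mul, abs_of_pos ht0] at this
        rw [le_div_iff₀ (by positivity), mul_comm]
        exact (mul_le_mul_of_nonneg_right ht.1 (abs_nonneg _)).trans this
      · rw [deriv_eq_zero_of_eq_zero h0 (hz t ht), abs_zero]
        exact m2
    linarith
  · exact (P.hasFDerivAt_v hB i (hx0 x hx) (hS x hx).2).differentiableAt
  · have hxp : 0 < ‖x‖ := hτ.trans_le (hS x hx).1
    have e1 : |log (‖x‖ ^ 2)| ≤ |log (τ ^ 2)| + |log (r ^ 2)| := by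
      have a1 := log_le_log (by positivity : 0 < τ ^ 2)
        (pow_le_pow_left₀ hτ.le (hS x hx).1 2)
      have a2 := log_le_log (by positivity : 0 < ‖x‖ ^ 2)
        (pow_le_pow_left₀ hxp.le (hS x hx).2.le 2)
      have a3 := neg_abs_le (log (τ ^ 2))
      have a4 := le_abs_self (log (r ^ 2))
      have a5 := abs_nonneg (log (τ ^ 2))
      have a6 := abs_nonneg (log (r ^ 2))
      exact abs_le.2 ⟨by linarith, by linarith⟩
    have e2 : γ * log (‖x‖ ^ 2) ≤ |γ| * (|log (τ ^ 2)| + |log (r ^ 2)|) := by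
      refine (le_abs_self _).trans ?_
      rw [abs_mul]
      gcongr
    have e3 : log (P.H i x) ≤ |log B| :=
      (log_le_log (P.H_pos hB i (hx0 x hx) (hS x hx).2)
        (P.H_le i x (hx0 x hx) (hS x hx).2)).trans (le_abs_self _)
    rw [v]
    linarith [le_abs_self (P.c i)]
  · have hxp : 0 < ‖x‖ := hτ.trans_le (hS x hx).1
    rw [(P.hasFDerivAt_v hB i (hx0 x hx) (hS x hx).2).fderiv]
    have hH := P.H_pos hB i (hx0 x hx) (hS x hx).2
    have e1 : ‖(2 * γ / ‖x‖ ^ 2) • innerSL ℝ x‖ ≤ |2 * γ| / τ := by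
      rw [norm_smul, innerSL_apply_norm, norm_div, norm_eq_abs, norm_eq_abs,
        abs_of_nonneg (sq_nonneg ‖x‖), div_mul_eq_mul_div, div_le_div_iff₀ (by positivity) hτ]
      have := (hS x hx).1
      have h5 := abs_nonneg (2 * γ)
      calc |2 * γ| * ‖x‖ * τ ≤ |2 * γ| * ‖x‖ * ‖x‖ := by gcongr
        _ = |2 * γ| * ‖x‖ ^ 2 := by ring
    have e2 : ‖(P.H i x)⁻¹ • fderiv ℝ (P.H i) x‖ ≤ B * B := by
      rw [norm_smul, norm_eq_abs, abs_of_pos (inv_pos.2 hH)]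
      exact mul_le_mul ((inv_le_comm₀ hH hB).2 (P.le_H i x (hx0 x hx) (hS x hx).2))
        (P.H_grad i x (hx0 x hx) (hS x hx).2) (norm_nonneg _) hB.le
    linarith [norm_add_le ((2 * γ / ‖x‖ ^ 2) • innerSL ℝ x) ((P.H i x)⁻¹ • fderiv ℝ (P.H i) x)]
  · have hxp : 0 < ‖x‖ := hτ.trans_le (hS x hx).1
    have e1 : (1 / ‖x‖) ^ singExp γ ≤ (1 / τ) ^ singExp γ :=
      rpow_le_rpow (by positivity) (one_div_le_one_div_of_le hτ (hS x hx).1)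
        (singExp_nonneg γ)
    linarith [hf x, mul_le_mul_of_nonneg_left e1 hMf]
  · exact P.f_eq_exp hB i (hx0 x hx) (hS x hx).2

include hγ in
/-- The Pohozaev identity. -/
lemma two_mul_sum_integral_div (hsymm : A.IsSymm) {G : ℝ → ℝ} {p : E2} {a b : ℝ} {M : Fin n → ℝ}
    (h : ∀ i, IsPohozaevSetup (singExp γ) (P.f i) (fun y => ∑ j, A i j * P.f j y) (P.v i) G p
      a b (M i)) (hA : ∀ i j, 0 ≤ A i j) :
    2 * ∑ i, ∫ x, pohozaevDiv (P.v i) G p x ∂P.ρ i = ∑ i, ∑ j, A i j *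
      ∫ z, (pohozaevKernel G p 0 z + pohozaevKernel G p 0 z.swap) ∂(P.ρ i).prod (P.ρ j) := by
  have := P.isFiniteMeasure_ρ hγ
  have := P.isFiniteMeasure_ν hγ hA
  set I : Fin n → Fin n → ℝ := fun i j => ∫ z, pohozaevKernel G p 0 z ∂(P.ρ i).prod (P.ρ j) with hI
  have hint : ∀ i j, Integrable (pohozaevKernel G p 0) ((P.ρ i).prod (P.ρ j)) := fun i j =>
    (h i).integrable_kernel 0 (P.riesz j)
  have e1 : ∀ i, ∫ x, pohozaevDiv (P.v i) G p x ∂P.ρ i = ∑ j, A i j * I i j := by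
    intro i
    have hν : Integrable (pohozaevKernel G p 0) ((P.ρ i).prod (P.ν i)) :=
      (h i).integrable_kernel 0 (P.riesz_ν hA i)
    have h2 : ∀ᵐ x ∂P.ρ i, ∀ j, Integrable (fun y => pohozaevKernel G p 0 (x, y)) (P.ρ j) :=
      ae_all_iff.2 fun j => (hint i j).prod_right_ae
    have h3 := (h i).integral_div
    change ∫ x, pohozaevDiv (P.v i) G p x ∂P.ρ i =
      ∫ z, pohozaevKernel G p 0 z ∂(P.ρ i).prod (P.ν i) at h3
    rw [h3, integral_prod _ hν]
    have h4 : ∫ x, ∫ y, pohozaevKernel G p 0 (x, y) ∂P.ν i ∂P.ρ i =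
        ∫ x, ∑ j, A i j * ∫ y, pohozaevKernel G p 0 (x, y) ∂P.ρ j ∂P.ρ i := by
      refine integral_congr_ae ?_
      filter_upwards [h2] with x hx
      exact P.integral_ν hA i hx
    rw [h4, integral_finsetSum _ fun j _ => (hint i j).integral_prod_left.const_mul _]
    refine sum_congr rfl fun j _ => ?_
    rw [integral_const_mul, hI]
    simp only
    rw [integral_prod _ (hint i j)]
  have e2 : ∀ i j, ∫ z, (pohozaevKernel G p 0 z + pohozaevKernel G p 0 z.swap)
      ∂(P.ρ i).prod (P.ρ j) = I i j + I j i := by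
    intro i j
    have hs : Integrable (fun z : E2 × E2 => pohozaevKernel G p 0 z.swap)
      ((P.ρ i).prod (P.ρ j)) := (hint j i).swap
    rw [integral_add (hint i j) hs, integral_prod_swap]
  simp only [e1, e2, mul_add, sum_add_distrib]
  have e3 : ∑ i, ∑ j, A i j * I j i = ∑ i, ∑ j, A i j * I i j := by
    rw [sum_comm]
    exact sum_congr rfl fun i _ => sum_congr rfl fun j _ => by rw [hsymm.apply]
  rw [e3]
  ring

/-- The divergence of the cutoff vector field is close to `2 * μ` on the ball. -/
lemma abs_div_sub_le (hB : 0 < B) {G : ℝ → ℝ} (h0 : ∀ t, 0 ≤ G t)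
    (h1 : ∀ t, G t ≤ 1) {N s τ T μ : ℝ} (hN : ∀ t, |t * deriv G t| ≤ N) (hτ : 0 < τ)
    (hs : 2 * τ < s) (hT : 4 ≤ T) (hz : ∀ t ∉ Icc (τ ^ 2) (4 * s ^ 2), G t = 0)
    (ho : ∀ t ∈ Icc (4 * τ ^ 2) (s ^ 2), G t = 1) {p : E2}
    (hp : ‖p‖ + T * s ≤ r) (hpμ : (p = 0 ∧ μ = 1 + γ) ∨ (4 * s ≤ ‖p‖ ∧ μ = 1)) (i : Fin n) (x : E2) :
    |pohozaevDiv (P.v i) G p x - 2 * μ * (closedBall p s).indicator 1 x| ≤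
      (4 + 2 * N + 6 * |γ| + 2 * B ^ 2 * r) *
        (closedBall p (T * s) \ closedBall p s ∪ closedBall p (2 * τ)).indicator 1 x +
      (2 * B ^ 2 * s + 8 * |γ| * (s / ‖p‖)) := by
  have hs0 : 0 < s := by linarith
  have hN0 : 0 ≤ N := (abs_nonneg _).trans (hN 0)
  have hr : 0 < r := lt_of_lt_of_le (by positivity) hp
  have hTs : 4 * s ≤ T * s := mul_le_mul_of_nonneg_right hT hs0.le
  set E := 2 * B ^ 2 * s + 8 * |γ| * (s / ‖p‖) with hE
  have hE0 : 0 ≤ E := by positivity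
  have hμ : |2 * μ| ≤ 2 + 2 * |γ| ∧ |2 * (μ - 1)| ≤ 2 * |γ| := by
    rcases hpμ with ⟨-, rfl⟩ | ⟨-, rfl⟩
    · rw [add_sub_cancel_left, abs_mul, abs_mul, abs_two]
      have := abs_add_le 1 γ
      rw [abs_one] at this
      exact ⟨by linarith, le_rfl⟩
    · rw [mul_one, sub_self, mul_zero, abs_two, abs_zero]
      constructor <;> linarith [abs_nonneg γ]
  have hEle : E ≤ 2 * B ^ 2 * r + 2 * |γ| := by
    have a1 : s ≤ r := by linarith [norm_nonneg p]
    have a2 : s / ‖p‖ ≤ 1 / 4 := by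
      rcases hpμ with ⟨rfl, -⟩ | ⟨h2, -⟩
      · rw [norm_zero, div_zero]; norm_num
      · rw [div_le_div_iff₀ (by linarith) (by norm_num)]
        linarith
    have a3 := mul_le_mul_of_nonneg_left a1 (by positivity : 0 ≤ 2 * B ^ 2)
    have a4 := mul_le_mul_of_nonneg_left a2 (by positivity : 0 ≤ 8 * |γ|)
    linarith
  have hv : ‖x - p‖ ^ 2 ∈ Icc (τ ^ 2) (4 * s ^ 2) →
      |fderiv ℝ (P.v i) x (x - p) - 2 * (μ - 1)| ≤ E := by
    intro hx
    have hx2 : ‖x - p‖ ≤ 2 * s := by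
      refine le_of_sq_le_sq ?_ (by positivity)
      nlinarith [hx.2]
    have hxr : ‖x‖ < r := by linarith [norm_le_insert' x p]
    have hx0 : x ≠ 0 := by
      rintro rfl
      rw [zero_sub, norm_neg] at hx hx2
      rcases hpμ with ⟨rfl, -⟩ | ⟨h2, -⟩
      · rw [norm_zero] at hx
        nlinarith [hx.1]
      · linarith
    have hxp : 0 < ‖x‖ := norm_pos_iff.2 hx0
    have hH := P.H_pos hB i hx0 hxr
    rw [(P.hasFDerivAt_v hB i hx0 hxr).fderiv]
    simp only [_root_.add_apply, _root_.smul_apply, innerSL_apply_apply, smul_eq_mul]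
    have e1 : |(P.H i x)⁻¹ * fderiv ℝ (P.H i) x (x - p)| ≤ 2 * B ^ 2 * s := by
      rw [abs_mul, abs_of_pos (inv_pos.2 hH)]
      calc (P.H i x)⁻¹ * |fderiv ℝ (P.H i) x (x - p)| ≤ B * (B * (2 * s)) := by
            refine mul_le_mul ((inv_le_comm₀ hH hB).2 (P.le_H i x hx0 hxr)) ?_ (abs_nonneg _) hB.le
            exact (ContinuousLinearMap.le_opNorm _ _).trans
              (mul_le_mul (P.H_grad i x hx0 hxr) hx2 (norm_nonneg _) hB.le)
        _ = 2 * B ^ 2 * s := by ring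
    have e2 : |2 * γ / ‖x‖ ^ 2 * inner ℝ x (x - p) - 2 * (μ - 1)| ≤ 8 * |γ| * (s / ‖p‖) := by
      rcases hpμ with ⟨rfl, rfl⟩ | ⟨h2, rfl⟩
      · rw [sub_zero, real_inner_self_eq_norm_sq, div_mul_cancel₀ _ (by positivity)]
        simp
      · have hp0 : 0 < ‖p‖ := by linarith
        have hpx : ‖p‖ / 2 ≤ ‖x‖ := by
          have := norm_le_insert' p x
          rw [norm_sub_rev] at this
          linarith
        rw [sub_self, mul_zero, sub_zero, abs_mul, abs_div, abs_of_nonneg (sq_nonneg ‖x‖), abs_mul,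
          abs_two, div_mul_eq_mul_div, div_le_iff₀ (by positivity)]
        have a1 := abs_real_inner_le_norm x (x - p)
        have a2 : s / ‖p‖ * ‖p‖ = s := div_mul_cancel₀ _ hp0.ne'
        calc 2 * |γ| * |(inner ℝ x (x - p) : ℝ)| ≤ 2 * |γ| * (‖x‖ * (2 * s)) := by
              have := a1.trans (mul_le_mul_of_nonneg_left hx2 hxp.le)
              gcongr
          _ = 8 * |γ| * (s / ‖p‖) * ((‖p‖ / 2) * ‖x‖) := by
              rw [show 8 * |γ| * (s / ‖p‖) * ((‖p‖ / 2) * ‖x‖) =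
                4 * |γ| * (s / ‖p‖ * ‖p‖) * ‖x‖ by ring, a2]
              ring
          _ ≤ 8 * |γ| * (s / ‖p‖) * ‖x‖ ^ 2 := by
              rw [sq]
              gcongr
    have e3 := abs_add_le (2 * γ / ‖x‖ ^ 2 * inner ℝ x (x - p) - 2 * (μ - 1))
      ((P.H i x)⁻¹ * fderiv ℝ (P.H i) x (x - p))
    rw [show 2 * γ / ‖x‖ ^ 2 * inner ℝ x (x - p) + (P.H i x)⁻¹ * fderiv ℝ (P.H i) x (x - p) -
      2 * (μ - 1) = 2 * γ / ‖x‖ ^ 2 * inner ℝ x (x - p) - 2 * (μ - 1) +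
        (P.H i x)⁻¹ * fderiv ℝ (P.H i) x (x - p) by ring]
    linarith
  by_cases hxD : x ∈ closedBall p (T * s) \ closedBall p s ∪ closedBall p (2 * τ)
  · rw [indicator_of_mem hxD]
    have c1 : |2 * μ * (closedBall p s).indicator (1 : E2 → ℝ) x| ≤ 2 + 2 * |γ| := by
      rw [abs_mul]
      refine (mul_le_of_le_one_right (abs_nonneg _) ?_).trans hμ.1
      rw [abs_of_nonneg (show 0 ≤ (closedBall p s).indicator (1 : E2 → ℝ) x from
        indicator_nonneg (fun _ _ => zero_le_one) x)]
      exact Set.indicator_le_self' (fun _ _ => zero_le_one) x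
    have c2 : |G (‖x - p‖ ^ 2) * fderiv ℝ (P.v i) x (x - p)| ≤ 2 * |γ| + E := by
      by_cases hx : ‖x - p‖ ^ 2 ∈ Icc (τ ^ 2) (4 * s ^ 2)
      · rw [abs_mul, abs_of_nonneg (h0 _)]
        refine (mul_le_of_le_one_left (abs_nonneg _) (h1 _)).trans ?_
        have := abs_add_le (fderiv ℝ (P.v i) x (x - p) - 2 * (μ - 1)) (2 * (μ - 1))
        rw [sub_add_cancel] at this
        linarith [hv hx, hμ.2]
      · rw [hz _ hx, zero_mul, abs_zero]
        positivity
    have c3 : |2 * G (‖x - p‖ ^ 2)| ≤ 2 := by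
      rw [abs_of_nonneg (mul_nonneg two_pos.le (h0 _))]
      linarith [h1 (‖x - p‖ ^ 2)]
    have c4 : |2 * ‖x - p‖ ^ 2 * deriv G (‖x - p‖ ^ 2)| ≤ 2 * N := by
      rw [mul_assoc, abs_mul, abs_two]
      linarith [hN (‖x - p‖ ^ 2)]
    have c5 := abs_sub (pohozaevDiv (P.v i) G p x)
      (2 * μ * (closedBall p s).indicator (1 : E2 → ℝ) x)
    have c6 : |pohozaevDiv (P.v i) G p x| ≤ 2 + 2 * N + (2 * |γ| + E) :=
      (abs_add_three _ _ _).trans (add_le_add_three c3 c4 c2)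
    simp only [Pi.one_apply, mul_one] at *
    linarith
  · rw [indicator_of_notMem hxD, mul_zero, zero_add]
    simp only [Set.mem_union, Set.mem_sdiff, mem_closedBall, dist_eq_norm, not_or, not_and_or,
      not_le] at hxD
    by_cases hx : x ∈ closedBall p s
    · have hx' := hx
      rw [mem_closedBall, dist_eq_norm] at hx'
      have hG1 : G (‖x - p‖ ^ 2) = 1 := ho _ ⟨by nlinarith [hxD.2],
        pow_le_pow_left₀ (norm_nonneg _) hx' 2⟩
      rw [indicator_of_mem hx, pohozaevDiv, hG1, deriv_eq_zero_of_eq_one h1 hG1]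
      have := hv ⟨by nlinarith [hxD.2], by nlinarith [norm_nonneg (x - p)]⟩
      rw [show 2 * 1 + 2 * ‖x - p‖ ^ 2 * 0 + 1 * fderiv ℝ (P.v i) x (x - p) -
        2 * μ * (1 : E2 → ℝ) x = fderiv ℝ (P.v i) x (x - p) - 2 * (μ - 1) by
          rw [Pi.one_apply]; ring]
      exact this
    · have hx' := hx
      rw [mem_closedBall, dist_eq_norm] at hx'
      have h4 := hxD.1.resolve_right (not_not.2 (not_le.1 hx'))
      have hG0 : G (‖x - p‖ ^ 2) = 0 := hz _ fun h5 => by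
        have h6 : 4 * s < ‖x - p‖ := hTs.trans_lt h4
        nlinarith [h5.2]
      rw [indicator_of_notMem hx, pohozaevDiv, hG0, deriv_eq_zero_of_eq_zero h0 hG0]
      simpa using hE0

end LiouvillePotential

end PohozaevEstimate

section PohozaevBound
open Matrix

namespace LiouvillePotential

variable {n : ℕ} {A : Matrix (Fin n) (Fin n) ℝ} {γ r B : ℝ}

lemma abs_integral_div_sub_le (P : LiouvillePotential A γ r B) (hγ : -1 < γ) {G : ℝ → ℝ} {p : E2}
    {i : Fin n} (hint : Integrable (pohozaevDiv (P.v i) G p) (P.ρ i)) {S D : Set E2}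
    (hS : MeasurableSet S) (hD : MeasurableSet D) {μ c e : ℝ}
    (h : ∀ x, |pohozaevDiv (P.v i) G p x - 2 * μ * S.indicator 1 x| ≤ c * D.indicator 1 x + e) :
    |∫ x, pohozaevDiv (P.v i) G p x ∂P.ρ i - 2 * μ * (P.ρ i).real S| ≤
      c * (P.ρ i).real D + e * (P.ρ i).real Set.univ := by
  have := P.isFiniteMeasure_ρ hγ i
  have hind : ∀ S : Set E2, MeasurableSet S → Integrable (S.indicator (1 : E2 → ℝ)) (P.ρ i) :=
    fun S hS => (integrable_const (1 : ℝ)).indicator hS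
  have j1 : Integrable (fun x => c * D.indicator (1 : E2 → ℝ) x) (P.ρ i) := (hind D hD).const_mul c
  have j2 : Integrable (fun x => c * D.indicator (1 : E2 → ℝ) x + e) (P.ρ i) :=
    j1.add (integrable_const e)
  have j3 : Integrable (fun x => 2 * μ * S.indicator (1 : E2 → ℝ) x) (P.ρ i) :=
    (hind S hS).const_mul _
  have e1 : ∫ x, 2 * μ * S.indicator (1 : E2 → ℝ) x ∂P.ρ i = 2 * μ * (P.ρ i).real S := by
    rw [integral_const_mul, integral_indicator_one hS]
  rw [← e1, ← integral_sub hint j3]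
  refine (norm_integral_le_of_norm_le (f := fun x => pohozaevDiv (P.v i) G p x -
    2 * μ * S.indicator (1 : E2 → ℝ) x) j2 (ae_of_all _ h)).trans_eq ?_
  rw [integral_add j1 (integrable_const e), integral_const_mul, integral_indicator_one hD,
    integral_const, smul_eq_mul]
  ring

/-- The approximate Pohozaev identity on balls, with constants independent of the solution. -/
theorem exists_abs_pohozaev_le (hγ : -1 < γ) (hA : ∀ i j, 0 ≤ A i j) (hsymm : A.IsSymm)
    (hB : 0 < B) (hr : 0 < r) :
    ∃ K > 0, ∀ (P : LiouvillePotential A γ r B) (p : E2) (s T μ : ℝ), 0 < s → 4 ≤ T →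
      ‖p‖ + T * s ≤ r → ((p = 0 ∧ μ = 1 + γ) ∨ (4 * s ≤ ‖p‖ ∧ μ = 1)) →
      |(fun j => (P.ρ j).real (closedBall p s)) ⬝ᵥ
          (A *ᵥ fun j => (P.ρ j).real (closedBall p s)) -
        4 * μ * ∑ j, (P.ρ j).real (closedBall p s)| ≤
      K * (∑ j, (P.ρ j).real (closedBall p (T * s) \ closedBall p s) + 1 / T + s + s / ‖p‖) := by
  obtain ⟨N, hN0, hcut⟩ := exists_annular_cutoff
  set a := entrySum A with ha
  have ha0 : 0 ≤ a := entrySum_nonneg hA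
  set K₁ := 2 * a * (2 + 2 * N) * B + 2 * (4 + 2 * N + 6 * |γ| + 2 * B ^ 2 * r) with hK₁
  have hK₁0 : 0 ≤ K₁ := by positivity
  have q1 : 0 ≤ 2 * a * B ^ 2 := by positivity
  have q2 : 0 ≤ 4 * B ^ 3 := by positivity
  have q3 : 0 ≤ 16 * |γ| * B := by positivity
  refine ⟨K₁ + 2 * a * B ^ 2 + 4 * B ^ 3 + 16 * |γ| * B + 1, by positivity,
    fun P p s T μ hs hT hp hpμ => ?_⟩
  have hfin := P.isFiniteMeasure_ρ hγ
  have hT0 : 0 < T := by linarith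
  obtain ⟨t, ht, htd⟩ := P.diffuse hγ (ε := 1 / T) (by positivity)
  obtain ⟨τ, hτ, hτs, hτt⟩ : ∃ τ, 0 < τ ∧ 2 * τ < s ∧ 2 * τ ≤ t :=
    ⟨min s t / 4, by positivity, by linarith [min_le_left s t], by linarith [min_le_right s t]⟩
  obtain ⟨G, hG, h0, h1, hN, hz, ho⟩ := hcut s τ hτ hτs
  have hTs : 4 * s ≤ T * s := mul_le_mul_of_nonneg_right hT hs.le
  have hS : ∀ x : E2, ‖x - p‖ ^ 2 ∈ Icc (τ ^ 2) (4 * s ^ 2) → τ ≤ ‖x‖ ∧ ‖x‖ < r := by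
    intro x hx
    have h2 : ‖x - p‖ ≤ 2 * s := by nlinarith [hx.2, norm_nonneg (x - p)]
    refine ⟨?_, by linarith [norm_le_insert' x p]⟩
    rcases hpμ with ⟨rfl, -⟩ | ⟨h3, -⟩
    · rw [sub_zero] at hx
      nlinarith [hx.1, norm_nonneg x]
    · have := norm_le_insert' p x
      rw [norm_sub_rev] at this
      linarith
  choose M hM using P.exists_isPohozaevSetup hγ hA hB hG h0 h1 hN hτ hz hS
  set S := closedBall p s with hSdef
  set D := closedBall p (T * s) \ closedBall p s ∪ closedBall p (2 * τ) with hD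
  have hSm : MeasurableSet S := measurableSet_closedBall
  have hDm : MeasurableSet D :=
    (measurableSet_closedBall.diff measurableSet_closedBall).union measurableSet_closedBall
  set m : Fin n → ℝ := fun j => (P.ρ j).real S with hm
  set d : Fin n → ℝ := fun j => (P.ρ j).real D with hd
  set R : Fin n → ℝ := fun j => (P.ρ j).real Set.univ with hR
  have hd0 : ∀ j, 0 ≤ d j := fun j => measureReal_nonneg
  have hR0 : ∀ j, 0 ≤ R j := fun j => measureReal_nonneg
  have hRB : ∑ j, R j ≤ B := P.mass_le
  have hdsum : ∑ j, d j ≤ ∑ j, (P.ρ j).real (closedBall p (T * s) \ closedBall p s) + 1 / T := by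
    have e1 : ∑ j, (P.ρ j).real (closedBall p (2 * τ)) ≤ 1 / T :=
      (sum_le_sum fun j _ => measureReal_mono (closedBall_subset_closedBall hτt)).trans
        (htd p).le
    have e2 : ∑ j, d j ≤ ∑ j, ((P.ρ j).real (closedBall p (T * s) \ closedBall p s) +
        (P.ρ j).real (closedBall p (2 * τ))) :=
      sum_le_sum fun j _ => measureReal_union_le _ _
    rw [sum_add_distrib] at e2
    linarith
  set E := 2 * B ^ 2 * s + 8 * |γ| * (s / ‖p‖) with hE
  have hE0 : 0 ≤ E := by positivity
  set Z : Fin n → ℝ := fun i => ∫ x, pohozaevDiv (P.v i) G p x ∂P.ρ i with hZ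
  have hZle : ∀ i, |Z i - 2 * μ * m i| ≤
      (4 + 2 * N + 6 * |γ| + 2 * B ^ 2 * r) * d i + E * R i := fun i =>
    P.abs_integral_div_sub_le hγ (hM i).integrable_div hSm hDm
      (P.abs_div_sub_le hB h0 h1 hN hτ hτs hT hz ho hp hpμ i)
  set Q : Fin n → Fin n → ℝ := fun i j =>
    ∫ z, (pohozaevKernel G p 0 z + pohozaevKernel G p 0 z.swap) ∂(P.ρ i).prod (P.ρ j) with hQ
  have hQle : ∀ i j, |Q i j - m i * m j| ≤
      (2 + 2 * N) * (d i * R j + R i * d j) + 2 / T * (R i * R j) := by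
    intro i j
    have k1 : Integrable (pohozaevKernel G p 0) ((P.ρ i).prod (P.ρ j)) :=
      (hM i).integrable_kernel 0 (P.riesz j)
    have k2 : Integrable (pohozaevKernel G p 0) ((P.ρ j).prod (P.ρ i)) :=
      (hM j).integrable_kernel 0 (P.riesz i)
    have k3 : Integrable (fun z : E2 × E2 => pohozaevKernel G p 0 z.swap)
      ((P.ρ i).prod (P.ρ j)) := k2.swap
    have : IsFiniteMeasure (dens (P.f i)) := hfin i
    have : IsFiniteMeasure (dens (P.f j)) := hfin j
    have hne : ∀ᵐ z ∂(P.ρ i).prod (P.ρ j), z.1 ≠ z.2 := ae_prod_dens_ne (P.f i) (P.f j)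
    refine abs_integral_prod_sub_le (k1.add k3) hSm hDm ?_
    filter_upwards [hne] with z hz'
    exact abs_symm_kernel_sub_le (hG.differentiable one_ne_zero) h0 h1 hN hτ hτs hT hz ho p hz'
  have hid : 2 * ∑ i, Z i = ∑ i, ∑ j, A i j * Q i j :=
    P.two_mul_sum_integral_div hγ hsymm hM hA
  have hquad : m ⬝ᵥ (A *ᵥ m) = ∑ i, ∑ j, A i j * (m i * m j) := by
    simp only [dotProduct, mulVec, mul_sum]
    exact sum_congr rfl fun i _ => sum_congr rfl fun j _ => by ring
  have hdiff : m ⬝ᵥ (A *ᵥ m) - 4 * μ * ∑ j, m j =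
      2 * ∑ i, (Z i - 2 * μ * m i) - ∑ i, ∑ j, A i j * (Q i j - m i * m j) := by
    simp only [mul_sub, sum_sub_distrib]
    rw [hquad, hid, ← mul_sum]
    ring
  have b1 : |∑ i, (Z i - 2 * μ * m i)| ≤
      (4 + 2 * N + 6 * |γ| + 2 * B ^ 2 * r) * ∑ j, d j + E * ∑ j, R j := by
    refine (abs_sum_le_sum_abs _ _).trans ((sum_le_sum fun i _ => hZle i).trans_eq ?_)
    rw [sum_add_distrib, mul_sum, mul_sum]
  have b2 : |∑ i, ∑ j, A i j * (Q i j - m i * m j)| ≤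
      a * ((2 + 2 * N) * (2 * ((∑ j, d j) * ∑ j, R j)) + 2 / T * ((∑ j, R j) * ∑ j, R j)) := by
    have c1 : |∑ i, ∑ j, A i j * (Q i j - m i * m j)| ≤
        ∑ i, ∑ j, a * ((2 + 2 * N) * (d i * R j + R i * d j) + 2 / T * (R i * R j)) := by
      refine (abs_sum_le_sum_abs _ _).trans (sum_le_sum fun i _ =>
        (abs_sum_le_sum_abs _ _).trans (sum_le_sum fun j _ => ?_))
      rw [abs_mul, abs_of_nonneg (hA i j)]
      exact mul_le_mul (entry_le_entrySum hA i j) (hQle i j) (abs_nonneg _) ha0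
    refine c1.trans_eq ?_
    simp only [← mul_sum, sum_add_distrib, ← sum_mul]
    ring
  set X := ∑ j, (P.ρ j).real (closedBall p (T * s) \ closedBall p s) with hX
  have hX0 : 0 ≤ X := sum_nonneg fun j _ => measureReal_nonneg
  have hsd0 : 0 ≤ ∑ j, d j := sum_nonneg fun j _ => hd0 j
  have hsR0 : 0 ≤ ∑ j, R j := sum_nonneg fun j _ => hR0 j
  rw [hdiff]
  have b3 : |2 * ∑ i, (Z i - 2 * μ * m i) - ∑ i, ∑ j, A i j * (Q i j - m i * m j)| ≤
      2 * |∑ i, (Z i - 2 * μ * m i)| + |∑ i, ∑ j, A i j * (Q i j - m i * m j)| := by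
    refine (abs_sub _ _).trans_eq ?_
    rw [abs_mul, abs_two]
  refine b3.trans ?_
  set Y := ∑ j, d j
  set V := ∑ j, R j
  have w0 : 0 ≤ s / ‖p‖ := by positivity
  have w1 : 0 < 1 / T := by positivity
  have c1 : a * ((2 + 2 * N) * (2 * (Y * V)) + 2 / T * (V * V)) ≤
      a * ((2 + 2 * N) * (2 * (Y * B)) + 2 / T * (B * B)) := by gcongr
  have c2 : E * V ≤ E * B := by gcongr
  have c3 : K₁ * Y ≤ K₁ * (X + 1 / T) := by gcongr
  have c4 : 2 / T = 2 * (1 / T) := by ring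
  rw [c4] at c1
  have c5 : 0 ≤ 2 * a * B ^ 2 * (X + s + s / ‖p‖) := by positivity
  have c6 : 0 ≤ 4 * B ^ 3 * (X + 1 / T + s / ‖p‖) := by positivity
  have c7 : 0 ≤ 16 * |γ| * B * (X + 1 / T + s) := by positivity
  have c8 : 0 ≤ (X + 1 / T + s + s / ‖p‖) := by positivity
  have c9 : 0 ≤ K₁ * (s + s / ‖p‖) := by positivity
  have hgoal : 2 * ((4 + 2 * N + 6 * |γ| + 2 * B ^ 2 * r) * Y + E * B) +
      a * ((2 + 2 * N) * (2 * (Y * B)) + 2 * (1 / T) * (B * B)) =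
      K₁ * Y + 4 * B ^ 3 * s + 16 * |γ| * B * (s / ‖p‖) + 2 * a * B ^ 2 * (1 / T) := by
    rw [hK₁, hE]; ring
  rw [c4] at b2
  linarith

end LiouvillePotential

end PohozaevBound

section NonSimple
open Matrix

lemma log_div_le_add {s t a : ℝ} (ht : 0 < t) (hts : t ≤ s) (ha : 0 ≤ a) :
    log (s / a) ≤ log (s / t) + if a ≤ t then t / a else 0 := by
  have hs : 0 < s := ht.trans_le hts
  have h0 : 0 ≤ log (s / t) := log_nonneg ((one_le_div ht).2 hts)
  rcases ha.eq_or_lt with rfl | ha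
  · simp [ht.le, h0]
  · split_ifs with h
    · have h1 := log_le_sub_one_of_pos (div_pos ht ha)
      rw [log_div ht.ne' ha.ne'] at h1
      rw [log_div hs.ne' ha.ne', log_div hs.ne' ht.ne']
      linarith
    · rw [add_zero]
      exact log_le_log (by positivity) (by gcongr; linarith)

namespace LiouvillePotential

variable {n : ℕ} {A : Matrix (Fin n) (Fin n) ℝ} {γ r B : ℝ}

lemma setIntegral_ν_le (P : LiouvillePotential A γ r B) (hA : ∀ i j, 0 ≤ A i j) (i : Fin n)
    {S : Set E2} (hS : MeasurableSet S) {M : ℝ} {φ : E2 → ℝ} (hφ : ∀ z, 0 ≤ φ z)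
    (hM : ∀ z ∈ S, ∑ j, A i j * P.f j z ≤ M) (hint : IntegrableOn φ S) :
    IntegrableOn φ S (P.ν i) ∧ ∫ z in S, φ z ∂P.ν i ≤ M * ∫ z in S, φ z := by
  have hg := P.riesz_ν hA i
  have h1 : Integrable (S.indicator φ) := (integrable_indicator_iff hS).2 hint
  have hle : ∀ z, (∑ j, A i j * P.f j z) * S.indicator φ z ≤ M * S.indicator φ z := fun z => by
    by_cases hz : z ∈ S
    · rw [indicator_of_mem hz]
      exact mul_le_mul_of_nonneg_right (hM z hz) (hφ z)
    · simp [indicator_of_notMem hz]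
  have h2 : Integrable fun z => (∑ j, A i j * P.f j z) * S.indicator φ z := by
    refine (h1.const_mul M).mono' (hg.meas.aestronglyMeasurable.mul h1.aestronglyMeasurable)
      (ae_of_all _ fun z => ?_)
    rw [norm_eq_abs, abs_of_nonneg (mul_nonneg (hg.nonneg z)
      (indicator_nonneg (fun z _ => hφ z) z))]
    exact hle z
  refine ⟨(integrable_indicator_iff hS).1 ((integrable_dens_iff hg.meas hg.nonneg).2 h2), ?_⟩
  rw [← integral_indicator hS, ← integral_indicator hS, ← integral_const_mul]
  exact (integral_dens hg.meas hg.nonneg _).trans_le (integral_mono h2 (h1.const_mul M) hle)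

/-- If the mass of a ball is small, the density at its center is controlled at its scale. -/
theorem exists_mul_sq_le (hγ : -1 < γ) (hA : ∀ i j, 0 ≤ A i j) (hB : 0 < B) :
    ∃ C, ∀ (P : LiouvillePotential A γ r B) (i : Fin n) (x : E2) (s : ℝ), 0 < s → s ≤ ‖x‖ →
      ‖x‖ + 2 * s ≤ r → 1 ≤ P.f i x * s ^ 2 →
      (∀ j, ∀ z ∈ closedBall x s, P.f j z ≤ 8 * P.f i x) →
      entrySum A * ∑ j, (P.ρ j).real (closedBall x s) ≤ 1 → P.f i x * s ^ 2 ≤ C := by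
  obtain ⟨C₁, hC₁, hker⟩ := exists_kernel_bound zero_le_one one_lt_two
  set a := entrySum A with ha
  have ha0 : 0 ≤ a := entrySum_nonneg hA
  set v₁ := volume.real (ball (0 : E2) 1) with hv₁
  set K₁ := 8 * a * (C₁ + v₁) with hK₁
  set L := 4 ^ |2 * γ| * B * exp (a * B * log 2) with hL
  set C₂ := (16 / v₁) * (B * 4 ^ (|2 * γ|) * exp (a * B * log 2)) with hC₂
  refine ⟨(2 * L * (C₂ * B) * exp K₁) ^ 2, fun P i x s hs hsx hxr h1 hf hm => ?_⟩
  have hν := P.isFiniteMeasure_ν hγ hA i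
  have hρ := P.isFiniteMeasure_ρ hγ
  set F := P.f i x with hF
  have hs2 : 0 < s ^ 2 := by positivity
  have hF0 : 0 < F := pos_of_mul_pos_left (by linarith) hs2.le
  set t := 1 / √F with ht
  have hq : 0 < √F := sqrt_pos.2 hF0
  have hq2 : √F ^ 2 = F := sq_sqrt hF0.le
  have ht0 : 0 < t := by positivity
  have ht2 : F * t ^ 2 = 1 := by rw [ht, div_pow, hq2]; field_simp
  have hst : s / t = s * √F := by rw [ht]; field_simp
  have hst1 : 1 ≤ s * √F := by
    refine (one_le_sq_iff₀ (by positivity)).1 ?_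
    rw [mul_pow, hq2]; linarith
  have hts : t ≤ s := by
    rw [ht, div_le_iff₀ hq]; linarith
  have hx0 : x ≠ 0 := norm_pos_iff.1 (hs.trans_le hsx)
  have hden := P.density_le hγ hA hB i hs hx0 (by linarith) (by rw [sub_self, norm_zero]; positivity : ‖x - x‖ ≤ s / 2)
  have e1 : (s / ‖x‖) ^ singExp γ ≤ 1 := rpow_le_one (by positivity)
    ((div_le_one (hs.trans_le hsx)).2 hsx) (singExp_nonneg γ)
  have e2 : exp (P.lam i x s) ≤ C₂ * B := by
    refine (P.exp_lam_le_mul_real hγ hA hB i hs hxr).trans ?_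
    refine mul_le_mul_of_nonneg_left ?_ (by positivity)
    exact (measureReal_mono (Set.subset_univ _)).trans ((single_le_sum
      (f := fun j => (P.ρ j).real Set.univ) (fun j _ => measureReal_nonneg)
      (mem_univ i)).trans P.mass_le)
  have hcb : ∀ t, MeasurableSet (closedBall x t) := fun t => measurableSet_closedBall
  have hg := P.riesz_ν hA i
  have hgF : ∀ z ∈ closedBall x s, ∑ j, A i j * P.f j z ≤ 8 * a * F := fun z hz => by
    have h2 : ∑ j, A i j * P.f j z ≤ ∑ j, A i j * (8 * F) :=
      sum_le_sum fun j _ => mul_le_mul_of_nonneg_left (hf j z hz) (hA i j)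
    have h3 : ∑ j, A i j ≤ a := single_le_sum (f := fun i => ∑ j, A i j)
      (fun i _ => sum_nonneg fun j _ => hA i j) (mem_univ i)
    rw [← sum_mul] at h2
    nlinarith
  obtain ⟨k1, k2⟩ := hker x t ht0 _ (hcb t) measure_closedBall_lt_top.ne
  simp only [rpow_one] at k1 k2
  have hker3 := P.setIntegral_ν_le hA i (hcb t) (φ := fun z => t / ‖z - x‖) (fun z => by positivity)
    (fun z hz => hgF z (closedBall_subset_closedBall hts hz)) k1
  have e3 : ∫ z in closedBall x t, t / ‖z - x‖ ∂P.ν i ≤ K₁ := by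
    refine hker3.2.trans ((mul_le_mul_of_nonneg_left k2 (by positivity)).trans_eq ?_)
    rw [Measure.addHaar_real_closedBall _ _ ht0.le, finrank_euclideanSpace_fin, ← hv₁]
    linear_combination 8 * a * (C₁ + v₁) * ht2
  have e4 : ∫ z in closedBall x s, log (s / ‖x - z‖) ∂P.ν i ≤ log (s / t) + K₁ := by
    have hind : Integrable ((closedBall x t).indicator fun z => t / ‖z - x‖) (P.ν i) :=
      (integrable_indicator_iff (hcb t)).2 hker3.1
    have h2 : ∀ z, log (s / ‖x - z‖) ≤
        log (s / t) + (closedBall x t).indicator (fun z => t / ‖z - x‖) z := by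
      intro z
      refine (log_div_le_add ht0 hts (norm_nonneg _)).trans_eq ?_
      have hz : z ∈ closedBall x t ↔ ‖x - z‖ ≤ t := by
        rw [mem_closedBall, dist_eq_norm, norm_sub_rev]
      by_cases h : ‖x - z‖ ≤ t
      · rw [if_pos h, indicator_of_mem (hz.2 h), norm_sub_rev]
      · rw [if_neg h, indicator_of_notMem (mt hz.1 h)]
    have hlog : Integrable (fun z => log (s / ‖x - z‖)) (P.ν i) :=
      hg.integrable_log_div (singExp_nonneg γ) (singExp_lt_two hγ) hs x
    have h3 := integral_mono hlog.integrableOn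
      (((integrable_const (log (s / t))).add hind).integrableOn (s := closedBall x s)) h2
    refine h3.trans ?_
    simp only [Pi.add_apply]
    rw [integral_add (integrable_const _) hind.integrableOn, setIntegral_const, smul_eq_mul,
      setIntegral_indicator (hcb t), Set.inter_eq_right.2 (closedBall_subset_closedBall hts)]
    refine add_le_add (mul_le_of_le_one_left (log_nonneg ?_)
      ((P.real_ν_le hγ hA i (hcb s)).trans hm)) e3
    rwa [hst]
  have e5 : exp (∫ z in closedBall x s, log (s / ‖x - z‖) ∂P.ν i) ≤
      s * √F * exp K₁ := by
    refine (exp_le_exp.2 e4).trans_eq ?_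
    rw [exp_add, hst, exp_log (by positivity)]
  have e6 : F ≤ L * (C₂ * B / s ^ 2) * 2 * (s * √F * exp K₁) := by
    refine hden.trans ?_
    gcongr
    linarith
  have e7 : s * √F ≤ 2 * L * (C₂ * B) * exp K₁ := by
    have h3 : L * (C₂ * B / s ^ 2) * 2 * (s * √F * exp K₁) * s ^ 2 =
      (2 * L * (C₂ * B) * exp K₁) * (s * √F) := by field_simp
    have h4 := mul_le_mul_of_nonneg_right e6 hs2.le
    rw [h3] at h4
    refine le_of_mul_le_mul_right ?_ (by linarith : 0 < s * √F)
    refine le_trans (le_of_eq ?_) h4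
    nth_rewrite 3 [← hq2]
    ring
  calc F * s ^ 2 = (s * √F) ^ 2 := by rw [mul_pow, hq2]; ring
    _ ≤ _ := by gcongr


variable (A γ r B) in
/-- Sequences of solutions with uniform bounds form a family to which the concentration analysis
applies. -/
theorem exists_liouvilleFamily (hγ : -1 < γ) (hA : ∀ i j, 0 ≤ A i j) (hsymm : A.IsSymm)
    (hB : 0 < B) (hr : 0 < r) {η : ℝ} (hη : 0 < η) (P : ℕ → LiouvillePotential A γ r B) :
    ∃ Q : LiouvilleFamily n A γ, (∀ k j, Q.ρ k j = (P k).ρ j) ∧ Q.ε₀ ≤ η := by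
  obtain ⟨K₁, hK₁, hpo⟩ := exists_abs_pohozaev_le hγ hA hsymm hB hr
  obtain ⟨K₂, hK₂, ε₁, hε₁, hle⟩ := exists_real_le_mul_exp_lam (r := r) hγ hA hB
  set C₂ := (16 / volume.real (ball (0 : E2) 1)) * (B * 4 ^ (|2 * γ|) *
      exp (entrySum A * B * log 2)) with hC₂
  have hC₂0 : 0 ≤ C₂ := by positivity
  refine ⟨{
    ρ := fun k j => (P k).ρ j
    lam := fun k j => (P k).lam j
    r₀ := r / 2
    K := K₁ + K₂ + C₂ + B
    ε₀ := min ε₁ η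
    r₀_pos := by positivity
    K_pos := by positivity
    ε₀_pos := lt_min hε₁ hη
    finite := fun k i => (P k).isFiniteMeasure_ρ hγ i
    mass_le := fun k => (P k).mass_le.trans (by linarith)
    diffuse := fun k ε hε => (P k).diffuse hγ hε
    exp_lam_le := fun k i x s hs h => ?_
    le_exp_lam := fun k i x s hs h h' => ?_
    compare := fun Λ => ⟨_, fun k i x x' s s' hs hs' h1 h2 h3 =>
      (P k).abs_lam_sub_le hγ hA i hs hs' h1 h2 h3⟩
    slope_le := fun k i x s s' hs h => (P k).lam_sub_le hγ hA i x hs h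
    le_slope := fun k i x s s' hs h => (P k).le_lam_sub hγ hA i x hs h
    pohozaev := fun k p s T μ hs hT hp hμ => ?_ }, fun _ _ => rfl, min_le_right _ _⟩
  · refine ((P k).exp_lam_le_mul_real hγ hA hB i hs (by linarith)).trans ?_
    exact mul_le_mul_of_nonneg_right (by linarith) measureReal_nonneg
  · refine (hle (P k) i x s hs (by linarith) ((sum_le_sum fun j _ => ?_).trans
      (h'.trans (min_le_left _ _)))).trans (mul_le_mul_of_nonneg_right (by linarith)
        (exp_pos _).le)
    have := (P k).isFiniteMeasure_ρ hγ j
    exact measureReal_mono (closedBall_subset_closedBall (by linarith))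
  · refine (hpo (P k) p s T μ hs hT (by linarith) hμ).trans ?_
    have h1 : 0 ≤ ∑ j, ((P k).ρ j).real (closedBall p (T * s) \ closedBall p s) :=
      sum_nonneg fun j _ => measureReal_nonneg
    have hT0 : 0 < T := by linarith
    exact mul_le_mul_of_nonneg_right (by linarith) (by positivity)

lemma exists_sq_mul_le (P : LiouvillePotential A γ r B) (hγ : -1 < γ) (i : Fin n) :
    ∃ M, ∀ x, ‖x‖ < r → ‖x‖ ^ 2 * P.f i x ≤ M := by
  obtain ⟨M, R, hM, hf, -⟩ := (P.riesz i).bound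
  have h2 := singExp_lt_two hγ
  refine ⟨M * r ^ (2 - singExp γ), fun x hx => ?_⟩
  rcases (norm_nonneg x).eq_or_lt with h0 | h0
  · rw [← h0] at hx ⊢
    rw [zero_pow two_ne_zero, zero_mul]
    positivity
  · calc ‖x‖ ^ 2 * P.f i x ≤ ‖x‖ ^ 2 * (M * (1 / ‖x‖) ^ singExp γ) := by gcongr; exact hf x
      _ = M * ‖x‖ ^ (2 - singExp γ) := by
        rw [rpow_sub h0, one_div, inv_rpow h0.le, ← rpow_natCast]
        push_cast
        field_simp
      _ ≤ M * r ^ (2 - singExp γ) := by gcongr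

/-- Near-maximizers of the scale invariant density. -/
lemma exists_near_maximizer (P : LiouvillePotential A γ r B) (hγ : -1 < γ) {N : ℝ} (hN : 0 < N)
    {i₀ : Fin n} {x₀ : E2} (hx₀ : ‖x₀‖ < r) (h : N < ‖x₀‖ ^ 2 * P.f i₀ x₀) :
    ∃ i x, ‖x‖ < r ∧ N < ‖x‖ ^ 2 * P.f i x ∧
      ∀ j y, ‖y‖ < r → ‖y‖ ^ 2 * P.f j y ≤ 2 * (‖x‖ ^ 2 * P.f i x) := by
  choose M hM using P.exists_sq_mul_le hγ
  set V : Set ℝ := {v | ∃ i x, ‖x‖ < r ∧ v = ‖x‖ ^ 2 * P.f i x} with hV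
  have hbdd : BddAbove V := by
    refine ⟨∑ i, |M i|, ?_⟩
    rintro _ ⟨i, x, hx, rfl⟩
    exact ((hM i x hx).trans (le_abs_self _)).trans
      (single_le_sum (f := fun i => |M i|) (fun i _ => abs_nonneg _) (mem_univ i))
  have hmem : ‖x₀‖ ^ 2 * P.f i₀ x₀ ∈ V := ⟨i₀, x₀, hx₀, rfl⟩
  have hS : N < sSup V := h.trans_le (le_csSup hbdd hmem)
  obtain ⟨_, ⟨i, x, hx, rfl⟩, hlt⟩ := exists_lt_of_lt_csSup ⟨_, hmem⟩
    (max_lt hS (half_lt_self (hN.trans hS)))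
  refine ⟨i, x, hx, (le_max_left _ _).trans_lt hlt, fun j y hy => ?_⟩
  linarith [le_csSup hbdd ⟨j, y, hy, rfl⟩, (le_max_right N (sSup V / 2)).trans_lt hlt]

/-- A sequence of solutions with uniform bounds whose blowup at the origin is not simple has a
singular source of integer strength. -/
theorem strength_eq_natCast (hn : 0 < n) (hA : H1 A) (hA2 : H2 A) (hγ : -1 < γ) (hB : 0 < B)
    (hr : 0 < r) (P : ℕ → LiouvillePotential A γ r B)
    (hbig : ∀ N : ℝ, ∃ k i x, ‖x‖ < r ∧ N < ‖x‖ ^ 2 * (P k).f i x)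
    (haway : ∀ ε > 0, ∃ C, ∀ k i x, ε ≤ ‖x‖ → ‖x‖ < r → (P k).f i x ≤ C) :
    ∃ m : ℕ, 0 < m ∧ 1 + γ = (m : ℝ) := by
  have hA0 := hA.2.1
  have hsel : ∀ N : ℕ, ∃ k i x, ‖x‖ < r ∧ (N : ℝ) + 1 < ‖x‖ ^ 2 * (P k).f i x ∧
      ∀ j y, ‖y‖ < r → ‖y‖ ^ 2 * (P k).f j y ≤ 2 * (‖x‖ ^ 2 * (P k).f i x) := fun N => by
    obtain ⟨k, i₀, x₀, hx₀, h⟩ := hbig (N + 1)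
    obtain ⟨i, x, h'⟩ := (P k).exists_near_maximizer hγ (by positivity) hx₀ h
    exact ⟨k, i, x, h'⟩
  choose k i x hxr hxN hmax using hsel
  have ha := entrySum_nonneg hA0
  obtain ⟨Q, hQ, hQη⟩ := exists_liouvilleFamily A γ r B hγ hA0 hA.1 hB hr
    (η := 1 / (entrySum A + 1)) (by positivity) fun N => P (k N)
  obtain ⟨C, hC⟩ := exists_mul_sq_le (r := r) hγ hA0 hB
  set 𝒰 : Ultrafilter ℕ := hyperfilter ℕ
  have hev : ∀ p : ℕ → Prop, (∀ᶠ N in atTop, p N) → ∀ᶠ N in (𝒰 : Filter ℕ), p N := fun p hp =>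
    Nat.hyperfilter_le_atTop hp
  have hx0 : ∀ N, x N ≠ 0 := fun N h => by
    have := hxN N
    rw [h, norm_zero, zero_pow two_ne_zero, zero_mul] at this
    linarith [(Nat.cast_nonneg N : (0 : ℝ) ≤ N)]
  have hsmall : ∀ ε > 0, ∀ᶠ N in atTop, ‖x N‖ ≤ ε := by
    intro ε hε
    obtain ⟨C, hC⟩ := haway ε hε
    filter_upwards [eventually_ge_atTop ⌈r ^ 2 * |C|⌉₊] with N hN
    by_contra! h
    have h1 := hC (k N) (i N) (x N) h.le (hxr N)
    have h2 : ‖x N‖ ^ 2 * (P (k N)).f (i N) (x N) ≤ r ^ 2 * |C| :=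
      mul_le_mul (pow_le_pow_left₀ (norm_nonneg _) (hxr N).le 2) (h1.trans (le_abs_self _))
        (((P (k N)).riesz _).nonneg _) (by positivity)
    linarith [hxN N, Nat.ceil_le.1 hN]
  refine Q.strength_eq_natCast (𝒰 := 𝒰) hn hA hA2 hγ x (hev _ (Eventually.of_forall hx0))
    (fun ε hε => hev _ (hsmall ε hε)) fun ε hε => hev _ ?_
  set θ := min ε (1 / 2) with hθ
  have hθ0 : 0 < θ := lt_min hε (by norm_num)
  have hθ2 : θ ≤ 1 / 2 := min_le_right _ _
  filter_upwards [hsmall (r / 2) (by positivity),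
    eventually_ge_atTop ⌈(|C| + 1) / θ ^ 2⌉₊] with N hN hNC
  by_contra! hlt
  have hX : 0 < ‖x N‖ := norm_pos_iff.2 (hx0 N)
  have hs : 0 < θ * ‖x N‖ := by positivity
  have hs2 : θ * ‖x N‖ ≤ ‖x N‖ / 2 := by nlinarith
  have hfin := (P (k N)).isFiniteMeasure_ρ hγ
  have h1 : |C| + 1 < (P (k N)).f (i N) (x N) * (θ * ‖x N‖) ^ 2 := by
    have h2 := (Nat.ceil_le.1 hNC).trans_lt ((lt_add_one _).trans (hxN N))
    rw [div_lt_iff₀ (by positivity)] at h2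
    linarith
  have h3 := hC (P (k N)) (i N) (x N) (θ * ‖x N‖) hs (by linarith) (by linarith)
    (by linarith [abs_nonneg C]) ?_ ?_
  · linarith [le_abs_self C]
  · intro j z hz
    rw [mem_closedBall, dist_eq_norm] at hz
    have h4 : ‖x N‖ / 2 ≤ ‖z‖ := by
      have := norm_le_insert' (x N) z
      rw [norm_sub_rev] at this
      linarith
    have h5 : ‖z‖ < r := by linarith [norm_le_insert' z (x N)]
    have h6 := hmax N j z h5
    have h7 := ((P (k N)).riesz j).nonneg z
    have h8 : (‖x N‖ / 2) ^ 2 * (P (k N)).f j z ≤ ‖z‖ ^ 2 * (P (k N)).f j z := by gcongr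
    refine le_of_mul_le_mul_left ?_ (by positivity : 0 < ‖x N‖ ^ 2)
    linarith
  · have h4 : ∑ j, ((P (k N)).ρ j).real (closedBall (x N) (θ * ‖x N‖)) ≤ 1 / (entrySum A + 1) := by
      refine (sum_le_sum fun j _ => measureReal_mono (closedBall_subset_closedBall
        (mul_le_mul_of_nonneg_right (min_le_left _ _) hX.le))).trans ?_
      have h5 : Q.tot N (closedBall (x N) (ε * ‖x N‖)) =
          ∑ j, ((P (k N)).ρ j).real (closedBall (x N) (ε * ‖x N‖)) :=
        sum_congr rfl fun j _ => by rw [hQ]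
      linarith
    refine (mul_le_mul_of_nonneg_left h4 ha).trans ?_
    rw [mul_one_div, div_le_one (by positivity)]
    linarith

end LiouvillePotential

end NonSimple

section WeakForm

/-- The partial derivatives of a function on the plane. -/
def pd (i : Fin 2) (f : E2 → ℝ) (x : E2) : ℝ := fderiv ℝ f x (EuclideanSpace.single i 1)

lemma lap_eq_sum_pd (f : E2 → ℝ) (x : E2) : lap f x = ∑ i, pd i (pd i f) x := rfl

lemma contDiffAt_pd {f : E2 → ℝ} {x : E2} (hf : ContDiffAt ℝ 2 f x) (i : Fin 2) :
    ContDiffAt ℝ 1 (pd i f) x :=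
  (hf.fderiv_right (m := 1) (by norm_num)).clm_apply contDiffAt_const

lemma contDiff_pd {f : E2 → ℝ} (hf : ContDiff ℝ 2 f) (i : Fin 2) : ContDiff ℝ 1 (pd i f) :=
  contDiff_iff_contDiffAt.2 fun _ => contDiffAt_pd hf.contDiffAt i

lemma continuousAt_pd {f : E2 → ℝ} {x : E2} (hf : ContDiffAt ℝ 1 f x) (i : Fin 2) :
    ContinuousAt (pd i f) x :=
  ((hf.fderiv_right (m := 0) (by norm_num)).clm_apply contDiffAt_const).continuousAt

lemma tsupport_pd_subset (i : Fin 2) (f : E2 → ℝ) : tsupport (pd i f) ⊆ tsupport f :=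
  tsupport_fderiv_apply_subset ℝ _

lemma tsupport_lap_subset (f : E2 → ℝ) : tsupport (lap f) ⊆ tsupport f := by
  refine closure_minimal (fun x hx => ?_) (isClosed_tsupport f)
  by_contra h
  refine hx (sum_eq_zero fun i _ => ?_)
  have h0 : pd i (pd i f) x = 0 := image_eq_zero_of_notMem_tsupport fun h' =>
    h (tsupport_pd_subset i f (tsupport_pd_subset i (pd i f) h'))
  exact h0

lemma continuousAt_lap {f : E2 → ℝ} {x : E2} (hf : ContDiffAt ℝ 2 f x) : ContinuousAt (lap f) x :=
  tendsto_finsetSum _ fun i _ => continuousAt_pd (contDiffAt_pd hf i) i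

lemma continuous_lap {f : E2 → ℝ} (hf : ContDiff ℝ 2 f) : Continuous (lap f) :=
  continuous_iff_continuousAt.2 fun _ => continuousAt_lap hf.contDiffAt

lemma Filter.EventuallyEq.pd_eq {f g : E2 → ℝ} {x : E2} (h : f =ᶠ[𝓝 x] g) (i : Fin 2) :
    pd i f =ᶠ[𝓝 x] pd i g := by
  filter_upwards [h.fderiv (𝕜 := ℝ)] with y hy
  rw [pd, pd, hy]

lemma Filter.EventuallyEq.lap_eq {f g : E2 → ℝ} {x : E2} (h : f =ᶠ[𝓝 x] g) :
    lap f x = lap g x :=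
  sum_congr rfl fun i _ => ((h.pd_eq i).pd_eq i).eq_of_nhds

lemma pd_mul {f g : E2 → ℝ} {x : E2} (hf : DifferentiableAt ℝ f x) (hg : DifferentiableAt ℝ g x)
    (i : Fin 2) : pd i (fun y => f y * g y) x = f x * pd i g x + g x * pd i f x := by
  rw [pd, fderiv_fun_mul hf hg]
  rfl

lemma pd_add {f g : E2 → ℝ} {x : E2} (hf : DifferentiableAt ℝ f x) (hg : DifferentiableAt ℝ g x)
    (i : Fin 2) : pd i (fun y => f y + g y) x = pd i f x + pd i g x := by
  rw [pd, fderiv_fun_add hf hg]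
  rfl

lemma lap_add {f g : E2 → ℝ} {x : E2} (hf : ContDiffAt ℝ 2 f x) (hg : ContDiffAt ℝ 2 g x) :
    lap (fun y => f y + g y) x = lap f x + lap g x := by
  rw [lap_eq_sum_pd, lap_eq_sum_pd, lap_eq_sum_pd, ← sum_add_distrib]
  refine sum_congr rfl fun i _ => ?_
  have h : pd i (fun y => f y + g y) =ᶠ[𝓝 x] fun y => pd i f y + pd i g y := by
    filter_upwards [hf.eventually (by simp), hg.eventually (by simp)] with y hy hy'
    exact pd_add (hy.differentiableAt two_ne_zero) (hy'.differentiableAt two_ne_zero) i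
  rw [(h.pd_eq i).eq_of_nhds, pd_add ((contDiffAt_pd hf i).differentiableAt one_ne_zero)
    ((contDiffAt_pd hg i).differentiableAt one_ne_zero)]

lemma lap_mul {f g : E2 → ℝ} {x : E2} (hf : ContDiffAt ℝ 2 f x) (hg : ContDiffAt ℝ 2 g x) :
    lap (fun y => f y * g y) x = f x * lap g x + 2 * ∑ i, pd i f x * pd i g x + g x * lap f x := by
  simp only [lap_eq_sum_pd, mul_sum, ← sum_add_distrib]
  refine sum_congr rfl fun i _ => ?_
  have h : pd i (fun y => f y * g y) =ᶠ[𝓝 x] fun y => f y * pd i g y + g y * pd i f y := by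
    filter_upwards [hf.eventually (by simp), hg.eventually (by simp)] with y hy hy'
    exact pd_mul (hy.differentiableAt two_ne_zero) (hy'.differentiableAt two_ne_zero) i
  have df := hf.differentiableAt two_ne_zero
  have dg := hg.differentiableAt two_ne_zero
  have df' := (contDiffAt_pd hf i).differentiableAt one_ne_zero
  have dg' := (contDiffAt_pd hg i).differentiableAt one_ne_zero
  have d1 : DifferentiableAt ℝ (fun y => f y * pd i g y) x := df.mul dg'
  have d2 : DifferentiableAt ℝ (fun y => g y * pd i f y) x := dg.mul df'
  rw [(h.pd_eq i).eq_of_nhds, pd_add d1 d2, pd_mul df dg', pd_mul dg df']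
  ring

lemma lap_const (c : ℝ) (x : E2) : lap (fun _ => c) x = 0 := by
  have h : ∀ c : ℝ, ∀ i, pd i (fun _ => c) = fun _ => 0 := fun c i => by ext y; simp [pd]
  simp [lap_eq_sum_pd, h]

lemma lap_comp_smul {f : E2 → ℝ} (hf : ContDiff ℝ 2 f) (c : ℝ) (x : E2) :
    lap (fun y => f (c • y)) x = c ^ 2 * lap f (c • x) := by
  have h : ∀ (f : E2 → ℝ) i x, pd i (fun y => f (c • y)) x = c * pd i f (c • x) := fun f i x => by
    rw [pd, fderiv_comp_smul]
    rfl
  rw [lap_eq_sum_pd, lap_eq_sum_pd, mul_sum]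
  refine sum_congr rfl fun i _ => ?_
  have h' : pd i (fun y => f (c • y)) = fun y => c * pd i f (c • y) := funext (h f i)
  have d : Differentiable ℝ fun y => pd i f (c • y) :=
    ((contDiff_pd hf i).differentiable one_ne_zero).comp (differentiable_id.const_smul c)
  have e := h (pd i f) i x
  rw [pd] at e
  rw [h', pd, fderiv_const_mul (d x), sq, mul_assoc, ← e]
  rfl

lemma pd_radial {F : ℝ → ℝ} {F' : ℝ} {p x : E2} (h : HasDerivAt F F' (‖x - p‖ ^ 2)) (i : Fin 2) :
    pd i (fun y => F (‖y - p‖ ^ 2)) x = 2 * F' * (x i - p i) := by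
  have h1 : HasFDerivAt (fun y : E2 => ‖y - p‖ ^ 2) (2 • innerSL ℝ (x - p)) x := by
    simpa using ((hasFDerivAt_id x).sub_const p).norm_sq
  have h2 := (h.comp_hasFDerivAt x h1).fderiv
  rw [pd, show (fun y => F (‖y - p‖ ^ 2)) = F ∘ fun y : E2 => ‖y - p‖ ^ 2 from rfl, h2]
  simp [EuclideanSpace.inner_single_right]
  ring

lemma lap_radial {F F' : ℝ → ℝ} {F'' : ℝ} {p x : E2}
    (h : ∀ᶠ t in 𝓝 (‖x - p‖ ^ 2), HasDerivAt F (F' t) t) (h' : HasDerivAt F' F'' (‖x - p‖ ^ 2)) :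
    lap (fun y => F (‖y - p‖ ^ 2)) x = 4 * F' (‖x - p‖ ^ 2) + 4 * ‖x - p‖ ^ 2 * F'' := by
  have hc : Tendsto (fun y : E2 => ‖y - p‖ ^ 2) (𝓝 x) (𝓝 (‖x - p‖ ^ 2)) := by
    have : Continuous fun y : E2 => ‖y - p‖ ^ 2 := by fun_prop
    exact this.tendsto x
  have e : ∀ i : Fin 2, pd i (pd i fun y => F (‖y - p‖ ^ 2)) x =
      2 * F' (‖x - p‖ ^ 2) + 4 * F'' * (x i - p i) ^ 2 := by
    intro i
    have h1 : pd i (fun y => F (‖y - p‖ ^ 2)) =ᶠ[𝓝 x]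
        fun y => 2 * F' (‖y - p‖ ^ 2) * (y i - p i) := by
      filter_upwards [hc.eventually h] with y hy
      exact pd_radial hy i
    have d0 : HasFDerivAt (fun y : E2 => ‖y - p‖ ^ 2) (2 • innerSL ℝ (x - p)) x := by
      simpa using ((hasFDerivAt_id x).sub_const p).norm_sq
    have d1 : DifferentiableAt ℝ (fun y : E2 => 2 * F' (‖y - p‖ ^ 2)) x :=
      (h'.comp_hasFDerivAt x d0).differentiableAt.const_mul 2
    have d3 : HasFDerivAt (fun y : E2 => y i - p i) (EuclideanSpace.proj i : E2 →L[ℝ] ℝ) x :=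
      ((EuclideanSpace.proj i : E2 →L[ℝ] ℝ).hasFDerivAt).sub_const (p i)
    have d4 : pd i (fun y : E2 => y i - p i) x = 1 := by
      rw [pd, d3.fderiv]
      simp
    have d5 : pd i (fun y : E2 => 2 * F' (‖y - p‖ ^ 2)) x = 2 * (2 * F'' * (x i - p i)) := by
      exact pd_radial (F := fun t => 2 * F' t) (h'.const_mul 2) i |>.trans (by ring)
    rw [(h1.pd_eq i).eq_of_nhds, pd_mul d1 d3.differentiableAt, d4, d5]
    ring
  have hn : ‖x - p‖ ^ 2 = (x 0 - p 0) ^ 2 + (x 1 - p 1) ^ 2 := by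
    rw [EuclideanSpace.norm_sq_eq, Fin.sum_univ_two]
    simp
  rw [lap_eq_sum_pd, Fin.sum_univ_two, e, e]
  linear_combination -4 * F'' * hn

/-- Green's identity. -/
lemma integral_mul_lap_eq {u ψ : E2 → ℝ} (hψ : ContDiff ℝ 2 ψ) (hψc : HasCompactSupport ψ)
    (hu : ∀ x ∈ tsupport ψ, ContDiffAt ℝ 2 u x) : ∫ x, u x * lap ψ x = ∫ x, lap u x * ψ x := by
  have hint : ∀ a b : E2 → ℝ, (∀ x ∈ tsupport ψ, ContinuousAt a x) → Continuous b →
      tsupport b ⊆ tsupport ψ → Integrable fun x => a x * b x := by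
    intro a b ha hb hbψ
    have hs : tsupport (fun x => a x * b x) ⊆ tsupport b :=
      closure_mono fun x hx => right_ne_zero_of_mul hx
    refine Continuous.integrable_of_hasCompactSupport (continuous_of_tsupport fun x hx =>
      (ha x (hbψ (hs hx))).mul hb.continuousAt) (hψc.of_isClosed_subset (isClosed_tsupport _)
        (hs.trans hbψ))
  have hi : ∀ i : Fin 2, Integrable (fun x => u x * pd i (pd i ψ) x) ∧
      Integrable (fun x => pd i (pd i u) x * ψ x) ∧
      ∫ x, u x * pd i (pd i ψ) x = ∫ x, pd i (pd i u) x * ψ x := by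
    intro i
    have c1 : Continuous (pd i (pd i ψ)) :=
      continuous_iff_continuousAt.2 fun x => continuousAt_pd (contDiff_pd hψ i).contDiffAt i
    have c2 := (contDiff_pd hψ i).continuous
    have s2 := tsupport_pd_subset i ψ
    have s1 := (tsupport_pd_subset i (pd i ψ)).trans s2
    have u0 : ∀ x ∈ tsupport ψ, ContinuousAt u x := fun x hx => (hu x hx).continuousAt
    have u1 : ∀ x ∈ tsupport ψ, ContinuousAt (pd i u) x := fun x hx =>
      (contDiffAt_pd (hu x hx) i).continuousAt
    have u2 : ∀ x ∈ tsupport ψ, ContinuousAt (pd i (pd i u)) x := fun x hx =>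
      continuousAt_pd (contDiffAt_pd (hu x hx) i) i
    have i1 := hint u _ u0 c1 s1
    have i2 := hint (pd i u) _ u1 c2 s2
    have i3 := hint _ ψ u2 hψ.continuous le_rfl
    refine ⟨i1, i3, ?_⟩
    have g1 : ∫ x, u x * pd i (pd i ψ) x = -∫ x, pd i u x * pd i ψ x :=
      integral_mul_fderiv_eq_neg_fderiv_mul_of_integrable i2 i1 (hint u _ u0 c2 s2)
        (fun x hx => (hu x (s2 hx)).differentiableAt two_ne_zero)
        (fun x _ => (contDiff_pd hψ i).contDiffAt.differentiableAt one_ne_zero)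
    have g2 : ∫ x, pd i u x * pd i ψ x = -∫ x, pd i (pd i u) x * ψ x :=
      integral_mul_fderiv_eq_neg_fderiv_mul_of_integrable i3 i2 (hint _ ψ u1 hψ.continuous le_rfl)
        (fun x hx => (contDiffAt_pd (hu x hx) i).differentiableAt one_ne_zero)
        (fun x _ => hψ.contDiffAt.differentiableAt two_ne_zero)
    rw [g1, g2, neg_neg]
  simp only [lap_eq_sum_pd, mul_sum, sum_mul]
  rw [integral_finsetSum _ fun i _ => (hi i).1, integral_finsetSum _ fun i _ => (hi i).2.1]
  exact sum_congr rfl fun i _ => (hi i).2.2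

end WeakForm

section WeakForm

lemma exists_abs_lap_mul_comp_smul_le {ψ χ : E2 → ℝ} (hψ : ContDiff ℝ 2 ψ)
    (hψc : HasCompactSupport ψ) (hχ : ContDiff ℝ 2 χ) (hχc : HasCompactSupport χ) :
    ∃ K, ∀ c : ℝ, 1 ≤ c → ∀ x, |lap (fun y => ψ y * χ (c • y)) x| ≤ K * c ^ 2 := by
  have hpd : ∀ f : E2 → ℝ, ContDiff ℝ 2 f → HasCompactSupport f → ∀ i, ∃ C, ∀ x, |pd i f x| ≤ C :=
    fun f hf hc i => (contDiff_pd hf i).continuous.bounded_above_of_compact_support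
      (hc.of_isClosed_subset (isClosed_tsupport _) (tsupport_pd_subset i f))
  have hlap : ∀ f : E2 → ℝ, ContDiff ℝ 2 f → HasCompactSupport f → ∃ C, ∀ x, |lap f x| ≤ C :=
    fun f hf hc => (continuous_lap hf).bounded_above_of_compact_support
      (hc.of_isClosed_subset (isClosed_tsupport _) (tsupport_lap_subset f))
  choose P hP using hpd ψ hψ hψc
  choose Q hQ using hpd χ hχ hχc
  obtain ⟨L, hL⟩ := hlap ψ hψ hψc
  obtain ⟨N, hN⟩ := hlap χ hχ hχc
  obtain ⟨S, hS⟩ := hψ.continuous.bounded_above_of_compact_support hψc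
  obtain ⟨T, hT⟩ := hχ.continuous.bounded_above_of_compact_support hχc
  refine ⟨S * N + 2 * ∑ i, P i * Q i + T * L, fun c hc x => ?_⟩
  have hχs : ContDiff ℝ 2 fun y => χ (c • y) := hχ.comp (contDiff_id.const_smul c)
  have hp : ∀ i, pd i (fun y => χ (c • y)) x = c * pd i χ (c • x) := fun i => by
    rw [pd, fderiv_comp_smul]
    rfl
  have hc2 : c ≤ c ^ 2 := by nlinarith
  have hc1 : 1 ≤ c ^ 2 := hc.trans hc2
  have hS0 : 0 ≤ S := (norm_nonneg _).trans (hS 0)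
  have hT0 : 0 ≤ T := (norm_nonneg _).trans (hT 0)
  have hP0 : ∀ i, 0 ≤ P i := fun i => (abs_nonneg _).trans (hP i 0)
  have hQ0 : ∀ i, 0 ≤ Q i := fun i => (abs_nonneg _).trans (hQ i 0)
  have hL0 : 0 ≤ L := (abs_nonneg _).trans (hL 0)
  rw [lap_mul hψ.contDiffAt hχs.contDiffAt, lap_comp_smul hχ]
  simp only [hp]
  have b1 : |ψ x * (c ^ 2 * lap χ (c • x))| ≤ S * N * c ^ 2 := by
    rw [abs_mul, abs_mul, abs_of_nonneg (by positivity : 0 ≤ c ^ 2)]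
    calc |ψ x| * (c ^ 2 * |lap χ (c • x)|) ≤ S * (c ^ 2 * N) := by
          have := hS x
          have := hN (c • x)
          rw [norm_eq_abs] at *
          gcongr
      _ = S * N * c ^ 2 := by ring
  have b2 : |2 * ∑ i, pd i ψ x * (c * pd i χ (c • x))| ≤ 2 * (∑ i, P i * Q i) * c ^ 2 := by
    rw [abs_mul, abs_two, mul_assoc, sum_mul]
    refine mul_le_mul_of_nonneg_left ((abs_sum_le_sum_abs _ _).trans
      (sum_le_sum fun i _ => ?_)) zero_le_two
    rw [abs_mul, abs_mul, abs_of_nonneg (zero_le_one.trans hc)]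
    calc |pd i ψ x| * (c * |pd i χ (c • x)|) ≤ P i * (c ^ 2 * Q i) := by
          have := hP i x
          have := hQ i (c • x)
          have := hP0 i
          gcongr
      _ = P i * Q i * c ^ 2 := by ring
  have b3 : |χ (c • x) * lap ψ x| ≤ T * L * c ^ 2 := by
    rw [abs_mul]
    calc |χ (c • x)| * |lap ψ x| ≤ T * L := by
          have := hT (c • x)
          have := hL x
          rw [norm_eq_abs] at *
          gcongr
      _ ≤ T * L * c ^ 2 := le_mul_of_one_le_right (by positivity) hc1
  calc _ ≤ _ + _ + _ := (abs_add_le _ _).trans (add_le_add_left (abs_add_le _ _) _)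
    _ ≤ _ := add_le_add (add_le_add b1 b2) b3
    _ = _ := by ring

/-- Green's identity for a function that is `C²` away from the origin and continuous there. -/
lemma integral_mul_lap_eq_of_punctured {u g ψ : E2 → ℝ} {δ : ℝ} (hδ : 0 < δ)
    (hu : ∀ x, x ≠ 0 → ‖x‖ < δ → ContDiffAt ℝ 2 u x)
    (hl : ∀ x, x ≠ 0 → ‖x‖ < δ → lap u x = -g x) (hc : ContinuousAt u 0)
    (hg : IntegrableOn g (ball 0 δ)) (hψ : ContDiff ℝ 2 ψ) (hψc : HasCompactSupport ψ)
    (hs : tsupport ψ ⊆ ball 0 δ) : ∫ x, u x * lap ψ x = -∫ x, g x * ψ x := by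
  have hsn : ∀ x ∈ tsupport ψ, ‖x‖ < δ := fun x hx => mem_ball_zero_iff.1 (hs hx)
  have huc : ∀ x, ‖x‖ < δ → ContinuousAt u x := fun x hx => by
    by_cases h0 : x = 0
    · exact h0 ▸ hc
    · exact (hu x h0 hx).continuousAt
  have hlapψ : ∫ x, lap ψ x = 0 := by
    have := integral_mul_lap_eq (u := fun _ => 1) hψ hψc fun _ _ => contDiffAt_const
    simpa [lap_const] using this
  have hint : ∀ a b : E2 → ℝ, (∀ x, ‖x‖ < δ → ContinuousAt a x) → Continuous b →
      tsupport b ⊆ tsupport ψ → Integrable fun x => a x * b x := by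
    intro a b ha hb hbψ
    have h' : tsupport (fun x => a x * b x) ⊆ tsupport b :=
      closure_mono fun x hx => right_ne_zero_of_mul hx
    exact Continuous.integrable_of_hasCompactSupport (continuous_of_tsupport fun x hx =>
      (ha x (hsn x (hbψ (h' hx)))).mul hb.continuousAt)
      (hψc.of_isClosed_subset (isClosed_tsupport _) (h'.trans hbψ))
  set v : E2 → ℝ := fun x => u x + -u 0 with hv
  have hvc : ∀ x, ‖x‖ < δ → ContinuousAt v x := fun x hx => (huc x hx).add continuousAt_const
  have hlc := continuous_lap hψ
  have huv : ∫ x, v x * lap ψ x = ∫ x, u x * lap ψ x := by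
    have i1 := hint u _ huc hlc (tsupport_lap_subset ψ)
    have i2 := hint (fun _ => -u 0) _ (fun _ _ => continuousAt_const) hlc (tsupport_lap_subset ψ)
    simp only [hv, add_mul]
    rw [integral_add i1 i2, integral_const_mul, hlapψ, mul_zero, add_zero]
  obtain ⟨χ, hχ, hχc, hχ1, hχ0, hχi⟩ : ∃ χ : E2 → ℝ, ContDiff ℝ 2 χ ∧ HasCompactSupport χ ∧
      (∀ x, ‖x‖ < 1 → χ x = 1) ∧ (∀ x, 2 ≤ ‖x‖ → χ x = 0) ∧ ∀ x, χ x ∈ Icc (0:ℝ) 1 := by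
    let b : ContDiffBump (0 : E2) := ⟨1, 2, one_pos, one_lt_two⟩
    refine ⟨b, b.contDiff, b.hasCompactSupport, fun x hx => b.one_of_mem_closedBall ?_,
      fun x hx => b.zero_of_le_dist ?_, fun x => ⟨b.nonneg, b.le_one⟩⟩
    · simpa using hx.le
    · simpa using hx
  obtain ⟨K, hK⟩ := exists_abs_lap_mul_comp_smul_le hψ hψc hχ hχc
  have hgψ : Integrable fun x => g x * ψ x := by
    have hz : (fun x => g x * ψ x) = (ball 0 δ).indicator fun x => g x * ψ x := by
      ext x
      by_cases hx : x ∈ ball (0 : E2) δ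
      · rw [indicator_of_mem hx]
      · rw [indicator_of_notMem hx,
          image_eq_zero_of_notMem_tsupport fun h => hx (hs h), mul_zero]
    obtain ⟨S, hS⟩ := hψ.continuous.bounded_above_of_compact_support hψc
    rw [hz, integrable_indicator_iff measurableSet_ball]
    exact hg.mul_bdd hψ.continuous.aestronglyMeasurable (Eventually.of_forall hS)
  have key : ∀ c : ℝ, 1 ≤ c → (∫ x, v x * lap ψ x) + ∫ x, g x * ψ x =
      (∫ x, v x * lap (fun y => ψ y * χ (c • y)) x) + ∫ x, g x * ψ x * χ (c • x) := by
    intro c hc1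
    have hc0 : 0 < c := zero_lt_one.trans_le hc1
    have hχs : ContDiff ℝ 2 fun y => χ (c • y) := hχ.comp (contDiff_id.const_smul c)
    have h1 : ContDiff ℝ 2 fun y => ψ y * χ (c • y) := hψ.mul hχs
    have h2 : ContDiff ℝ 2 fun y => ψ y * (1 - χ (c • y)) := hψ.mul (contDiff_const.sub hχs)
    have t1 : tsupport (fun y => ψ y * χ (c • y)) ⊆ tsupport ψ :=
      closure_mono fun x hx => left_ne_zero_of_mul hx
    have t2 : tsupport (fun y => ψ y * (1 - χ (c • y))) ⊆ tsupport ψ :=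
      closure_mono fun x hx => left_ne_zero_of_mul hx
    have t0 : (0 : E2) ∉ tsupport fun y => ψ y * (1 - χ (c • y)) := by
      rw [notMem_tsupport_iff_eventuallyEq]
      filter_upwards [ball_mem_nhds (0 : E2) (inv_pos.2 hc0)] with y hy
      have hn : ‖c • y‖ < 1 := by
        rw [norm_smul, norm_of_nonneg hc0.le]
        rw [mem_ball_zero_iff] at hy
        calc c * ‖y‖ < c * c⁻¹ := by gcongr
          _ = 1 := mul_inv_cancel₀ hc0.ne'
      simp [hχ1 _ hn]
    have hne : ∀ x ∈ tsupport (fun y => ψ y * (1 - χ (c • y))), x ≠ 0 := fun x hx h =>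
      t0 (h ▸ hx)
    have green := integral_mul_lap_eq (u := v) h2
      (hψc.of_isClosed_subset (isClosed_tsupport _) t2)
      fun x hx => (hu x (hne x hx) (hsn x (t2 hx))).add contDiffAt_const
    have e1 : ∀ x, lap v x * (ψ x * (1 - χ (c • x))) = -(g x * ψ x * (1 - χ (c • x))) := by
      intro x
      by_cases hx : x ∈ tsupport fun y => ψ y * (1 - χ (c • y))
      · rw [hv, lap_add (hu x (hne x hx) (hsn x (t2 hx))) contDiffAt_const, lap_const,
          hl x (hne x hx) (hsn x (t2 hx))]
        ring
      · have := image_eq_zero_of_notMem_tsupport hx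
        rw [mul_assoc, this, mul_zero, mul_zero, neg_zero]
    have e2 : ∀ x, v x * lap ψ x = v x * lap (fun y => ψ y * χ (c • y)) x +
        v x * lap (fun y => ψ y * (1 - χ (c • y))) x := by
      intro x
      have : ψ = fun y => ψ y * χ (c • y) + ψ y * (1 - χ (c • y)) := by ext y; ring
      conv_lhs => rw [this, lap_add h1.contDiffAt h2.contDiffAt]
      ring
    have hχi' : Integrable fun x => g x * ψ x * χ (c • x) :=
      hgψ.mul_bdd (c := 1) hχs.continuous.aestronglyMeasurable (Eventually.of_forall fun x => by
        rw [norm_of_nonneg (hχi _).1]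
        exact (hχi _).2)
    have e3 : ∀ x, -(g x * ψ x * (1 - χ (c • x))) = g x * ψ x * χ (c • x) - g x * ψ x := by
      intro x
      ring
    simp only [e1, e3] at green
    rw [integral_sub hχi' hgψ] at green
    simp only [e2]
    rw [integral_add (hint v _ hvc (continuous_lap h1) ((tsupport_lap_subset _).trans t1))
      (hint v _ hvc (continuous_lap h2) ((tsupport_lap_subset _).trans t2)), green]
    ring
  have lim1 : Tendsto (fun c : ℝ => ∫ x, g x * ψ x * χ (c • x)) atTop (𝓝 0) := by
    have : ∫ x : E2, (0 : ℝ) = 0 := integral_zero _ _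
    rw [← this]
    refine tendsto_integral_filter_of_dominated_convergence (fun x => ‖g x * ψ x‖) ?_ ?_ hgψ.norm ?_
    · exact Eventually.of_forall fun c => hgψ.aestronglyMeasurable.mul
        (hχ.continuous.comp (continuous_const_smul c)).aestronglyMeasurable
    · refine Eventually.of_forall fun c => Eventually.of_forall fun x => ?_
      rw [norm_mul, norm_of_nonneg (hχi _).1]
      exact mul_le_of_le_one_right (norm_nonneg _) (hχi _).2
    · filter_upwards [Measure.ae_ne volume (0 : E2)] with x hx
      refine tendsto_const_nhds.congr' ?_
      filter_upwards [eventually_ge_atTop (2 / ‖x‖), eventually_gt_atTop 0] with c hc' h0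
      rw [hχ0, mul_zero]
      rw [norm_smul, norm_of_nonneg h0.le]
      exact (div_le_iff₀ (norm_pos_iff.2 hx)).1 hc'
  have lim2 : Tendsto (fun c : ℝ => ∫ x, v x * lap (fun y => ψ y * χ (c • y)) x) atTop (𝓝 0) := by
    have hK0 : 0 ≤ K := by simpa using (abs_nonneg _).trans (hK 1 le_rfl 0)
    set V := volume.real (ball (0 : E2) 1) with hV
    have hV0 : 0 ≤ V := measureReal_nonneg
    refine Metric.tendsto_atTop.2 fun ε hε => ?_
    obtain ⟨ρ, hρ, hvρ⟩ := Metric.continuousAt_iff.1 (hvc 0 (by simpa using hδ))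
      (ε / (4 * K * V + 1)) (by positivity)
    refine ⟨max 1 (3 / ρ), fun c hc' => ?_⟩
    have hc1 : 1 ≤ c := (le_max_left _ _).trans hc'
    have hc0 : 0 < c := zero_lt_one.trans_le hc1
    have hcρ : 2 / c < ρ := by
      have : 3 / ρ ≤ c := (le_max_right _ _).trans hc'
      rw [div_le_iff₀ hρ] at this
      rw [div_lt_iff₀ hc0]
      linarith
    have hz : ∀ x ∉ closedBall (0 : E2) (2 / c), v x * lap (fun y => ψ y * χ (c • y)) x = 0 := by
      intro x hx
      have hx' : x ∉ tsupport fun y => ψ y * χ (c • y) := by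
        refine fun h => hx (closure_minimal (fun y hy => ?_) isClosed_closedBall h)
        by_contra hy'
        refine right_ne_zero_of_mul hy (hχ0 _ ?_)
        rw [mem_closedBall_zero_iff, not_le, div_lt_iff₀ hc0] at hy'
        rw [norm_smul, norm_of_nonneg hc0.le, mul_comm]
        exact hy'.le
      have : lap (fun y => ψ y * χ (c • y)) x = 0 :=
        image_eq_zero_of_notMem_tsupport fun h => hx' (tsupport_lap_subset _ h)
      rw [this, mul_zero]
    rw [dist_zero_right, ← setIntegral_eq_integral_of_forall_compl_eq_zero hz]
    have hb : ∀ x ∈ closedBall (0 : E2) (2 / c), ‖v x * lap (fun y => ψ y * χ (c • y)) x‖ ≤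
        ε / (4 * K * V + 1) * (K * c ^ 2) := by
      intro x hx
      rw [mem_closedBall_zero_iff] at hx
      rw [norm_mul]
      have h1 := hvρ (by simpa using hx.trans_lt hcρ : dist x 0 < ρ)
      have h2 : v 0 = 0 := by simp [hv]
      rw [h2, dist_zero_right] at h1
      exact mul_le_mul h1.le (hK c hc1 x) (norm_nonneg _) (by positivity)
    calc _ ≤ ε / (4 * K * V + 1) * (K * c ^ 2) * volume.real (closedBall (0 : E2) (2 / c)) :=
          norm_setIntegral_le_of_norm_le_const measure_closedBall_lt_top hb
      _ = ε * (4 * K * V) / (4 * K * V + 1) := by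
          rw [Measure.addHaar_real_closedBall _ _ (by positivity), ← hV]
          simp only [finrank_euclideanSpace, Fintype.card_fin]
          field_simp
          ring
      _ < ε := by
          rw [div_lt_iff₀ (by positivity)]
          nlinarith
  have hfin : (∫ x, v x * lap ψ x) + ∫ x, g x * ψ x = 0 := by
    have l := lim2.add lim1
    rw [add_zero] at l
    refine tendsto_nhds_unique (tendsto_const_nhds.congr' ?_) l
    filter_upwards [eventually_ge_atTop 1] with c hc'
    exact key c hc'
  rw [← huv]
  linarith

end WeakForm

section Superharmonic

lemma lap_nonneg_of_isLocalMin {v : E2 → ℝ} {x : E2} (hv : ContDiffAt ℝ 2 v x)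
    (hm : IsLocalMin v x) : 0 ≤ lap v x := by
  rw [lap_eq_sum_pd]
  refine sum_nonneg fun i _ => ?_
  set e : E2 := EuclideanSpace.single i 1
  have hl : ∀ t : ℝ, HasDerivAt (fun t : ℝ => x + t • e) e t := fun t => by
    simpa using ((hasDerivAt_id t).smul_const e).const_add x
  have hx : x + (0 : ℝ) • e = x := by simp
  have hc : Tendsto (fun t : ℝ => x + t • e) (𝓝 0) (𝓝 x) := by
    simpa [hx] using (hl 0).continuousAt.tendsto
  have d1 : deriv (fun t : ℝ => v (x + t • e)) =ᶠ[𝓝 0] fun t => pd i v (x + t • e) := by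
    filter_upwards [hc.eventually (hv.eventually (by simp))] with t ht
    exact ((ht.differentiableAt two_ne_zero).hasFDerivAt.comp_hasDerivAt t (hl t)).deriv
  have d2 : deriv (deriv fun t : ℝ => v (x + t • e)) 0 = pd i (pd i v) x := by
    rw [d1.deriv_eq]
    have h : HasFDerivAt (pd i v) (fderiv ℝ (pd i v) x) (x + (0 : ℝ) • e) := by
      rw [hx]
      exact ((contDiffAt_pd hv i).differentiableAt one_ne_zero).hasFDerivAt
    exact (h.comp_hasDerivAt 0 (hl 0)).deriv
  have hmin : IsLocalMin (fun t : ℝ => v (x + t • e)) 0 := by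
    filter_upwards [hc.eventually hm] with t ht
    rwa [hx]
  by_contra! hneg
  have hcont : ContinuousAt (fun t : ℝ => v (x + t • e)) 0 := by
    have h : ContinuousAt v (x + (0 : ℝ) • e) := hx.symm ▸ hv.continuousAt
    exact ContinuousAt.comp (f := fun t : ℝ => x + t • e) h (hl 0).continuousAt
  have hmax := isLocalMax_of_deriv_deriv_neg (d2.trans_lt hneg) hmin.deriv_eq_zero hcont
  have hconst : (fun t : ℝ => v (x + t • e)) =ᶠ[𝓝 0] fun _ => v (x + (0 : ℝ) • e) := by
    filter_upwards [hmin, hmax] with t h1 h2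
    exact le_antisymm h2 h1
  have h0 : deriv (deriv fun t : ℝ => v (x + t • e)) 0 = 0 := by
    rw [hconst.deriv.deriv_eq]
    simp
  linarith

/-- The minimum principle on a punctured disc. -/
lemma le_of_superharmonic {u : E2 → ℝ} {δ c : ℝ} (hu : ContinuousOn u (closedBall 0 δ))
    (hu2 : ∀ x, x ≠ 0 → ‖x‖ < δ → ContDiffAt ℝ 2 u x)
    (hl : ∀ x, x ≠ 0 → ‖x‖ < δ → lap u x ≤ 0) (hc : ∀ x, ‖x‖ = δ → c ≤ u x) {x : E2}
    (hx0 : x ≠ 0) (hxδ : ‖x‖ ≤ δ) : c ≤ u x := by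
  have hδ : 0 < δ := (norm_pos_iff.2 hx0).trans_le hxδ
  have key : ∀ ε > 0, c ≤ u x +
      ε * (-(1 / 2) * log (‖x‖ ^ 2) - ‖x‖ ^ 2 + (1 / 2 * log (δ ^ 2) + δ ^ 2)) := by
    intro ε hε
    set F : ℝ → ℝ := fun t =>
      ε * (-(1 / 2) * log t - t + (1 / 2 * log (δ ^ 2) + δ ^ 2)) with hF
    have hF1 : ∀ t, t ≠ 0 → HasDerivAt F (ε * (-(1 / 2) * t⁻¹ - 1)) t := fun t ht =>
      (((((hasDerivAt_log ht).const_mul _).sub (hasDerivAt_id t)).add_const _).const_mul ε)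
    have hF2 : ∀ t, t ≠ 0 →
        HasDerivAt (fun t => ε * (-(1 / 2) * t⁻¹ - 1)) (ε * (-(1 / 2) * (-(t ^ 2)⁻¹))) t :=
      fun t ht => ((((hasDerivAt_inv ht).const_mul _).sub_const _).const_mul ε)
    by_contra! hlt
    obtain ⟨m, hm⟩ := (isCompact_closedBall (0 : E2) δ).bddBelow_image hu
    have hm' : ∀ y : E2, ‖y‖ ≤ δ → m ≤ u y := fun y hy =>
      hm ⟨y, mem_closedBall_zero_iff.2 hy, rfl⟩
    obtain ⟨ρ, hρ, hρF⟩ : ∃ ρ > 0, ∀ y : E2, y ≠ 0 → ‖y‖ ≤ ρ → ‖y‖ ≤ δ →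
        c ≤ u y + F (‖y‖ ^ 2) := by
      refine ⟨δ * exp (-((c - m) / ε)), by positivity, fun y hy hyρ hyδ => ?_⟩
      have hy0 := norm_pos_iff.2 hy
      have h1 : log ‖y‖ ≤ log δ - (c - m) / ε := by
        have := log_le_log hy0 hyρ
        rw [log_mul hδ.ne' (exp_pos _).ne', log_exp] at this
        linarith
      have h2 : ‖y‖ ^ 2 ≤ δ ^ 2 := by gcongr
      have h3 : c - m ≤ F (‖y‖ ^ 2) := by
        simp only [hF, log_pow]
        push_cast
        calc c - m = ε * ((c - m) / ε) := by field_simp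
          _ ≤ _ := by
            gcongr
            linarith
      linarith [hm' y hyδ]
    have hK : IsCompact {y : E2 | ρ ≤ ‖y‖ ∧ ‖y‖ ≤ δ} := by
      have : {y : E2 | ρ ≤ ‖y‖ ∧ ‖y‖ ≤ δ} = closedBall 0 δ ∩ {y | ρ ≤ ‖y‖} := by
        ext y
        simp [and_comm]
      rw [this]
      exact (isCompact_closedBall _ _).inter_right (isClosed_le continuous_const continuous_norm)
    have hFc : ∀ y : E2, y ≠ 0 → ContinuousAt (fun y : E2 => F (‖y‖ ^ 2)) y := fun y hy =>
      ContinuousAt.comp (f := fun y : E2 => ‖y‖ ^ 2)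
        (hF1 _ (pow_ne_zero 2 (norm_ne_zero_iff.2 hy))).continuousAt (by fun_prop)
    have hvc : ContinuousOn (fun y : E2 => u y + F (‖y‖ ^ 2)) {y : E2 | ρ ≤ ‖y‖ ∧ ‖y‖ ≤ δ} :=
      (hu.mono fun y hy => mem_closedBall_zero_iff.2 hy.2).add fun y hy =>
        (hFc y (norm_pos_iff.1 (hρ.trans_le hy.1))).continuousWithinAt
    have hxρ : ρ ≤ ‖x‖ := by
      by_contra! h
      exact absurd (hρF x hx0 h.le hxδ) (not_le.2 hlt)
    obtain ⟨y, hy, hymin⟩ := hK.exists_isMinOn ⟨x, hxρ, hxδ⟩ hvc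
    have hyc : u y + F (‖y‖ ^ 2) < c := (hymin ⟨hxρ, hxδ⟩).trans_lt hlt
    have hy0 : y ≠ 0 := norm_pos_iff.1 (hρ.trans_le hy.1)
    have hyρ : ρ < ‖y‖ := by
      by_contra! h
      exact absurd (hρF y hy0 h hy.2) (not_le.2 hyc)
    have hyδ : ‖y‖ < δ := by
      refine lt_of_le_of_ne hy.2 fun h => ?_
      have : F (‖y‖ ^ 2) = 0 := by
        simp only [hF, h]
        ring
      linarith [hc y h]
    have hloc : IsLocalMin (fun y : E2 => u y + F (‖y - 0‖ ^ 2)) y := by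
      filter_upwards [continuous_norm.continuousAt.eventually (lt_mem_nhds hyρ),
        continuous_norm.continuousAt.eventually (gt_mem_nhds hyδ)] with z h1 h2
      simpa using hymin ⟨h1.le, h2.le⟩
    have hne : ‖y - 0‖ ^ 2 ≠ 0 := by simpa using hy0
    have hFd : ContDiffAt ℝ 2 (fun y : E2 => F (‖y - 0‖ ^ 2)) y := by
      have h1 : ContDiffAt ℝ 2 F (‖y - 0‖ ^ 2) :=
        ((((contDiffAt_const.mul (contDiffAt_log.2 hne)).sub contDiffAt_id).add
          contDiffAt_const).const_smul ε)
      have h2 : ContDiffAt ℝ 2 (fun y : E2 => ‖y - 0‖ ^ 2) y :=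
        ((contDiff_id.sub contDiff_const).norm_sq ℝ).contDiffAt
      exact ContDiffAt.comp (f := fun y : E2 => ‖y - 0‖ ^ 2) y h1 h2
    have hpos := lap_nonneg_of_isLocalMin ((hu2 y hy0 hyδ).add hFd) hloc
    have hev : ∀ᶠ t in 𝓝 (‖y - 0‖ ^ 2), HasDerivAt F (ε * (-(1 / 2) * t⁻¹ - 1)) t := by
      filter_upwards [eventually_ne_nhds hne] with t ht
      exact hF1 t ht
    rw [lap_add (hu2 y hy0 hyδ) hFd, lap_radial hev (hF2 _ hne)] at hpos
    have e : 4 * (ε * (-(1 / 2) * (‖y - 0‖ ^ 2)⁻¹ - 1)) +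
        4 * ‖y - 0‖ ^ 2 * (ε * (-(1 / 2) * (-((‖y - 0‖ ^ 2) ^ 2)⁻¹))) = -4 * ε := by
      field_simp
      ring
    linarith [hl y hy0 hyδ]
  by_contra! hlt
  set D := -(1 / 2) * log (‖x‖ ^ 2) - ‖x‖ ^ 2 + (1 / 2 * log (δ ^ 2) + δ ^ 2)
  have h1 := key ((c - u x) / (2 * (|D| + 1))) (div_pos (by linarith) (by positivity))
  have h2 : (c - u x) / (2 * (|D| + 1)) * D ≤ (c - u x) / 2 := by
    rw [div_mul_eq_mul_div, div_le_iff₀ (by positivity)]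
    nlinarith [le_abs_self D]
  linarith

lemma exists_radial_cutoff {a b : ℝ} (hab : a < b) (hb : 0 < b) :
    ∃ F G G' : ℝ → ℝ, ContDiff ℝ 2 F ∧ (∀ t, HasDerivAt F (-G t) t) ∧
      (∀ t, HasDerivAt (fun t => -G t) (-G' t) t) ∧ (∀ t, G t ≤ 1) ∧ (∀ t, 0 ≤ G t) ∧
      (∀ t, G' t ≤ 0) ∧ (∀ t < a, G t = 1 ∧ G' t = 0) ∧ (∀ t, b ≤ t → F t = 0) ∧
      ∀ t, 0 ≤ t → 0 ≤ F t ∧ F t ≤ b := by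
  set G : ℝ → ℝ := fun t => smoothTransition ((b - t) / (b - a)) with hG
  have hba : 0 < b - a := sub_pos.2 hab
  have hGc : ContDiff ℝ 1 G :=
    smoothTransition.contDiff.comp ((contDiff_const.sub contDiff_id).div_const _)
  have hGanti : Antitone G := fun s t hst => smoothTransition.monotone (by gcongr)
  have hG0 : ∀ t, b ≤ t → G t = 0 := fun t ht =>
    smoothTransition.zero_of_nonpos (div_nonpos_of_nonpos_of_nonneg (by linarith) hba.le)
  have hG1 : ∀ t ≤ a, G t = 1 := fun t ht =>
    smoothTransition.one_of_one_le ((one_le_div hba).2 (by linarith))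
  have hGnn : ∀ t, 0 ≤ G t := fun t => smoothTransition.nonneg _
  have hGle : ∀ t, G t ≤ 1 := fun t => smoothTransition.le_one _
  have hF : ∀ t, HasDerivAt (fun t => -∫ s in b..t, G s) (-G t) t := fun t =>
    (intervalIntegral.integral_hasDerivAt_right (hGc.continuous.intervalIntegrable _ _)
      (hGc.continuous.stronglyMeasurableAtFilter _ _) hGc.continuous.continuousAt).neg
  have hF0 : ∀ t, b ≤ t → -∫ s in b..t, G s = 0 := fun t ht => by
    rw [intervalIntegral.integral_congr (g := fun _ => 0)]
    · simp
    · intro s hs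
      rw [Set.uIcc_of_le ht] at hs
      exact hG0 s hs.1
  refine ⟨fun t => -∫ s in b..t, G s, G, deriv G, ?_, hF, fun t =>
    ((hGc.differentiable one_ne_zero) t).hasDerivAt.neg, hGle, hGnn,
    fun t => hGanti.deriv_nonpos, fun t ht => ⟨hG1 t ht.le, ?_⟩, hF0, fun t ht => ?_⟩
  · have : ContDiff ℝ (1 + 1) fun t => -∫ s in b..t, G s := by
      rw [contDiff_succ_iff_deriv]
      refine ⟨fun t => (hF t).differentiableAt, by simp, ?_⟩
      rw [funext fun t => (hF t).deriv]
      exact hGc.neg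
    exact this
  · have : G =ᶠ[𝓝 t] fun _ => 1 := by
      filter_upwards [gt_mem_nhds ht] with s hs
      exact hG1 s hs.le
    rw [this.deriv_eq]
    simp
  · beta_reduce
    rcases le_total b t with h | h
    · rw [hF0 t h]
      exact ⟨le_rfl, hb.le⟩
    · rw [← intervalIntegral.integral_symm]
      refine ⟨intervalIntegral.integral_nonneg h fun s _ => hGnn s, ?_⟩
      calc ∫ s in t..b, G s ≤ ∫ s in t..b, (1 : ℝ) :=
            intervalIntegral.integral_mono_on h (hGc.continuous.intervalIntegrable _ _)
              (by simp) fun s _ => hGle s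
        _ ≤ b := by simp [ht]

/-- A superharmonic function with bounded boundary oscillation is controlled in the interior. -/
lemma exists_integral_sub_le_of_superharmonic {u g : E2 → ℝ} {δ C m : ℝ} (hδ : 0 < δ)
    (hu : ContinuousOn u (closedBall 0 δ))
    (hu2 : ∀ x, x ≠ 0 → ‖x‖ < δ → ContDiffAt ℝ 2 u x)
    (hl : ∀ x, x ≠ 0 → ‖x‖ < δ → lap u x = -g x) (hg0 : ∀ x, x ≠ 0 → ‖x‖ < δ → 0 ≤ g x)
    (hg : IntegrableOn g (ball 0 δ)) (hgm : ∫ x in ball 0 δ, g x ≤ m)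
    (hosc : ∀ x ∈ sphere (0 : E2) δ, ∀ y ∈ sphere (0 : E2) δ, |u x - u y| ≤ C) :
    ∃ c, (∀ x, ‖x‖ ≤ δ → c ≤ u x) ∧ ∫ x in ball (0 : E2) (δ / 2), (u x - c) ≤
      (C + 1) * volume.real (ball (0 : E2) δ) + δ ^ 2 * m / 4 := by
  have hsc : IsCompact (sphere (0 : E2) δ) := isCompact_sphere _ _
  obtain ⟨p, hp, hpmin⟩ := hsc.exists_isMinOn (NormedSpace.sphere_nonempty.2 hδ.le)
    (hu.mono sphere_subset_closedBall)
  have hle : ∀ x, x ≠ 0 → ‖x‖ ≤ δ → u p ≤ u x := fun x hx0 hx =>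
    le_of_superharmonic hu hu2 (fun x h0 h => by
      rw [hl x h0 h]
      exact neg_nonpos.2 (hg0 x h0 h)) (fun x hx => hpmin (mem_sphere_zero_iff_norm.2 hx)) hx0 hx
  have hc0 : ContinuousAt u 0 := hu.continuousAt (closedBall_mem_nhds _ hδ)
  have hle' : ∀ x, ‖x‖ ≤ δ → u p ≤ u x := by
    intro x hx
    by_cases hx0 : x = 0
    · rw [hx0]
      refine ge_of_tendsto (hc0.tendsto.mono_left (nhdsWithin_le_nhds (s := {0}ᶜ))) ?_
      filter_upwards [self_mem_nhdsWithin, nhdsWithin_le_nhds (closedBall_mem_nhds (0 : E2) hδ)]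
        with y hy hy'
      exact hle y hy (mem_closedBall_zero_iff.1 hy')
    · exact hle x hx0 hx
  refine ⟨u p, hle', ?_⟩
  have hC : 0 ≤ C := (abs_nonneg _).trans (hosc p hp p hp)
  obtain ⟨ρ, hρδ, hρ2, hρ⟩ : ∃ ρ < δ, δ / 2 < ρ ∧ ∀ x, ρ ≤ ‖x‖ → ‖x‖ ≤ δ →
      u x ≤ u p + (C + 1) := by
    have huc := (isCompact_closedBall (0 : E2) δ).uniformContinuousOn_of_continuous hu
    obtain ⟨η, hη, hη'⟩ := Metric.uniformContinuousOn_iff.1 huc 1 one_pos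
    refine ⟨max (3 * δ / 4) (δ - η / 2), max_lt (by linarith) (by linarith),
      lt_max_of_lt_left (by linarith), fun x h1 h2 => ?_⟩
    have hx0 : 0 < ‖x‖ := lt_of_lt_of_le (by linarith) ((le_max_left _ _).trans h1)
    have hq : (δ / ‖x‖) • x ∈ sphere (0 : E2) δ := by
      rw [mem_sphere_zero_iff_norm, norm_smul, norm_of_nonneg (by positivity),
        div_mul_cancel₀ _ hx0.ne']
    have hd : dist x ((δ / ‖x‖) • x) < η := by
      have e : (δ / ‖x‖) • x - x = (δ / ‖x‖ - 1) • x := by rw [sub_smul, one_smul]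
      rw [dist_comm, dist_eq_norm, e, norm_smul, norm_of_nonneg, sub_mul,
        div_mul_cancel₀ _ hx0.ne', one_mul]
      · linarith [(le_max_right _ _).trans h1]
      · rw [sub_nonneg, one_le_div hx0]
        exact h2
    have h3 := hη' x (mem_closedBall_zero_iff.2 h2) _ (sphere_subset_closedBall hq) hd
    rw [dist_eq] at h3
    linarith [(abs_lt.1 h3).2, (abs_le.1 (hosc _ hq p hp)).2]
  have hρ0 : 0 < ρ := by linarith
  obtain ⟨b, hb1, hb2⟩ := exists_between (by gcongr : ρ ^ 2 < δ ^ 2)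
  have hb0 : 0 < b := (by positivity : 0 < ρ ^ 2).trans hb1
  obtain ⟨F, G, G', hF, hF', hG', hG1, hG0, hGn, hGa, hFb, hF01⟩ := exists_radial_cutoff hb1 hb0
  set ψ : E2 → ℝ := fun y => F (‖y - 0‖ ^ 2) with hψdef
  have hψ : ContDiff ℝ 2 ψ := hF.comp ((contDiff_id.sub contDiff_const).norm_sq ℝ)
  have hψl : ∀ x, lap ψ x = -4 * G (‖x‖ ^ 2) - 4 * ‖x‖ ^ 2 * G' (‖x‖ ^ 2) := fun x => by
    rw [lap_radial (Eventually.of_forall hF') (hG' _), sub_zero]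
    ring
  have hts : tsupport ψ ⊆ closedBall 0 √b := by
    refine closure_minimal (fun x hx => ?_) isClosed_closedBall
    by_contra h
    rw [mem_closedBall_zero_iff, not_le] at h
    refine hx (hFb _ ?_)
    rw [sub_zero, ← sqrt_le_sqrt_iff (by positivity), sqrt_sq (norm_nonneg _)]
    exact h.le
  have hbδ : √b < δ := (sqrt_lt' hδ).2 hb2
  have hts' : tsupport ψ ⊆ ball 0 δ := hts.trans (closedBall_subset_ball hbδ)
  have hψc : HasCompactSupport ψ :=
    (isCompact_closedBall (0 : E2) √b).of_isClosed_subset (isClosed_tsupport _) hts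
  have hψz : ∀ x ∉ ball (0 : E2) δ, ψ x = 0 := fun x hx =>
    image_eq_zero_of_notMem_tsupport fun h => hx (hts' h)
  have hlz : ∀ x ∉ ball (0 : E2) δ, lap ψ x = 0 := fun x hx =>
    image_eq_zero_of_notMem_tsupport fun h => hx (hts' (tsupport_lap_subset _ h))
  set K := u p + (C + 1) with hK
  have green := integral_mul_lap_eq_of_punctured (u := fun x => u x + -K) hδ
    (fun x h0 h => (hu2 x h0 h).add contDiffAt_const)
    (fun x h0 h => by rw [lap_add (hu2 x h0 h) contDiffAt_const, lap_const, hl x h0 h, add_zero])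
    (hc0.add continuousAt_const) hg hψ hψc hts'
  have hbm : ∀ x, 0 ≤ ψ x ∧ ψ x ≤ δ ^ 2 := fun x =>
    ⟨(hF01 _ (by positivity)).1, ((hF01 _ (by positivity)).2).trans hb2.le⟩
  have hgψ : ∫ x, g x * ψ x ≤ δ ^ 2 * m := by
    rw [← setIntegral_eq_integral_of_forall_compl_eq_zero (s := ball (0 : E2) δ)
      fun x hx => by rw [hψz x hx, mul_zero]]
    calc ∫ x in ball (0 : E2) δ, g x * ψ x ≤ ∫ x in ball (0 : E2) δ, δ ^ 2 * g x := by
          refine integral_mono_ae (hg.mul_bdd (c := δ ^ 2) hψ.continuous.aestronglyMeasurable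
            (Eventually.of_forall fun x => by
              rw [norm_of_nonneg (hbm x).1]
              exact (hbm x).2)) (hg.const_mul _) ?_
          filter_upwards [ae_restrict_mem measurableSet_ball,
            ae_restrict_of_ae (Measure.ae_ne volume (0 : E2))] with x hx hx0
          have h1 := hg0 x hx0 (mem_ball_zero_iff.1 hx)
          have h2 := (hbm x).2
          nlinarith
      _ ≤ δ ^ 2 * m := by
          rw [integral_const_mul]
          gcongr
  have hpt : ∀ x ∈ ball (0 : E2) δ, (u x + -K) * lap ψ x ≤
      (ball (0 : E2) (δ / 2)).indicator (fun x => -4 * (u x - u p)) x + 4 * (C + 1) := by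
    intro x hx
    rw [mem_ball_zero_iff] at hx
    have hup := hle' x hx.le
    rw [hψl]
    rcases lt_or_ge ‖x‖ ρ with h | h
    · have ha := hGa (‖x‖ ^ 2) (by gcongr)
      rw [ha.1, ha.2]
      have : -4 * (u x - u p) ≤ (ball (0 : E2) (δ / 2)).indicator (fun x => -4 * (u x - u p)) x := by
        by_cases hx2 : x ∈ ball (0 : E2) (δ / 2)
        · rw [indicator_of_mem hx2]
        · rw [indicator_of_notMem hx2]
          linarith
      rw [hK]
      linarith
    · rw [indicator_of_notMem (by
        rw [mem_ball_zero_iff, not_lt]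
        linarith)]
      have h1 := hρ x h hx.le
      have h2 : (u x + -K) * (-4 * ‖x‖ ^ 2 * G' (‖x‖ ^ 2)) ≤ 0 :=
        mul_nonpos_of_nonpos_of_nonneg (by linarith)
          (mul_nonneg_of_nonpos_of_nonpos (by nlinarith [sq_nonneg ‖x‖]) (hGn _))
      have h3 := hG0 (‖x‖ ^ 2)
      have h4 := hG1 (‖x‖ ^ 2)
      have h5 : (K - u x) * G (‖x‖ ^ 2) ≤ C + 1 := by
        calc _ ≤ (K - u x) * 1 := by
              have : 0 ≤ K - u x := by linarith
              gcongr
          _ ≤ C + 1 := by linarith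
      linarith
  have hui : IntegrableOn u (closedBall 0 δ) := hu.integrableOn_compact (isCompact_closedBall _ _)
  have hb' : volume (ball (0 : E2) δ) < ⊤ := measure_ball_lt_top
  have hsub : ball (0 : E2) (δ / 2) ⊆ ball 0 δ := ball_subset_ball (by linarith)
  have hi1 : IntegrableOn (fun x => -4 * (u x - u p)) (ball 0 δ) := by
    have h1 : IntegrableOn (fun _ : E2 => u p) (ball 0 δ) := integrableOn_const hb'.ne
    exact ((hui.mono_set ball_subset_closedBall).sub h1).const_mul _
  have hi2 : Integrable ((ball (0 : E2) (δ / 2)).indicator fun x => -4 * (u x - u p))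
      (volume.restrict (ball 0 δ)) := hi1.indicator measurableSet_ball
  have hi3 : IntegrableOn (fun _ : E2 => 4 * (C + 1)) (ball 0 δ) := integrableOn_const hb'.ne
  have hi0 : IntegrableOn (fun x => (u x + -K) * lap ψ x) (ball 0 δ) := by
    have h1 : ContinuousOn (fun x => (u x + -K) * lap ψ x) (closedBall 0 δ) :=
      (hu.add continuousOn_const).mul (continuous_lap hψ).continuousOn
    exact (h1.integrableOn_compact (isCompact_closedBall _ _)).mono_set ball_subset_closedBall
  have hmono := setIntegral_mono_on hi0 (hi2.add hi3) measurableSet_ball hpt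
  rw [setIntegral_eq_integral_of_forall_compl_eq_zero fun x hx => by rw [hlz x hx, mul_zero],
    green] at hmono
  have hadd : ∫ x in ball (0 : E2) δ,
      ((ball (0 : E2) (δ / 2)).indicator (fun x => -4 * (u x - u p)) x + 4 * (C + 1)) =
      -4 * (∫ x in ball (0 : E2) (δ / 2), (u x - u p)) +
        4 * (C + 1) * volume.real (ball (0 : E2) δ) := by
    rw [integral_add hi2 hi3, setIntegral_indicator measurableSet_ball,
      Set.inter_eq_right.2 hsub, integral_const_mul]
    simp
    ring
  have hmono' := hmono.trans_eq hadd
  linarith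

end Superharmonic

section Representation

/-- The total mass of the standard bubble; its value is `2π`. -/
def bubbleMass : ℝ := ∫ z : E2, 2 / (1 + ‖z‖ ^ 2) ^ 2

lemma integrable_bubble : Integrable fun z : E2 => 2 / (1 + ‖z‖ ^ 2) ^ 2 := by
  have h := (integrable_rpow_neg_one_add_norm_sq (E := E2) (μ := volume) (r := 4)
    (by simp; norm_num)).const_mul 2
  refine h.congr (Eventually.of_forall fun z => ?_)
  have : (-4 / 2 : ℝ) = -(2 : ℕ) := by norm_num
  simp only [this]
  rw [rpow_neg (by positivity), rpow_natCast, div_eq_mul_inv]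

lemma bubbleMass_pos : 0 < bubbleMass := by
  rw [bubbleMass, integral_pos_iff_support_of_nonneg (fun z => by positivity) integrable_bubble]
  have : Function.support (fun z : E2 => 2 / (1 + ‖z‖ ^ 2) ^ 2) = Set.univ := by
    ext z
    simp only [Function.mem_support, Set.mem_univ, iff_true]
    positivity
  rw [this]
  exact Measure.measure_univ_pos.2 (NeZero.ne _)

lemma tendsto_integral_bubble {g : E2 → ℝ} {x : E2} (hg : Integrable g) (hx : ContinuousAt g x) :
    Tendsto (fun c : ℝ => ∫ y, g y * (2 * (c ^ 2)⁻¹ / (‖y - x‖ ^ 2 + (c ^ 2)⁻¹) ^ 2)) atTop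
      (𝓝 (bubbleMass * g x)) := by
  have hb := bubbleMass_pos
  have hlim : Tendsto (fun z : E2 => ‖z‖ ^ Module.finrank ℝ E2 *
      (bubbleMass⁻¹ * (2 / (1 + ‖z‖ ^ 2) ^ 2))) (Bornology.cobounded E2) (𝓝 0) := by
    have h1 : Tendsto (fun t : ℝ => bubbleMass⁻¹ * 2 * (t ^ 2)⁻¹) atTop (𝓝 0) := by
      simpa using (tendsto_pow_atTop (α := ℝ) two_ne_zero).inv_tendsto_atTop.const_mul
        (bubbleMass⁻¹ * 2)
    refine squeeze_zero' (Eventually.of_forall fun z => by positivity) ?_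
      (h1.comp tendsto_norm_cobounded_atTop)
    filter_upwards [tendsto_norm_cobounded_atTop.eventually (eventually_gt_atTop 0)] with z hz
    simp only [finrank_euclideanSpace, Fintype.card_fin, Function.comp]
    have : ‖z‖ ^ 2 * (2 / (1 + ‖z‖ ^ 2) ^ 2) ≤ 2 * (‖z‖ ^ 2)⁻¹ := by
      rw [← div_eq_mul_inv, mul_div_assoc', div_le_div_iff₀ (by positivity) (by positivity)]
      nlinarith [sq_nonneg ‖z‖]
    calc _ = bubbleMass⁻¹ * (‖z‖ ^ 2 * (2 / (1 + ‖z‖ ^ 2) ^ 2)) := by ring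
      _ ≤ bubbleMass⁻¹ * (2 * (‖z‖ ^ 2)⁻¹) := by gcongr
      _ = _ := by ring
  have h := tendsto_integral_comp_smul_smul_of_integrable' (μ := volume)
    (φ := fun z : E2 => bubbleMass⁻¹ * (2 / (1 + ‖z‖ ^ 2) ^ 2)) (fun z => by positivity)
    (by rw [integral_const_mul]; exact inv_mul_cancel₀ hb.ne') hlim hg hx
  refine ((h.const_mul bubbleMass).congr' ?_)
  filter_upwards [eventually_gt_atTop 0] with c hc
  rw [← integral_const_mul]
  refine integral_congr_ae (Eventually.of_forall fun y => ?_)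
  simp only [finrank_euclideanSpace, Fintype.card_fin, smul_eq_mul, norm_smul,
    norm_of_nonneg hc.le, norm_sub_rev x y]
  field_simp
  ring

lemma contDiff_log_norm_sq_add {s : ℝ} (hs : 0 < s) (x : E2) :
    ContDiff ℝ 2 fun y : E2 => 1 / 2 * log (‖y - x‖ ^ 2 + s) :=
  contDiff_const.mul (((((contDiff_id.sub contDiff_const).norm_sq ℝ).add contDiff_const).log
    fun y => by positivity))

lemma hasDerivAt_half_log_add {s t : ℝ} (h : t + s ≠ 0) :
    HasDerivAt (fun t => 1 / 2 * log (t + s)) (1 / 2 * (t + s)⁻¹) t := by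
  have := (((hasDerivAt_id t).add_const s).log h).const_mul (1 / 2)
  simpa using this

lemma pd_log_norm_sq_add {s : ℝ} (hs : 0 < s) (x y : E2) (i : Fin 2) :
    pd i (fun y : E2 => 1 / 2 * log (‖y - x‖ ^ 2 + s)) y =
      (y i - x i) / (‖y - x‖ ^ 2 + s) := by
  rw [pd_radial (F := fun t => 1 / 2 * log (t + s)) (hasDerivAt_half_log_add (by positivity))]
  field_simp

lemma lap_log_norm_sq_add {s : ℝ} (hs : 0 < s) (x y : E2) :
    lap (fun y : E2 => 1 / 2 * log (‖y - x‖ ^ 2 + s)) y =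
      2 * s / (‖y - x‖ ^ 2 + s) ^ 2 := by
  have h0 : ‖y - x‖ ^ 2 + s ≠ 0 := by positivity
  have h1 : ∀ᶠ t in 𝓝 (‖y - x‖ ^ 2),
      HasDerivAt (fun t => 1 / 2 * log (t + s)) (1 / 2 * (t + s)⁻¹) t := by
    have : ∀ᶠ t in 𝓝 (‖y - x‖ ^ 2), t + s ≠ 0 :=
      ContinuousAt.eventually_ne (by fun_prop) h0
    filter_upwards [this] with t ht
    exact hasDerivAt_half_log_add ht
  have h2 : HasDerivAt (fun t => 1 / 2 * (t + s)⁻¹)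
      (1 / 2 * (-1 / (‖y - x‖ ^ 2 + s) ^ 2)) (‖y - x‖ ^ 2) :=
    ((((hasDerivAt_id _).add_const s).fun_inv h0).const_mul (1 / 2))
  rw [lap_radial h1 h2]
  field_simp
  ring

/-- Green's representation of a function on a disc: up to a boundary-layer term, it is the
logarithmic potential of its Laplacian. -/
lemma bubbleMass_mul_eq {u g η : E2 → ℝ} {δ ρ R : ℝ} {x : E2} (hR : 0 < R) (hRδ : R < δ)
    (hu : ContinuousOn u (closedBall 0 δ)) (hu2 : ∀ x, x ≠ 0 → ‖x‖ < δ → ContDiffAt ℝ 2 u x)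
    (hl : ∀ x, x ≠ 0 → ‖x‖ < δ → lap u x = -g x) (hg : IntegrableOn g (ball 0 δ))
    (hη : ContDiff ℝ 2 η) (hη1 : ∀ y, ‖y‖ < ρ → η y = 1) (hη0 : ∀ y, R < ‖y‖ → η y = 0)
    (hx : ‖x‖ < ρ) (hxR : ‖x‖ < R)
    (hlog : Integrable fun y => g y * η y * log ‖y - x‖) :
    bubbleMass * u x = -(∫ y, g y * η y * log ‖y - x‖) -
      ((∑ i, ∫ y in closedBall (0 : E2) R \ ball 0 ρ,
          u y * (2 * pd i η y) * ((y - x) i / ‖y - x‖ ^ 2)) +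
        ∫ y in closedBall (0 : E2) R \ ball 0 ρ, u y * lap η y * log ‖y - x‖) := by
  have hδ : 0 < δ := hR.trans hRδ
  set S : Set E2 := closedBall (0 : E2) R \ ball 0 ρ with hS
  have hSc : IsCompact S := (isCompact_closedBall _ _).diff isOpen_ball
  have hSδ : S ⊆ closedBall 0 δ := Set.sdiff_subset.trans (closedBall_subset_closedBall hRδ.le)
  have hxS : ∀ y ∈ S, 0 < ‖y - x‖ := fun y hy => norm_pos_iff.2 <| sub_ne_zero.2 fun h => by
    refine hy.2 ?_
    rw [h, mem_ball_zero_iff]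
    exact hx
  have hts : tsupport η ⊆ closedBall 0 R := by
    refine closure_minimal (fun y hy => ?_) isClosed_closedBall
    by_contra h
    rw [mem_closedBall_zero_iff, not_le] at h
    exact hy (hη0 y h)
  have hηc : HasCompactSupport η :=
    (isCompact_closedBall (0 : E2) R).of_isClosed_subset (isClosed_tsupport _) hts
  have hout : ∀ y ∉ S, (∀ i, pd i η y = 0) ∧ lap η y = 0 := by
    intro y hy
    by_cases hyR : y ∈ closedBall (0 : E2) R
    · have hyρ : ‖y‖ < ρ := by
        by_contra h
        exact hy ⟨hyR, fun h' => h (mem_ball_zero_iff.1 h')⟩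
      have he : η =ᶠ[𝓝 y] fun _ => 1 := by
        filter_upwards [continuous_norm.continuousAt.eventually (gt_mem_nhds hyρ)] with z hz
        exact hη1 z hz
      exact ⟨fun i => (he.pd_eq i).eq_of_nhds.trans (by simp [pd]), by rw [he.lap_eq, lap_const]⟩
    · have hyt : y ∉ tsupport η := fun h => hyR (hts h)
      exact ⟨fun i => image_eq_zero_of_notMem_tsupport fun h => hyt (tsupport_pd_subset i η h),
        image_eq_zero_of_notMem_tsupport fun h => hyt (tsupport_lap_subset η h)⟩
  set Q : ℝ → E2 → ℝ := fun s y => (∑ i, 2 * pd i η y * ((y - x) i / (‖y - x‖ ^ 2 + s))) +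
    lap η y * (1 / 2 * log (‖y - x‖ ^ 2 + s)) with hQ
  have hQ0 : ∀ s, ∀ y ∉ S, u y * Q s y = 0 := fun s y hy => by
    simp [hQ, (hout y hy).1, (hout y hy).2]
  have hQc : ∀ y ∈ S, ∀ s, 0 ≤ s → ContinuousAt (fun p : ℝ × E2 => Q p.1 p.2) (s, y) := by
    intro y hy s hs
    have hp : ∀ i, Continuous (pd i η) := fun i => (contDiff_pd hη i).continuous
    have hlc := continuous_lap hη
    have hne : ‖y - x‖ ^ 2 + s ≠ 0 := by
      have := hxS y hy
      positivity
    have c0 : Continuous fun p : ℝ × E2 => ‖p.2 - x‖ ^ 2 + p.1 := by fun_prop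
    refine ContinuousAt.add (tendsto_finsetSum _ fun i _ => ?_) ?_
    · have c1 : Continuous fun p : ℝ × E2 => 2 * pd i η p.2 :=
        continuous_const.mul ((hp i).comp continuous_snd)
      have c2 : Continuous fun p : ℝ × E2 => (p.2 - x) i := by fun_prop
      exact c1.continuousAt.mul (c2.continuousAt.div c0.continuousAt hne)
    · have c1 : Continuous fun p : ℝ × E2 => lap η p.2 := hlc.comp continuous_snd
      exact c1.continuousAt.mul (continuousAt_const.mul (c0.continuousAt.log hne))
  obtain ⟨B, hB⟩ := (isCompact_Icc (a := (0 : ℝ)) (b := 1)).prod hSc |>.exists_bound_of_continuousOn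
    (f := fun p : ℝ × E2 => Q p.1 p.2)
    fun p hp => (hQc p.2 hp.2 p.1 hp.1.1).continuousWithinAt
  have huS : IntegrableOn u S := (hu.mono hSδ).integrableOn_compact hSc
  have hQm : ∀ s, 0 ≤ s → AEStronglyMeasurable (Q s) (volume.restrict S) := fun s hs =>
    ContinuousOn.aestronglyMeasurable (fun y hy => ((hQc y hy s hs).comp
      (f := fun y : E2 => (s, y)) (by fun_prop)).continuousWithinAt) hSc.isClosed.measurableSet
  have hgη : Integrable fun y => g y * η y := by
    obtain ⟨D, hD⟩ := hη.continuous.bounded_above_of_compact_support hηc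
    have hz : (fun x => g x * η x) = (ball 0 δ).indicator fun x => g x * η x := by
      ext y
      by_cases hy : y ∈ ball (0 : E2) δ
      · rw [indicator_of_mem hy]
      · rw [indicator_of_notMem hy, hη0 y, mul_zero]
        rw [mem_ball_zero_iff, not_lt] at hy
        linarith
    rw [hz, integrable_indicator_iff measurableSet_ball]
    exact hg.mul_bdd hη.continuous.aestronglyMeasurable (Eventually.of_forall hD)
  have hsc : Tendsto (fun c : ℝ => (c ^ 2)⁻¹) atTop (𝓝 0) :=
    (tendsto_pow_atTop (α := ℝ) two_ne_zero).inv_tendsto_atTop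
  have hs01 : ∀ c : ℝ, 1 ≤ c → 0 < (c ^ 2)⁻¹ ∧ (c ^ 2)⁻¹ ≤ 1 := fun c hc =>
    ⟨by positivity, inv_le_one_of_one_le₀ (one_le_pow₀ hc)⟩
  have lim1 : Tendsto (fun c : ℝ => ∫ y in S, u y * Q (c ^ 2)⁻¹ y) atTop
      (𝓝 (∫ y in S, u y * Q 0 y)) := by
    refine tendsto_integral_filter_of_dominated_convergence (fun y => ‖u y‖ * B) ?_ ?_
      (huS.norm.mul_const B) ?_
    · filter_upwards [eventually_ge_atTop 1] with c hc
      exact huS.aestronglyMeasurable.mul (hQm _ (hs01 c hc).1.le)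
    · filter_upwards [eventually_ge_atTop 1] with c hc
      filter_upwards [ae_restrict_mem hSc.isClosed.measurableSet] with y hy
      rw [norm_mul]
      exact mul_le_mul_of_nonneg_left (hB ((c ^ 2)⁻¹, y) ⟨⟨(hs01 c hc).1.le, (hs01 c hc).2⟩, hy⟩)
        (norm_nonneg _)
    · filter_upwards [ae_restrict_mem hSc.isClosed.measurableSet] with y hy
      have h1 : Tendsto (fun s => Q s y) (𝓝 0) (𝓝 (Q 0 y)) :=
        (hQc y hy 0 le_rfl).comp (f := fun s : ℝ => (s, y)) (by fun_prop)
      exact (h1.comp hsc).const_mul _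
  have lim2 : Tendsto (fun c : ℝ => ∫ y, g y * η y * (1 / 2 * log (‖y - x‖ ^ 2 + (c ^ 2)⁻¹)))
      atTop (𝓝 (∫ y, g y * η y * log ‖y - x‖)) := by
    refine tendsto_integral_filter_of_dominated_convergence (fun y =>
      ‖g y * η y * log ‖y - x‖‖ + ‖g y * η y‖ * (1 / 2 * log ((2 * R) ^ 2 + 1))) ?_ ?_
      (hlog.norm.add (hgη.norm.mul_const _)) ?_
    · filter_upwards [eventually_ge_atTop 1] with c hc
      exact hgη.aestronglyMeasurable.mul
        (contDiff_log_norm_sq_add (hs01 c hc).1 x).continuous.aestronglyMeasurable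
    · filter_upwards [eventually_ge_atTop 1] with c hc
      filter_upwards [Measure.ae_ne volume x] with y hy
      have hyx : 0 < ‖y - x‖ := norm_pos_iff.2 (sub_ne_zero.2 hy)
      by_cases hyR : R < ‖y‖
      · simp [hη0 y hyR]
      · rw [norm_mul, norm_mul (g y * η y), ← mul_add]
        refine mul_le_mul_of_nonneg_left ?_ (norm_nonneg _)
        obtain ⟨hs0, hs1⟩ := hs01 c hc
        have h1 : ‖y - x‖ ≤ 2 * R := (norm_sub_le _ _).trans (by linarith)
        have h2 : 0 ≤ 1 / 2 * log ((2 * R) ^ 2 + 1) :=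
          mul_nonneg (by norm_num) (log_nonneg (by nlinarith))
        have h3 : 1 / 2 * log (‖y - x‖ ^ 2 + (c ^ 2)⁻¹) ≤
            1 / 2 * log ((2 * R) ^ 2 + 1) := by gcongr
        have h4 : log ‖y - x‖ ≤ 1 / 2 * log (‖y - x‖ ^ 2 + (c ^ 2)⁻¹) := by
          have := log_le_log (by positivity)
            (by linarith : ‖y - x‖ ^ 2 ≤ ‖y - x‖ ^ 2 + (c ^ 2)⁻¹)
          rw [log_pow] at this
          push_cast at this
          linarith
        rw [norm_eq_abs, norm_eq_abs, abs_le]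
        constructor <;> linarith [neg_abs_le (log ‖y - x‖), abs_nonneg (log ‖y - x‖)]
    · filter_upwards [Measure.ae_ne volume x] with y hy
      have hyx : 0 < ‖y - x‖ := norm_pos_iff.2 (sub_ne_zero.2 hy)
      have h1 : Tendsto (fun s : ℝ => 1 / 2 * log (‖y - x‖ ^ 2 + s)) (𝓝 0)
          (𝓝 (1 / 2 * log (‖y - x‖ ^ 2 + 0))) := by
        have : ContinuousAt (fun s : ℝ => 1 / 2 * log (‖y - x‖ ^ 2 + s)) 0 :=
          continuousAt_const.mul (ContinuousAt.log (by fun_prop) (by positivity))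
        exact this
      have h2 : 1 / 2 * log (‖y - x‖ ^ 2 + 0) = log ‖y - x‖ := by
        rw [add_zero, log_pow]
        push_cast
        ring
      rw [h2] at h1
      exact (h1.comp hsc).const_mul _
  have huη : ∀ y, ContinuousAt (fun y => u y * η y) y := by
    intro y
    rcases lt_or_ge ‖y‖ δ with h | h
    · exact (hu.continuousAt (mem_of_superset (isOpen_ball.mem_nhds (mem_ball_zero_iff.2 h))
        ball_subset_closedBall)).mul hη.continuous.continuousAt
    · refine (continuousAt_const (y := (0 : ℝ))).congr ?_
      filter_upwards [continuous_norm.continuousAt.eventually (lt_mem_nhds (hRδ.trans_le h))]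
        with z hz
      rw [hη0 z hz, mul_zero]
  have huηi : Integrable fun y => u y * η y :=
    (continuous_iff_continuousAt.2 huη).integrable_of_hasCompactSupport
      (hηc.of_isClosed_subset (isClosed_tsupport _) (closure_mono fun y hy => right_ne_zero_of_mul hy))
  have lim0 := tendsto_integral_bubble huηi (huη x)
  rw [hη1 x hx, mul_one] at lim0
  have key : ∀ c : ℝ, 1 ≤ c →
      ∫ y, u y * η y * (2 * (c ^ 2)⁻¹ / (‖y - x‖ ^ 2 + (c ^ 2)⁻¹) ^ 2) =
      -(∫ y, g y * η y * (1 / 2 * log (‖y - x‖ ^ 2 + (c ^ 2)⁻¹))) -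
        ∫ y in S, u y * Q (c ^ 2)⁻¹ y := by
    intro c hc
    obtain ⟨hs0, hs1⟩ := hs01 c hc
    set s := (c ^ 2)⁻¹
    have hL := contDiff_log_norm_sq_add hs0 x
    have ht : tsupport (fun y => η y * (1 / 2 * log (‖y - x‖ ^ 2 + s))) ⊆ tsupport η :=
      closure_mono fun y hy => left_ne_zero_of_mul hy
    have green := integral_mul_lap_eq_of_punctured hδ hu2 hl
      (hu.continuousAt (closedBall_mem_nhds _ hδ)) hg (hη.mul hL)
      (hηc.of_isClosed_subset (isClosed_tsupport _) ht)
      (ht.trans (hts.trans (closedBall_subset_ball hRδ)))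
    have e : ∀ y, u y * lap (fun y => η y * (1 / 2 * log (‖y - x‖ ^ 2 + s))) y =
        u y * η y * (2 * s / (‖y - x‖ ^ 2 + s) ^ 2) + u y * Q s y := by
      intro y
      rw [lap_mul hη.contDiffAt hL.contDiffAt, lap_log_norm_sq_add hs0]
      simp only [pd_log_norm_sq_add hs0, hQ, Fin.sum_univ_two, PiLp.sub_apply]
      ring
    have i1 : Integrable fun y => u y * η y * (2 * s / (‖y - x‖ ^ 2 + s) ^ 2) := by
      refine huηi.mul_bdd (c := 2 * s / s ^ 2) ?_ (Eventually.of_forall fun y => ?_)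
      · exact Continuous.aestronglyMeasurable (Continuous.div₀ (by fun_prop) (by fun_prop)
          fun y => by positivity)
      · rw [norm_of_nonneg (by positivity)]
        gcongr
        nlinarith [sq_nonneg ‖y - x‖]
    have i2' : IntegrableOn (fun y => u y * Q s y) S := by
      refine Integrable.mul_bdd (c := B) huS (hQm s hs0.le) ?_
      filter_upwards [ae_restrict_mem hSc.isClosed.measurableSet] with y hy
      exact hB (s, y) ⟨⟨hs0.le, hs1⟩, hy⟩
    have i2 : Integrable fun y => u y * Q s y := by
      have hz : (fun y => u y * Q s y) = S.indicator fun y => u y * Q s y := by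
        ext y
        by_cases hy : y ∈ S
        · rw [indicator_of_mem hy]
        · rw [indicator_of_notMem hy, hQ0 s y hy]
      rw [hz, integrable_indicator_iff hSc.isClosed.measurableSet]
      exact i2'
    have e' : ∀ y, g y * (η y * (1 / 2 * log (‖y - x‖ ^ 2 + s))) =
        g y * η y * (1 / 2 * log (‖y - x‖ ^ 2 + s)) := fun y => (mul_assoc _ _ _).symm
    simp only [e, e'] at green
    rw [integral_add i1 i2] at green
    rw [setIntegral_eq_integral_of_forall_compl_eq_zero (hQ0 s)]
    linarith
  have hfin := tendsto_nhds_unique (lim0.congr' (by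
    filter_upwards [eventually_ge_atTop 1] with c hc
    exact key c hc)) (lim2.neg.sub lim1)
  rw [hfin]
  congr 1
  have ci : ∀ q : E2 → ℝ, (∀ y ∈ S, ContinuousAt q y) → IntegrableOn (fun y => u y * q y) S :=
    fun q hq => ((hu.mono hSδ).mul fun y hy =>
      (hq y hy).continuousWithinAt).integrableOn_compact hSc
  have j1 : ∀ i, IntegrableOn (fun y => u y * (2 * pd i η y) * ((y - x) i / ‖y - x‖ ^ 2)) S := by
    intro i
    have := ci (fun y => 2 * pd i η y * ((y - x) i / ‖y - x‖ ^ 2)) fun y hy => by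
      have := hxS y hy
      have c1 : Continuous (pd i η) := (contDiff_pd hη i).continuous
      exact (continuousAt_const.mul c1.continuousAt).mul
        (ContinuousAt.div (by fun_prop) (by fun_prop) (by positivity))
    simpa only [mul_assoc] using this
  have j2 : IntegrableOn (fun y => u y * lap η y * log ‖y - x‖) S := by
    have := ci (fun y => lap η y * log ‖y - x‖) fun y hy => by
      have := hxS y hy
      have c1 := continuous_lap hη
      exact c1.continuousAt.mul (ContinuousAt.log (by fun_prop) (by positivity))
    simpa only [mul_assoc] using this
  rw [← integral_finsetSum _ fun i _ => j1 i,
    ← integral_add (integrable_finsetSum _ fun i _ => j1 i) j2]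
  refine integral_congr_ae (Eventually.of_forall fun y => ?_)
  simp only [hQ, add_zero, log_pow, Fin.sum_univ_two]
  push_cast
  ring

end Representation

section BoundaryTerm

lemma exists_annulus_potential_bound {q : E2 → ℝ} (hq : ∀ z, z ≠ 0 → ContDiffAt ℝ 1 q z)
    {r ρ : ℝ} (hr : r < ρ) (R : ℝ) : ∃ D, 0 ≤ D ∧ ∀ V : E2 → ℝ,
      IntegrableOn V (closedBall 0 R \ ball 0 ρ) → ∀ x, ‖x‖ < r →
        |∫ y in closedBall (0 : E2) R \ ball 0 ρ, V y * q (y - x)| ≤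
          D * ∫ y in closedBall (0 : E2) R \ ball 0 ρ, |V y| ∧
        ∃ T : E2 →L[ℝ] ℝ, HasFDerivAt
          (fun x => ∫ y in closedBall (0 : E2) R \ ball 0 ρ, V y * q (y - x)) T x ∧
          ‖T‖ ≤ D * ∫ y in closedBall (0 : E2) R \ ball 0 ρ, |V y| := by
  set S : Set E2 := closedBall (0 : E2) R \ ball 0 ρ with hS
  have hSm : MeasurableSet S := measurableSet_closedBall.diff measurableSet_ball
  set K : Set E2 := closedBall (0 : E2) (R + r) \ ball 0 (ρ - r) with hK
  have hKc : IsCompact K := (isCompact_closedBall _ _).diff isOpen_ball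
  have hK0 : ∀ z ∈ K, z ≠ 0 := fun z hz h => hz.2 <| by
    rw [h]
    exact mem_ball_self (sub_pos.2 hr)
  have hSK : ∀ y ∈ S, ∀ x : E2, ‖x‖ < r → y - x ∈ K := by
    intro y hy x hx
    have h1 := mem_closedBall_zero_iff.1 hy.1
    have h2 : ρ ≤ ‖y‖ := not_lt.1 fun h => hy.2 (mem_ball_zero_iff.2 h)
    refine ⟨mem_closedBall_zero_iff.2 ((norm_sub_le _ _).trans (by linarith)), fun h => ?_⟩
    rw [mem_ball_zero_iff] at h
    linarith [norm_sub_norm_le y x]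
  obtain ⟨D₁, h₁⟩ := hKc.exists_bound_of_continuousOn (f := q)
    fun z hz => (hq z (hK0 z hz)).continuousAt.continuousWithinAt
  have hfc : ∀ z, z ≠ 0 → ContinuousAt (fderiv ℝ q) z := fun z hz =>
    ((hq z hz).fderiv_right (m := 0) (by norm_num)).continuousAt
  obtain ⟨D₂, h₂⟩ := hKc.exists_bound_of_continuousOn (f := fderiv ℝ q)
    fun z hz => (hfc z (hK0 z hz)).continuousWithinAt
  refine ⟨|D₁| + |D₂|, by positivity, fun V hV x hx => ?_⟩
  have hI : 0 ≤ ∫ y in S, |V y| := integral_nonneg fun y => abs_nonneg _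
  have hb1 : ∀ᵐ y ∂volume.restrict S, ∀ x : E2, ‖x‖ < r → ‖q (y - x)‖ ≤ |D₁| := by
    filter_upwards [ae_restrict_mem hSm] with y hy x hx
    exact (h₁ _ (hSK y hy x hx)).trans (le_abs_self _)
  have hqm : ∀ x : E2, ‖x‖ < r → AEStronglyMeasurable (fun y => q (y - x)) (volume.restrict S) :=
    fun x hx => ContinuousOn.aestronglyMeasurable (fun y hy =>
      ((hq _ (hK0 _ (hSK y hy x hx))).continuousAt.comp (f := fun y => y - x)
        (by fun_prop)).continuousWithinAt) hSm
  have hfm : AEStronglyMeasurable (fun y => fderiv ℝ q (y - x)) (volume.restrict S) :=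
    ContinuousOn.aestronglyMeasurable (fun y hy =>
      ((hfc _ (hK0 _ (hSK y hy x hx))).comp (f := fun y => y - x)
        (by fun_prop)).continuousWithinAt) hSm
  have hi : ∀ x : E2, ‖x‖ < r → IntegrableOn (fun y => V y * q (y - x)) S := fun x hx =>
    hV.mul_bdd (hqm x hx) (hb1.mono fun y hy => hy x hx)
  have hbd : ∀ᵐ y ∂volume.restrict S, ∀ z ∈ ball (0 : E2) r,
      ‖V y • -fderiv ℝ q (y - z)‖ ≤ |D₂| * |V y| := by
    filter_upwards [ae_restrict_mem hSm] with y hy z hz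
    rw [norm_smul, norm_neg, norm_eq_abs, mul_comm]
    exact mul_le_mul_of_nonneg_right ((h₂ _ (hSK y hy z (mem_ball_zero_iff.1 hz))).trans
      (le_abs_self _)) (abs_nonneg _)
  refine ⟨?_, ∫ y in S, V y • -fderiv ℝ q (y - x), ?_, ?_⟩
  · calc |∫ y in S, V y * q (y - x)| ≤ ∫ y in S, |D₁| * |V y| := by
          refine norm_integral_le_of_norm_le (f := fun y => V y * q (y - x))
            (hV.abs.const_mul _) ?_
          filter_upwards [hb1] with y hy
          rw [norm_mul, mul_comm, norm_eq_abs (V y)]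
          exact mul_le_mul_of_nonneg_right (hy x hx) (abs_nonneg _)
      _ = |D₁| * ∫ y in S, |V y| := integral_const_mul _ _
      _ ≤ _ := mul_le_mul_of_nonneg_right (by linarith [abs_nonneg D₂]) hI
  · refine hasFDerivAt_integral_of_dominated_of_fderiv_le (bound := fun y => |D₂| * |V y|)
      (F := fun x y => V y * q (y - x)) (F' := fun x y => V y • -fderiv ℝ q (y - x))
      (isOpen_ball.mem_nhds (mem_ball_zero_iff.2 hx)) ?_ (hi x hx)
      (hV.aestronglyMeasurable.smul hfm.neg) hbd (hV.abs.const_mul _) ?_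
    · filter_upwards [isOpen_ball.mem_nhds (mem_ball_zero_iff.2 hx)] with z hz
      exact (hi z (mem_ball_zero_iff.1 hz)).aestronglyMeasurable
    · filter_upwards [ae_restrict_mem hSm] with y hy z hz
      have h1 : HasFDerivAt (fun z : E2 => y - z) (-ContinuousLinearMap.id ℝ E2) z :=
        (hasFDerivAt_id z).const_sub y
      have h2 := ((hq _ (hK0 _ (hSK y hy z (mem_ball_zero_iff.1 hz)))).differentiableAt
        one_ne_zero).hasFDerivAt.comp (f := fun z : E2 => y - z) z h1
      have h3 := h2.const_mul (V y)
      have e : V y • (fderiv ℝ q (y - z)).comp (-ContinuousLinearMap.id ℝ E2) =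
          V y • -fderiv ℝ q (y - z) := by
        ext v
        simp
      rw [e] at h3
      exact h3
  · calc ‖∫ y in S, V y • -fderiv ℝ q (y - x)‖ ≤ ∫ y in S, |D₂| * |V y| :=
          norm_integral_le_of_norm_le (hV.abs.const_mul _)
            (hbd.mono fun y hy => hy x (mem_ball_zero_iff.2 hx))
      _ = |D₂| * ∫ y in S, |V y| := integral_const_mul _ _
      _ ≤ _ := mul_le_mul_of_nonneg_right (by linarith [abs_nonneg D₁]) hI

/-- The boundary-layer term of Green's representation with cutoff `η`. -/
def boundaryTerm (η u : E2 → ℝ) (ρ R : ℝ) (x : E2) : ℝ :=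
  (∑ i, ∫ y in closedBall (0 : E2) R \ ball 0 ρ,
      u y * (2 * pd i η y) * ((y - x) i / ‖y - x‖ ^ 2)) +
    ∫ y in closedBall (0 : E2) R \ ball 0 ρ, u y * lap η y * log ‖y - x‖

lemma exists_boundaryTerm_bound {η : E2 → ℝ} (hη : ContDiff ℝ 2 η) {r ρ : ℝ} (hr : r < ρ)
    (R : ℝ) : ∃ D, 0 ≤ D ∧ ∀ u : E2 → ℝ, IntegrableOn u (closedBall 0 R \ ball 0 ρ) →
      ∀ x, ‖x‖ < r →
        |boundaryTerm η u ρ R x| ≤ D * ∫ y in closedBall (0 : E2) R \ ball 0 ρ, |u y| ∧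
        ∃ T : E2 →L[ℝ] ℝ, HasFDerivAt (boundaryTerm η u ρ R) T x ∧
          ‖T‖ ≤ D * ∫ y in closedBall (0 : E2) R \ ball 0 ρ, |u y| := by
  set S : Set E2 := closedBall (0 : E2) R \ ball 0 ρ with hS
  have hSm : MeasurableSet S := measurableSet_closedBall.diff measurableSet_ball
  have hSc : IsCompact S := (isCompact_closedBall _ _).diff isOpen_ball
  have hsq : ∀ z : E2, z ≠ 0 → ‖z‖ ^ 2 ≠ 0 := fun z hz => pow_ne_zero 2 (norm_ne_zero_iff.2 hz)
  have hn : ∀ z : E2, ContDiffAt ℝ 1 (fun z : E2 => ‖z‖ ^ 2) z := fun z =>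
    (contDiff_id.norm_sq ℝ).contDiffAt
  have term : ∀ q a : E2 → ℝ, (∀ z, z ≠ 0 → ContDiffAt ℝ 1 q z) → Continuous a →
      ∃ D, 0 ≤ D ∧ ∀ u : E2 → ℝ, IntegrableOn u S → ∀ x, ‖x‖ < r →
        |∫ y in S, u y * a y * q (y - x)| ≤ D * ∫ y in S, |u y| ∧
        ∃ T : E2 →L[ℝ] ℝ, HasFDerivAt (fun x => ∫ y in S, u y * a y * q (y - x)) T x ∧
          ‖T‖ ≤ D * ∫ y in S, |u y| := by
    intro q a hq ha
    obtain ⟨D, hD, h⟩ := exists_annulus_potential_bound hq hr R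
    obtain ⟨N, hN⟩ := hSc.exists_bound_of_continuousOn ha.continuousOn
    refine ⟨D * |N|, by positivity, fun u hu x hx => ?_⟩
    have hb : ∀ᵐ y ∂volume.restrict S, ‖a y‖ ≤ |N| := by
      filter_upwards [ae_restrict_mem hSm] with y hy
      exact (hN y hy).trans (le_abs_self _)
    have hi : IntegrableOn (fun y => u y * a y) S := hu.mul_bdd ha.aestronglyMeasurable hb
    have hle : D * ∫ y in S, |u y * a y| ≤ D * |N| * ∫ y in S, |u y| := by
      rw [mul_assoc]
      refine mul_le_mul_of_nonneg_left ?_ hD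
      rw [← integral_const_mul]
      refine integral_mono_ae hi.abs (hu.abs.const_mul _) ?_
      filter_upwards [hb] with y hy
      rw [abs_mul, mul_comm]
      exact mul_le_mul_of_nonneg_right hy (abs_nonneg _)
    obtain ⟨h1, T, hT, h2⟩ := h _ hi x hx
    exact ⟨h1.trans hle, T, hT, h2.trans hle⟩
  have t1 : ∀ i : Fin 2, _ := fun i => term (fun z => z i / ‖z‖ ^ 2) (fun y => 2 * pd i η y)
    (fun z hz => ContDiffAt.div (by fun_prop) (hn z) (hsq z hz))
    (continuous_const.mul (contDiff_pd hη i).continuous)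
  choose D hD h using t1
  obtain ⟨E, hE, h'⟩ := term (fun z => log ‖z‖) (lap η)
    (fun z hz => ((contDiffAt_norm ℝ hz)).log (norm_ne_zero_iff.2 hz)) (continuous_lap hη)
  refine ⟨∑ i, D i + E, add_nonneg (sum_nonneg fun i _ => hD i) hE, fun u hu x hx => ?_⟩
  rw [add_mul, sum_mul]
  choose T hT hT' using fun i => (h i u hu x hx).2
  obtain ⟨T', h1, h2⟩ := (h' u hu x hx).2
  refine ⟨(abs_add_le _ _).trans (add_le_add ((abs_sum_le_sum_abs _ _).trans
    (sum_le_sum fun i _ => (h i u hu x hx).1)) (h' u hu x hx).1), ∑ i, T i + T', ?_,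
    (norm_add_le _ _).trans (add_le_add ((norm_sum_le _ _).trans
    (sum_le_sum fun i _ => hT' i)) h2)⟩
  exact (HasFDerivAt.fun_sum fun i _ => hT i).add h1

end BoundaryTerm

section Localization

lemma IsRieszDensity.mul_of_le_one {κ : ℝ} {f η : E2 → ℝ} (hf : IsRieszDensity κ f)
    (hη : Measurable η) (h0 : ∀ x, 0 ≤ η x) (h1 : ∀ x, η x ≤ 1) :
    IsRieszDensity κ fun x => f x * η x := by
  obtain ⟨M, R, hM, hb, hR⟩ := hf.bound
  refine ⟨hf.meas.mul hη, fun x => mul_nonneg (hf.nonneg x) (h0 x), M, R, hM, fun x => ?_,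
    fun x hx => by rw [hR x hx, zero_mul]⟩
  exact (mul_le_of_le_one_right (hf.nonneg x) (h1 x)).trans (hb x)

lemma IsRieszDensity.const_mul {κ a : ℝ} (ha : 0 ≤ a) {f : E2 → ℝ} (hf : IsRieszDensity κ f) :
    IsRieszDensity κ fun x => a * f x := by
  simpa using IsRieszDensity.sum (ι := Unit) (a := fun _ => a) (fun _ => ha) fun _ => hf

lemma isRieszDensity_indicator {δ : ℝ} (γ : ℝ) {v : E2 → ℝ}
    (hv : ContinuousOn v (closedBall 0 δ)) (hv0 : ∀ x ∈ closedBall (0 : E2) δ, 0 ≤ v x) :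
    IsRieszDensity (singExp γ)
      ((closedBall (0 : E2) δ).indicator fun x => ‖x‖ ^ (2 * γ) * v x) := by
  obtain ⟨M, hM⟩ := (isCompact_closedBall (0 : E2) δ).exists_bound_of_continuousOn hv
  have hp : ∀ x : E2, ‖x‖ ≤ δ → ‖x‖ ^ (2 * γ) ≤ (1 + |δ| ^ (2 * γ)) * (1 / ‖x‖) ^ singExp γ := by
    intro x hx
    have hd : 0 ≤ |δ| ^ (2 * γ) := rpow_nonneg (abs_nonneg _) _
    rcases le_total 0 γ with h | h
    · rw [singExp, max_eq_left (by linarith), rpow_zero, mul_one]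
      have := rpow_le_rpow (norm_nonneg x) (hx.trans (le_abs_self δ))
        (by linarith : 0 ≤ 2 * γ)
      linarith
    · rw [singExp, max_eq_right (by linarith), one_div, inv_rpow (norm_nonneg x),
        ← rpow_neg (norm_nonneg x), neg_neg]
      nlinarith [rpow_nonneg (norm_nonneg x) (2 * γ)]
  refine ⟨?_, fun x => indicator_nonneg (fun x hx => mul_nonneg
    (rpow_nonneg (norm_nonneg x) _) (hv0 x hx)) x, (1 + |δ| ^ (2 * γ)) * |M|, δ,
    by positivity, fun x => ?_, fun x hx => ?_⟩
  · have h1 : Measurable ((closedBall (0 : E2) δ).indicator v) := by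
      classical
      rw [← Set.piecewise_eq_indicator]
      exact hv.measurable_piecewise continuousOn_const measurableSet_closedBall
    have h2 : ((closedBall (0 : E2) δ).indicator fun x => ‖x‖ ^ (2 * γ) * v x) =
        fun x => ‖x‖ ^ (2 * γ) * (closedBall (0 : E2) δ).indicator v x := by
      ext x
      rw [Set.indicator_mul_right]
    rw [h2]
    exact (measurable_norm.pow_const _).mul h1
  · by_cases hx : x ∈ closedBall (0 : E2) δ
    · rw [indicator_of_mem hx]
      have h1 := hp x (mem_closedBall_zero_iff.1 hx)
      have h2 : v x ≤ |M| := (le_abs_self _).trans ((hM x hx).trans (le_abs_self _))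
      calc ‖x‖ ^ (2 * γ) * v x
          ≤ (1 + |δ| ^ (2 * γ)) * (1 / ‖x‖) ^ singExp γ * |M| :=
            mul_le_mul h1 h2 (hv0 x hx) (by positivity)
        _ = _ := by ring
    · rw [indicator_of_notMem hx]
      positivity
  · exact indicator_of_notMem (fun h => hx.not_ge (mem_closedBall_zero_iff.1 h)) _

lemma exists_local_representation {δ : ℝ} (hδ : 0 < δ) (C m : ℝ) {η : E2 → ℝ}
    (hη : ContDiff ℝ 2 η) (hη1 : ∀ y, ‖y‖ < δ / 4 → η y = 1)
    (hη0 : ∀ y, 3 * δ / 8 < ‖y‖ → η y = 0) :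
    ∃ W, 0 ≤ W ∧ ∀ u g : E2 → ℝ, ContinuousOn u (closedBall 0 δ) →
      (∀ x, x ≠ 0 → ‖x‖ < δ → ContDiffAt ℝ 2 u x) →
      (∀ x, x ≠ 0 → ‖x‖ < δ → lap u x = -g x) → (∀ x, 0 ≤ g x) → Integrable g →
      (∫ x, g x) ≤ m →
      (∀ x ∈ sphere (0 : E2) δ, ∀ y ∈ sphere (0 : E2) δ, |u x - u y| ≤ C) →
      (∀ x, Integrable fun y => g y * η y * log ‖y - x‖) →
      ∃ (c : ℝ) (w : E2 → ℝ), ∀ x, ‖x‖ < δ / 8 → |w x| ≤ W ∧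
        (∃ T : E2 →L[ℝ] ℝ, HasFDerivAt w T x ∧ ‖T‖ ≤ W) ∧
        u x = c + w x - bubbleMass⁻¹ * ∫ y, g y * η y * log ‖y - x‖ := by
  have hκ := bubbleMass_pos
  obtain ⟨D, hD, h⟩ := exists_boundaryTerm_bound hη (by linarith : δ / 8 < δ / 4) (3 * δ / 8)
  set L := (C + 1) * volume.real (ball (0 : E2) δ) + δ ^ 2 * m / 4 with hL
  refine ⟨bubbleMass⁻¹ * (D * |L|), by positivity, fun u g hu hu2 hl hg0 hg hgm hosc hlog => ?_⟩
  obtain ⟨c, hc, hcL⟩ := exists_integral_sub_le_of_superharmonic hδ hu hu2 hl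
    (fun x _ _ => hg0 x) hg.integrableOn
    ((setIntegral_le_integral hg (ae_of_all _ hg0)).trans hgm) hosc
  have hv : ContinuousOn (fun x => u x + -c) (closedBall 0 δ) := hu.add continuousOn_const
  have hS : closedBall (0 : E2) (3 * δ / 8) \ ball 0 (δ / 4) ⊆ ball 0 (δ / 2) := fun y hy =>
    closedBall_subset_ball (by linarith) hy.1
  have hi : IntegrableOn (fun x => u x + -c) (ball 0 (δ / 2)) :=
    (hv.integrableOn_compact (isCompact_closedBall _ _)).mono_set
      (ball_subset_closedBall.trans (closedBall_subset_closedBall (by linarith)))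
  have hI : ∫ y in closedBall (0 : E2) (3 * δ / 8) \ ball 0 (δ / 4), |u y + -c| ≤ |L| := by
    refine (setIntegral_mono_set hi.abs (ae_of_all _ fun y => abs_nonneg _)
      hS.eventuallyLE).trans ?_
    refine le_trans (le_of_eq ?_) (hcL.trans (le_abs_self _))
    refine setIntegral_congr_fun measurableSet_ball fun y hy => ?_
    have := hc y (by linarith [mem_ball_zero_iff.1 hy])
    rw [← sub_eq_add_neg, abs_of_nonneg (sub_nonneg.2 this)]
  refine ⟨c, fun x => -bubbleMass⁻¹ *
    boundaryTerm η (fun x => u x + -c) (δ / 4) (3 * δ / 8) x, fun x hx => ?_⟩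
  obtain ⟨h1, T, hT, h2⟩ := h _ (hi.mono_set hS) x hx
  have hle : ∀ a, a ≤ D * ∫ y in closedBall (0 : E2) (3 * δ / 8) \ ball 0 (δ / 4), |u y + -c| →
      bubbleMass⁻¹ * a ≤ bubbleMass⁻¹ * (D * |L|) := fun a ha =>
    mul_le_mul_of_nonneg_left (ha.trans (mul_le_mul_of_nonneg_left hI hD)) (by positivity)
  refine ⟨?_, ⟨_, hT.const_mul _, ?_⟩, ?_⟩
  · rw [abs_mul, abs_neg, abs_of_pos (inv_pos.2 hκ)]
    exact hle _ h1
  · rw [norm_smul, norm_neg, norm_eq_abs, abs_of_pos (inv_pos.2 hκ)]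
    exact hle _ h2
  · have e : bubbleMass * (u x + -c) = -(∫ y, g y * η y * log ‖y - x‖) -
        boundaryTerm η (fun x => u x + -c) (δ / 4) (3 * δ / 8) x :=
      bubbleMass_mul_eq (by linarith) (by linarith) hv
        (fun x h0 hx => (hu2 x h0 hx).add contDiffAt_const)
        (fun x h0 hx => by rw [lap_add (hu2 x h0 hx) contDiffAt_const, lap_const, hl x h0 hx,
          add_zero]) hg.integrableOn hη hη1 hη0 (by linarith) (by linarith) (hlog x)
    linear_combination bubbleMass⁻¹ * e - (u x - c) * inv_mul_cancel₀ hκ.ne'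

end Localization

section Main

variable {n : ℕ} {δ γ : ℝ} {A : Matrix (Fin n) (Fin n) ℝ} {h u : ℕ → Fin n → E2 → ℝ} {M : ℕ → ℝ}

/-- The density `|x|^{2γ} hᵢᵏ e^{ũᵢᵏ}` on the closed ball, extended by zero. -/
def cutDensity (δ γ : ℝ) (h u : ℕ → Fin n → E2 → ℝ) (k : ℕ) (i : Fin n) : E2 → ℝ :=
  (closedBall (0 : E2) δ).indicator fun x => ‖x‖ ^ (2 * γ) * (h k i x * exp (u k i x))

lemma cutDensity_apply {k : ℕ} {i : Fin n} {x : E2} (hx : ‖x‖ ≤ δ) :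
    cutDensity δ γ h u k i x = ‖x‖ ^ (2 * γ) * (h k i x * exp (u k i x)) :=
  indicator_of_mem (mem_closedBall_zero_iff.2 hx) _

lemma cutDensity_eq_exp {k : ℕ} {i : Fin n} {x : E2} (hx : ‖x‖ ≤ δ) (h0 : x ≠ 0) :
    cutDensity δ γ h u k i x = h k i x * exp (u k i x + 2 * γ * log ‖x‖) := by
  rw [cutDensity_apply hx, rpow_def_of_pos (norm_pos_iff.2 h0), exp_add,
    mul_comm (2 * γ)]
  ring

namespace LocalBlowupSetup

lemma isRieszDensity (S : LocalBlowupSetup n δ γ A h u M) (k : ℕ) (i : Fin n) :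
    IsRieszDensity (singExp γ) (cutDensity δ γ h u k i) :=
  isRieszDensity_indicator γ ((S.h_c1 k i).continuousOn.mul (S.u_cont k i).rexp)
    fun x hx => mul_nonneg (S.c₁_pos.le.trans (S.h_lb k i x hx)) (exp_pos _).le

lemma integral_cutDensity_le (S : LocalBlowupSetup n δ γ A h u M) (k : ℕ) (i : Fin n) :
    ∫ x, cutDensity δ γ h u k i x ≤ S.C := by
  rw [cutDensity, integral_indicator measurableSet_closedBall]
  exact S.energy k i

lemma C_nonneg (S : LocalBlowupSetup n δ γ A h u M) : 0 ≤ S.C :=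
  (integral_nonneg (S.isRieszDensity 0 ⟨0, S.hn⟩).nonneg).trans (S.integral_cutDensity_le 0 _)

lemma exists_liouvillePotential (S : LocalBlowupSetup n δ γ A h u M) :
    ∃ B : ℝ, 0 < B ∧ ∃ P : ℕ → LiouvillePotential A γ (δ / 8) B, ∀ k i x, ‖x‖ < δ / 8 →
      (P k).f i x = bubbleMass⁻¹ * cutDensity δ γ h u k i x := by
  have hδ := S.hδ
  have hκ := bubbleMass_pos
  have hs := singExp_nonneg γ
  have hs2 := singExp_lt_two S.hγ
  have hA := S.hH1.2.1
  let η : ContDiffBump (0 : E2) := ⟨δ / 4, 3 * δ / 8, by linarith, by linarith⟩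
  have hη1 : ∀ y, ‖y‖ < δ / 4 → η y = 1 := fun y hy =>
    η.one_of_mem_closedBall (mem_closedBall_zero_iff.2 hy.le)
  have hη0 : ∀ y, 3 * δ / 8 < ‖y‖ → η y = 0 := fun y hy =>
    η.zero_of_le_dist (by rw [dist_zero_right]; exact hy.le)
  obtain ⟨W, hW, hrep⟩ := exists_local_representation hδ S.C (entrySum A * S.C) η.contDiff hη1 hη0
  set F : ℕ → Fin n → E2 → ℝ := cutDensity δ γ h u with hF
  have hFr := S.isRieszDensity
  set g : ℕ → Fin n → E2 → ℝ := fun k i x => ∑ j, A i j * F k j x with hg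
  have hgr : ∀ k i, IsRieszDensity (singExp γ) (g k i) := fun k i =>
    IsRieszDensity.sum (fun j => hA i j) fun j => hFr k j
  have hηm : Measurable η := η.continuous.measurable
  have hgη : ∀ k i, IsRieszDensity (singExp γ) fun x => g k i x * η x := fun k i =>
    (hgr k i).mul_of_le_one hηm (fun _ => η.nonneg) fun _ => η.le_one
  have hlog : ∀ k i x, Integrable fun y => g k i y * η y * log ‖y - x‖ := by
    intro k i x
    have := (integrable_dens_iff (hgη k i).meas (hgη k i).nonneg).1
      ((hgη k i).integrable_log hs hs2 x)
    simpa only [norm_sub_rev x] using this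
  have hgm : ∀ k i, ∫ x, g k i x ≤ entrySum A * S.C := by
    intro k i
    rw [hg, integral_finsetSum _ fun j _ => ((hFr k j).integrable hs hs2).const_mul _]
    simp_rw [integral_const_mul]
    have h1 : ∑ j, A i j ≤ entrySum A :=
      single_le_sum (f := fun i => ∑ j, A i j)
        (fun i _ => sum_nonneg fun j _ => hA i j) (mem_univ i)
    calc ∑ j, A i j * ∫ x, F k j x ≤ ∑ j, A i j * S.C := sum_le_sum fun j _ =>
          mul_le_mul_of_nonneg_left (S.integral_cutDensity_le k j) (hA i j)
      _ = (∑ j, A i j) * S.C := (sum_mul ..).symm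
      _ ≤ _ := mul_le_mul_of_nonneg_right h1 S.C_nonneg
  choose c w hw using fun k i => hrep (u k i) (g k i) (S.u_cont k i)
    (fun x h0 hx => (S.u_c2 k i).contDiffAt ((isOpen_ball.sdiff isClosed_singleton).mem_nhds
      ⟨mem_ball_zero_iff.2 hx, h0⟩))
    (fun x h0 hx => by
      have := S.pde k i x ⟨mem_ball_zero_iff.2 hx, h0⟩
      rw [eq_neg_of_add_eq_zero_left this]
      simp only [hg, hF, cutDensity_apply hx.le])
    (hgr k i).nonneg ((hgr k i).integrable hs hs2) (hgm k i) (S.osc k i) (hlog k i)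
  have hball : ∀ x : E2, ‖x‖ < δ / 8 → x ∈ closedBall (0 : E2) δ := fun x hx =>
    mem_closedBall_zero_iff.2 (by linarith)
  have hc₂ : 0 ≤ S.c₂ := by
    have h0 := hball 0 (by rw [norm_zero]; positivity)
    exact S.c₁_pos.le.trans ((S.h_lb 0 ⟨0, S.hn⟩ 0 h0).trans (S.h_ub 0 ⟨0, S.hn⟩ 0 h0))
  have hc₃ : 0 ≤ S.c₃ :=
    (norm_nonneg _).trans (S.h_grad 0 ⟨0, S.hn⟩ 0 (hball 0 (by rw [norm_zero]; positivity)))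
  have hc₁ := S.c₁_pos
  have hC := S.C_nonneg
  set b₁ := n * (bubbleMass⁻¹ * S.C) with hb₁
  set b₂ := bubbleMass⁻¹ * (S.c₂ * exp W) with hb₂
  set b₃ := bubbleMass * S.c₁⁻¹ * exp W with hb₃
  set b₄ := bubbleMass⁻¹ * (S.c₂ * (exp W * W) + exp W * S.c₃) with hb₄
  have hb₁0 : 0 ≤ b₁ := by positivity
  have hb₂0 : 0 ≤ b₂ := by positivity
  have hb₃0 : 0 < b₃ := by positivity
  have hb₄0 : 0 ≤ b₄ := by positivity
  have hexp : ∀ k i x, ‖x‖ < δ / 8 → exp (w k i x) ≤ exp W := fun k i x hx =>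
    exp_le_exp.2 (abs_le.1 (hw k i x hx).1).2
  have hder : ∀ k i x, ‖x‖ < δ / 8 → ∃ T : E2 →L[ℝ] ℝ,
      HasFDerivAt (fun x => bubbleMass⁻¹ * (h k i x * exp (w k i x))) T x ∧ ‖T‖ ≤ b₄ := by
    intro k i x hx
    obtain ⟨hw1, ⟨T, hT, hTW⟩, -⟩ := hw k i x hx
    have hn : closedBall (0 : E2) δ ∈ 𝓝 x := mem_of_superset
      (isOpen_ball.mem_nhds (mem_ball_zero_iff.2 hx)) fun y hy => hball y (mem_ball_zero_iff.1 hy)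
    have h1 : HasFDerivAt (h k i) (fderivWithin ℝ (h k i) (closedBall 0 δ) x) x := by
      rw [fderivWithin_of_mem_nhds hn]
      exact (((S.h_c1 k i).contDiffAt hn).differentiableAt one_ne_zero).hasFDerivAt
    refine ⟨_, (h1.mul hT.exp).const_mul _, ?_⟩
    rw [norm_smul, norm_eq_abs, abs_of_pos (inv_pos.2 hκ)]
    refine mul_le_mul_of_nonneg_left ((norm_add_le _ _).trans (add_le_add ?_ ?_)) (by positivity)
    · rw [norm_smul, norm_smul, norm_eq_abs, norm_eq_abs, abs_exp,
        abs_of_nonneg (hc₁.le.trans (S.h_lb k i x (hball x hx)))]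
      exact mul_le_mul (S.h_ub k i x (hball x hx)) (mul_le_mul (hexp k i x hx) hTW
        (norm_nonneg _) (exp_pos _).le) (by positivity) hc₂
    · rw [norm_smul, norm_eq_abs, abs_exp]
      exact mul_le_mul (hexp k i x hx) (S.h_grad k i x (hball x hx)) (norm_nonneg _)
        (exp_pos _).le
  have hfr : ∀ k i, IsRieszDensity (singExp γ) fun x => bubbleMass⁻¹ * (F k i x * η x) :=
    fun k i => ((hFr k i).mul_of_le_one hηm (fun _ => η.nonneg) fun _ => η.le_one).const_mul
      (by positivity)
  refine ⟨b₁ + b₂ + b₃ + b₄, by positivity, fun k => ⟨fun i x => bubbleMass⁻¹ * (F k i x * η x),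
    fun i x => bubbleMass⁻¹ * (h k i x * exp (w k i x)), c k, hfr k, ?_, ?_, ?_, ?_, ?_, ?_⟩,
    fun k i x hx => ?_⟩
  · have hm : ∀ i, (dens fun x => bubbleMass⁻¹ * (F k i x * η x)).real Set.univ ≤
        bubbleMass⁻¹ * S.C := by
      intro i
      rw [(hfr k i).real_dens hs hs2 _ MeasurableSet.univ, setIntegral_univ, integral_const_mul]
      refine mul_le_mul_of_nonneg_left ?_ (by positivity)
      refine le_trans (integral_mono_of_nonneg (ae_of_all _ fun x =>
        mul_nonneg ((hFr k i).nonneg x) η.nonneg) ((hFr k i).integrable hs hs2)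
        (ae_of_all _ fun x => mul_le_of_le_one_right ((hFr k i).nonneg x) η.le_one))
        (S.integral_cutDensity_le k i)
    refine (sum_le_sum fun i _ => hm i).trans ?_
    rw [sum_const, card_univ, Fintype.card_fin, nsmul_eq_mul]
    linarith
  · intro i x h0 hx
    have e1 : (fun y => ∑ j, A i j * (bubbleMass⁻¹ * (F k j y * η y))) =
        fun y => bubbleMass⁻¹ * (g k i y * η y) := by
      ext y
      rw [hg, sum_mul, mul_sum]
      exact sum_congr rfl fun j _ => by ring
    have hgη' := (hgη k i).const_mul (inv_pos.2 hκ).le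
    have e2 : ∫ y, log ‖x - y‖ ∂dens (fun y => bubbleMass⁻¹ * (g k i y * η y)) =
        bubbleMass⁻¹ * ∫ y, g k i y * η y * log ‖y - x‖ := by
      rw [integral_dens hgη'.meas hgη'.nonneg, ← integral_const_mul]
      simp only [norm_sub_rev x, mul_assoc]
    rw [e1, e2, hη1 x (by linarith), mul_one, hF, cutDensity_apply (by linarith),
      (hw k i x hx).2.2, show c k i + w k i x -
        bubbleMass⁻¹ * ∫ y, g k i y * η y * log ‖y - x‖ = w k i x + (c k i -
        bubbleMass⁻¹ * ∫ y, g k i y * η y * log ‖y - x‖) by ring, exp_add]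
    ring
  · intro i x _ hx
    obtain ⟨T, hT, -⟩ := hder k i x hx
    exact hT.differentiableAt
  · intro i x _ hx
    have h1 : bubbleMass⁻¹ * (h k i x * exp (w k i x)) ≤ b₂ :=
      mul_le_mul_of_nonneg_left (mul_le_mul (S.h_ub k i x (hball x hx)) (hexp k i x hx)
        (exp_pos _).le hc₂) (by positivity)
    linarith
  · intro i x _ hx
    calc (b₁ + b₂ + b₃ + b₄)⁻¹ ≤ b₃⁻¹ := inv_anti₀ hb₃0 (by linarith)
      _ = bubbleMass⁻¹ * (S.c₁ * exp (-W)) := by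
        rw [hb₃, exp_neg]
        field_simp
      _ ≤ _ := mul_le_mul_of_nonneg_left (mul_le_mul (S.h_lb k i x (hball x hx))
        (exp_le_exp.2 (abs_le.1 (hw k i x hx).1).1) (exp_pos _).le
        (hc₁.le.trans (S.h_lb k i x (hball x hx)))) (by positivity)
  · intro i x _ hx
    obtain ⟨T, hT, hTb⟩ := hder k i x hx
    rw [hT.fderiv]
    linarith
  · change bubbleMass⁻¹ * (F k i x * η x) = _
    rw [hη1 x (by linarith), mul_one]

end LocalBlowupSetup

end Main

/-- in the local blowup setup, if the blowup at the origin is non-simple,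
i.e. `maxᵢ max_{B_δ} (ũᵢᵏ(x) + 2μ log|x|) → ∞`, then `μ = 1 + γ` is a positive integer. -/
theorem nonsimple_blowup_integer_strength {n : ℕ} {δ γ : ℝ}
    {A : Matrix (Fin n) (Fin n) ℝ} {h u : ℕ → Fin n → E2 → ℝ} {M : ℕ → ℝ}
    (S : LocalBlowupSetup n δ γ A h u M)
    (hnonsimple : ∀ R : ℝ, ∃ N : ℕ, ∀ k ≥ N, ∃ i : Fin n, ∃ x ∈ closedBall (0:E2) δ,
      x ≠ 0 ∧ R ≤ u k i x + 2*(1+γ)*log ‖x‖) :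
    ∃ m : ℕ, 0 < m ∧ 1 + γ = (m : ℝ) := by
  have hδ := S.hδ
  have hκ := bubbleMass_pos
  have hc₁ := S.c₁_pos
  obtain ⟨B, hB, P, hP⟩ := S.exists_liouvillePotential
  refine LiouvillePotential.strength_eq_natCast S.hn S.hH1 S.hH2 S.hγ hB
    (by positivity : 0 < δ / 8) P (fun N => ?_) fun ε hε => ?_
  · obtain ⟨D, hD⟩ := S.no_blowup_away (δ / 8) (by positivity) (by linarith)
    obtain ⟨k, hk⟩ := hnonsimple (max (D + 2 * log δ + 1) (bubbleMass * S.c₁⁻¹ * N))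
    obtain ⟨i, x, hx, h0, hR⟩ := hk k le_rfl
    have hx0 : 0 < ‖x‖ := norm_pos_iff.2 h0
    have hxδ := mem_closedBall_zero_iff.1 hx
    have hxr : ‖x‖ < δ / 8 := by
      by_contra hlt
      have h1 := hD k i x hx (not_lt.1 hlt)
      have h2 := log_le_log hx0 hxδ
      have h3 := (le_max_left _ _).trans hR
      linarith
    refine ⟨k, i, x, hxr, ?_⟩
    have e : ‖x‖ ^ 2 * (bubbleMass⁻¹ * (h k i x * exp (u k i x + 2 * γ * log ‖x‖))) =
        bubbleMass⁻¹ * (h k i x * exp (u k i x + 2 * (1 + γ) * log ‖x‖)) := by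
      rw [show u k i x + 2 * (1 + γ) * log ‖x‖ =
        (u k i x + 2 * γ * log ‖x‖) + (log ‖x‖ + log ‖x‖) by ring,
        exp_add (_ + _), exp_add (log ‖x‖), exp_log hx0]
      ring
    rw [hP k i x hxr, cutDensity_eq_exp hxδ h0, e]
    have h1 := (le_max_right _ _).trans hR
    have h2 := add_one_le_exp (u k i x + 2 * (1 + γ) * log ‖x‖)
    have h3 : N = bubbleMass⁻¹ * (S.c₁ * (bubbleMass * S.c₁⁻¹ * N)) := by field_simp
    rw [h3]
    refine mul_lt_mul_of_pos_left ?_ (by positivity)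
    refine lt_of_lt_of_le (mul_lt_mul_of_pos_left (by linarith) hc₁)
      (mul_le_mul_of_nonneg_right (S.h_lb k i x hx) (exp_pos _).le)
  · obtain ⟨D, hD⟩ := S.no_blowup_away (min ε (δ / 2)) (lt_min hε (by positivity))
      ((min_le_right _ _).trans_lt (by linarith))
    refine ⟨bubbleMass⁻¹ * (S.c₂ * exp D), fun k i x hε' hx => ?_⟩
    have hxb : x ∈ closedBall (0 : E2) δ := mem_closedBall_zero_iff.2 (by linarith)
    rw [hP k i x hx, cutDensity_eq_exp (by linarith) (norm_pos_iff.1 (hε.trans_le hε'))]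
    refine mul_le_mul_of_nonneg_left ?_ (by positivity)
    exact mul_le_mul (S.h_ub k i x hxb)
      (exp_le_exp.2 (hD k i x hxb ((min_le_left _ _).trans hε'))) (exp_pos _).le
      (hc₁.le.trans ((S.h_lb k i x hxb).trans (S.h_ub k i x hxb)))
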